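/- Suppose that for every n∈ℤ an at most countable set 𝔖(n)={s_n(i): i∈ℕ}⊂[1,2^b] is given. There is a constant C (depending only on b, c_+, c_- and the fixed cutoff functions, but independent of the sets 𝔖(n)) such that for all 1<p≤2 and all integers ℓ≥1, ‖ ( Σ_{j,n∈ℤ} Σ_{i∈ℕ} |w_n(i) · 𝒜_{j,ℓ}^{n,i} f|² )^{1/2} ‖_{L^p(ℝ²)} ≤ C (p-1)^{3-10/p} 2^{-ℓ(p-1)/2} (sup_{n∈ℤ} ‖w_n‖_{ℓ^p(ℕ)}) ‖f‖_{L^p(ℝ²)} for all Schwartz functions f and all sequences w_n:ℕ→ℂ, where 𝒜_{j,ℓ}^{n,i} is any one of the operators A_{j,ℓ}^{2^{bn}s_n(i)}, 2^{-ℓ}(d/ds)A_{j,ℓ}^{2^{bn}s}|_{s=s_n(i)}, T_{j,ℓ,±}^{2^{bn}s_n(i)}, or 2^{-ℓ}(d/ds)T_{j,ℓ,±}^{2^{bn}s}|_{s=s_n(i)}. -/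

import Mathlib

open MeasureTheory Filter Set Topology
open scoped ENNReal NNReal Topology Classical

noncomputable section

/-- The homogeneous curve of degree `b`: `γ_b(t) = c₊ t^b` for `t > 0`,
`γ_b(t) = c₋ (-t)^b` for `t < 0`, `γ_b(0) = 0`. -/
def curve (b cp cm t : ℝ) : ℝ :=
  if 0 < t then cp * t ^ b else if t < 0 then cm * (-t) ^ b else 0

/-- The maximal function along the curve `(t, u γ_b(t))`. -/
def Mu (b cp cm u : ℝ) (f : ℝ × ℝ → ℝ) (x : ℝ × ℝ) : ℝ :=
  ⨆ R : {R : ℝ // 0 < R},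
    ((R : ℝ))⁻¹ * ∫ t in (0:ℝ)..(R : ℝ), |f (x - (t, u * curve b cp cm t))|

/-- The maximal function `𝓜^U f = sup_{u ∈ U} M^{(u)} f`. -/
def calM (b cp cm : ℝ) (U : Set ℝ) (f : ℝ × ℝ → ℝ) (x : ℝ × ℝ) : ℝ :=
  ⨆ u : U, Mu b cp cm (u : ℝ) f x

/-- The Hilbert transform along the curve `(t, u γ_b(t))` (principal value). -/
def Hu (b cp cm u : ℝ) (f : ℝ × ℝ → ℝ) (x : ℝ × ℝ) : ℝ :=
  limUnder (𝓝[>] (0:ℝ)) fun ε : ℝ =>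
    ∫ t in {t : ℝ | ε < |t| ∧ |t| < ε⁻¹}, f (x - (t, u * curve b cp cm t)) / t

/-- The maximal function `𝓗^U f = sup_{u ∈ U} |H^{(u)} f|`, valued in `ℝ≥0∞`. -/
def calH (b cp cm : ℝ) (U : Set ℝ) (f : ℝ × ℝ → ℝ) (x : ℝ × ℝ) : ℝ≥0∞ :=
  ⨆ u : U, ENNReal.ofReal |Hu b cp cm (u : ℝ) f x|

/-- The `L^p` norm of an `ℝ≥0∞`-valued function on `ℝ²`. -/
def lpN (g : ℝ × ℝ → ℝ≥0∞) (p : ℝ) : ℝ≥0∞ :=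
  (∫⁻ x : ℝ × ℝ, g x ^ p) ^ (1 / p)

def eN (p : ℝ) : ℝ≥0∞ := ENNReal.ofReal p

/-- `U^r = r⁻¹ U ∩ [1,2] = {ρ ∈ [1,2] : rρ ∈ U}`. -/
def UrSet (U : Set ℝ) (r : ℝ) : Set ℝ := {ρ : ℝ | ρ ∈ Icc (1:ℝ) 2 ∧ r * ρ ∈ U}

/-- `N(A,δ)`: minimal number of intervals of length `δ` needed to cover `A`. -/
def covN (A : Set ℝ) (δ : ℝ) : ℕ :=
  sInf {n : ℕ | ∃ F : Finset ℝ, F.card = n ∧ A ⊆ ⋃ a ∈ F, Icc a (a + δ)}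

/-- `𝒦_p(U,δ) = δ^{1-1/p} sup_{r>0} N(U^r,δ)^{1/p}`. -/
def Kp (U : Set ℝ) (δ p : ℝ) : ℝ :=
  δ ^ (1 - 1 / p) * ⨆ r : {r : ℝ // 0 < r}, ((covN (UrSet U (r : ℝ)) δ : ℝ)) ^ (1 / p)

/-- `p_cr(U) = 1 + limsup_{δ→0+} sup_{r>0} log N(U^r,δ) / log(1/δ)`. -/
def pcr (U : Set ℝ) : ℝ :=
  1 + limsup (fun δ : ℝ =>
      (⨆ r : {r : ℝ // 0 < r}, Real.log (covN (UrSet U (r : ℝ)) δ)) / Real.log δ⁻¹)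
    (𝓝[>] (0:ℝ))

/-- `𝔑(U) = 1 + #{n ∈ ℤ : [2ⁿ, 2ⁿ⁺¹] ∩ U ≠ ∅}`. -/
def frakN (U : Set ℝ) : ℕ∞ :=
  1 + Set.encard {n : ℤ | (Icc ((2:ℝ) ^ n) ((2:ℝ) ^ (n + 1)) ∩ U).Nonempty}

/-- `√(log 𝔑(U))`, valued in `ℝ≥0∞` (equal to `∞` if `𝔑(U) = ∞`). -/
def sqrtLogN (U : Set ℝ) : ℝ≥0∞ :=
  if frakN U = ⊤ then ⊤
  else ENNReal.ofReal (Real.sqrt (Real.log ((frakN U).toNat : ℝ)))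

/-- The `L^p → L^p` operator norm of `𝓜^U` (smallest admissible constant, possibly `∞`). -/
def opNormM (b cp cm : ℝ) (U : Set ℝ) (p : ℝ) : ℝ≥0∞ :=
  sInf {C : ℝ≥0∞ | ∀ f : SchwartzMap (ℝ × ℝ) ℝ,
    eLpNorm (calM b cp cm U ⇑f) (eN p) volume ≤ C * eLpNorm ⇑f (eN p) volume}

/-- The `L^p → L^p` operator norm of `𝓗^U` (smallest admissible constant, possibly `∞`). -/
def opNormH (b cp cm : ℝ) (U : Set ℝ) (p : ℝ) : ℝ≥0∞ :=
  sInf {C : ℝ≥0∞ | ∀ f : SchwartzMap (ℝ × ℝ) ℝ,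
    lpN (calH b cp cm U ⇑f) p ≤ C * eLpNorm ⇑f (eN p) volume}

/-- `θ_{p,ℓ}`. -/
def theta (p : ℝ) (l : ℕ) : ℝ :=
  if (l : ℝ) ≤ (p - 1)⁻¹ then (p - 1) ^ (3 - 10 / p) else (l : ℝ) ^ (7 * (2 / p - 1))

/-- `Σ_{ℓ≥1} θ_{p,ℓ} 𝒦_p(U, 2^{-ℓ})`, valued in `ℝ≥0∞`. -/
def KpSum (U : Set ℝ) (p : ℝ) : ℝ≥0∞ :=
  ∑' l : ℕ, ENNReal.ofReal (theta p (l + 1) * Kp U ((2:ℝ) ^ (-((l : ℝ) + 1))) p)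



/-- The Fourier transform on `ℝ²`. -/
def FT (f : ℝ × ℝ → ℂ) (ξ : ℝ × ℝ) : ℂ :=
  ∫ x : ℝ × ℝ,
    Complex.exp ((((-(2 * Real.pi * (x.1 * ξ.1 + x.2 * ξ.2))) : ℝ) : ℂ) * Complex.I) * f x

/-- The inverse Fourier transform on `ℝ²`. -/
def FTinv (g : ℝ × ℝ → ℂ) (x : ℝ × ℝ) : ℂ :=
  ∫ ξ : ℝ × ℝ,
    Complex.exp (((2 * Real.pi * (x.1 * ξ.1 + x.2 * ξ.2) : ℝ) : ℂ) * Complex.I) * g ξ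

/-- `τ̂₀(ξ) = ∫ e^{-2πi(ξ₁t + ξ₂γ_b(t))} χ₊(t) dt`. -/
def tauHat (b cp cm : ℝ) (χp : ℝ → ℝ) (ξ : ℝ × ℝ) : ℂ :=
  ∫ t : ℝ,
    Complex.exp ((((-(2 * Real.pi * (ξ.1 * t + ξ.2 * curve b cp cm t))) : ℝ) : ℂ) * Complex.I)
      * ((χp t : ℝ) : ℂ)

/-- `σ̂(ξ) = ∫ e^{-2πi(ξ₁t + ξ₂γ_b(t))} χ(t) dt/t` for a cutoff `χ`. -/
def sigmaHat (b cp cm : ℝ) (χ : ℝ → ℝ) (ξ : ℝ × ℝ) : ℂ :=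
  ∫ t : ℝ,
    Complex.exp ((((-(2 * Real.pi * (ξ.1 * t + ξ.2 * curve b cp cm t))) : ℝ) : ℂ) * Complex.I)
      * ((χ t / t : ℝ) : ℂ)

/-- `ρ̂₀(ξ) = (1-η₀(ξ)) ς₋(ξ₁/(c₊ξ₂)) τ̂₀(ξ)`. -/
def rhoHat (b cp cm : ℝ) (χp : ℝ → ℝ) (η : ℝ × ℝ → ℝ) (ςm : ℝ → ℝ) (ξ : ℝ × ℝ) : ℂ :=
  (((1 - η ξ) * ςm (ξ.1 / (cp * ξ.2)) : ℝ) : ℂ) * tauHat b cp cm χp ξ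

/-- `μ̂_{0,±}`; `sgn = true` is the `+` sign. -/
def muHat (b cp cm : ℝ) (χp : ℝ → ℝ) (η : ℝ × ℝ → ℝ) (ςp ςm : ℝ → ℝ) (sgn : Bool)
    (ξ : ℝ × ℝ) : ℂ :=
  if sgn then
    (((1 - η ξ) * ςm (ξ.1 / (cp * ξ.2)) : ℝ) : ℂ) * sigmaHat b cp cm χp ξ
  else
    (((1 - η ξ) * ςp (ξ.1 / (cm * ξ.2)) : ℝ) : ℂ) * sigmaHat b cp cm (fun t => χp (-t)) ξ

/-- `ζ_ℓ(ξ) = ζ₀(2^{-ℓ}ξ) - ζ₀(2^{1-ℓ}ξ)`. -/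
def zl (ζ : ℝ × ℝ → ℝ) (l : ℕ) (ξ : ℝ × ℝ) : ℝ :=
  ζ ((2:ℝ) ^ (-(l : ℝ)) • ξ) - ζ ((2:ℝ) ^ (1 - (l : ℝ)) • ξ)

/-- The anisotropic dilation `ξ ↦ (2^{-j}ξ₁, 2^{-jb} u ξ₂)`. -/
def dil (b : ℝ) (j : ℤ) (u : ℝ) (ξ : ℝ × ℝ) : ℝ × ℝ :=
  ((2:ℝ) ^ (-(j : ℝ)) * ξ.1, (2:ℝ) ^ (-((j : ℝ) * b)) * (u * ξ.2))

/-- `A_{j,ℓ}^u`, defined via `(A_{j,ℓ}^u f)^(ξ) = ζ_ℓ(...) ρ̂₀(...) f̂(ξ)`. -/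
def Ajl (b cp cm : ℝ) (χp : ℝ → ℝ) (η : ℝ × ℝ → ℝ) (ςm : ℝ → ℝ) (ζ : ℝ × ℝ → ℝ)
    (j : ℤ) (l : ℕ) (u : ℝ) (f : ℝ × ℝ → ℝ) : ℝ × ℝ → ℂ :=
  FTinv fun ξ =>
    ((zl ζ l (dil b j u ξ) : ℝ) : ℂ) * rhoHat b cp cm χp η ςm (dil b j u ξ)
      * FT (fun x => ((f x : ℝ) : ℂ)) ξ

/-- `T_{j,ℓ,±}^u`, defined via `(T_{j,ℓ,±}^u f)^(ξ) = ζ_ℓ(...) μ̂_{0,±}(...) f̂(ξ)`. -/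
def Tjl (b cp cm : ℝ) (χp : ℝ → ℝ) (η : ℝ × ℝ → ℝ) (ςp ςm : ℝ → ℝ) (ζ : ℝ × ℝ → ℝ)
    (sgn : Bool) (j : ℤ) (l : ℕ) (u : ℝ) (f : ℝ × ℝ → ℝ) : ℝ × ℝ → ℂ :=
  FTinv fun ξ =>
    ((zl ζ l (dil b j u ξ) : ℝ) : ℂ) * muHat b cp cm χp η ςp ςm sgn (dil b j u ξ)
      * FT (fun x => ((f x : ℝ) : ℂ)) ξ

/-- `φ̂₀(ξ) = η₀(ξ)τ̂₀(ξ) + (1-η₀(ξ))(1-ς₋(ξ₁/(c₊ξ₂)))τ̂₀(ξ)` (maximal-function version). -/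
def phiHatTau (b cp cm : ℝ) (χp : ℝ → ℝ) (η : ℝ × ℝ → ℝ) (ςm : ℝ → ℝ) (ξ : ℝ × ℝ) : ℂ :=
  ((η ξ + (1 - η ξ) * (1 - ςm (ξ.1 / (cp * ξ.2))) : ℝ) : ℂ) * tauHat b cp cm χp ξ

/-- `A_{j,0}^u`, defined via `(A_{j,0}^u f)^(ξ) = φ̂₀(2^{-j}ξ₁, 2^{-jb}uξ₂) f̂(ξ)`. -/
def Aj0 (b cp cm : ℝ) (χp : ℝ → ℝ) (η : ℝ × ℝ → ℝ) (ςm : ℝ → ℝ)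
    (j : ℤ) (u : ℝ) (f : ℝ × ℝ → ℝ) : ℝ × ℝ → ℂ :=
  FTinv fun ξ => phiHatTau b cp cm χp η ςm (dil b j u ξ) * FT (fun x => ((f x : ℝ) : ℂ)) ξ

/-- `φ̂₀(ξ)` (Hilbert-transform version, built from `σ̂_±`). -/
def phiHatSigma (b cp cm : ℝ) (χp : ℝ → ℝ) (η : ℝ × ℝ → ℝ) (ςp ςm : ℝ → ℝ)
    (ξ : ℝ × ℝ) : ℂ :=
  ((η ξ : ℝ) : ℂ) * (sigmaHat b cp cm χp ξ + sigmaHat b cp cm (fun t => χp (-t)) ξ)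
    + (((1 - η ξ) * (1 - ςm (ξ.1 / (cp * ξ.2))) : ℝ) : ℂ) * sigmaHat b cp cm χp ξ
    + (((1 - η ξ) * (1 - ςp (ξ.1 / (cm * ξ.2))) : ℝ) : ℂ)
        * sigmaHat b cp cm (fun t => χp (-t)) ξ

/-- `S^{(u)}`, defined via `(S^{(u)} f)^(ξ) = Σ_j φ̂₀(2^{-j}ξ₁, 2^{-jb}uξ₂) f̂(ξ)`. -/
def Sop (b cp cm : ℝ) (χp : ℝ → ℝ) (η : ℝ × ℝ → ℝ) (ςp ςm : ℝ → ℝ)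
    (u : ℝ) (f : ℝ × ℝ → ℝ) : ℝ × ℝ → ℂ :=
  FTinv fun ξ =>
    (∑' j : ℤ, phiHatSigma b cp cm χp η ςp ςm (dil b j u ξ)) * FT (fun x => ((f x : ℝ) : ℂ)) ξ

/-- The convolution `τ_j^u * f`. -/
def tauConv (b cp cm : ℝ) (χp : ℝ → ℝ) (j : ℤ) (u : ℝ) (f : ℝ × ℝ → ℝ) (x : ℝ × ℝ) : ℝ :=
  ∫ t : ℝ, f (x - (t, u * curve b cp cm t)) * ((2:ℝ) ^ j * χp ((2:ℝ) ^ j * t))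

/-- The `ℓ^p(ℕ)` norm of a sequence. -/
def wNorm (w : ℕ → ℂ) (p : ℝ) : ℝ≥0∞ :=
  (∑' i : ℕ, ENNReal.ofReal (‖w i‖ ^ p)) ^ (1 / p)

/-- The auxiliary maximal operator `𝔐_R[f,w]`. -/
def MfrakR (b cp cm : ℝ) (χp : ℝ → ℝ) (s : ℤ → ℕ → ℝ) (R : ℕ)
    (f : ℝ × ℝ → ℝ) (w : ℤ → ℕ → ℂ) (x : ℝ × ℝ) : ℝ≥0∞ :=
  ⨆ (j : ℤ) (_ : -(R:ℤ) ≤ j ∧ j ≤ R) (n : ℤ) (_ : -(R:ℤ) ≤ n ∧ n ≤ R) (i : ℕ),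
    ENNReal.ofReal
      (‖w n i‖ * |tauConv b cp cm χp j ((2:ℝ) ^ (b * (n : ℝ)) * s n i) f x|)

/-- `B_p(R)`: the best constant in `‖𝔐_R[f,w]‖_p ≤ C (sup_n ‖w_n‖_{ℓ^p}) ‖f‖_p`. -/
def BpR (b cp cm : ℝ) (χp : ℝ → ℝ) (s : ℤ → ℕ → ℝ) (p : ℝ) (R : ℕ) : ℝ≥0∞ :=
  ⨆ (f : SchwartzMap (ℝ × ℝ) ℝ) (w : ℤ → ℕ → ℂ)
    (_ : eLpNorm ⇑f (eN p) volume ≤ 1) (_ : ∀ n : ℤ, wNorm (w n) p ≤ 1),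
    lpN (MfrakR b cp cm χp s R ⇑f w) p

/-- `ℓ^q` norm (over an index type) of an `ℝ≥0∞`-valued family, `q ∈ (0,∞]`. -/
def lqS {ι : Type*} (q : ℝ≥0∞) (g : ι → ℝ≥0∞) : ℝ≥0∞ :=
  if q = ⊤ then ⨆ i, g i else (∑' i, g i ^ q.toReal) ^ (1 / q.toReal)

/-- The quotient `p/q`, with the convention `p/∞ = 0`. -/
def pqr (p : ℝ) (q : ℝ≥0∞) : ℝ := if q = ⊤ then 0 else p / q.toReal

/-! ### Maximal averages on the line -/

lemma lintegral_affine {g : ℝ → ℝ≥0∞} (hg : Measurable g) (x : ℝ) {c : ℝ} (hc : 0 < c) :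
    ∫⁻ t, g (x + c * t) = ENNReal.ofReal c⁻¹ * ∫⁻ y, g y := by
  have h1 : ∫⁻ t, g (x + c * t) = ∫⁻ y, g (x + y) ∂(Measure.map (fun t => c * t) volume) := by
    rw [lintegral_map (by fun_prop) (by fun_prop)]
  rw [h1, Real.map_volume_mul_left hc.ne', lintegral_smul_measure,
    lintegral_add_left_eq_self g x, abs_of_pos (inv_pos.2 hc), smul_eq_mul]

lemma lintegral_affine_Icc {h : ℝ → ℝ≥0∞} (hh : Measurable h) (x : ℝ) {c : ℝ} (hc : 0 < c)
    (a b : ℝ) :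
    ∫⁻ t in Icc a b, h (x + c * t)
      = ENNReal.ofReal c⁻¹ * ∫⁻ y in Icc (x + c * a) (x + c * b), h y := by
  rw [← lintegral_indicator measurableSet_Icc, ← lintegral_indicator measurableSet_Icc,
    ← lintegral_affine (hh.indicator measurableSet_Icc) x hc]
  congr 1
  ext t
  have : (x + c * t ∈ Icc (x + c * a) (x + c * b)) ↔ t ∈ Icc a b := by
    simp [mul_le_mul_iff_right₀ hc]
  by_cases ht : t ∈ Icc a b
  · rw [indicator_of_mem ht, indicator_of_mem (this.2 ht)]
  · rw [indicator_of_notMem ht, indicator_of_notMem (fun h => ht (this.1 h))]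

/-- The average of `h` over the dyadic interval of radius `2^{-m}` centred at `x`. -/
def avgBall (h : ℝ → ℝ≥0∞) (m : ℤ) (x : ℝ) : ℝ≥0∞ :=
  ∫⁻ t in Icc (-1 : ℝ) 1, h (x + (2:ℝ) ^ (-m) * t)

/-- The (dyadic, centred) Hardy–Littlewood maximal function. -/
def maxFun (h : ℝ → ℝ≥0∞) (x : ℝ) : ℝ≥0∞ := ⨆ m : ℤ, avgBall h m x

lemma avgBall_eq {h : ℝ → ℝ≥0∞} (hh : Measurable h) (m : ℤ) (x : ℝ) :
    avgBall h m x = ENNReal.ofReal ((2:ℝ) ^ m)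
      * ∫⁻ y in Metric.closedBall x ((2:ℝ) ^ (-m)), h y := by
  rw [avgBall, lintegral_affine_Icc hh x (by positivity), Real.closedBall_eq_Icc, zpow_neg, inv_inv]
  congr 4 <;> ring

lemma measurable_avgBall_uncurry {α : Type*} [MeasurableSpace α] {h : α × ℝ → ℝ≥0∞}
    (hh : Measurable h) (m : ℤ) : Measurable fun q : α × ℝ => avgBall (fun t => h (q.1, t)) m q.2 := by
  unfold avgBall
  refine Measurable.lintegral_prod_right' (ν := volume.restrict (Icc (-1:ℝ) 1))
    (f := fun z : (α × ℝ) × ℝ => h (z.1.1, z.1.2 + (2:ℝ) ^ (-m) * z.2)) ?_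
  fun_prop

lemma measurable_maxFun_uncurry {α : Type*} [MeasurableSpace α] {h : α × ℝ → ℝ≥0∞}
    (hh : Measurable h) : Measurable fun q : α × ℝ => maxFun (fun t => h (q.1, t)) q.2 :=
  Measurable.iSup fun m => measurable_avgBall_uncurry hh m

lemma measurable_avgBall {h : ℝ → ℝ≥0∞} (hh : Measurable h) (m : ℤ) :
    Measurable (avgBall h m) :=
  (measurable_avgBall_uncurry (α := Unit) (h := fun q => h q.2) (by fun_prop) m).comp
    (measurable_const (a := ()) |>.prodMk measurable_id)

lemma measurable_maxFun {h : ℝ → ℝ≥0∞} (hh : Measurable h) : Measurable (maxFun h) :=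
  Measurable.iSup fun m => measurable_avgBall hh m

lemma maxFun_weak_aux {h : ℝ → ℝ≥0∞} (hh : Measurable h) (lam : ℝ≥0∞) (N : ℕ) :
    lam * volume {x | ∃ m : ℤ, -(N : ℤ) ≤ m ∧ lam < avgBall h m x} ≤ 8 * ∫⁻ y, h y := by
  obtain ⟨u, hut, hdisj, hcov⟩ := Vitali.exists_disjoint_subfamily_covering_enlargement_closedBall
    {q : ℝ × ℤ | -(N : ℤ) ≤ q.2 ∧ lam < avgBall h q.2 q.1} Prod.fst (fun q => (2:ℝ) ^ (-q.2))
    ((2:ℝ) ^ (N : ℤ)) (fun q hq => zpow_le_zpow_right₀ (by norm_num) (by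
      have := hq.1; omega)) 4 (by norm_num)
  have hcount : u.Countable := by
    refine hdisj.countable_of_nonempty_interior fun q _ => ?_
    refine ⟨q.1, ?_⟩
    exact Metric.ball_subset_interior_closedBall (Metric.mem_ball_self (by positivity))
  have hsub : {x | ∃ m : ℤ, -(N : ℤ) ≤ m ∧ lam < avgBall h m x}
      ⊆ ⋃ q ∈ u, Metric.closedBall q.1 (4 * (2:ℝ) ^ (-q.2)) := by
    rintro x ⟨m, hm, hx⟩
    obtain ⟨q, hq, hsq⟩ := hcov (x, m) ⟨hm, hx⟩
    refine mem_biUnion hq (hsq ?_)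
    exact Metric.mem_closedBall_self (by positivity)
  have hone : ∀ q ∈ u, lam * volume (Metric.closedBall q.1 (4 * (2:ℝ) ^ (-q.2)))
      ≤ 8 * ∫⁻ y in Metric.closedBall q.1 ((2:ℝ) ^ (-q.2)), h y := by
    intro q hq
    have h1 := (hut hq).2.le
    rw [avgBall_eq hh] at h1
    rw [Real.volume_closedBall]
    have h2 : ENNReal.ofReal (2 * (4 * (2:ℝ) ^ (-q.2))) = 8 * ENNReal.ofReal ((2:ℝ) ^ (-q.2)) := by
      rw [show (8 : ℝ≥0∞) = ENNReal.ofReal 8 by norm_num, ← ENNReal.ofReal_mul (by norm_num)]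
      congr 1; ring
    rw [h2]
    calc lam * (8 * ENNReal.ofReal ((2:ℝ) ^ (-q.2)))
        ≤ (ENNReal.ofReal ((2:ℝ) ^ q.2) * ∫⁻ y in Metric.closedBall q.1 ((2:ℝ) ^ (-q.2)), h y)
          * (8 * ENNReal.ofReal ((2:ℝ) ^ (-q.2))) := by gcongr
      _ = 8 * (ENNReal.ofReal ((2:ℝ) ^ q.2) * ENNReal.ofReal ((2:ℝ) ^ (-q.2)))
            * ∫⁻ y in Metric.closedBall q.1 ((2:ℝ) ^ (-q.2)), h y := by ring
      _ = _ := by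
          rw [← ENNReal.ofReal_mul (by positivity), ← zpow_add₀ (by norm_num)]
          simp
  calc lam * volume {x | ∃ m : ℤ, -(N : ℤ) ≤ m ∧ lam < avgBall h m x}
      ≤ lam * ∑' q : u, volume (Metric.closedBall q.1.1 (4 * (2:ℝ) ^ (-q.1.2))) := by
        gcongr
        exact (measure_mono hsub).trans (measure_biUnion_le _ hcount _)
    _ = ∑' q : u, lam * volume (Metric.closedBall q.1.1 (4 * (2:ℝ) ^ (-q.1.2))) :=
        ENNReal.tsum_mul_left.symm
    _ ≤ ∑' q : u, 8 * ∫⁻ y in Metric.closedBall q.1.1 ((2:ℝ) ^ (-q.1.2)), h y :=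
        ENNReal.tsum_le_tsum fun q => hone q.1 q.2
    _ = 8 * ∫⁻ y in ⋃ q ∈ u, Metric.closedBall q.1 ((2:ℝ) ^ (-q.2)), h y := by
        rw [ENNReal.tsum_mul_left, lintegral_biUnion hcount
          (fun q _ => Metric.isClosed_closedBall.measurableSet) hdisj]
    _ ≤ 8 * ∫⁻ y, h y := by gcongr; exact Measure.restrict_le_self

lemma maxFun_weak {h : ℝ → ℝ≥0∞} (hh : Measurable h) (lam : ℝ≥0∞) :
    lam * volume {x | lam < maxFun h x} ≤ 8 * ∫⁻ y, h y := by
  have hE : {x | lam < maxFun h x}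
      = ⋃ N : ℕ, {x | ∃ m : ℤ, -(N : ℤ) ≤ m ∧ lam < avgBall h m x} := by
    ext x
    simp only [maxFun, mem_ofPred_eq, lt_iSup_iff, mem_iUnion]
    constructor
    · rintro ⟨m, hm⟩
      exact ⟨m.natAbs, m, by omega, hm⟩
    · rintro ⟨N, m, _, hm⟩
      exact ⟨m, hm⟩
  have hmono : Monotone fun N : ℕ => {x | ∃ m : ℤ, -(N : ℤ) ≤ m ∧ lam < avgBall h m x} := by
    intro N N' hN x
    rintro ⟨m, h1, h2⟩
    exact ⟨m, by have : (N : ℤ) ≤ N' := by exact_mod_cast hN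
                 omega, h2⟩
  rw [hE, hmono.measure_iUnion, ENNReal.mul_iSup]
  exact iSup_le fun N => maxFun_weak_aux hh lam N

/-- Layer-cake representation of a power. -/
lemma layer_rpow {a : ℝ} (ha : 0 < a) (x : ℝ≥0∞) :
    ∫⁻ s in Ioi (0:ℝ), {s : ℝ | ENNReal.ofReal s < x}.indicator
      (fun s => ENNReal.ofReal (s ^ (a - 1))) s = ENNReal.ofReal a⁻¹ * x ^ a := by
  have hfin : ∀ r : ℝ, 0 ≤ r → ∫⁻ s in Ioo (0:ℝ) r, ENNReal.ofReal (s ^ (a - 1))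
      = ENNReal.ofReal (r ^ a / a) := by
    intro r hr
    have hint : IntervalIntegrable (fun s : ℝ => s ^ (a - 1)) volume 0 r :=
      intervalIntegral.intervalIntegrable_rpow' (by linarith)
    rw [restrict_Ioo_eq_restrict_Ioc, ← ofReal_integral_eq_lintegral_ofReal
      ((intervalIntegrable_iff_integrableOn_Ioc_of_le hr).1 hint),
      ← intervalIntegral.integral_of_le hr, integral_rpow (Or.inl (by linarith))]
    · rw [sub_add_cancel, Real.zero_rpow ha.ne', sub_zero]
    · filter_upwards [ae_restrict_mem measurableSet_Ioc] with s hs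
      exact Real.rpow_nonneg hs.1.le _
  have hms : MeasurableSet {s : ℝ | ENNReal.ofReal s < x} :=
    measurableSet_lt (by fun_prop) measurable_const
  rw [lintegral_indicator hms, Measure.restrict_restrict hms]
  induction x with
  | top =>
    rw [ENNReal.top_rpow_of_pos ha, ENNReal.mul_top (by simpa using ha)]
    have : ({s : ℝ | ENNReal.ofReal s < ⊤} ∩ Ioi (0:ℝ)) = Ioi 0 := by ext; simp
    rw [this]
    refine ENNReal.eq_top_of_forall_nnreal_le fun r => ?_
    have h1 := hfin ((r * a) ^ a⁻¹) (by positivity)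
    rw [← Real.rpow_mul (by positivity), inv_mul_cancel₀ ha.ne', Real.rpow_one,
      mul_div_cancel_right₀ _ ha.ne', ENNReal.ofReal_coe_nnreal] at h1
    rw [← h1]
    exact lintegral_mono_set Ioo_subset_Ioi_self
  | coe r =>
    have : ({s : ℝ | ENNReal.ofReal s < (r : ℝ≥0∞)} ∩ Ioi (0:ℝ)) = Ioo 0 (r : ℝ) := by
      ext s
      simp only [mem_inter_iff, mem_ofPred_eq, mem_Ioi, mem_Ioo]
      constructor
      · rintro ⟨h1, h2⟩
        refine ⟨h2, ?_⟩
        rw [← ENNReal.ofReal_coe_nnreal, ENNReal.ofReal_lt_ofReal_iff_of_nonneg h2.le] at h1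
        exact h1
      · rintro ⟨h1, h2⟩
        refine ⟨?_, h1⟩
        rw [← ENNReal.ofReal_coe_nnreal, ENNReal.ofReal_lt_ofReal_iff_of_nonneg h1.le]
        exact h2
    rw [this, hfin r r.2, div_eq_inv_mul, ENNReal.ofReal_mul (by positivity),
      ← ENNReal.ofReal_rpow_of_nonneg (NNReal.coe_nonneg r) ha.le, ENNReal.ofReal_coe_nnreal]

lemma maxFun_trunc {h : ℝ → ℝ≥0∞} (hh : Measurable h) {s : ℝ} (hs : 0 < s) :
    ENNReal.ofReal s * volume {x | ENNReal.ofReal s < maxFun h x}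
      ≤ 16 * ∫⁻ y, {y | ENNReal.ofReal s < 4 * h y}.indicator h y := by
  have hms : MeasurableSet {y | ENNReal.ofReal s < 4 * h y} :=
    measurableSet_lt measurable_const (by fun_prop)
  set k := {y | ENNReal.ofReal s < 4 * h y}.indicator h with hk
  have hkm : Measurable k := hh.indicator hms
  have hle : ∀ y, h y ≤ k y + ENNReal.ofReal (s / 4) := by
    intro y
    by_cases hy : ENNReal.ofReal s < 4 * h y
    · rw [hk, indicator_of_mem (by exact hy)]; exact le_self_add
    · rw [not_lt] at hy
      refine le_trans ?_ le_add_self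
      rw [ENNReal.ofReal_div_of_pos (by norm_num), ENNReal.le_div_iff_mul_le (by norm_num) (by norm_num)]
      simpa [mul_comm] using hy
  have hmax : ∀ x, maxFun h x ≤ maxFun k x + ENNReal.ofReal (s / 2) := by
    intro x
    refine iSup_le fun m => ?_
    calc avgBall h m x ≤ ∫⁻ t in Icc (-1 : ℝ) 1, (k (x + (2:ℝ) ^ (-m) * t) + ENNReal.ofReal (s / 4)) :=
          lintegral_mono fun t => hle _
      _ = avgBall k m x + ENNReal.ofReal (s / 2) := by
          rw [lintegral_add_right _ measurable_const, lintegral_const]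
          simp only [MeasurableSet.univ, Measure.restrict_apply, univ_inter, Real.volume_Icc]
          rw [← ENNReal.ofReal_mul (by positivity)]
          unfold avgBall
          congr 2; ring
      _ ≤ _ := by gcongr; exact le_iSup (fun m => avgBall k m x) m
  have hsub : {x | ENNReal.ofReal s < maxFun h x} ⊆ {x | ENNReal.ofReal (s / 2) < maxFun k x} := by
    intro x hx
    simp only [mem_ofPred_eq] at hx ⊢
    by_contra hcon
    rw [not_lt] at hcon
    have := hx.trans_le ((hmax x).trans (add_le_add_left hcon _))
    rw [← ENNReal.ofReal_add (by positivity) (by positivity), add_halves] at this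
    exact lt_irrefl _ this
  have h2 : ENNReal.ofReal s = 2 * ENNReal.ofReal (s / 2) := by
    rw [show (2 : ℝ≥0∞) = ENNReal.ofReal 2 by norm_num, ← ENNReal.ofReal_mul (by norm_num)]
    congr 1; ring
  calc ENNReal.ofReal s * volume {x | ENNReal.ofReal s < maxFun h x}
      ≤ ENNReal.ofReal s * volume {x | ENNReal.ofReal (s / 2) < maxFun k x} := by gcongr
    _ = 2 * (ENNReal.ofReal (s / 2) * volume {x | ENNReal.ofReal (s / 2) < maxFun k x}) := by
        rw [h2]; ring
    _ ≤ 2 * (8 * ∫⁻ y, k y) := by gcongr 2 * ?_; exact maxFun_weak hkm _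
    _ = 16 * ∫⁻ y, k y := by ring

/-- The maximal theorem, with the growth of the constant as `p → 1`. -/
lemma maxFun_strong {h : ℝ → ℝ≥0∞} (hh : Measurable h) {p : ℝ} (hp : 1 < p) (hp2 : p ≤ 2) :
    ∫⁻ x, maxFun h x ^ p ≤ ENNReal.ofReal (128 / (p - 1)) * ∫⁻ x, h x ^ p := by
  have hp0 : 0 < p := by linarith
  have hM := measurable_maxFun hh
  have hcake : ∀ x, maxFun h x ^ p = ENNReal.ofReal p *
      ∫⁻ s in Ioi (0:ℝ), {s : ℝ | ENNReal.ofReal s < maxFun h x}.indicator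
      (fun s => ENNReal.ofReal (s ^ (p - 1))) s := by
    intro x
    rw [layer_rpow hp0, ← mul_assoc, ← ENNReal.ofReal_mul hp0.le, mul_inv_cancel₀ hp0.ne']
    simp
  simp_rw [hcake]
  have hset1 : MeasurableSet {q : ℝ × ℝ | ENNReal.ofReal q.2 < maxFun h q.1} :=
    measurableSet_lt (by fun_prop) (by fun_prop)
  have hset2 : MeasurableSet {q : ℝ × ℝ | ENNReal.ofReal q.1 < 4 * h q.2} :=
    measurableSet_lt (by fun_prop) (by fun_prop)
  rw [lintegral_const_mul']
  swap; · simp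
  rw [lintegral_lintegral_swap]
  swap
  · refine Measurable.aemeasurable ?_
    have : Measurable ({q : ℝ × ℝ | ENNReal.ofReal q.2 < maxFun h q.1}.indicator
      (fun q => ENNReal.ofReal (q.2 ^ (p - 1)))) := by
        refine Measurable.indicator ?_ hset1
        fun_prop
    exact this
  have hstep : ∀ s ∈ Ioi (0:ℝ), ∫⁻ x, {s : ℝ | ENNReal.ofReal s < maxFun h x}.indicator
      (fun s => ENNReal.ofReal (s ^ (p - 1))) s
      ≤ ∫⁻ y, 16 * (h y * {s : ℝ | ENNReal.ofReal s < 4 * h y}.indicator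
      (fun s => ENNReal.ofReal (s ^ (p - 1 - 1))) s) := by
    intro s hs
    have hs0 : (0:ℝ) < s := hs
    have e1 : ∀ x, {s : ℝ | ENNReal.ofReal s < maxFun h x}.indicator
      (fun s => ENNReal.ofReal (s ^ (p - 1))) s = {x | ENNReal.ofReal s < maxFun h x}.indicator
        (fun _ => ENNReal.ofReal (s ^ (p - 1))) x := fun x => rfl
    have e2 : ∀ y, 16 * (h y * {s : ℝ | ENNReal.ofReal s < 4 * h y}.indicator
      (fun s => ENNReal.ofReal (s ^ (p - 1 - 1))) s) = ENNReal.ofReal (s ^ (p - 1 - 1)) * (16 *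
        {y | ENNReal.ofReal s < 4 * h y}.indicator h y) := by
      intro y
      by_cases hy : ENNReal.ofReal s < 4 * h y
      · rw [indicator_of_mem (show s ∈ {s : ℝ | ENNReal.ofReal s < 4 * h y} from hy),
          indicator_of_mem (show y ∈ {y | ENNReal.ofReal s < 4 * h y} from hy)]
        ring
      · rw [indicator_of_notMem (show s ∉ {s : ℝ | ENNReal.ofReal s < 4 * h y} from hy),
          indicator_of_notMem (show y ∉ {y | ENNReal.ofReal s < 4 * h y} from hy)]
        ring
    simp_rw [e1, e2]
    rw [lintegral_indicator (measurableSet_lt measurable_const hM), lintegral_const,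
      lintegral_const_mul' _ _ (by simp), lintegral_const_mul' _ _ (by simp)]
    have e3 : ENNReal.ofReal (s ^ (p - 1)) = ENNReal.ofReal (s ^ (p - 1 - 1)) * ENNReal.ofReal s := by
      rw [← ENNReal.ofReal_mul (by positivity)]
      congr 1
      nth_rewrite 3 [← Real.rpow_one s]
      rw [← Real.rpow_add hs0]; ring_nf
    rw [e3, mul_assoc]
    gcongr ENNReal.ofReal (s ^ (p - 1 - 1)) * ?_
    simpa using maxFun_trunc hh hs0
  calc ENNReal.ofReal p * (∫⁻ s in Ioi (0:ℝ), ∫⁻ x, {s : ℝ | ENNReal.ofReal s < maxFun h x}.indicator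
      (fun s => ENNReal.ofReal (s ^ (p - 1))) s)
      ≤ ENNReal.ofReal p * ∫⁻ s in Ioi (0:ℝ), ∫⁻ y, 16 * (h y *
        {s : ℝ | ENNReal.ofReal s < 4 * h y}.indicator
      (fun s => ENNReal.ofReal (s ^ (p - 1 - 1))) s) := by
        gcongr ENNReal.ofReal p * ?_
        exact setLIntegral_mono' measurableSet_Ioi hstep
    _ = ENNReal.ofReal p * ∫⁻ y, ∫⁻ s in Ioi (0:ℝ), 16 * (h y *
        {s : ℝ | ENNReal.ofReal s < 4 * h y}.indicator
      (fun s => ENNReal.ofReal (s ^ (p - 1 - 1))) s) := by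
        rw [lintegral_lintegral_swap]
        refine Measurable.aemeasurable ?_
        have : Measurable ({q : ℝ × ℝ | ENNReal.ofReal q.1 < 4 * h q.2}.indicator
          (fun q => ENNReal.ofReal (q.1 ^ (p - 1 - 1)))) := by
            refine Measurable.indicator ?_ hset2
            fun_prop
        exact ((measurable_const.mul ((hh.comp measurable_snd).mul this)) :)
    _ = ENNReal.ofReal p * ∫⁻ y, (16 * ENNReal.ofReal (p - 1)⁻¹ * 4 ^ (p - 1)) * h y ^ p := by
        congr 1
        refine lintegral_congr fun y => ?_
        have hmeas : Measurable ({s : ℝ | ENNReal.ofReal s < 4 * h y}.indicator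
            (fun s => ENNReal.ofReal (s ^ (p - 1 - 1)))) := by
          refine Measurable.indicator (by fun_prop) (measurableSet_lt (by fun_prop) measurable_const)
        rw [lintegral_const_mul _ (hmeas.const_mul _), lintegral_const_mul _ hmeas,
          layer_rpow (by linarith), ENNReal.mul_rpow_of_nonneg _ _ (by linarith)]
        have : h y ^ p = h y * h y ^ (p - 1) := by
          nth_rewrite 2 [← ENNReal.rpow_one (h y)]
          rw [← ENNReal.rpow_add_of_nonneg _ _ (by norm_num) (by linarith)]
          congr 1; ring
        rw [this]; ring
    _ ≤ ENNReal.ofReal (128 / (p - 1)) * ∫⁻ x, h x ^ p := by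
        rw [lintegral_const_mul _ (by fun_prop), ← mul_assoc]
        gcongr
        have h4 : (4 : ℝ≥0∞) ^ (p - 1) ≤ 4 := by
          calc (4 : ℝ≥0∞) ^ (p - 1) ≤ 4 ^ (1:ℝ) :=
                ENNReal.rpow_le_rpow_of_exponent_le (by norm_num) (by linarith)
            _ = 4 := ENNReal.rpow_one _
        calc ENNReal.ofReal p * (16 * ENNReal.ofReal (p - 1)⁻¹ * 4 ^ (p - 1))
            ≤ ENNReal.ofReal 2 * (ENNReal.ofReal 16 * ENNReal.ofReal (p - 1)⁻¹ * ENNReal.ofReal 4) := by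
              gcongr
              · simp
              · simpa using h4
          _ = _ := by
              rw [← ENNReal.ofReal_mul (by norm_num), ← ENNReal.ofReal_mul (by
                have : 0 < (p - 1)⁻¹ := inv_pos.2 (by linarith)
                positivity), ← ENNReal.ofReal_mul (by norm_num)]
              congr 1; ring

lemma interval_le_maxFun {h : ℝ → ℝ≥0∞} (hh : Measurable h) (m : ℤ) {s a b X : ℝ} (x : ℝ)
    (hX : 1 ≤ X) (ha : -X ≤ s + a) (hb : s + b ≤ X) :
    ∫⁻ v in Icc a b, h (x + (2:ℝ) ^ (-m) * (s + v)) ≤ ENNReal.ofReal (2 * X) * maxFun h x := by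
  obtain ⟨n, hn1, hn2⟩ := exists_nat_pow_near hX (show (1:ℝ) < 2 by norm_num)
  have e1 : ∀ v, h (x + (2:ℝ) ^ (-m) * (s + v)) = h ((x + (2:ℝ) ^ (-m) * s) + (2:ℝ) ^ (-m) * v) := by
    intro v; congr 1; ring
  simp_rw [e1]
  rw [lintegral_affine_Icc hh _ (by positivity)]
  have hsub : Icc (x + (2:ℝ) ^ (-m) * s + (2:ℝ) ^ (-m) * a) (x + (2:ℝ) ^ (-m) * s + (2:ℝ) ^ (-m) * b)
      ⊆ Metric.closedBall x ((2:ℝ) ^ (-(m - (n + 1)))) := by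
    rw [Real.closedBall_eq_Icc]
    have h2 : (2:ℝ) ^ (-(m - (n + 1))) = (2:ℝ) ^ (-m) * (2:ℝ) ^ (n + 1) := by
      rw [neg_sub, show ((n : ℤ) + 1 - m) = -m + ((n + 1 : ℕ) : ℤ) by push_cast; ring,
        zpow_add₀ (by norm_num), zpow_natCast]
    have h3 : (0:ℝ) < (2:ℝ) ^ (-m) := by positivity
    rw [h2]
    refine Icc_subset_Icc ?_ ?_
    · have := mul_le_mul_of_nonneg_left (show -(2:ℝ) ^ (n + 1) ≤ s + a by linarith) h3.le
      linarith
    · have := mul_le_mul_of_nonneg_left (show s + b ≤ (2:ℝ) ^ (n + 1) by linarith) h3.le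
      linarith
  have hm := avgBall_eq hh (m - (n + 1)) x
  have h4 : (2:ℝ) ^ m = (2:ℝ) ^ (n + 1) * (2:ℝ) ^ (m - (n + 1) : ℤ) := by
    rw [← zpow_natCast (2:ℝ) (n + 1), ← zpow_add₀ (by norm_num)]
    congr 1; push_cast; ring
  calc ENNReal.ofReal ((2:ℝ) ^ (-m))⁻¹ * ∫⁻ y in Icc (x + (2:ℝ) ^ (-m) * s + (2:ℝ) ^ (-m) * a)
        (x + (2:ℝ) ^ (-m) * s + (2:ℝ) ^ (-m) * b), h y
      ≤ ENNReal.ofReal ((2:ℝ) ^ (-m))⁻¹ * ∫⁻ y in Metric.closedBall x ((2:ℝ) ^ (-(m - (n + 1)))), h y := by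
        gcongr
    _ = ENNReal.ofReal ((2:ℝ) ^ (n + 1)) * avgBall h (m - (n + 1)) x := by
        rw [hm, ← mul_assoc, ← ENNReal.ofReal_mul (by positivity), zpow_neg, inv_inv, ← h4]
    _ ≤ _ := by
        gcongr
        · rw [pow_succ]; linarith
        · exact le_iSup (fun m => avgBall h m x) _

lemma box_le_maxFun {h : ℝ → ℝ≥0∞} (hh : Measurable h) (m : ℤ) (s x : ℝ) :
    ∫⁻ v in Icc (0:ℝ) 1, h (x + (2:ℝ) ^ (-m) * (s + v))
      ≤ ENNReal.ofReal (2 * (1 + |s|)) * maxFun h x :=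
  interval_le_maxFun hh m x (by linarith [abs_nonneg s]) (by linarith [neg_abs_le s])
    (by linarith [le_abs_self s])

lemma maxFun_le_of_bdd {h : ℝ → ℝ≥0∞} {K : ℝ≥0∞} (hK : ∀ t, h t ≤ K) (x : ℝ) :
    maxFun h x ≤ 2 * K := by
  refine iSup_le fun m => ?_
  calc avgBall h m x ≤ ∫⁻ t in Icc (-1 : ℝ) 1, K := lintegral_mono fun t => hK _
    _ = 2 * K := by
      rw [lintegral_const]
      simp only [MeasurableSet.univ, Measure.restrict_apply, univ_inter, Real.volume_Icc]
      rw [mul_comm]; norm_num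

/-- Maximal function in the first variable. -/
def maxFst (h : ℝ × ℝ → ℝ≥0∞) (x : ℝ × ℝ) : ℝ≥0∞ := maxFun (fun t => h (t, x.2)) x.1

/-- Maximal function in the second variable. -/
def maxSnd (h : ℝ × ℝ → ℝ≥0∞) (x : ℝ × ℝ) : ℝ≥0∞ := maxFun (fun t => h (x.1, t)) x.2

lemma measurable_maxSnd {h : ℝ × ℝ → ℝ≥0∞} (hh : Measurable h) : Measurable (maxSnd h) :=
  measurable_maxFun_uncurry hh

lemma measurable_maxFst {h : ℝ × ℝ → ℝ≥0∞} (hh : Measurable h) : Measurable (maxFst h) :=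
  (measurable_maxFun_uncurry (h := fun q : ℝ × ℝ => h (q.2, q.1)) (by fun_prop)).comp
    measurable_swap

lemma maxSnd_strong {h : ℝ × ℝ → ℝ≥0∞} (hh : Measurable h) {p : ℝ} (hp : 1 < p) (hp2 : p ≤ 2) :
    ∫⁻ x, maxSnd h x ^ p ≤ ENNReal.ofReal (128 / (p - 1)) * ∫⁻ x, h x ^ p := by
  have hM := measurable_maxSnd hh
  rw [Measure.volume_eq_prod, lintegral_prod _ (by fun_prop), lintegral_prod _ (by fun_prop),
    ← lintegral_const_mul' _ _ (by simp)]
  refine lintegral_mono fun x => ?_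
  exact maxFun_strong (h := fun t => h (x, t)) (by fun_prop) hp hp2

lemma maxFst_strong {h : ℝ × ℝ → ℝ≥0∞} (hh : Measurable h) {p : ℝ} (hp : 1 < p) (hp2 : p ≤ 2) :
    ∫⁻ x, maxFst h x ^ p ≤ ENNReal.ofReal (128 / (p - 1)) * ∫⁻ x, h x ^ p := by
  have hM := measurable_maxFst hh
  rw [Measure.volume_eq_prod, lintegral_prod_symm _ (by fun_prop),
    lintegral_prod_symm _ (by fun_prop), ← lintegral_const_mul' _ _ (by simp)]
  refine lintegral_mono fun x => ?_
  exact maxFun_strong (h := fun t => h (t, x)) (by fun_prop) hp hp2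

/-! ### Dyadic differences of one-sided averages -/

/-- The function `x^p - κ x²` is midpoint convex and monotone on `[0, M]`
for `κ = p(p-1)M^{p-2}/2`. -/
lemma rpow_sub_sq_convex {p M : ℝ} (hp : 1 < p) (hp2 : p ≤ 2) (hM : 0 < M) :
    ConvexOn ℝ (Icc 0 M) (fun x => x ^ p - p * (p - 1) / 2 * M ^ (p - 2) * x ^ 2) ∧
    MonotoneOn (fun x => x ^ p - p * (p - 1) / 2 * M ^ (p - 2) * x ^ 2) (Icc 0 M) := by
  set κ := p * (p - 1) / 2 * M ^ (p - 2) with hκ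
  have hd : ∀ x ∈ Ioo 0 M, HasDerivAt (fun x => x ^ p - κ * x ^ 2) (p * x ^ (p - 1) - κ * (2 * x)) x := by
    intro x hx
    have h1 := Real.hasDerivAt_rpow_const (x := x) (p := p) (Or.inl hx.1.ne')
    have h2 := (hasDerivAt_pow 2 x).const_mul κ
    simpa only [Nat.cast_ofNat, Nat.add_one_sub_one, pow_one] using! h1.sub h2
  have hd2 : ∀ x ∈ Ioo 0 M, HasDerivAt (fun x => p * x ^ (p - 1) - κ * (2 * x))
      (p * ((p - 1) * x ^ (p - 2)) - κ * 2) x := by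
    intro x hx
    have h1 := (Real.hasDerivAt_rpow_const (x := x) (p := p - 1) (Or.inl hx.1.ne')).const_mul p
    have h2 := ((hasDerivAt_id x).const_mul 2).const_mul κ
    have h3 := h1.sub h2
    have e : p - 1 - 1 = p - 2 := by ring
    simpa only [e, mul_one, id] using! h3
  have hcont : ContinuousOn (fun x => x ^ p - κ * x ^ 2) (Icc 0 M) := by
    refine ContinuousOn.sub ?_ (by fun_prop)
    exact (Real.continuous_rpow_const (by linarith)).continuousOn
  have hpow : ∀ x ∈ Ioo 0 M, M ^ (p - 2) ≤ x ^ (p - 2) := by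
    intro x hx
    exact Real.rpow_le_rpow_of_nonpos hx.1 hx.2.le (by linarith)
  constructor
  · refine convexOn_of_hasDerivWithinAt2_nonneg (convex_Icc 0 M) hcont
      (f' := fun x => p * x ^ (p - 1) - κ * (2 * x))
      (f'' := fun x => p * ((p - 1) * x ^ (p - 2)) - κ * 2) ?_ ?_ ?_
    · intro x hx; rw [interior_Icc] at hx; exact (hd x hx).hasDerivWithinAt
    · intro x hx; rw [interior_Icc] at hx; exact (hd2 x hx).hasDerivWithinAt
    · intro x hx; rw [interior_Icc] at hx
      have := hpow x hx
      have h3 : 0 ≤ p * (p - 1) := by nlinarith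
      rw [hκ]
      nlinarith [mul_le_mul_of_nonneg_left this h3]
  · refine monotoneOn_of_hasDerivWithinAt_nonneg (convex_Icc 0 M) hcont
      (f' := fun x => p * x ^ (p - 1) - κ * (2 * x)) ?_ ?_
    · intro x hx; rw [interior_Icc] at hx ⊢; exact (hd x hx).hasDerivWithinAt
    · intro x hx; rw [interior_Icc] at hx
      have h1 := hpow x hx
      have h2 : x ^ (p - 1) = x ^ (p - 2) * x := by
        nth_rewrite 3 [← Real.rpow_one x]
        rw [← Real.rpow_add hx.1]; ring_nf
      have h4 : 0 < M ^ (p - 2) := by positivity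
      rw [hκ, h2]
      have h5 : (p - 1) * M ^ (p - 2) ≤ x ^ (p - 2) := by nlinarith
      have h6 := mul_le_mul_of_nonneg_left h5 (show 0 ≤ p * x by nlinarith [hx.1])
      nlinarith

lemma norm_rpow_midpoint {E : Type*} [NormedAddCommGroup E] [InnerProductSpace ℝ E]
    {p M : ℝ} (hp : 1 < p) (hp2 : p ≤ 2) (hM : 0 < M) {a b : E} (ha : ‖a‖ ≤ M) (hb : ‖b‖ ≤ M) :
    p * (p - 1) / 2 * M ^ (p - 2) * ‖(2⁻¹ : ℝ) • (a - b)‖ ^ 2 + ‖(2⁻¹ : ℝ) • (a + b)‖ ^ p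
      ≤ 2⁻¹ * (‖a‖ ^ p + ‖b‖ ^ p) := by
  obtain ⟨hc, hm⟩ := rpow_sub_sq_convex hp hp2 hM
  set κ := p * (p - 1) / 2 * M ^ (p - 2)
  have h1 := hc.2 ⟨norm_nonneg a, ha⟩ ⟨norm_nonneg b, hb⟩ (show (0:ℝ) ≤ 2⁻¹ by norm_num)
    (show (0:ℝ) ≤ 2⁻¹ by norm_num) (by norm_num)
  have hn : ‖(2⁻¹ : ℝ) • (a + b)‖ ≤ 2⁻¹ * ‖a‖ + 2⁻¹ * ‖b‖ := by
    rw [norm_smul]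
    have := norm_add_le a b
    norm_num
    linarith
  have h2 := hm (a := ‖(2⁻¹ : ℝ) • (a + b)‖) (b := 2⁻¹ * ‖a‖ + 2⁻¹ * ‖b‖)
    ⟨norm_nonneg _, hn.trans (by linarith)⟩ ⟨by positivity, by linarith⟩ hn
  simp only [smul_eq_mul] at h1 h2
  have h3 := parallelogram_law_with_norm ℝ a b
  have e1 : ‖(2⁻¹ : ℝ) • (a - b)‖ ^ 2 = 4⁻¹ * (‖a - b‖ * ‖a - b‖) := by
    rw [norm_smul]; norm_num; ring
  have e2 : ‖(2⁻¹ : ℝ) • (a + b)‖ ^ 2 = 4⁻¹ * (‖a + b‖ * ‖a + b‖) := by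
    rw [norm_smul]; norm_num; ring
  have e3 : ‖(2⁻¹ : ℝ) • (a - b)‖ ^ 2 + ‖(2⁻¹ : ℝ) • (a + b)‖ ^ 2 = 2⁻¹ * (‖a‖ ^ 2 + ‖b‖ ^ 2) := by
    rw [e1, e2]; nlinarith
  have e4 : κ * ‖(2⁻¹ : ℝ) • (a - b)‖ ^ 2 = κ * (2⁻¹ * (‖a‖ ^ 2 + ‖b‖ ^ 2))
      - κ * ‖(2⁻¹ : ℝ) • (a + b)‖ ^ 2 := by rw [← e3]; ring
  rw [e4]
  linarith

lemma intervalIntegrable_of_bdd {E : Type*} [NormedAddCommGroup E] {F : ℝ → E} (hF : StronglyMeasurable F) {K : ℝ}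
    (hK : ∀ t, ‖F t‖ ≤ K) (a b : ℝ) : IntervalIntegrable F volume a b := by
  refine (intervalIntegrable_const (c := K)).mono_fun hF.aestronglyMeasurable ?_
  filter_upwards with t
  exact (hK t).trans (le_abs_self K)

section DyadicAverage

variable {E : Type*} [NormedAddCommGroup E] [NormedSpace ℝ E]

/-- The average of `F` over `[x, x + 2^{-m}]`. -/
def dAvg (m : ℤ) (F : ℝ → E) (x : ℝ) : E := ∫ t in (0:ℝ)..1, F (x + (2:ℝ) ^ (-m) * t)

/-- The dyadic difference of consecutive averages. -/
def dDiff (m : ℤ) (F : ℝ → E) (x : ℝ) : E := dAvg (m + 1) F x - dAvg m F x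

lemma dAvg_eq_half {F : ℝ → E} (hF : StronglyMeasurable F) {K : ℝ}
    (hK : ∀ t, ‖F t‖ ≤ K) (m : ℤ) (x : ℝ) :
    dAvg m F x = (2⁻¹ : ℝ) • (dAvg (m + 1) F x + dAvg (m + 1) F (x + (2:ℝ) ^ (-(m + 1)))) := by
  have hr : (2:ℝ) ^ (-m) = 2 * (2:ℝ) ^ (-(m + 1)) := by
    rw [← zpow_one_add₀ (by norm_num)]; congr 1; ring
  set r := (2:ℝ) ^ (-(m + 1)) with hrdef
  have hii : ∀ a b, IntervalIntegrable (fun t => F (x + 2 * r * t)) volume a b := fun a b =>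
    intervalIntegrable_of_bdd (F := fun t => F (x + 2 * r * t))
      (hF.comp_measurable (by fun_prop)) (fun t => hK _) a b
  unfold dAvg
  rw [hr, ← intervalIntegral.integral_add_adjacent_intervals (hii 0 2⁻¹) (hii 2⁻¹ 1), smul_add]
  congr 1
  · have := intervalIntegral.integral_comp_mul_left (a := 0) (b := 1)
      (fun t => F (x + 2 * r * t)) (show (2⁻¹:ℝ) ≠ 0 by norm_num)
    simp only [mul_zero, mul_one, inv_inv] at this
    rw [show (fun t => F (x + r * t)) = fun t => F (x + 2 * r * (2⁻¹ * t)) by ext t; ring_nf, this,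
      smul_smul]
    norm_num
  · have := intervalIntegral.integral_comp_mul_add (a := 0) (b := 1)
      (fun t => F (x + 2 * r * t)) (show (2⁻¹:ℝ) ≠ 0 by norm_num) 2⁻¹
    simp only [mul_zero, mul_one, inv_inv, zero_add] at this
    rw [show (fun t => F (x + r + r * t)) = fun t => F (x + 2 * r * (2⁻¹ * t + 2⁻¹)) by
      ext t; ring_nf, this, smul_smul]
    norm_num

lemma enorm_dAvg_le (F : ℝ → E) (m : ℤ) (x : ℝ) :
    ‖dAvg m F x‖ₑ ≤ ∫⁻ v in Icc (0:ℝ) 1, ‖F (x + (2:ℝ) ^ (-m) * v)‖ₑ := by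
  unfold dAvg
  rw [intervalIntegral.integral_of_le zero_le_one, ← restrict_Ioc_eq_restrict_Icc]
  exact enorm_integral_le_lintegral_enorm _

lemma stronglyMeasurable_dAvg_uncurry {α : Type*} [MeasurableSpace α] {F : α × ℝ → E}
    (hF : StronglyMeasurable F) (m : ℤ) :
    StronglyMeasurable fun q : α × ℝ => dAvg m (fun t => F (q.1, t)) q.2 := by
  unfold dAvg
  simp_rw [intervalIntegral.integral_of_le (zero_le_one' ℝ)]
  refine StronglyMeasurable.integral_prod_right' (ν := volume.restrict (Ioc (0:ℝ) 1))
    (f := fun z : (α × ℝ) × ℝ => F (z.1.1, z.1.2 + (2:ℝ) ^ (-m) * z.2)) ?_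
  exact hF.comp_measurable (by fun_prop)

lemma stronglyMeasurable_dAvg {F : ℝ → E} (hF : StronglyMeasurable F) (m : ℤ) :
    StronglyMeasurable (dAvg m F) :=
  (stronglyMeasurable_dAvg_uncurry (α := Unit) (F := fun q => F q.2)
    (hF.comp_measurable measurable_snd) m).comp_measurable
    (measurable_const (a := ()) |>.prodMk measurable_id)

lemma dAvg_lp {F : ℝ → E} (hF : StronglyMeasurable F) (m : ℤ) {p : ℝ} (hp : 1 ≤ p) :
    ∫⁻ x, ‖dAvg m F x‖ₑ ^ p ≤ ∫⁻ x, ‖F x‖ₑ ^ p := by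
  have hF' : Measurable fun x => ‖F x‖ₑ := hF.enorm
  have hpt : ∀ x, ‖dAvg m F x‖ₑ ^ p ≤ ∫⁻ v in Icc (0:ℝ) 1, ‖F (x + (2:ℝ) ^ (-m) * v)‖ₑ ^ p := by
    intro x
    have hg : Measurable fun v : ℝ => ‖F (x + (2:ℝ) ^ (-m) * v)‖ₑ := by fun_prop
    have h1 := ENNReal.lintegral_mul_norm_pow_le (μ := volume.restrict (Icc (0:ℝ) 1))
      (f := fun v => ‖F (x + (2:ℝ) ^ (-m) * v)‖ₑ ^ p) (g := fun _ => 1) (p := 1 / p) (q := 1 - 1 / p)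
      (hg.pow_const p).aemeasurable (by fun_prop) (by positivity)
      (by rw [sub_nonneg, div_le_one (by linarith)]; exact hp) (by ring)
    have h2 := (enorm_dAvg_le F m x)
    have h3 : ∫⁻ v in Icc (0:ℝ) 1, ‖F (x + (2:ℝ) ^ (-m) * v)‖ₑ
        ≤ (∫⁻ v in Icc (0:ℝ) 1, ‖F (x + (2:ℝ) ^ (-m) * v)‖ₑ ^ p) ^ (1 / p) := by
      refine le_trans (le_of_eq ?_) (h1.trans (le_of_eq ?_))
      · refine lintegral_congr fun v => ?_
        rw [ENNReal.one_rpow, mul_one, ← ENNReal.rpow_mul, mul_one_div_cancel (by linarith),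
          ENNReal.rpow_one]
      · simp
    calc _ ≤ ((∫⁻ v in Icc (0:ℝ) 1, ‖F (x + (2:ℝ) ^ (-m) * v)‖ₑ ^ p) ^ (1 / p)) ^ p := by
          gcongr; exact h2.trans h3
      _ = _ := by
          rw [← ENNReal.rpow_mul, one_div_mul_cancel (by linarith), ENNReal.rpow_one]
  calc ∫⁻ x, ‖dAvg m F x‖ₑ ^ p
      ≤ ∫⁻ x, ∫⁻ v in Icc (0:ℝ) 1, ‖F (x + (2:ℝ) ^ (-m) * v)‖ₑ ^ p := lintegral_mono hpt
    _ = ∫⁻ v in Icc (0:ℝ) 1, ∫⁻ x, ‖F (x + (2:ℝ) ^ (-m) * v)‖ₑ ^ p := by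
        rw [lintegral_lintegral_swap]
        refine Measurable.aemeasurable ?_
        simp only [Function.uncurry_def]
        fun_prop
    _ = ∫⁻ v in Icc (0:ℝ) 1, ∫⁻ x, ‖F x‖ₑ ^ p := by
        refine lintegral_congr fun v => ?_
        exact lintegral_add_right_eq_self (fun x => ‖F x‖ₑ ^ p) _
    _ = _ := by simp

end DyadicAverage

section SquareFunction

variable {E : Type*} [NormedAddCommGroup E] [InnerProductSpace ℝ E]

lemma dDiff_energy_pointwise {F : ℝ → E} (hF : StronglyMeasurable F) {K : ℝ}
    (hK : ∀ t, ‖F t‖ ≤ K) {p : ℝ} (hp : 1 < p) (hp2 : p ≤ 2) (m : ℤ) (x : ℝ) :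
    ENNReal.ofReal ((p - 1) / 2) * ((4 * maxFun (fun t => ‖F t‖ₑ) x) ^ (p - 2) * ‖dDiff m F x‖ₑ ^ 2)
      + ‖dAvg m F x‖ₑ ^ p
      ≤ 2⁻¹ * (‖dAvg (m + 1) F x‖ₑ ^ p + ‖dAvg (m + 1) F (x + (2:ℝ) ^ (-(m + 1)))‖ₑ ^ p) := by
  have hF' : Measurable fun x => ‖F x‖ₑ := hF.enorm
  set H := maxFun (fun t => ‖F t‖ₑ) x with hH
  have hHtop : 4 * H ≠ ⊤ := by
    refine ENNReal.mul_ne_top (by norm_num) (ne_top_of_le_ne_top ?_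
      (maxFun_le_of_bdd (K := ENNReal.ofReal K) (fun t => ?_) x))
    · exact ENNReal.mul_ne_top (by norm_num) (by simp)
    · rw [← ofReal_norm]; exact ENNReal.ofReal_le_ofReal (hK t)
  set a := dAvg (m + 1) F x
  set b := dAvg (m + 1) F (x + (2:ℝ) ^ (-(m + 1)))
  have hab : dAvg m F x = (2⁻¹ : ℝ) • (a + b) := dAvg_eq_half hF hK m x
  have hD : dDiff m F x = (2⁻¹ : ℝ) • (a - b) := by
    rw [dDiff, hab]; module
  have ha : ‖a‖ₑ ≤ 4 * H := by
    refine (enorm_dAvg_le F (m + 1) x).trans ?_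
    have := box_le_maxFun hF' (m + 1) 0 x
    simp only [zero_add, abs_zero, add_zero, mul_one] at this
    refine this.trans ?_
    gcongr
    norm_num
  have hb : ‖b‖ₑ ≤ 4 * H := by
    refine (enorm_dAvg_le F (m + 1) _).trans ?_
    have := box_le_maxFun hF' (m + 1) 1 x
    have e : ENNReal.ofReal (2 * (1 + |1|)) = 4 := by norm_num
    rw [e] at this
    refine le_trans (le_of_eq ?_) this
    refine lintegral_congr fun v => ?_
    congr 2; ring
  rw [hab, hD]
  set M := (4 * H).toReal with hM
  have hMe : 4 * H = ENNReal.ofReal M := (ENNReal.ofReal_toReal hHtop).symm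
  rw [hMe] at ha hb ⊢
  rw [← ofReal_norm, ENNReal.ofReal_le_ofReal_iff ENNReal.toReal_nonneg] at ha hb
  change ‖a‖ ≤ M at ha
  change ‖b‖ ≤ M at hb
  rcases (show 0 ≤ M from ENNReal.toReal_nonneg).eq_or_lt with h0 | h0
  · rw [← h0] at ha hb
    have ha0 : a = 0 := norm_le_zero_iff.1 ha
    have hb0 : b = 0 := norm_le_zero_iff.1 hb
    simp [ha0, hb0, show 0 < p by linarith]
  · have key := norm_rpow_midpoint hp hp2 h0 ha hb
    have hp0 : (0:ℝ) ≤ p := by linarith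
    rw [ENNReal.ofReal_rpow_of_pos h0]
    simp only [← ofReal_norm]
    rw [← ENNReal.ofReal_pow (norm_nonneg _), ENNReal.ofReal_rpow_of_nonneg (norm_nonneg _) hp0,
      ENNReal.ofReal_rpow_of_nonneg (norm_nonneg _) hp0, ENNReal.ofReal_rpow_of_nonneg (norm_nonneg _) hp0,
      ← ENNReal.ofReal_mul (by positivity), ← ENNReal.ofReal_mul (by linarith),
      ← ENNReal.ofReal_add (by
        have : 0 ≤ p - 1 := by linarith
        positivity) (by positivity), ← ENNReal.ofReal_add (by positivity) (by positivity),
      show (2⁻¹ : ℝ≥0∞) = ENNReal.ofReal 2⁻¹ by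
        rw [ENNReal.ofReal_inv_of_pos (by norm_num)]; norm_num,
      ← ENNReal.ofReal_mul (by norm_num)]
    refine ENNReal.ofReal_le_ofReal (le_trans ?_ key)
    gcongr ?_ + _
    rw [← mul_assoc]
    gcongr
    nlinarith

lemma dDiff_energy {F : ℝ → E} (hF : StronglyMeasurable F) {K : ℝ}
    (hK : ∀ t, ‖F t‖ ≤ K) {p : ℝ} (hp : 1 < p) (hp2 : p ≤ 2) (m : ℤ) :
    ENNReal.ofReal ((p - 1) / 2) *
      (∫⁻ x, (4 * maxFun (fun t => ‖F t‖ₑ) x) ^ (p - 2) * ‖dDiff m F x‖ₑ ^ 2)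
      + ∫⁻ x, ‖dAvg m F x‖ₑ ^ p ≤ ∫⁻ x, ‖dAvg (m + 1) F x‖ₑ ^ p := by
  have hA := fun m => (stronglyMeasurable_dAvg hF m).enorm
  have hD : Measurable fun x => ‖dDiff m F x‖ₑ :=
    ((stronglyMeasurable_dAvg hF (m + 1)).sub (stronglyMeasurable_dAvg hF m)).enorm
  have hMx := measurable_maxFun (h := fun t => ‖F t‖ₑ) hF.enorm
  rw [← lintegral_const_mul' _ _ (by simp), ← lintegral_add_right _ (by have := hA m; fun_prop)]
  refine (lintegral_mono fun x => dDiff_energy_pointwise hF hK hp hp2 m x).trans ?_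
  rw [lintegral_const_mul' _ _ (by simp), lintegral_add_left (by have := hA (m + 1); fun_prop),
    lintegral_add_right_eq_self (fun x => ‖dAvg (m + 1) F x‖ₑ ^ p), ← two_mul, ← mul_assoc,
    ENNReal.inv_mul_cancel (by norm_num) (by norm_num), one_mul]

lemma dDiff_energy_sum {F : ℝ → E} (hF : StronglyMeasurable F) {K : ℝ}
    (hK : ∀ t, ‖F t‖ ≤ K) {p : ℝ} (hp : 1 < p) (hp2 : p ≤ 2) (S : Finset ℤ) :
    ENNReal.ofReal ((p - 1) / 2) * ∑ m ∈ S,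
      ∫⁻ x, (4 * maxFun (fun t => ‖F t‖ₑ) x) ^ (p - 2) * ‖dDiff m F x‖ₑ ^ 2
      ≤ ∫⁻ x, ‖F x‖ₑ ^ p := by
  set e : ℤ → ℝ≥0∞ := fun m =>
    ∫⁻ x, (4 * maxFun (fun t => ‖F t‖ₑ) x) ^ (p - 2) * ‖dDiff m F x‖ₑ ^ 2 with he
  obtain ⟨N, hN⟩ : ∃ N : ℤ, ∀ m ∈ S, N ≤ m := by
    obtain ⟨N, hN⟩ := S.bddBelow
    exact ⟨N, fun m hm => hN hm⟩
  obtain ⟨N', hN'⟩ : ∃ N' : ℤ, ∀ m ∈ S, m ≤ N' := by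
    obtain ⟨N, hN⟩ := S.bddAbove
    exact ⟨N, fun m hm => hN hm⟩
  have hind : ∀ n : ℕ, ENNReal.ofReal ((p - 1) / 2) * ∑ i ∈ Finset.range n, e (N + i)
      + ∫⁻ x, ‖dAvg N F x‖ₑ ^ p ≤ ∫⁻ x, ‖dAvg (N + n) F x‖ₑ ^ p := by
    intro n
    induction n with
    | zero => simp
    | succ n ih =>
      rw [Finset.sum_range_succ, mul_add, add_right_comm]
      refine (add_le_add_left ih _).trans ?_
      rw [add_comm]
      have := dDiff_energy hF hK hp hp2 (N + n)
      rw [add_assoc] at this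
      rw [Nat.cast_succ]
      exact this
  have hsub : S ⊆ (Finset.range ((N' - N).toNat + 1)).image (fun i : ℕ => N + (i : ℤ)) := by
    intro m hm
    rw [Finset.mem_image]
    have h1 := hN m hm
    have h2 := hN' m hm
    refine ⟨(m - N).toNat, ?_, ?_⟩
    · rw [Finset.mem_range]; omega
    · omega
  have h3 : ∑ m ∈ S, e m ≤ ∑ i ∈ Finset.range ((N' - N).toNat + 1), e (N + i) := by
    refine (Finset.sum_le_sum_of_subset hsub).trans (le_of_eq ?_)
    rw [Finset.sum_image]
    intro i _ j _ hij
    simpa using hij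
  calc _ ≤ ENNReal.ofReal ((p - 1) / 2) * ∑ i ∈ Finset.range ((N' - N).toNat + 1), e (N + i) := by
        gcongr
    _ ≤ _ := le_self_add.trans ((hind _).trans (dAvg_lp hF _ hp.le))

/-- Littlewood–Paley type inequality for dyadic differences of averages. -/
lemma dDiff_square {F : ℝ → E} (hF : StronglyMeasurable F) {K : ℝ}
    (hK : ∀ t, ‖F t‖ ≤ K) {p : ℝ} (hp : 1 < p) (hp2 : p ≤ 2) (S : Finset ℤ) :
    ∫⁻ x, (∑ m ∈ S, ‖dDiff m F x‖ₑ ^ 2) ^ (p / 2)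
      ≤ ENNReal.ofReal (2048 / (p - 1)) * ∫⁻ x, ‖F x‖ₑ ^ p := by
  have hF' : Measurable fun x => ‖F x‖ₑ := hF.enorm
  have hD : ∀ m, Measurable fun x => ‖dDiff m F x‖ₑ := fun m =>
    ((stronglyMeasurable_dAvg hF (m + 1)).sub (stronglyMeasurable_dAvg hF m)).enorm
  have hMx := measurable_maxFun (h := fun t => ‖F t‖ₑ) hF'
  set H := fun x => 4 * maxFun (fun t => ‖F t‖ₑ) x with hHdef
  have hHm : Measurable H := by fun_prop
  have hHtop : ∀ x, H x ≠ ⊤ := by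
    intro x
    refine ENNReal.mul_ne_top (by norm_num) (ne_top_of_le_ne_top ?_
      (maxFun_le_of_bdd (K := ENNReal.ofReal K) (fun t => ?_) x))
    · exact ENNReal.mul_ne_top (by norm_num) (by simp)
    · rw [← ofReal_norm]; exact ENNReal.ofReal_le_ofReal (hK t)
  have hH0 : ∀ x, H x = 0 → ∀ m, ‖dDiff m F x‖ₑ = 0 := by
    intro x hx m
    have h0 : maxFun (fun t => ‖F t‖ₑ) x = 0 := by simpa [hHdef] using hx
    have : ∀ k, dAvg k F x = 0 := by
      intro k
      have h1 := box_le_maxFun hF' k 0 x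
      rw [h0, mul_zero] at h1
      have h2 := (enorm_dAvg_le F k x)
      simp only [zero_add] at h1
      simpa using h2.trans h1
    simp [dDiff, this]
  have hpt : ∀ x, (∑ m ∈ S, ‖dDiff m F x‖ₑ ^ 2) ^ (p / 2)
      ≤ (H x ^ p) ^ (1 - p / 2) * (∑ m ∈ S, H x ^ (p - 2) * ‖dDiff m F x‖ₑ ^ 2) ^ (p / 2) := by
    intro x
    by_cases hx : H x = 0
    · simp [hH0 x hx, show 0 < p by linarith]
    · rw [← Finset.mul_sum, ENNReal.mul_rpow_of_nonneg (H x ^ (p - 2)) _ (by linarith), ← mul_assoc,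
        ← ENNReal.rpow_mul, ← ENNReal.rpow_mul, ← ENNReal.rpow_add _ _ hx (hHtop x),
        show p * (1 - p / 2) + (p - 2) * (p / 2) = 0 by ring, ENNReal.rpow_zero, one_mul]
  have hHp : ∫⁻ x, H x ^ p ≤ ENNReal.ofReal (2048 / (p - 1)) * ∫⁻ x, ‖F x‖ₑ ^ p := by
    have h1 := maxFun_strong hF' hp hp2
    calc ∫⁻ x, H x ^ p = 4 ^ p * ∫⁻ x, maxFun (fun t => ‖F t‖ₑ) x ^ p := by
          rw [← lintegral_const_mul _ (by fun_prop)]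
          refine lintegral_congr fun x => ?_
          rw [ENNReal.mul_rpow_of_nonneg _ _ (by linarith)]
      _ ≤ ENNReal.ofReal 16 * (ENNReal.ofReal (128 / (p - 1)) * ∫⁻ x, ‖F x‖ₑ ^ p) := by
          gcongr
          calc (4 : ℝ≥0∞) ^ p ≤ 4 ^ (2:ℝ) :=
                ENNReal.rpow_le_rpow_of_exponent_le (by norm_num) hp2
            _ ≤ _ := by norm_num
      _ = _ := by
          rw [← mul_assoc, ← ENNReal.ofReal_mul (by norm_num)]
          congr 2; ring
  have hEn : ∫⁻ x, ∑ m ∈ S, H x ^ (p - 2) * ‖dDiff m F x‖ₑ ^ 2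
      ≤ ENNReal.ofReal (2048 / (p - 1)) * ∫⁻ x, ‖F x‖ₑ ^ p := by
    rw [lintegral_finsetSum _ (fun m _ => by have := hD m; fun_prop)]
    have h1 := dDiff_energy_sum hF hK hp hp2 S
    have h2 : ENNReal.ofReal (2 / (p - 1)) * ENNReal.ofReal ((p - 1) / 2) = 1 := by
      rw [← ENNReal.ofReal_mul (by
        have : 0 < p - 1 := by linarith
        positivity), div_mul_div_cancel₀ (by linarith)]
      simp
    calc _ = ENNReal.ofReal (2 / (p - 1)) * (ENNReal.ofReal ((p - 1) / 2) * ∑ m ∈ S,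
        ∫⁻ x, H x ^ (p - 2) * ‖dDiff m F x‖ₑ ^ 2) := by rw [← mul_assoc, h2, one_mul]
      _ ≤ _ := by
        gcongr
        norm_num
  calc ∫⁻ x, (∑ m ∈ S, ‖dDiff m F x‖ₑ ^ 2) ^ (p / 2)
      ≤ ∫⁻ x, (H x ^ p) ^ (1 - p / 2) * (∑ m ∈ S, H x ^ (p - 2) * ‖dDiff m F x‖ₑ ^ 2) ^ (p / 2) :=
        lintegral_mono hpt
    _ ≤ (∫⁻ x, H x ^ p) ^ (1 - p / 2) *
        (∫⁻ x, ∑ m ∈ S, H x ^ (p - 2) * ‖dDiff m F x‖ₑ ^ 2) ^ (p / 2) := by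
        refine ENNReal.lintegral_mul_norm_pow_le (by fun_prop) ?_ (by linarith) (by linarith) (by ring)
        refine Measurable.aemeasurable (Finset.measurable_sum _ fun m _ => ?_)
        have := hD m; fun_prop
    _ ≤ (ENNReal.ofReal (2048 / (p - 1)) * ∫⁻ x, ‖F x‖ₑ ^ p) ^ (1 - p / 2) *
        (ENNReal.ofReal (2048 / (p - 1)) * ∫⁻ x, ‖F x‖ₑ ^ p) ^ (p / 2) := by
        gcongr
        linarith
    _ = _ := by
        rw [← ENNReal.rpow_add_of_nonneg _ _ (by linarith) (by linarith)]
        simp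

end SquareFunction

/-! ### Two-parameter dyadic differences -/

lemma norm_dAvg_le {E : Type*} [NormedAddCommGroup E] [NormedSpace ℝ E] {F : ℝ → E} {K : ℝ}
    (hK : ∀ t, ‖F t‖ ≤ K) (m : ℤ) (x : ℝ) : ‖dAvg m F x‖ ≤ K := by
  have := intervalIntegral.norm_integral_le_of_norm_le_const (a := 0) (b := 1)
    (f := fun t => F (x + (2:ℝ) ^ (-m) * t)) (C := K) (fun t _ => hK _)
  simpa [dAvg] using this

lemma norm_dDiff_le {E : Type*} [NormedAddCommGroup E] [NormedSpace ℝ E] {F : ℝ → E} {K : ℝ}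
    (hK : ∀ t, ‖F t‖ ≤ K) (m : ℤ) (x : ℝ) : ‖dDiff m F x‖ ≤ 2 * K :=
  (norm_sub_le _ _).trans (by linarith [norm_dAvg_le hK m x, norm_dAvg_le hK (m + 1) x])

/-- Two-parameter dyadic difference. -/
def dDiff2 (j k : ℤ) (f : ℝ × ℝ → ℝ) (x : ℝ × ℝ) : ℝ :=
  dDiff j (fun s => dDiff k (fun t => f (s, t)) x.2) x.1

lemma stronglyMeasurable_dDiff_snd {α : Type*} [MeasurableSpace α] {f : α × ℝ → ℝ}
    (hf : Measurable f) (k : ℤ) :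
    StronglyMeasurable fun q : α × ℝ => dDiff k (fun t => f (q.1, t)) q.2 :=
  (stronglyMeasurable_dAvg_uncurry hf.stronglyMeasurable (k + 1)).sub
    (stronglyMeasurable_dAvg_uncurry hf.stronglyMeasurable k)

lemma measurable_dDiff2 {f : ℝ × ℝ → ℝ} (hf : Measurable f) (j k : ℤ) :
    Measurable (dDiff2 j k f) := by
  have h1 := (stronglyMeasurable_dDiff_snd hf k).measurable
  have h2 := (stronglyMeasurable_dDiff_snd
    (f := fun q : ℝ × ℝ => dDiff k (fun t => f (q.2, t)) q.1) (h1.comp measurable_swap) j).measurable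
  exact h2.comp measurable_swap

lemma dAvg_toLp {ι : Type*} [Fintype ι] {g : ι → ℝ → ℝ} (hg : ∀ i, Measurable (g i)) {K : ℝ}
    (hK : ∀ i t, ‖g i t‖ ≤ K) (m : ℤ) (x : ℝ) (i : ι) :
    (dAvg m (fun s => (WithLp.toLp 2 (fun i => g i s) : EuclideanSpace ℝ ι)) x) i
      = dAvg m (g i) x := by
  have hm : Measurable fun s => (WithLp.toLp 2 (fun i => g i s) : EuclideanSpace ℝ ι) :=
    (WithLp.measurable_toLp 2 (ι → ℝ)).comp (measurable_pi_lambda _ hg)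
  have hb : ∀ s, ‖(WithLp.toLp 2 (fun i => g i s) : EuclideanSpace ℝ ι)‖
      ≤ √(∑ _i : ι, K ^ 2) := by
    intro s
    rw [EuclideanSpace.norm_eq]
    refine Real.sqrt_le_sqrt (Finset.sum_le_sum fun i _ => ?_)
    exact pow_le_pow_left₀ (norm_nonneg _) (hK i s) 2
  have hii := intervalIntegrable_of_bdd
    (F := fun t => (WithLp.toLp 2 (fun i => g i (x + (2:ℝ) ^ (-m) * t)) : EuclideanSpace ℝ ι))
    (hm.stronglyMeasurable.comp_measurable (by fun_prop)) (fun t => hb _) 0 1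
  have := (EuclideanSpace.proj (𝕜 := ℝ) i).intervalIntegral_comp_comm hii
  simpa [dAvg] using this.symm

lemma enorm_sq_toLp {ι : Type*} [Fintype ι] (v : EuclideanSpace ℝ ι) :
    ‖v‖ₑ ^ 2 = ∑ i, ‖v i‖ₑ ^ 2 := by
  simp_rw [← ofReal_norm]
  rw [← ENNReal.ofReal_pow (norm_nonneg _), EuclideanSpace.norm_sq_eq,
    ENNReal.ofReal_sum_of_nonneg (fun i _ => by positivity)]
  exact Finset.sum_congr rfl fun i _ => ENNReal.ofReal_pow (norm_nonneg _) _

lemma enorm_rpow_eq_sq (a : ℝ≥0∞) (p : ℝ) : (a ^ 2) ^ (p / 2) = a ^ p := by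
  rw [← ENNReal.rpow_natCast, ← ENNReal.rpow_mul]
  congr 1; push_cast; ring

/-- Two-parameter Littlewood–Paley inequality for dyadic differences of averages. -/
lemma dDiff2_square {f : ℝ × ℝ → ℝ} (hf : Measurable f) {K : ℝ} (hK : ∀ x, ‖f x‖ ≤ K)
    {p : ℝ} (hp : 1 < p) (hp2 : p ≤ 2) (S T : Finset ℤ) :
    ∫⁻ x, (∑ j ∈ S, ∑ k ∈ T, ‖dDiff2 j k f x‖ₑ ^ 2) ^ (p / 2)
      ≤ ENNReal.ofReal (2048 / (p - 1)) ^ 2 * ∫⁻ x, ‖f x‖ₑ ^ p := by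
  have hDk : ∀ k, Measurable fun q : ℝ × ℝ => dDiff k (fun t => f (q.1, t)) q.2 := fun k =>
    (stronglyMeasurable_dDiff_snd hf k).measurable
  have hDD : ∀ j k, Measurable (dDiff2 j k f) := measurable_dDiff2 hf
  have hfirst : ∀ y : ℝ, ∫⁻ x, (∑ j ∈ S, ∑ k ∈ T, ‖dDiff2 j k f (x, y)‖ₑ ^ 2) ^ (p / 2)
      ≤ ENNReal.ofReal (2048 / (p - 1)) *
        ∫⁻ x, (∑ k ∈ T, ‖dDiff k (fun t => f (x, t)) y‖ₑ ^ 2) ^ (p / 2) := by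
    intro y
    set g : T → ℝ → ℝ := fun k s => dDiff k (fun t => f (s, t)) y with hg
    have hgm : ∀ k, Measurable (g k) := fun k =>
      (hDk k).comp (measurable_id.prodMk measurable_const)
    have hgb : ∀ k s, ‖g k s‖ ≤ 2 * K := fun k s => norm_dDiff_le (fun t => hK _) _ _
    have hm : Measurable fun s => (WithLp.toLp 2 (fun i => g i s) : EuclideanSpace ℝ T) :=
      (WithLp.measurable_toLp 2 (T → ℝ)).comp (measurable_pi_lambda _ hgm)
    have hb : ∀ s, ‖(WithLp.toLp 2 (fun i => g i s) : EuclideanSpace ℝ T)‖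
        ≤ √(∑ _i : T, (2 * K) ^ 2) := by
      intro s
      rw [EuclideanSpace.norm_eq]
      refine Real.sqrt_le_sqrt (Finset.sum_le_sum fun i _ => ?_)
      exact pow_le_pow_left₀ (norm_nonneg _) (hgb i s) 2
    have key := dDiff_square hm.stronglyMeasurable hb hp hp2 S
    refine le_trans (le_of_eq ?_) (key.trans (le_of_eq ?_))
    · refine lintegral_congr fun x => ?_
      congr 1
      refine Finset.sum_congr rfl fun j _ => ?_
      rw [enorm_sq_toLp, ← Finset.sum_coe_sort]
      refine Finset.sum_congr rfl fun k _ => ?_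
      congr 2
      simp only [dDiff2, dDiff, PiLp.sub_apply]
      rw [dAvg_toLp hgm hgb, dAvg_toLp hgm hgb]
      rfl
    · congr 1
      refine lintegral_congr fun x => ?_
      rw [← enorm_rpow_eq_sq, enorm_sq_toLp]
      congr 1
      exact (Finset.sum_coe_sort T (fun k => ‖dDiff k (fun t => f (x, t)) y‖ₑ ^ 2))
  have hsecond : ∀ x : ℝ, ∫⁻ y, (∑ k ∈ T, ‖dDiff k (fun t => f (x, t)) y‖ₑ ^ 2) ^ (p / 2)
      ≤ ENNReal.ofReal (2048 / (p - 1)) * ∫⁻ y, ‖f (x, y)‖ₑ ^ p := fun x =>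
    dDiff_square (F := fun t => f (x, t)) (hf.comp (measurable_const.prodMk measurable_id)).stronglyMeasurable
      (fun t => hK _) hp hp2 T
  calc ∫⁻ x, (∑ j ∈ S, ∑ k ∈ T, ‖dDiff2 j k f x‖ₑ ^ 2) ^ (p / 2)
      = ∫⁻ y, ∫⁻ x, (∑ j ∈ S, ∑ k ∈ T, ‖dDiff2 j k f (x, y)‖ₑ ^ 2) ^ (p / 2) := by
        rw [Measure.volume_eq_prod, lintegral_prod_symm _ (by fun_prop)]
    _ ≤ ∫⁻ y, ENNReal.ofReal (2048 / (p - 1)) *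
        ∫⁻ x, (∑ k ∈ T, ‖dDiff k (fun t => f (x, t)) y‖ₑ ^ 2) ^ (p / 2) := lintegral_mono hfirst
    _ = ENNReal.ofReal (2048 / (p - 1)) *
        ∫⁻ x, ∫⁻ y, (∑ k ∈ T, ‖dDiff k (fun t => f (x, t)) y‖ₑ ^ 2) ^ (p / 2) := by
        rw [lintegral_const_mul' _ _ (by simp), lintegral_lintegral_swap]
        refine Measurable.aemeasurable ?_
        refine Measurable.pow_const (Finset.measurable_sum _ fun k _ => ?_) _
        have := (hDk k).comp measurable_swap
        exact this.enorm.pow_const 2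
    _ ≤ ENNReal.ofReal (2048 / (p - 1)) *
        ∫⁻ x, ENNReal.ofReal (2048 / (p - 1)) * ∫⁻ y, ‖f (x, y)‖ₑ ^ p := by
        gcongr ENNReal.ofReal (2048 / (p - 1)) * ?_
        exact lintegral_mono hsecond
    _ = _ := by
        rw [lintegral_const_mul' _ _ (by simp), Measure.volume_eq_prod,
          lintegral_prod _ (by fun_prop), sq, mul_assoc]

/-! ### Vector-valued bounds from maximal bounds -/

section AverageOperator

variable {Z : Type*} [MeasurableSpace Z]

lemma measurable_finset_sup {X ι : Type*} [MeasurableSpace X] (S : Finset ι) {f : ι → X → ℝ≥0∞}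
    (hf : ∀ α, Measurable (f α)) : Measurable fun x => S.sup fun α => f α x := by
  induction S using Finset.induction_on with
  | empty => simp
  | insert a s _ ih =>
    simp only [Finset.sup_insert]
    exact (hf a).sup ih

/-- The averaging operator `h ↦ ∫ h(· + y(z)) dν(z)`. -/
def avgOp (ν : Measure Z) (y : Z → ℝ × ℝ) (h : ℝ × ℝ → ℝ≥0∞) (x : ℝ × ℝ) : ℝ≥0∞ :=
  ∫⁻ z, h (x + y z) ∂ν

lemma measurable_avgOp {ν : Measure Z} [SFinite ν] {y : Z → ℝ × ℝ} (hy : Measurable y)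
    {h : ℝ × ℝ → ℝ≥0∞} (hh : Measurable h) : Measurable (avgOp ν y h) :=
  Measurable.lintegral_prod_right' (f := fun q : (ℝ × ℝ) × Z => h (q.1 + y q.2)) (by fun_prop)

lemma avgOp_mono {ν : Measure Z} {y : Z → ℝ × ℝ} {h k : ℝ × ℝ → ℝ≥0∞} (hk : ∀ x, h x ≤ k x)
    (x : ℝ × ℝ) : avgOp ν y h x ≤ avgOp ν y k x := lintegral_mono fun _ => hk _

lemma avgOp_add {ν : Measure Z} {y : Z → ℝ × ℝ} (hy : Measurable y) {h k : ℝ × ℝ → ℝ≥0∞}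
    (hh : Measurable h) (x : ℝ × ℝ) :
    avgOp ν y (fun x => h x + k x) x = avgOp ν y h x + avgOp ν y k x :=
  lintegral_add_left (by fun_prop) _

lemma avgOp_lp {ν : Measure Z} [SFinite ν] {y : Z → ℝ × ℝ} (hy : Measurable y)
    {h : ℝ × ℝ → ℝ≥0∞} (hh : Measurable h) {p : ℝ} (hp : 1 ≤ p) :
    ∫⁻ x, avgOp ν y h x ^ p ≤ ν univ ^ p * ∫⁻ x, h x ^ p := by
  have hp0 : 0 < p := by linarith
  have hq : 0 ≤ 1 - 1 / p := by rw [sub_nonneg, div_le_one hp0]; exact hp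
  have hpt : ∀ x, avgOp ν y h x ^ p ≤ ν univ ^ (p - 1) * avgOp ν y (fun x => h x ^ p) x := by
    intro x
    have h1 := ENNReal.lintegral_mul_norm_pow_le (μ := ν)
      (f := fun z => h (x + y z) ^ p) (g := fun _ => 1) (p := 1 / p) (q := 1 - 1 / p)
      (by fun_prop) (by fun_prop) (by positivity) hq (by ring)
    have h2 : avgOp ν y h x ≤ avgOp ν y (fun x => h x ^ p) x ^ (1 / p) * ν univ ^ (1 - 1 / p) := by
      refine le_trans (le_of_eq ?_) (h1.trans (le_of_eq ?_))
      · refine lintegral_congr fun v => ?_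
        rw [ENNReal.one_rpow, mul_one, ← ENNReal.rpow_mul, mul_one_div_cancel hp0.ne',
          ENNReal.rpow_one]
      · simp [avgOp]
    calc _ ≤ (avgOp ν y (fun x => h x ^ p) x ^ (1 / p) * ν univ ^ (1 - 1 / p)) ^ p := by gcongr
      _ = _ := by
          rw [ENNReal.mul_rpow_of_nonneg _ _ hp0.le, ← ENNReal.rpow_mul, ← ENNReal.rpow_mul,
            one_div_mul_cancel hp0.ne', ENNReal.rpow_one, mul_comm,
            show (1 - 1 / p) * p = p - 1 by field_simp]
  calc ∫⁻ x, avgOp ν y h x ^ p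
      ≤ ∫⁻ x, ν univ ^ (p - 1) * avgOp ν y (fun x => h x ^ p) x := lintegral_mono hpt
    _ = ν univ ^ (p - 1) * ∫⁻ x, avgOp ν y (fun x => h x ^ p) x :=
        lintegral_const_mul _ (measurable_avgOp hy (by fun_prop))
    _ = ν univ ^ (p - 1) * (ν univ * ∫⁻ x, h x ^ p) := by
        congr 1
        unfold avgOp
        rw [lintegral_lintegral_swap (by
          refine Measurable.aemeasurable ?_
          simp only [Function.uncurry_def]
          fun_prop)]
        simp_rw [fun z => lintegral_add_right_eq_self (μ := volume) (fun x => h x ^ p) (y z)]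
        rw [lintegral_const, mul_comm]
    _ = _ := by
        rw [← mul_assoc]
        congr 1
        nth_rewrite 2 [← ENNReal.rpow_one (ν univ)]
        rw [← ENNReal.rpow_add_of_nonneg _ _ (by linarith) (by norm_num)]
        congr 1; ring

/-- A maximal bound for a family of averaging operators implies a vector-valued bound. -/
lemma avgOp_vector {ι : Type*} (S : Finset ι) {ν : Measure Z} [SFinite ν] {y : ι → Z → ℝ × ℝ}
    (hy : ∀ α, Measurable (y α)) {p : ℝ} (hp : 1 < p) (hp2 : p ≤ 2) {B : ℝ≥0∞}
    (hB : ∀ h : ℝ × ℝ → ℝ≥0∞, Measurable h → (∃ N : ℝ≥0, ∀ x, h x ≤ N) →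
      ∫⁻ x, (S.sup fun α => avgOp ν (y α) h x) ^ p ≤ B * ∫⁻ x, h x ^ p)
    {h : ι → ℝ × ℝ → ℝ≥0∞} (hh : ∀ α, Measurable (h α)) 
    (hbd : ∃ N : ℝ≥0, ∀ α x, h α x ≤ N) :
    ∫⁻ x, (∑ α ∈ S, avgOp ν (y α) (h α) x ^ 2) ^ (p / 2)
      ≤ (ν univ ^ p) ^ (p / 2) * B ^ (1 - p / 2) * ∫⁻ x, (∑ α ∈ S, h α x ^ 2) ^ (p / 2) := by
  have hp0 : 0 < p := by linarith
  set G : ℝ × ℝ → ℝ≥0∞ := fun x => (∑ α ∈ S, h α x ^ 2) ^ (1 / 2 : ℝ) with hG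
  have hGm : Measurable G := by fun_prop
  have hfin : ∀ α x, h α x ≠ ⊤ := by
    obtain ⟨N, hN⟩ := hbd
    exact fun α x => ((hN α x).trans_lt ENNReal.coe_lt_top).ne
  have hGbd : ∃ N : ℝ≥0, ∀ x, G x ≤ N := by
    obtain ⟨N, hN⟩ := hbd
    have h1 : (∑ α ∈ S, (N : ℝ≥0∞) ^ 2) ^ (1 / 2 : ℝ) ≠ ⊤ :=
      ENNReal.rpow_ne_top_of_nonneg (by norm_num)
        (ENNReal.sum_ne_top.2 fun α _ => ENNReal.pow_ne_top ENNReal.coe_ne_top)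
    refine ⟨_, fun x => le_trans ?_ (ENNReal.coe_toNNReal h1).ge⟩
    simp only [hG]
    gcongr with α
    exact hN α x
  have hGtop : ∀ x, G x ≠ ⊤ := by
    intro x
    refine ENNReal.rpow_ne_top_of_nonneg (by norm_num) ?_
    exact ENNReal.sum_ne_top.2 fun α _ => ENNReal.pow_ne_top (hfin α x)
  have hG0 : ∀ x, G x = 0 → ∀ α ∈ S, h α x = 0 := by
    intro x hx α hα
    rw [hG] at hx
    simp only [ENNReal.rpow_eq_zero_iff] at hx
    rcases hx with hx | hx
    · have := Finset.sum_eq_zero_iff.1 hx.1 α hα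
      simpa using this
    · exfalso; norm_num at hx
  set k : ι → ℝ × ℝ → ℝ≥0∞ := fun α x => h α x ^ (2 / p) * G x ^ (1 - 2 / p) with hk
  have hkm : ∀ α, Measurable (k α) := fun α => by
    have := hh α; fun_prop
  have hdec : ∀ α ∈ S, ∀ x, h α x = k α x ^ (p / 2) * G x ^ (1 - p / 2) := by
    intro α hα x
    by_cases hx : G x = 0
    · simp [hk, hG0 x hx α hα, hp0]
    · simp only [hk]
      rw [ENNReal.mul_rpow_of_nonneg _ _ (by linarith), ← ENNReal.rpow_mul, ← ENNReal.rpow_mul,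
        mul_assoc, ← ENNReal.rpow_add _ _ hx (hGtop x),
        show 2 / p * (p / 2) = 1 by field_simp,
        show (1 - 2 / p) * (p / 2) + (1 - p / 2) = 0 by field_simp; ring]
      simp
  have hsumk : ∀ x, ∑ α ∈ S, k α x ^ p = G x ^ p := by
    intro x
    by_cases hx : G x = 0
    · rw [hx, ENNReal.zero_rpow_of_pos hp0]
      refine Finset.sum_eq_zero fun α hα => ?_
      simp [hk, hG0 x hx α hα, hp0]
    · have e1 : ∀ α, k α x ^ p = h α x ^ 2 * G x ^ (p - 2) := by
        intro α
        simp only [hk]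
        rw [ENNReal.mul_rpow_of_nonneg _ _ hp0.le, ← ENNReal.rpow_mul, ← ENNReal.rpow_mul,
          div_mul_cancel₀ _ hp0.ne', show (1 - 2 / p) * p = p - 2 by field_simp]
        congr 1
        rw [← ENNReal.rpow_natCast]; norm_num
      simp_rw [e1]
      rw [← Finset.sum_mul]
      have e2 : ∑ α ∈ S, h α x ^ 2 = G x ^ (2:ℝ) := by
        simp only [hG]
        rw [← ENNReal.rpow_mul]; norm_num
      rw [e2, ← ENNReal.rpow_add _ _ hx (hGtop x)]
      congr 1; ring
  have hGp : ∀ x, (∑ α ∈ S, h α x ^ 2) ^ (p / 2) = G x ^ p := by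
    intro x
    simp only [hG]
    rw [← ENNReal.rpow_mul]; congr 1; ring
  set A : ℝ × ℝ → ℝ≥0∞ := fun x => S.sup fun α => avgOp ν (y α) G x with hA
  have hAm : Measurable A :=
    measurable_finset_sup S fun α => measurable_avgOp (hy α) hGm
  have hone : ∀ α ∈ S, ∀ x, avgOp ν (y α) (h α) x ^ 2
      ≤ avgOp ν (y α) (k α) x ^ p * A x ^ (2 - p) := by
    intro α hα x
    have hkα := hkm α
    have hyα := hy α
    have h1 := ENNReal.lintegral_mul_norm_pow_le (μ := ν)
      (f := fun z => k α (x + y α z)) (g := fun z => G (x + y α z)) (p := p / 2) (q := 1 - p / 2)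
      (by fun_prop) (by fun_prop) (by positivity) (by linarith) (by ring)
    have h2 : avgOp ν (y α) (h α) x
        ≤ avgOp ν (y α) (k α) x ^ (p / 2) * avgOp ν (y α) G x ^ (1 - p / 2) := by
      refine le_trans (le_of_eq ?_) h1
      exact lintegral_congr fun z => hdec α hα _
    have h3 : avgOp ν (y α) G x ≤ A x := Finset.le_sup (f := fun α => avgOp ν (y α) G x) hα
    calc _ ≤ (avgOp ν (y α) (k α) x ^ (p / 2) * A x ^ (1 - p / 2)) ^ 2 := by
          gcongr
          refine h2.trans ?_
          gcongr
          linarith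
      _ = _ := by
          rw [mul_pow, ← ENNReal.rpow_natCast, ← ENNReal.rpow_natCast, ← ENNReal.rpow_mul,
            ← ENNReal.rpow_mul]
          congr 2 <;> push_cast <;> ring
  have hAk : Measurable fun x => ∑ α ∈ S, avgOp ν (y α) (k α) x ^ p :=
    Finset.measurable_sum _ fun α _ => (measurable_avgOp (hy α) (hkm α)).pow_const p
  calc ∫⁻ x, (∑ α ∈ S, avgOp ν (y α) (h α) x ^ 2) ^ (p / 2)
      ≤ ∫⁻ x, (∑ α ∈ S, avgOp ν (y α) (k α) x ^ p) ^ (p / 2) * (A x ^ p) ^ (1 - p / 2) := by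
        refine lintegral_mono fun x => ?_
        calc (∑ α ∈ S, avgOp ν (y α) (h α) x ^ 2) ^ (p / 2)
            ≤ (∑ α ∈ S, avgOp ν (y α) (k α) x ^ p * A x ^ (2 - p)) ^ (p / 2) := by
              gcongr with α hα
              exact hone α hα x
          _ = _ := by
              rw [← Finset.sum_mul, ENNReal.mul_rpow_of_nonneg _ _ (by linarith),
                ← ENNReal.rpow_mul, ← ENNReal.rpow_mul]
              congr 2; ring
    _ ≤ (∫⁻ x, ∑ α ∈ S, avgOp ν (y α) (k α) x ^ p) ^ (p / 2) * (∫⁻ x, A x ^ p) ^ (1 - p / 2) :=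
        ENNReal.lintegral_mul_norm_pow_le hAk.aemeasurable (by fun_prop) (by linarith)
          (by linarith) (by ring)
    _ ≤ (ν univ ^ p * ∫⁻ x, G x ^ p) ^ (p / 2) * (B * ∫⁻ x, G x ^ p) ^ (1 - p / 2) := by
        gcongr
        · rw [lintegral_finsetSum _ fun α _ => (measurable_avgOp (hy α) (hkm α)).pow_const p]
          simp_rw [← hsumk]
          rw [lintegral_finsetSum _ fun α _ => (hkm α).pow_const p, Finset.mul_sum]
          exact Finset.sum_le_sum fun α _ => avgOp_lp (hy α) (hkm α) hp.le
        · linarith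
        · exact hB G hGm hGbd
    _ = _ := by
        simp_rw [hGp]
        rw [ENNReal.mul_rpow_of_nonneg _ _ (by linarith),
          ENNReal.mul_rpow_of_nonneg _ _ (by linarith)]
        have : (∫⁻ x, G x ^ p) ^ (p / 2) * (∫⁻ x, G x ^ p) ^ (1 - p / 2) = ∫⁻ x, G x ^ p := by
          rw [← ENNReal.rpow_add_of_nonneg _ _ (by linarith) (by linarith)]
          simp
        calc _ = (ν univ ^ p) ^ (p / 2) * B ^ (1 - p / 2) *
              ((∫⁻ x, G x ^ p) ^ (p / 2) * (∫⁻ x, G x ^ p) ^ (1 - p / 2)) := by ring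
          _ = _ := by rw [this]

end AverageOperator

/-! ### Averages over thickened curves -/

/-- The decaying weight `(1 + u²)⁻²`. -/
def decay (u : ℝ) : ℝ≥0∞ := ENNReal.ofReal (((1 + u ^ 2) ^ 2)⁻¹)

lemma measurable_decay : Measurable decay := by unfold decay; fun_prop

/-- The finite measure with density `(1 + u²)⁻²`. -/
def decayMeasure : Measure ℝ := volume.withDensity decay

lemma decay_le {u v : ℝ} (hv : |v| ≤ 1) : decay u ≤ 9 * decay (u + v) := by
  unfold decay
  rw [show (9 : ℝ≥0∞) = ENNReal.ofReal 9 by norm_num, ← ENNReal.ofReal_mul (by norm_num)]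
  apply ENNReal.ofReal_le_ofReal
  have hv2 : v ^ 2 ≤ 1 := by rw [sq_le_one_iff_abs_le_one]; exact hv
  have h1 : 1 + (u + v) ^ 2 ≤ 3 * (1 + u ^ 2) := by nlinarith [sq_nonneg (u - v)]
  rw [inv_le_iff_one_le_mul₀ (by positivity), mul_right_comm, ← div_eq_mul_inv,
    le_div_iff₀ (by positivity), one_mul]
  calc (1 + (u + v) ^ 2) ^ 2 ≤ (3 * (1 + u ^ 2)) ^ 2 := by gcongr
    _ = _ := by ring

lemma lintegral_decayMeasure {F : ℝ → ℝ≥0∞} (hF : Measurable F) :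
    ∫⁻ u, F u ∂decayMeasure = ∫⁻ u, decay u * F u := by
  unfold decayMeasure
  rw [lintegral_withDensity_eq_lintegral_mul _ measurable_decay hF]
  rfl

lemma lintegral_decayMeasure_shift {F : ℝ → ℝ≥0∞} (hF : Measurable F) {v : ℝ} (hv : |v| ≤ 1) :
    ∫⁻ u, F u ∂decayMeasure ≤ 9 * ∫⁻ u, F (u + v) ∂decayMeasure := by
  rw [lintegral_decayMeasure hF, lintegral_decayMeasure (by fun_prop),
    ← lintegral_add_right_eq_self (μ := volume) _ v,
    ← lintegral_const_mul _ (by have := measurable_decay; fun_prop)]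
  refine lintegral_mono fun u => ?_
  rw [← mul_assoc]
  gcongr
  have := decay_le (u := u + v) (v := -v) (by rwa [abs_neg])
  simpa using this

lemma lintegral_decayMeasure_lt_top (a : ℝ) :
    ∫⁻ u, ENNReal.ofReal (a + |u|) ∂decayMeasure < ⊤ := by
  rw [lintegral_decayMeasure (by fun_prop)]
  have hint : Integrable (fun u : ℝ => (|a| + 1) * (1 + u ^ 2)⁻¹) :=
    integrable_inv_one_add_sq.const_mul _
  refine lt_of_le_of_lt (lintegral_mono fun u => ?_) hint.lintegral_lt_top
  unfold decay
  rw [← ENNReal.ofReal_mul (by positivity)]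
  apply ENNReal.ofReal_le_ofReal
  have h1 : a + |u| ≤ (|a| + 1) * (1 + u ^ 2) := by
    have := le_abs_self a
    have h2 : |u| ≤ 1 + u ^ 2 := by rw [← sq_abs]; nlinarith [sq_nonneg (|u| - 1)]
    have h3 := mul_nonneg (abs_nonneg a) (sq_nonneg u)
    linarith
  calc ((1 + u ^ 2) ^ 2)⁻¹ * (a + |u|)
      ≤ ((1 + u ^ 2) ^ 2)⁻¹ * ((|a| + 1) * (1 + u ^ 2)) := by gcongr
    _ = _ := by field_simp

instance : IsFiniteMeasure decayMeasure :=
  ⟨by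
    have := lintegral_decayMeasure_lt_top 1
    refine lt_of_le_of_lt ?_ this
    rw [← lintegral_one]
    refine lintegral_mono fun u => ?_
    rw [← ENNReal.ofReal_one]
    exact ENNReal.ofReal_le_ofReal (by have := abs_nonneg u; linarith)⟩

/-- The parameter measure of a thickened curve: two decaying parameters and the curve
parameter in `[1/2, 2]`. -/
def curveMeasure : Measure (ℝ × ℝ × ℝ) :=
  decayMeasure.prod (decayMeasure.prod (volume.restrict (Icc (1 / 2) 2)))

instance : IsFiniteMeasure curveMeasure := by unfold curveMeasure; infer_instance

lemma lintegral_curveMeasure {F : ℝ × ℝ × ℝ → ℝ≥0∞} (hF : Measurable F) :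
    ∫⁻ z, F z ∂curveMeasure
      = ∫⁻ u, (∫⁻ v, (∫⁻ t in Icc (1 / 2 : ℝ) 2, F (u, v, t)) ∂decayMeasure) ∂decayMeasure := by
  unfold curveMeasure
  rw [lintegral_prod _ hF.aemeasurable]
  refine lintegral_congr fun u => ?_
  rw [lintegral_prod _ (by fun_prop)]

/-- A point on the anisotropically dilated curve `(e t, c t^β)`, displaced at a finer scale. -/
def curvePt (β e : ℝ) (l : ℕ) (c : ℝ) (j k : ℤ) (z : ℝ × ℝ × ℝ) : ℝ × ℝ :=
  ((2:ℝ) ^ (-j) * (e * z.2.2) + (2:ℝ) ^ (-(j + l)) * z.1,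
    (2:ℝ) ^ (-k) * (c * z.2.2 ^ β) + (2:ℝ) ^ (-(k + l)) * z.2.1)

lemma measurable_curvePt (β e : ℝ) (l : ℕ) (c : ℝ) (j k : ℤ) :
    Measurable (curvePt β e l c j k) := by
  unfold curvePt; fun_prop

/-- The averaging operator over a thickened curve. -/
def curveAvg (β e : ℝ) (l : ℕ) (c : ℝ) (j k : ℤ) (h : ℝ × ℝ → ℝ≥0∞) (x : ℝ × ℝ) : ℝ≥0∞ :=
  avgOp curveMeasure (curvePt β e l c j k) h x

/-- The average over a dyadic box with corner `x`. -/
def boxAvg (j k : ℤ) (h : ℝ × ℝ → ℝ≥0∞) (x : ℝ × ℝ) : ℝ≥0∞ :=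
  ∫⁻ v in Icc (0:ℝ) 1, ∫⁻ w in Icc (0:ℝ) 1, h (x.1 + (2:ℝ) ^ (-j) * v, x.2 + (2:ℝ) ^ (-k) * w)

lemma measurable_boxAvg (j k : ℤ) {h : ℝ × ℝ → ℝ≥0∞} (hh : Measurable h) :
    Measurable (boxAvg j k h) := by
  unfold boxAvg
  refine Measurable.lintegral_prod_right' (f := fun q : (ℝ × ℝ) × ℝ =>
    ∫⁻ w in Icc (0:ℝ) 1, h (q.1.1 + (2:ℝ) ^ (-j) * q.2, q.1.2 + (2:ℝ) ^ (-k) * w)) ?_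
  exact Measurable.lintegral_prod_right' (f := fun q : ((ℝ × ℝ) × ℝ) × ℝ =>
    h (q.1.1.1 + (2:ℝ) ^ (-j) * q.1.2, q.1.1.2 + (2:ℝ) ^ (-k) * q.2)) (by fun_prop)

lemma curveAvg_shift (β e : ℝ) (l : ℕ) (c : ℝ) (j k : ℤ) {h : ℝ × ℝ → ℝ≥0∞} (hh : Measurable h)
    (x : ℝ × ℝ) {v w : ℝ} (hv : |v| ≤ 1) (hw : |w| ≤ 1) :
    curveAvg β e l c j k h x
      ≤ 81 * curveAvg β e l c j k h
        (x.1 + (2:ℝ) ^ (-(j + l)) * v, x.2 + (2:ℝ) ^ (-(k + l)) * w) := by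
  have hm := measurable_curvePt β e l c j k
  unfold curveAvg avgOp
  rw [lintegral_curveMeasure (by fun_prop), lintegral_curveMeasure (by fun_prop)]
  set H : ℝ → ℝ → ℝ≥0∞ := fun u u' => ∫⁻ t in Icc (1 / 2 : ℝ) 2,
    h (x + curvePt β e l c j k (u, u', t)) with hH
  have hHm : Measurable (Function.uncurry H) :=
    Measurable.lintegral_prod_right' (f := fun q : (ℝ × ℝ) × ℝ =>
      h (x + curvePt β e l c j k (q.1.1, q.1.2, q.2))) (by fun_prop)
  have hHm1 : ∀ u, Measurable (H u) := fun u => hHm.comp (by fun_prop : Measurable fun v => (u, v))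
  have hHm3 : Measurable fun u => ∫⁻ u', H u (u' + w) ∂decayMeasure :=
    Measurable.lintegral_prod_right' (f := fun q : ℝ × ℝ => H q.1 (q.2 + w))
      (hHm.comp (by fun_prop : Measurable fun q : ℝ × ℝ => (q.1, q.2 + w)))
  calc ∫⁻ u, ∫⁻ u', H u u' ∂decayMeasure ∂decayMeasure
      ≤ ∫⁻ u, 9 * ∫⁻ u', H u (u' + w) ∂decayMeasure ∂decayMeasure :=
        lintegral_mono fun u => lintegral_decayMeasure_shift (hHm1 u) hw
    _ = 9 * ∫⁻ u, ∫⁻ u', H u (u' + w) ∂decayMeasure ∂decayMeasure :=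
        lintegral_const_mul _ hHm3
    _ ≤ 9 * (9 * ∫⁻ u, ∫⁻ u', H (u + v) (u' + w) ∂decayMeasure ∂decayMeasure) := by
        gcongr
        exact lintegral_decayMeasure_shift hHm3 hv
    _ = _ := by
        rw [← mul_assoc]
        congr 1
        · norm_num
        · refine lintegral_congr fun u => lintegral_congr fun u' => ?_
          simp only [hH]
          refine lintegral_congr fun t => ?_
          congr 1
          ext <;> simp [curvePt] <;> ring

lemma curveAvg_le_boxAvg (β e : ℝ) (l : ℕ) (c : ℝ) (j k : ℤ) {h : ℝ × ℝ → ℝ≥0∞}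
    (hh : Measurable h) (x : ℝ × ℝ) :
    curveAvg β e l c j k h x ≤ 81 * curveAvg β e l c j k (boxAvg (j + l) (k + l) h) x := by
  have hm := measurable_curvePt β e l c j k
  set G : ℝ → ℝ → ℝ≥0∞ := fun v w => curveAvg β e l c j k h
        (x.1 + (2:ℝ) ^ (-(j + l)) * v, x.2 + (2:ℝ) ^ (-(k + l)) * w) with hG
  have hGm : Measurable (Function.uncurry G) :=
    (measurable_avgOp (ν := curveMeasure) hm hh).comp (by fun_prop :
      Measurable fun q : ℝ × ℝ =>
        (x.1 + (2:ℝ) ^ (-(j + l)) * q.1, x.2 + (2:ℝ) ^ (-(k + l)) * q.2))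
  have h1 : curveAvg β e l c j k h x
      ≤ ∫⁻ v in Icc (0:ℝ) 1, ∫⁻ w in Icc (0:ℝ) 1, 81 * G v w := by
    calc curveAvg β e l c j k h x
        = ∫⁻ v in Icc (0:ℝ) 1, ∫⁻ w in Icc (0:ℝ) 1, curveAvg β e l c j k h x := by simp
      _ ≤ _ := by
          refine setLIntegral_mono' measurableSet_Icc fun v hv =>
            setLIntegral_mono' measurableSet_Icc fun w hw => ?_
          exact curveAvg_shift β e l c j k hh x (by rw [abs_le]; constructor <;> linarith [hv.1, hv.2])
            (by rw [abs_le]; constructor <;> linarith [hw.1, hw.2])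
  refine h1.trans (le_of_eq ?_)
  have h2 : ∀ v, ∫⁻ w in Icc (0:ℝ) 1, 81 * G v w = 81 * ∫⁻ w in Icc (0:ℝ) 1, G v w := fun v =>
    lintegral_const_mul _ (hGm.comp (by fun_prop : Measurable fun w => (v, w)))
  simp_rw [h2]
  rw [lintegral_const_mul _ (show Measurable fun v => ∫⁻ w in Icc (0:ℝ) 1, G v w from
    Measurable.lintegral_prod_right' hGm)]
  congr 1
  have h3 : ∀ v, ∫⁻ w in Icc (0:ℝ) 1, G v w = ∫⁻ z, (∫⁻ w in Icc (0:ℝ) 1,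
      h ((x.1 + (2:ℝ) ^ (-(j + l)) * v, x.2 + (2:ℝ) ^ (-(k + l)) * w) + curvePt β e l c j k z))
        ∂curveMeasure := by
    intro v
    simp only [hG, curveAvg, avgOp]
    rw [lintegral_lintegral_swap]
    refine Measurable.aemeasurable ?_
    simp only [Function.uncurry_def]
    fun_prop
  simp_rw [h3]
  rw [lintegral_lintegral_swap]
  · unfold curveAvg avgOp boxAvg
    refine lintegral_congr fun z => lintegral_congr fun v => lintegral_congr fun w => ?_
    congr 1
    ext <;> simp <;> ring
  · refine Measurable.aemeasurable ?_
    exact Measurable.lintegral_prod_right' (f := fun q : (ℝ × (ℝ × ℝ × ℝ)) × ℝ =>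
      h ((x.1 + (2:ℝ) ^ (-(j + l)) * q.1.1, x.2 + (2:ℝ) ^ (-(k + l)) * q.2)
        + curvePt β e l c j k q.1.2)) (by fun_prop)

/-- Averages along `c t^β` are controlled by the maximal function. -/
lemma curve_le_maxFun {H : ℝ → ℝ≥0∞} (hH : Measurable H) {β : ℝ} (hβ : 1 ≤ β) {c₀ c₁ c : ℝ}
    (hc₀ : 0 < c₀) (hc : c₀ ≤ |c|) (hc1 : |c| ≤ c₁) (k : ℤ) (x w : ℝ) :
    ∫⁻ t in Icc (1 / 2 : ℝ) 2, H (x + (2:ℝ) ^ (-k) * (c * t ^ β + w))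
      ≤ ENNReal.ofReal (2 ^ β * (1 + c₁ * 2 ^ β) / c₀ * (1 + |w|)) * maxFun H x := by
  have hc1p : 0 < c₁ := by linarith
  have h2β : (0:ℝ) < 2 ^ β := by positivity
  have hder : ∀ t ∈ Icc (1 / 2 : ℝ) 2,
      HasDerivWithinAt (fun t : ℝ => c * t ^ β) (c * (β * t ^ (β - 1))) (Icc (1 / 2) 2) t := by
    intro t ht
    have ht0 : t ≠ 0 := by have := ht.1; positivity
    exact ((Real.hasDerivAt_rpow_const (Or.inl ht0)).const_mul c).hasDerivWithinAt
  have hcne : c ≠ 0 := by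
    rintro rfl; rw [abs_zero] at hc; linarith
  have hinj : InjOn (fun t : ℝ => c * t ^ β) (Icc (1 / 2) 2) := by
    intro s hs t ht hst
    have hs0 : (0:ℝ) ≤ s := by have := hs.1; linarith
    have ht0 : (0:ℝ) ≤ t := by have := ht.1; linarith
    have := mul_left_cancel₀ hcne hst
    exact (Real.rpow_left_inj hs0 ht0 (by positivity)).1 this
  have him := lintegral_image_eq_lintegral_abs_deriv_mul measurableSet_Icc hder hinj
    (fun v => H (x + (2:ℝ) ^ (-k) * (w + v)))
  have hlow : ∀ t ∈ Icc (1 / 2 : ℝ) 2, c₀ * (2 / 2 ^ β) ≤ |c * (β * t ^ (β - 1))| := by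
    intro t ht
    have ht0 : (0:ℝ) < t := by have := ht.1; linarith
    rw [abs_mul, abs_of_pos (by positivity : 0 < β * t ^ (β - 1))]
    have h1 : (1 / 2 : ℝ) ^ (β - 1) ≤ t ^ (β - 1) :=
      Real.rpow_le_rpow (by norm_num) ht.1 (by linarith)
    have h2 : (1 / 2 : ℝ) ^ (β - 1) = 2 / 2 ^ β := by
      rw [Real.div_rpow (by norm_num) (by norm_num), Real.one_rpow,
        Real.rpow_sub (by norm_num), Real.rpow_one]
      field_simp
    rw [← h2]
    have h3 : (1 / 2 : ℝ) ^ (β - 1) ≤ β * t ^ (β - 1) := by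
      have : 0 < t ^ (β - 1) := by positivity
      nlinarith
    gcongr
  have hsub : (fun t : ℝ => c * t ^ β) '' Icc (1 / 2) 2 ⊆ Icc (-(c₁ * 2 ^ β)) (c₁ * 2 ^ β) := by
    rintro _ ⟨t, ht, rfl⟩
    have ht0 : (0:ℝ) ≤ t := by have := ht.1; linarith
    rw [mem_Icc, ← abs_le, abs_mul, abs_of_nonneg (Real.rpow_nonneg ht0 β)]
    have := Real.rpow_le_rpow ht0 ht.2 (by linarith : 0 ≤ β)
    gcongr
  have hK : 0 < c₀ * (2 / 2 ^ β) := by positivity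
  have h1 : ENNReal.ofReal (c₀ * (2 / 2 ^ β)) *
      ∫⁻ t in Icc (1 / 2 : ℝ) 2, H (x + (2:ℝ) ^ (-k) * (c * t ^ β + w))
      ≤ ENNReal.ofReal (2 * (1 + c₁ * 2 ^ β + |w|)) * maxFun H x := by
    rw [← lintegral_const_mul _ (by fun_prop)]
    calc _ ≤ ∫⁻ t in Icc (1 / 2 : ℝ) 2, ENNReal.ofReal |c * (β * t ^ (β - 1))| *
            H (x + (2:ℝ) ^ (-k) * (w + c * t ^ β)) := by
          refine setLIntegral_mono' measurableSet_Icc fun t ht => ?_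
          rw [add_comm w]
          gcongr
          exact hlow t ht
      _ = ∫⁻ v in (fun t : ℝ => c * t ^ β) '' Icc (1 / 2) 2, H (x + (2:ℝ) ^ (-k) * (w + v)) :=
          him.symm
      _ ≤ ∫⁻ v in Icc (-(c₁ * 2 ^ β)) (c₁ * 2 ^ β), H (x + (2:ℝ) ^ (-k) * (w + v)) :=
          lintegral_mono_set hsub
      _ ≤ _ := by
          have hp : 0 < c₁ * 2 ^ β := by positivity
          refine interval_le_maxFun hH k x ?_ ?_ ?_
          · have := abs_nonneg w; linarith
          · have := neg_abs_le w; linarith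
          · have := le_abs_self w; linarith
  calc _ = ENNReal.ofReal (c₀ * (2 / 2 ^ β))⁻¹ * (ENNReal.ofReal (c₀ * (2 / 2 ^ β)) *
      ∫⁻ t in Icc (1 / 2 : ℝ) 2, H (x + (2:ℝ) ^ (-k) * (c * t ^ β + w))) := by
        rw [← mul_assoc, ← ENNReal.ofReal_mul (by positivity), inv_mul_cancel₀ hK.ne',
          ENNReal.ofReal_one, one_mul]
    _ ≤ ENNReal.ofReal (c₀ * (2 / 2 ^ β))⁻¹ *
        (ENNReal.ofReal (2 * (1 + c₁ * 2 ^ β + |w|)) * maxFun H x) := by gcongr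
    _ ≤ _ := by
        rw [← mul_assoc, ← ENNReal.ofReal_mul (by positivity)]
        gcongr ENNReal.ofReal ?_ * _
        have h2 : (c₀ * (2 / 2 ^ β))⁻¹ * (2 * (1 + c₁ * 2 ^ β + |w|))
            = 2 ^ β / c₀ * (1 + c₁ * 2 ^ β + |w|) := by field_simp
        rw [h2, mul_div_right_comm, mul_assoc]
        gcongr
        have := mul_nonneg (mul_nonneg hc1p.le h2β.le) (abs_nonneg w)
        linarith

lemma curveAvg_boxAvg_fst {β e : ℝ} (hβ : 1 ≤ β) (he : |e| = 1) (l : ℕ) {c₀ c₁ c : ℝ}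
    (hc₀ : 0 < c₀) (hc : c₀ ≤ |c|) (hc1 : |c| ≤ c₁) (j k : ℤ) {h : ℝ × ℝ → ℝ≥0∞}
    (hh : Measurable h) (x : ℝ × ℝ) :
    curveAvg β e l c j k (boxAvg j (k + l) h) x
      ≤ (∫⁻ u, ENNReal.ofReal (3 + |u|) ∂decayMeasure)
        * (∫⁻ u, ENNReal.ofReal (2 + |u|) ∂decayMeasure)
        * ENNReal.ofReal (2 * (2 ^ β * (1 + c₁ * 2 ^ β) / c₀)) * maxSnd (maxFst h) x := by
  have hc1p : 0 < c₁ := by linarith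
  have hm := measurable_curvePt β e l c j k
  set K : ℝ := 2 ^ β * (1 + c₁ * 2 ^ β) / c₀ with hK
  have hK0 : 0 ≤ K := by positivity
  have hF := measurable_maxFst hh
  have hpw : ((2:ℝ) ^ l)⁻¹ ≤ 1 := inv_le_one_of_one_le₀ (one_le_pow₀ (by norm_num))
  have hpw0 : 0 < ((2:ℝ) ^ l)⁻¹ := by positivity
  unfold curveAvg avgOp
  have hb := measurable_boxAvg j (k + l) hh
  rw [lintegral_curveMeasure (by fun_prop)]
  have hin : ∀ u v, ∫⁻ t in Icc (1 / 2 : ℝ) 2, boxAvg j (k + l) h (x + curvePt β e l c j k (u, v, t))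
      ≤ ENNReal.ofReal (3 + |u|) * (ENNReal.ofReal (2 + |v|) *
        (ENNReal.ofReal (2 * K) * maxSnd (maxFst h) x)) := by
    intro u v
    have h1 : ∀ t ∈ Icc (1 / 2 : ℝ) 2, boxAvg j (k + l) h (x + curvePt β e l c j k (u, v, t))
        ≤ ∫⁻ w in Icc (0:ℝ) 1, ENNReal.ofReal (2 * (3 + |u|)) *
          maxFst h (x.1, x.2 + (2:ℝ) ^ (-k) * (c * t ^ β + ((2:ℝ) ^ l)⁻¹ * (v + w))) := by
      intro t ht
      unfold boxAvg
      rw [lintegral_lintegral_swap (by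
        refine Measurable.aemeasurable ?_
        simp only [Function.uncurry_def]
        fun_prop)]
      refine lintegral_mono fun w => ?_
      have hs : |e * t + ((2:ℝ) ^ l)⁻¹ * u| ≤ 2 + |u| := by
        refine (abs_add_le _ _).trans ?_
        rw [abs_mul, abs_mul, he, one_mul, abs_of_pos hpw0, abs_of_nonneg (by linarith [ht.1])]
        have := mul_le_of_le_one_left (abs_nonneg u) hpw
        linarith [ht.2]
      have h2 := box_le_maxFun (h := fun y => h (y, x.2 + (2:ℝ) ^ (-k) *
        (c * t ^ β + ((2:ℝ) ^ l)⁻¹ * (v + w)))) (by fun_prop) j (e * t + ((2:ℝ) ^ l)⁻¹ * u) x.1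
      refine le_trans (le_of_eq ?_) (h2.trans ?_)
      · refine lintegral_congr fun a => ?_
        congr 1
        ext
        · simp only [curvePt, Prod.fst_add, neg_add, zpow_add₀ (two_ne_zero' ℝ), zpow_neg,
            zpow_natCast]
          ring
        · simp only [curvePt, Prod.snd_add, neg_add, zpow_add₀ (two_ne_zero' ℝ), zpow_neg,
            zpow_natCast]
          ring
      · gcongr ENNReal.ofReal (2 * ?_) * _
        linarith
    calc _ ≤ ∫⁻ t in Icc (1 / 2 : ℝ) 2, ∫⁻ w in Icc (0:ℝ) 1, ENNReal.ofReal (2 * (3 + |u|)) *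
          maxFst h (x.1, x.2 + (2:ℝ) ^ (-k) * (c * t ^ β + ((2:ℝ) ^ l)⁻¹ * (v + w))) :=
          setLIntegral_mono' measurableSet_Icc h1
      _ = ∫⁻ w in Icc (0:ℝ) 1, ∫⁻ t in Icc (1 / 2 : ℝ) 2, ENNReal.ofReal (2 * (3 + |u|)) *
          maxFst h (x.1, x.2 + (2:ℝ) ^ (-k) * (c * t ^ β + ((2:ℝ) ^ l)⁻¹ * (v + w))) := by
          rw [lintegral_lintegral_swap]
          refine Measurable.aemeasurable ?_
          simp only [Function.uncurry_def]
          fun_prop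
      _ ≤ ∫⁻ w in Icc (0:ℝ) 1, ENNReal.ofReal (2 * (3 + |u|)) *
            (ENNReal.ofReal (K * (2 + |v|)) * maxSnd (maxFst h) x) := by
          refine setLIntegral_mono' measurableSet_Icc fun w hw => ?_
          rw [lintegral_const_mul _ (by fun_prop)]
          gcongr ENNReal.ofReal (2 * (3 + |u|)) * ?_
          refine (curve_le_maxFun (H := fun y => maxFst h (x.1, y)) (by fun_prop) hβ hc₀ hc hc1 k
            x.2 _).trans ?_
          gcongr ENNReal.ofReal ?_ * ?_
          · refine mul_le_mul_of_nonneg_left ?_ hK0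
            rw [abs_mul, abs_of_pos hpw0]
            have h3 := mul_le_of_le_one_left (abs_nonneg (v + w)) hpw
            have h4 := abs_add_le v w
            rw [abs_of_nonneg hw.1] at h4
            linarith [hw.2]
          · exact le_rfl
      _ = _ := by
          rw [setLIntegral_const, Real.volume_Icc]
          have e1 : ENNReal.ofReal (2 * (3 + |u|)) = 2 * ENNReal.ofReal (3 + |u|) := by
            rw [ENNReal.ofReal_mul (by norm_num)]; norm_num
          have e2 : ENNReal.ofReal (2 * K) = 2 * ENNReal.ofReal K := by
            rw [ENNReal.ofReal_mul (by norm_num)]; norm_num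
          rw [e1, e2, ENNReal.ofReal_mul hK0]
          simp only [sub_zero, ENNReal.ofReal_one, mul_one]
          ring
  calc _ ≤ ∫⁻ u, (∫⁻ v, ENNReal.ofReal (3 + |u|) * (ENNReal.ofReal (2 + |v|) *
        (ENNReal.ofReal (2 * K) * maxSnd (maxFst h) x)) ∂decayMeasure) ∂decayMeasure :=
        lintegral_mono fun u => lintegral_mono fun v => hin u v
    _ = _ := by
        have e1 : ∀ u : ℝ, ∫⁻ v, ENNReal.ofReal (3 + |u|) * (ENNReal.ofReal (2 + |v|) *
            (ENNReal.ofReal (2 * K) * maxSnd (maxFst h) x)) ∂decayMeasure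
            = ENNReal.ofReal (3 + |u|) * ((∫⁻ v, ENNReal.ofReal (2 + |v|) ∂decayMeasure) *
              (ENNReal.ofReal (2 * K) * maxSnd (maxFst h) x)) := fun u => by
          rw [lintegral_const_mul _ (by fun_prop), lintegral_mul_const _ (by fun_prop)]
        simp_rw [e1]
        rw [lintegral_mul_const _ (by fun_prop)]
        ring

lemma curveAvg_boxAvg_snd {β e : ℝ} (hβ : 1 ≤ β) (he : |e| = 1) (l : ℕ) {c₁ c : ℝ}
    (hc1 : |c| ≤ c₁) (j k : ℤ) {h : ℝ × ℝ → ℝ≥0∞} (hh : Measurable h) (x : ℝ × ℝ) :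
    curveAvg β e l c j k (boxAvg (j + l) k h) x
      ≤ (∫⁻ u, ENNReal.ofReal (2 + |u|) ∂decayMeasure)
        * (∫⁻ u, ENNReal.ofReal (1 + c₁ * 2 ^ β + |u|) ∂decayMeasure)
        * 12 * maxFst (maxSnd h) x := by
  have hc1p : 0 ≤ c₁ := (abs_nonneg c).trans hc1
  have hm := measurable_curvePt β e l c j k
  have hF := measurable_maxSnd hh
  have hpw : ((2:ℝ) ^ l)⁻¹ ≤ 1 := inv_le_one_of_one_le₀ (one_le_pow₀ (by norm_num))
  have hpw0 : 0 < ((2:ℝ) ^ l)⁻¹ := by positivity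
  set L : ℝ := 1 + c₁ * 2 ^ β with hL
  unfold curveAvg avgOp
  have hb := measurable_boxAvg (j + l) k hh
  rw [lintegral_curveMeasure (by fun_prop)]
  have hin : ∀ u v, ∫⁻ t in Icc (1 / 2 : ℝ) 2, boxAvg (j + l) k h (x + curvePt β e l c j k (u, v, t))
      ≤ ENNReal.ofReal (2 + |u|) * (ENNReal.ofReal (L + |v|) *
        (12 * maxFst (maxSnd h) x)) := by
    intro u v
    have h1 : ∀ t ∈ Icc (1 / 2 : ℝ) 2, boxAvg (j + l) k h (x + curvePt β e l c j k (u, v, t))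
        ≤ ∫⁻ w in Icc (0:ℝ) 1, ENNReal.ofReal (2 * (L + |v|)) *
          maxSnd h (x.1 + (2:ℝ) ^ (-j) * (e * t ^ (1:ℝ) + ((2:ℝ) ^ l)⁻¹ * (u + w)), x.2) := by
      intro t ht
      unfold boxAvg
      refine lintegral_mono fun w => ?_
      have ht0 : (0:ℝ) ≤ t := by linarith [ht.1]
      have hs : |c * t ^ β + ((2:ℝ) ^ l)⁻¹ * v| ≤ c₁ * 2 ^ β + |v| := by
        refine (abs_add_le _ _).trans ?_
        rw [abs_mul, abs_mul, abs_of_pos hpw0, abs_of_nonneg (Real.rpow_nonneg ht0 β)]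
        have h3 := mul_le_of_le_one_left (abs_nonneg v) hpw
        have h4 := mul_le_mul hc1 (Real.rpow_le_rpow ht0 ht.2 (by linarith : 0 ≤ β))
          (Real.rpow_nonneg ht0 β) hc1p
        linarith
      have h2 := box_le_maxFun (h := fun y => h (x.1 + (2:ℝ) ^ (-j) *
        (e * t ^ (1:ℝ) + ((2:ℝ) ^ l)⁻¹ * (u + w)), y)) (by fun_prop) k
        (c * t ^ β + ((2:ℝ) ^ l)⁻¹ * v) x.2
      refine le_trans (le_of_eq ?_) (h2.trans ?_)
      · refine lintegral_congr fun a => ?_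
        congr 1
        ext
        · simp only [curvePt, Prod.fst_add, neg_add, zpow_add₀ (two_ne_zero' ℝ), zpow_neg,
            zpow_natCast, Real.rpow_one]
          ring
        · simp only [curvePt, Prod.snd_add, neg_add, zpow_add₀ (two_ne_zero' ℝ), zpow_neg,
            zpow_natCast]
          ring
      · gcongr ENNReal.ofReal (2 * ?_) * _
        linarith
    calc _ ≤ ∫⁻ t in Icc (1 / 2 : ℝ) 2, ∫⁻ w in Icc (0:ℝ) 1, ENNReal.ofReal (2 * (L + |v|)) *
          maxSnd h (x.1 + (2:ℝ) ^ (-j) * (e * t ^ (1:ℝ) + ((2:ℝ) ^ l)⁻¹ * (u + w)), x.2) :=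
          setLIntegral_mono' measurableSet_Icc h1
      _ = ∫⁻ w in Icc (0:ℝ) 1, ∫⁻ t in Icc (1 / 2 : ℝ) 2, ENNReal.ofReal (2 * (L + |v|)) *
          maxSnd h (x.1 + (2:ℝ) ^ (-j) * (e * t ^ (1:ℝ) + ((2:ℝ) ^ l)⁻¹ * (u + w)), x.2) := by
          rw [lintegral_lintegral_swap]
          refine Measurable.aemeasurable ?_
          simp only [Function.uncurry_def]
          fun_prop
      _ ≤ ∫⁻ w in Icc (0:ℝ) 1, ENNReal.ofReal (2 * (L + |v|)) *
            (ENNReal.ofReal (6 * (2 + |u|)) * maxFst (maxSnd h) x) := by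
          refine setLIntegral_mono' measurableSet_Icc fun w hw => ?_
          rw [lintegral_const_mul _ (by fun_prop)]
          gcongr ENNReal.ofReal (2 * (L + |v|)) * ?_
          refine (curve_le_maxFun (H := fun y => maxSnd h (y, x.2)) (by fun_prop) le_rfl
            one_pos he.ge he.le j x.1 _).trans ?_
          gcongr ENNReal.ofReal ?_ * ?_
          · rw [abs_mul, abs_of_pos hpw0]
            have h3 := mul_le_of_le_one_left (abs_nonneg (u + w)) hpw
            have h4 := abs_add_le u w
            rw [abs_of_nonneg hw.1] at h4
            norm_num
            linarith [hw.2]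
          · exact le_rfl
      _ = _ := by
          rw [setLIntegral_const, Real.volume_Icc]
          have e1 : ENNReal.ofReal (2 * (L + |v|)) = 2 * ENNReal.ofReal (L + |v|) := by
            rw [ENNReal.ofReal_mul (by norm_num)]; norm_num
          have e2 : ENNReal.ofReal (6 * (2 + |u|)) = 6 * ENNReal.ofReal (2 + |u|) := by
            rw [ENNReal.ofReal_mul (by norm_num)]; norm_num
          rw [e1, e2, show (12 : ℝ≥0∞) = 2 * 6 by norm_num]
          simp only [sub_zero, ENNReal.ofReal_one, mul_one]
          ring
  calc _ ≤ ∫⁻ u, (∫⁻ v, ENNReal.ofReal (2 + |u|) * (ENNReal.ofReal (L + |v|) *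
        (12 * maxFst (maxSnd h) x)) ∂decayMeasure) ∂decayMeasure :=
        lintegral_mono fun u => lintegral_mono fun v => hin u v
    _ = _ := by
        have e1 : ∀ u : ℝ, ∫⁻ v, ENNReal.ofReal (2 + |u|) * (ENNReal.ofReal (L + |v|) *
            (12 * maxFst (maxSnd h) x)) ∂decayMeasure
            = ENNReal.ofReal (2 + |u|) * ((∫⁻ v, ENNReal.ofReal (L + |v|) ∂decayMeasure) *
              (12 * maxFst (maxSnd h) x)) := fun u => by
          rw [lintegral_const_mul _ (by fun_prop), lintegral_mul_const _ (by fun_prop)]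
        simp_rw [e1]
        rw [lintegral_mul_const _ (by fun_prop)]
        ring

/-- Uniform constants in the box estimates for averages over thickened curves. -/
lemma exists_curveAvg_boxAvg {β : ℝ} (hβ : 1 ≤ β) {c₀ c₁ : ℝ} (hc₀ : 0 < c₀) :
    ∃ K : ℝ≥0, ∀ (e : ℝ), |e| = 1 → ∀ (l : ℕ) (c : ℝ), c₀ ≤ |c| → |c| ≤ c₁ →
      ∀ (j k : ℤ) (h : ℝ × ℝ → ℝ≥0∞), Measurable h → ∀ x,
        curveAvg β e l c j k (boxAvg j (k + l) h) x ≤ K * maxSnd (maxFst h) x ∧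
        curveAvg β e l c j k (boxAvg (j + l) k h) x ≤ K * maxFst (maxSnd h) x := by
  have hA : (∫⁻ u, ENNReal.ofReal (3 + |u|) ∂decayMeasure)
        * (∫⁻ u, ENNReal.ofReal (2 + |u|) ∂decayMeasure)
        * ENNReal.ofReal (2 * (2 ^ β * (1 + c₁ * 2 ^ β) / c₀)) ≠ ⊤ :=
    ENNReal.mul_ne_top (ENNReal.mul_ne_top (lintegral_decayMeasure_lt_top 3).ne
      (lintegral_decayMeasure_lt_top 2).ne) ENNReal.ofReal_ne_top
  have hB : (∫⁻ u, ENNReal.ofReal (2 + |u|) ∂decayMeasure)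
        * (∫⁻ u, ENNReal.ofReal (1 + c₁ * 2 ^ β + |u|) ∂decayMeasure) * 12 ≠ ⊤ :=
    ENNReal.mul_ne_top (ENNReal.mul_ne_top (lintegral_decayMeasure_lt_top 2).ne
      (lintegral_decayMeasure_lt_top _).ne) (by norm_num)
  lift ((∫⁻ u, ENNReal.ofReal (3 + |u|) ∂decayMeasure)
        * (∫⁻ u, ENNReal.ofReal (2 + |u|) ∂decayMeasure)
        * ENNReal.ofReal (2 * (2 ^ β * (1 + c₁ * 2 ^ β) / c₀))) to ℝ≥0 using hA with A hA'
  lift ((∫⁻ u, ENNReal.ofReal (2 + |u|) ∂decayMeasure)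
        * (∫⁻ u, ENNReal.ofReal (1 + c₁ * 2 ^ β + |u|) ∂decayMeasure) * 12) to ℝ≥0 using hB
        with B hB'
  refine ⟨max A B, fun e he l c hc hc1 j k h hh x => ⟨?_, ?_⟩⟩
  · refine (curveAvg_boxAvg_fst hβ he l hc₀ hc hc1 j k hh x).trans ?_
    rw [← hA']
    gcongr
    exact le_max_left _ _
  · refine (curveAvg_boxAvg_snd hβ he l hc1 j k hh x).trans ?_
    rw [← hB']
    gcongr
    exact le_max_right _ _

/-! ### Bounds for square functions over thickened curves -/

/-- Two-parameter average over a dyadic box. -/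
def dAvg2 (j k : ℤ) (f : ℝ × ℝ → ℝ) (x : ℝ × ℝ) : ℝ :=
  dAvg j (fun s => dAvg k (fun t => f (s, t)) x.2) x.1

lemma dAvg_sub_of_bdd {F G : ℝ → ℝ} (hF : Measurable F) (hG : Measurable G) {K K' : ℝ}
    (hK : ∀ t, ‖F t‖ ≤ K) (hK' : ∀ t, ‖G t‖ ≤ K') (m : ℤ) (x : ℝ) :
    dAvg m (fun t => F t - G t) x = dAvg m F x - dAvg m G x := by
  unfold dAvg
  exact intervalIntegral.integral_sub
    (intervalIntegrable_of_bdd (F := fun t => F (x + (2:ℝ) ^ (-m) * t))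
      (by exact (hF.comp (by fun_prop)).stronglyMeasurable) (fun t => hK _) _ _)
    (intervalIntegrable_of_bdd (F := fun t => G (x + (2:ℝ) ^ (-m) * t))
      (by exact (hG.comp (by fun_prop)).stronglyMeasurable) (fun t => hK' _) _ _)

lemma measurable_dAvg_snd {f : ℝ × ℝ → ℝ} (hf : Measurable f) (k : ℤ) (y : ℝ) :
    Measurable fun s => dAvg k (fun t => f (s, t)) y :=
  (stronglyMeasurable_dAvg_uncurry (α := ℝ) hf.stronglyMeasurable k).measurable.comp
    (by fun_prop : Measurable fun s : ℝ => (s, y))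

lemma dDiff2_eq {f : ℝ × ℝ → ℝ} (hf : Measurable f) {K : ℝ} (hK : ∀ x, ‖f x‖ ≤ K) (j k : ℤ)
    (x : ℝ × ℝ) : dDiff2 j k f x = (dAvg2 (j + 1) (k + 1) f x - dAvg2 (j + 1) k f x)
      - (dAvg2 j (k + 1) f x - dAvg2 j k f x) := by
  unfold dDiff2 dDiff dAvg2
  rw [dAvg_sub_of_bdd (measurable_dAvg_snd hf _ _) (measurable_dAvg_snd hf _ _)
      (fun t => norm_dAvg_le (fun _ => hK _) _ _) (fun t => norm_dAvg_le (fun _ => hK _) _ _),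
    dAvg_sub_of_bdd (measurable_dAvg_snd hf _ _) (measurable_dAvg_snd hf _ _)
      (fun t => norm_dAvg_le (fun _ => hK _) _ _) (fun t => norm_dAvg_le (fun _ => hK _) _ _)]

lemma sum_dDiff2 {f : ℝ × ℝ → ℝ} (hf : Measurable f) {K : ℝ} (hK : ∀ x, ‖f x‖ ≤ K) (j k : ℤ)
    (l : ℕ) (x : ℝ × ℝ) :
    ∑ r ∈ Finset.range l, ∑ r' ∈ Finset.range l, dDiff2 (j + r) (k + r') f x
      = (dAvg2 (j + l) (k + l) f x - dAvg2 (j + l) k f x)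
        - (dAvg2 j (k + l) f x - dAvg2 j k f x) := by
  simp_rw [dDiff2_eq hf hK]
  have h1 : ∀ r : ℕ, ∑ r' ∈ Finset.range l,
      ((dAvg2 (j + r + 1) (k + r' + 1) f x - dAvg2 (j + r + 1) (k + r') f x)
        - (dAvg2 (j + r) (k + r' + 1) f x - dAvg2 (j + r) (k + r') f x))
      = (dAvg2 (j + (r + 1 : ℕ)) (k + l) f x - dAvg2 (j + (r + 1 : ℕ)) k f x)
        - (dAvg2 (j + r) (k + l) f x - dAvg2 (j + r) k f x) := by
    intro r
    have := Finset.sum_range_sub (fun r' : ℕ =>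
      dAvg2 (j + (r + 1 : ℕ)) (k + r') f x - dAvg2 (j + r) (k + r') f x) l
    rw [show (dAvg2 (j + (r + 1 : ℕ)) (k + l) f x - dAvg2 (j + (r + 1 : ℕ)) k f x)
        - (dAvg2 (j + r) (k + l) f x - dAvg2 (j + r) k f x)
      = (dAvg2 (j + (r + 1 : ℕ)) (k + l) f x - dAvg2 (j + r) (k + l) f x)
        - (dAvg2 (j + (r + 1 : ℕ)) (k + (0:ℕ)) f x - dAvg2 (j + r) (k + (0:ℕ)) f x) by
        simp only [Nat.cast_zero, add_zero]; ring, ← this]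
    refine Finset.sum_congr rfl fun r' _ => ?_
    simp only [Nat.cast_add, Nat.cast_one, ← add_assoc]
    ring
  simp_rw [h1]
  have := Finset.sum_range_sub (fun r : ℕ =>
      dAvg2 (j + r) (k + l) f x - dAvg2 (j + r) k f x) l
  rw [this]
  simp

lemma ofReal_dAvg {F : ℝ → ℝ} (hF : Measurable F) (h0 : ∀ t, 0 ≤ F t) {K : ℝ}
    (hK : ∀ t, ‖F t‖ ≤ K) (m : ℤ) (x : ℝ) :
    ENNReal.ofReal (dAvg m F x)
      = ∫⁻ v in Icc (0:ℝ) 1, ENNReal.ofReal (F (x + (2:ℝ) ^ (-m) * v)) := by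
  have hi := intervalIntegrable_of_bdd (F := fun t => F (x + (2:ℝ) ^ (-m) * t))
      (by exact (hF.comp (by fun_prop)).stronglyMeasurable) (fun t => hK _) 0 1
  unfold dAvg
  rw [intervalIntegral.integral_of_le zero_le_one, restrict_Ioc_eq_restrict_Icc]
  refine ofReal_integral_eq_lintegral_ofReal ?_ (ae_of_all _ fun t => h0 _)
  rw [intervalIntegrable_iff_integrableOn_Ioc_of_le zero_le_one] at hi
  rwa [IntegrableOn, restrict_Ioc_eq_restrict_Icc] at hi

lemma dAvg_nonneg {F : ℝ → ℝ} (h0 : ∀ t, 0 ≤ F t) (m : ℤ) (x : ℝ) : 0 ≤ dAvg m F x :=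
  intervalIntegral.integral_nonneg zero_le_one fun _ _ => h0 _

lemma ofReal_dAvg2 {f : ℝ × ℝ → ℝ} (hf : Measurable f) (h0 : ∀ x, 0 ≤ f x) {K : ℝ}
    (hK : ∀ x, ‖f x‖ ≤ K) (j k : ℤ) (x : ℝ × ℝ) :
    ENNReal.ofReal (dAvg2 j k f x) = boxAvg j k (fun y => ENNReal.ofReal (f y)) x := by
  unfold dAvg2 boxAvg
  rw [ofReal_dAvg (measurable_dAvg_snd hf _ _) (fun t => dAvg_nonneg (fun _ => h0 _) _ _)
    (fun t => norm_dAvg_le (fun _ => hK _) _ _)]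
  refine lintegral_congr fun v => ?_
  rw [ofReal_dAvg (by fun_prop) (fun t => h0 _) (fun _ => hK _)]

lemma dAvg2_nonneg {f : ℝ × ℝ → ℝ} (h0 : ∀ x, 0 ≤ f x) (j k : ℤ) (x : ℝ × ℝ) :
    0 ≤ dAvg2 j k f x := dAvg_nonneg (fun _ => dAvg_nonneg (fun _ => h0 _) _ _) _ _

lemma boxAvg_le {f : ℝ × ℝ → ℝ} (hf : Measurable f) (h0 : ∀ x, 0 ≤ f x) {K : ℝ}
    (hK : ∀ x, ‖f x‖ ≤ K) (j k : ℤ) (l : ℕ) (x : ℝ × ℝ) :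
    boxAvg (j + l) (k + l) (fun y => ENNReal.ofReal (f y)) x
      ≤ (∑ r ∈ Finset.range l, ∑ r' ∈ Finset.range l, ‖dDiff2 (j + r) (k + r') f x‖ₑ)
        + boxAvg j (k + l) (fun y => ENNReal.ofReal (f y)) x
        + boxAvg (j + l) k (fun y => ENNReal.ofReal (f y)) x := by
  rw [← ofReal_dAvg2 hf h0 hK, ← ofReal_dAvg2 hf h0 hK, ← ofReal_dAvg2 hf h0 hK]
  have h1 : dAvg2 (j + l) (k + l) f x
      ≤ (∑ r ∈ Finset.range l, ∑ r' ∈ Finset.range l, ‖dDiff2 (j + r) (k + r') f x‖)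
        + dAvg2 j (k + l) f x + dAvg2 (j + l) k f x := by
    have h2 := sum_dDiff2 hf hK j k l x
    have h3 : ∑ r ∈ Finset.range l, ∑ r' ∈ Finset.range l, dDiff2 (j + r) (k + r') f x
        ≤ ∑ r ∈ Finset.range l, ∑ r' ∈ Finset.range l, ‖dDiff2 (j + r) (k + r') f x‖ :=
      Finset.sum_le_sum fun r _ => Finset.sum_le_sum fun r' _ => Real.le_norm_self _
    linarith [dAvg2_nonneg h0 j k x]
  refine (ENNReal.ofReal_le_ofReal h1).trans (le_of_eq ?_)
  have hs : 0 ≤ ∑ r ∈ Finset.range l, ∑ r' ∈ Finset.range l, ‖dDiff2 (j + r) (k + r') f x‖ := by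
    positivity
  rw [ENNReal.ofReal_add (add_nonneg hs (dAvg2_nonneg h0 _ _ _)) (dAvg2_nonneg h0 _ _ _),
    ENNReal.ofReal_add hs (dAvg2_nonneg h0 _ _ _),
    ENNReal.ofReal_sum_of_nonneg (fun r _ => by positivity)]
  congr 2
  refine Finset.sum_congr rfl fun r _ => ?_
  rw [ENNReal.ofReal_sum_of_nonneg (fun r _ => by positivity)]
  exact Finset.sum_congr rfl fun r _ => ofReal_norm _

lemma sq_sum_enorm_le {ι : Type*} (s : Finset ι) (a : ι → ℝ) :
    (∑ i ∈ s, ‖a i‖ₑ) ^ 2 ≤ s.card * ∑ i ∈ s, ‖a i‖ₑ ^ 2 := by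
  simp_rw [← ofReal_norm, ← ENNReal.ofReal_pow (norm_nonneg _)]
  rw [← ENNReal.ofReal_sum_of_nonneg (fun _ _ => by positivity),
    ← ENNReal.ofReal_sum_of_nonneg (fun _ _ => by positivity),
    ← ENNReal.ofReal_pow (by positivity), ← ENNReal.ofReal_natCast,
    ← ENNReal.ofReal_mul (by positivity)]
  exact ENNReal.ofReal_le_ofReal sq_sum_le_card_mul_sum_sq

lemma sum_shift_le (S : Finset (ℤ × ℤ)) (m m' : ℤ) {U V : Finset ℤ}
    (hU : ∀ α ∈ S, α.1 + m ∈ U) (hV : ∀ α ∈ S, α.2 + m' ∈ V) (F : ℤ → ℤ → ℝ≥0∞) :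
    ∑ α ∈ S, F (α.1 + m) (α.2 + m') ≤ ∑ j ∈ U, ∑ k ∈ V, F j k := by
  rw [← Finset.sum_product']
  have hinj : Function.Injective fun α : ℤ × ℤ => (α.1 + m, α.2 + m') := by
    rintro ⟨a, b⟩ ⟨c, d⟩ h
    simpa using h
  rw [← Finset.sum_image (s := S) (g := fun α : ℤ × ℤ => (α.1 + m, α.2 + m'))
    (f := fun α : ℤ × ℤ => F α.1 α.2) hinj.injOn]
  refine Finset.sum_le_sum_of_subset ?_
  intro q hq
  obtain ⟨α, hα, rfl⟩ := Finset.mem_image.1 hq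
  exact Finset.mem_product.2 ⟨hU α hα, hV α hα⟩

lemma dDiff2_shift_square {f : ℝ × ℝ → ℝ} (hf : Measurable f) {K : ℝ} (hK : ∀ x, ‖f x‖ ≤ K)
    {p : ℝ} (hp : 1 < p) (hp2 : p ≤ 2) (S : Finset (ℤ × ℤ)) (m : ℤ) :
    ∫⁻ x, (∑ α ∈ S, ‖dDiff2 (α.1 + m) (α.2 + m) f x‖ₑ ^ 2) ^ (p / 2)
      ≤ ENNReal.ofReal (2048 / (p - 1)) ^ 2 * ∫⁻ x, ‖f x‖ₑ ^ p := by
  refine le_trans (lintegral_mono fun x => ?_) (dDiff2_square hf hK hp hp2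
    (S.image fun α => α.1 + m) (S.image fun α => α.2 + m))
  gcongr
  exact sum_shift_le S m m (fun α hα => Finset.mem_image_of_mem _ hα)
    (fun α hα => Finset.mem_image_of_mem _ hα) fun j k => ‖dDiff2 j k f x‖ₑ ^ 2

lemma dDiff2_blocks_square {f : ℝ × ℝ → ℝ} (hf : Measurable f) {K : ℝ} (hK : ∀ x, ‖f x‖ ≤ K)
    {p : ℝ} (hp : 1 < p) (hp2 : p ≤ 2) (S : Finset (ℤ × ℤ)) (l : ℕ) :
    ∫⁻ x, (∑ α ∈ S, (∑ r ∈ Finset.range l, ∑ r' ∈ Finset.range l,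
        ‖dDiff2 (α.1 + r) (α.2 + r') f x‖ₑ) ^ 2) ^ (p / 2)
      ≤ ((l : ℝ≥0∞) ^ 4) ^ (p / 2) * (ENNReal.ofReal (2048 / (p - 1)) ^ 2 * ∫⁻ x, ‖f x‖ₑ ^ p) := by
  set U : Finset ℤ := (S ×ˢ Finset.range l).image fun q => q.1.1 + (q.2 : ℤ) with hU
  set V : Finset ℤ := (S ×ˢ Finset.range l).image fun q => q.1.2 + (q.2 : ℤ) with hV
  have hp0 : 0 ≤ p / 2 := by linarith
  have hpt : ∀ x, ∑ α ∈ S, (∑ r ∈ Finset.range l, ∑ r' ∈ Finset.range l,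
        ‖dDiff2 (α.1 + r) (α.2 + r') f x‖ₑ) ^ 2
      ≤ (l : ℝ≥0∞) ^ 4 * ∑ j ∈ U, ∑ k ∈ V, ‖dDiff2 j k f x‖ₑ ^ 2 := by
    intro x
    have h1 : ∀ α : ℤ × ℤ, (∑ r ∈ Finset.range l, ∑ r' ∈ Finset.range l,
        ‖dDiff2 (α.1 + r) (α.2 + r') f x‖ₑ) ^ 2
        ≤ (l : ℝ≥0∞) ^ 2 * ∑ q ∈ Finset.range l ×ˢ Finset.range l,
          ‖dDiff2 (α.1 + (q.1 : ℕ)) (α.2 + (q.2 : ℕ)) f x‖ₑ ^ 2 := by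
      intro α
      rw [← Finset.sum_product']
      refine (sq_sum_enorm_le _ _).trans (le_of_eq ?_)
      rw [Finset.card_product, Finset.card_range]
      push_cast
      ring
    refine (Finset.sum_le_sum fun α _ => h1 α).trans ?_
    rw [← Finset.mul_sum, Finset.sum_comm]
    calc _ ≤ (l : ℝ≥0∞) ^ 2 * ∑ q ∈ Finset.range l ×ˢ Finset.range l,
          ∑ j ∈ U, ∑ k ∈ V, ‖dDiff2 j k f x‖ₑ ^ 2 := by
          gcongr with q hq
          rw [Finset.mem_product] at hq
          refine sum_shift_le S q.1 q.2 (fun α hα => ?_) (fun α hα => ?_)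
            fun j k => ‖dDiff2 j k f x‖ₑ ^ 2
          · exact Finset.mem_image.2 ⟨(α, q.1), Finset.mem_product.2 ⟨hα, hq.1⟩, rfl⟩
          · exact Finset.mem_image.2 ⟨(α, q.2), Finset.mem_product.2 ⟨hα, hq.2⟩, rfl⟩
      _ = _ := by
          rw [Finset.sum_const, Finset.card_product, Finset.card_range, nsmul_eq_mul]
          push_cast
          ring
  calc _ ≤ ∫⁻ x, ((l : ℝ≥0∞) ^ 4) ^ (p / 2) *
        (∑ j ∈ U, ∑ k ∈ V, ‖dDiff2 j k f x‖ₑ ^ 2) ^ (p / 2) := by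
        refine lintegral_mono fun x => ?_
        rw [← ENNReal.mul_rpow_of_nonneg _ _ hp0]
        exact ENNReal.rpow_le_rpow (hpt x) hp0
    _ = ((l : ℝ≥0∞) ^ 4) ^ (p / 2) *
        ∫⁻ x, (∑ j ∈ U, ∑ k ∈ V, ‖dDiff2 j k f x‖ₑ ^ 2) ^ (p / 2) := by
        refine lintegral_const_mul _ ?_
        have := fun j k => measurable_dDiff2 hf j k
        fun_prop
    _ ≤ _ := by gcongr; exact dDiff2_square hf hK hp hp2 U V

/-- Maximal bound for averages over finitely many thickened curves, on bounded functions. -/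
def CurveBound (β e : ℝ) (l : ℕ) (c : ℤ × ℤ → ℝ) (S : Finset (ℤ × ℤ)) (p : ℝ) (B : ℝ≥0∞) : Prop :=
  ∀ h : ℝ × ℝ → ℝ≥0∞, Measurable h → (∃ N : ℝ≥0, ∀ x, h x ≤ N) →
    ∫⁻ x, (S.sup fun α => curveAvg β e l (c α) α.1 α.2 h x) ^ p ≤ B * ∫⁻ x, h x ^ p

lemma CurveBound.mono {β e : ℝ} {l : ℕ} {c : ℤ × ℤ → ℝ} {S : Finset (ℤ × ℤ)} {p : ℝ}
    {B B' : ℝ≥0∞} (h : CurveBound β e l c S p B) (hB : B ≤ B') : CurveBound β e l c S p B' :=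
  fun g hg hb => (h g hg hb).trans (by gcongr)

lemma curveBound_trivial (β e : ℝ) (l : ℕ) (c : ℤ × ℤ → ℝ) (S : Finset (ℤ × ℤ)) {p : ℝ}
    (hp : 1 ≤ p) : CurveBound β e l c S p (S.card * curveMeasure univ ^ p) := by
  intro h hh _
  have hm := fun α : ℤ × ℤ => measurable_curvePt β e l (c α) α.1 α.2
  calc _ ≤ ∫⁻ x, ∑ α ∈ S, curveAvg β e l (c α) α.1 α.2 h x ^ p := by
        refine lintegral_mono fun x => ?_
        rcases S.eq_empty_or_nonempty with rfl | hS
        · simp [show 0 < p by linarith]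
        · obtain ⟨α, hα, h1⟩ := Finset.exists_mem_eq_sup S hS
            (fun α => curveAvg β e l (c α) α.1 α.2 h x)
          simp only [h1]
          exact Finset.single_le_sum (f := fun α => curveAvg β e l (c α) α.1 α.2 h x ^ p)
            (fun _ _ => zero_le) hα
    _ = ∑ α ∈ S, ∫⁻ x, curveAvg β e l (c α) α.1 α.2 h x ^ p :=
        lintegral_finsetSum _ fun α _ => (measurable_avgOp (hm α) hh).pow_const p
    _ ≤ ∑ α ∈ S, curveMeasure univ ^ p * ∫⁻ x, h x ^ p :=
        Finset.sum_le_sum fun α _ => avgOp_lp (hm α) hh hp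
    _ = _ := by rw [Finset.sum_const, nsmul_eq_mul, mul_assoc]

lemma add_add_rpow_le (a b c : ℝ≥0∞) {p : ℝ} (hp : 1 ≤ p) (hp2 : p ≤ 2) :
    (a + b + c) ^ p ≤ 4 * (a ^ p + b ^ p + c ^ p) := by
  have h2 : ∀ x y : ℝ≥0∞, (x + y) ^ p ≤ 2 * (x ^ p + y ^ p) := fun x y =>
    (ENNReal.rpow_add_le_mul_rpow_add_rpow x y hp).trans (by
      gcongr
      nth_rewrite 2 [← ENNReal.rpow_one 2]
      exact ENNReal.rpow_le_rpow_of_exponent_le (by norm_num) (by linarith))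
  calc _ ≤ 2 * ((a + b) ^ p + c ^ p) := h2 _ _
    _ ≤ 2 * (2 * (a ^ p + b ^ p) + 2 * c ^ p) := by
        gcongr
        · exact h2 _ _
        · exact le_mul_of_one_le_left zero_le (by norm_num)
    _ = _ := by ring

lemma rpow_le_one_add_sq (a : ℝ≥0∞) {p : ℝ} (hp0 : 0 ≤ p) (hp2 : p ≤ 2) : a ^ p ≤ (1 + a) ^ 2 := by
  calc a ^ p ≤ (1 + a) ^ p := by gcongr; exact le_add_self
    _ ≤ (1 + a) ^ (2:ℝ) := ENNReal.rpow_le_rpow_of_exponent_le le_self_add hp2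
    _ = _ := by norm_num

lemma curveBound_step {β e : ℝ} {l : ℕ} (hl : 1 ≤ l) {c : ℤ × ℤ → ℝ} {S : Finset (ℤ × ℤ)} {p : ℝ}
    (hp : 1 < p) (hp2 : p ≤ 2) {K : ℝ≥0}
    (hK : ∀ (α : ℤ × ℤ) (h : ℝ × ℝ → ℝ≥0∞), Measurable h → ∀ x,
        curveAvg β e l (c α) α.1 α.2 (boxAvg α.1 (α.2 + l) h) x ≤ K * maxSnd (maxFst h) x ∧
        curveAvg β e l (c α) α.1 α.2 (boxAvg (α.1 + l) α.2 h) x ≤ K * maxFst (maxSnd h) x)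
    {B : ℝ≥0∞} (hB1 : 1 ≤ B) (hB : CurveBound β e l c S p B) :
    CurveBound β e l c S p ((81 ^ 2 * 4 * ((1 + curveMeasure univ) ^ 4 + 2 * (1 + K) ^ 2) *
      ((l : ℝ≥0∞) ^ 4) ^ (p / 2) * ENNReal.ofReal (2048 / (p - 1)) ^ 2) * B ^ (1 / 2 : ℝ)) := by
  intro h hh hbd
  obtain ⟨N, hN⟩ := hbd
  have hp0 : 0 < p := by linarith
  set f : ℝ × ℝ → ℝ := fun x => (h x).toReal with hf
  have hfm : Measurable f := hh.ennreal_toReal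
  have hf0 : ∀ x, 0 ≤ f x := fun x => ENNReal.toReal_nonneg
  have hfh : ∀ x, ENNReal.ofReal (f x) = h x := fun x =>
    ENNReal.ofReal_toReal ((hN x).trans_lt ENNReal.coe_lt_top).ne
  have hfK : ∀ x, ‖f x‖ ≤ N := fun x => by
    rw [Real.norm_of_nonneg (hf0 x)]
    exact ENNReal.toReal_le_coe_of_le_coe (hN x)
  have hfe : ∀ x, ‖f x‖ₑ = h x := fun x => by
    rw [← hfh x, Real.enorm_of_nonneg (hf0 x)]
  have hm := fun α : ℤ × ℤ => measurable_curvePt β e l (c α) α.1 α.2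
  set g : ℤ × ℤ → ℝ × ℝ → ℝ≥0∞ := fun α x =>
    ∑ r ∈ Finset.range l, ∑ r' ∈ Finset.range l, ‖dDiff2 (α.1 + r) (α.2 + r') f x‖ₑ with hg
  have hgm : ∀ α, Measurable (g α) := fun α => by
    have := fun j k => measurable_dDiff2 hfm j k
    fun_prop
  have hgb : ∃ N' : ℝ≥0, ∀ α x, g α x ≤ N' := by
    refine ⟨l * (l * (2 * (2 * N))), fun α x => ?_⟩
    have h1 : ∀ j k, ‖dDiff2 j k f x‖ₑ ≤ ((2 * (2 * N) : ℝ≥0) : ℝ≥0∞) := by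
      intro j k
      rw [enorm_le_coe]
      have : ‖dDiff2 j k f x‖ ≤ 2 * (2 * N) :=
        norm_dDiff_le (fun s => norm_dDiff_le (fun t => hfK _) _ _) _ _
      exact_mod_cast this
    calc g α x ≤ ∑ r ∈ Finset.range l, ∑ r' ∈ Finset.range l, ((2 * (2 * N) : ℝ≥0) : ℝ≥0∞) :=
          Finset.sum_le_sum fun r _ => Finset.sum_le_sum fun r' _ => h1 _ _
      _ = _ := by simp
  set P : ℝ≥0∞ := ENNReal.ofReal (2048 / (p - 1)) with hP
  set L : ℝ≥0∞ := ((l : ℝ≥0∞) ^ 4) ^ (p / 2) with hL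
  have hL1 : 1 ≤ L := by
    refine ENNReal.one_le_rpow ?_ (by positivity)
    exact_mod_cast Nat.one_le_pow _ _ hl
  set V : ℝ × ℝ → ℝ≥0∞ := fun x =>
    (∑ α ∈ S, curveAvg β e l (c α) α.1 α.2 (g α) x ^ 2) ^ (1 / 2 : ℝ) with hV
  have hVp : ∀ x, V x ^ p = (∑ α ∈ S, curveAvg β e l (c α) α.1 α.2 (g α) x ^ 2) ^ (p / 2) := by
    intro x
    simp only [hV]
    rw [← ENNReal.rpow_mul]; congr 1; ring
  have hcm : ∀ α : ℤ × ℤ, Measurable (curveAvg β e l (c α) α.1 α.2 (g α)) := fun α =>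
    measurable_avgOp (hm α) (hgm α)
  have hVm : Measurable V := by fun_prop
  have hM1 := measurable_maxSnd (measurable_maxFst hh)
  have hM2 := measurable_maxFst (measurable_maxSnd hh)
  have hpt : ∀ x, (S.sup fun α => curveAvg β e l (c α) α.1 α.2 h x)
      ≤ 81 * (V x + K * maxSnd (maxFst h) x + K * maxFst (maxSnd h) x) := by
    intro x
    refine Finset.sup_le fun α hα => ?_
    refine (curveAvg_le_boxAvg β e l (c α) α.1 α.2 hh x).trans ?_
    gcongr
    have h1 : ∀ y, boxAvg (α.1 + l) (α.2 + l) h y ≤ g α y + (boxAvg α.1 (α.2 + l) h y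
        + boxAvg (α.1 + l) α.2 h y) := by
      intro y
      have := boxAvg_le hfm hf0 hfK α.1 α.2 l y
      simp_rw [hfh] at this
      rwa [add_assoc] at this
    refine (avgOp_mono h1 x).trans ?_
    rw [avgOp_add (hm α) (hgm α), avgOp_add (hm α) (measurable_boxAvg _ _ hh), ← add_assoc]
    refine add_le_add (add_le_add ?_ (hK α h hh x).1) (hK α h hh x).2
    have h2 : curveAvg β e l (c α) α.1 α.2 (g α) x
        = (curveAvg β e l (c α) α.1 α.2 (g α) x ^ 2) ^ (1 / 2 : ℝ) := by
      rw [← ENNReal.rpow_natCast, ← ENNReal.rpow_mul]; norm_num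
    change curveAvg β e l (c α) α.1 α.2 (g α) x ≤ V x
    rw [h2]
    simp only [hV]
    gcongr
    exact Finset.single_le_sum (f := fun α => curveAvg β e l (c α) α.1 α.2 (g α) x ^ 2)
      (fun _ _ => zero_le) hα
  have hV2 : ∫⁻ x, V x ^ p ≤ (1 + curveMeasure univ) ^ 4 * B ^ (1 / 2 : ℝ) *
      (L * (P ^ 2 * ∫⁻ x, h x ^ p)) := by
    simp_rw [hVp]
    refine (avgOp_vector S hm hp hp2 hB hgm hgb).trans ?_
    gcongr ?_ * ?_ * ?_
    · calc (curveMeasure univ ^ p) ^ (p / 2) ≤ ((1 + curveMeasure univ) ^ 2) ^ (p / 2) := by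
            gcongr
            exact rpow_le_one_add_sq _ hp0.le hp2
        _ ≤ ((1 + curveMeasure univ) ^ 2) ^ (2:ℝ) :=
            ENNReal.rpow_le_rpow_of_exponent_le (one_le_pow₀ le_self_add) (by linarith)
        _ = _ := by rw [← ENNReal.rpow_natCast, ← ENNReal.rpow_natCast, ← ENNReal.rpow_mul]; norm_num
    · exact ENNReal.rpow_le_rpow_of_exponent_le hB1 (by linarith)
    · have := dDiff2_blocks_square hfm hfK hp hp2 S l
      simp_rw [hfe] at this
      exact this
  have hMP : ENNReal.ofReal (128 / (p - 1)) ≤ P := by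
    refine ENNReal.ofReal_le_ofReal ?_
    have : 0 < p - 1 := by linarith
    gcongr
    norm_num
  have hM1' : ∫⁻ x, (K * maxSnd (maxFst h) x) ^ p ≤ (1 + K) ^ 2 * (P ^ 2 * ∫⁻ x, h x ^ p) := by
    simp_rw [ENNReal.mul_rpow_of_nonneg _ _ hp0.le]
    rw [lintegral_const_mul _ (by fun_prop)]
    gcongr ?_ * ?_
    · exact rpow_le_one_add_sq _ hp0.le hp2
    · refine (maxSnd_strong (measurable_maxFst hh) hp hp2).trans ?_
      rw [sq, mul_assoc]
      gcongr
      refine (maxFst_strong hh hp hp2).trans ?_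
      gcongr
  have hM2' : ∫⁻ x, (K * maxFst (maxSnd h) x) ^ p ≤ (1 + K) ^ 2 * (P ^ 2 * ∫⁻ x, h x ^ p) := by
    simp_rw [ENNReal.mul_rpow_of_nonneg _ _ hp0.le]
    rw [lintegral_const_mul _ (by fun_prop)]
    gcongr ?_ * ?_
    · exact rpow_le_one_add_sq _ hp0.le hp2
    · refine (maxFst_strong (measurable_maxSnd hh) hp hp2).trans ?_
      rw [sq, mul_assoc]
      gcongr
      refine (maxSnd_strong hh hp hp2).trans ?_
      gcongr
  calc _ ≤ ∫⁻ x, 81 ^ 2 * (4 * (V x ^ p + (K * maxSnd (maxFst h) x) ^ p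
          + (K * maxFst (maxSnd h) x) ^ p)) := by
        refine lintegral_mono fun x => ?_
        refine (ENNReal.rpow_le_rpow (hpt x) hp0.le).trans ?_
        rw [ENNReal.mul_rpow_of_nonneg _ _ hp0.le]
        gcongr ?_ * ?_
        · calc (81 : ℝ≥0∞) ^ p ≤ 81 ^ (2:ℝ) :=
              ENNReal.rpow_le_rpow_of_exponent_le (by norm_num) hp2
            _ = _ := by norm_num
        · exact add_add_rpow_le _ _ _ hp.le hp2
    _ = 81 ^ 2 * (4 * ((∫⁻ x, V x ^ p) + (∫⁻ x, (K * maxSnd (maxFst h) x) ^ p)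
          + ∫⁻ x, (K * maxFst (maxSnd h) x) ^ p)) := by
        rw [lintegral_const_mul _ (by fun_prop), lintegral_const_mul _ (by fun_prop),
          lintegral_add_left (by fun_prop), lintegral_add_left (by fun_prop)]
    _ ≤ 81 ^ 2 * (4 * ((1 + curveMeasure univ) ^ 4 * B ^ (1 / 2 : ℝ) *
          (L * (P ^ 2 * ∫⁻ x, h x ^ p)) + (1 + K) ^ 2 * (1 * 1 * (P ^ 2 * ∫⁻ x, h x ^ p))
          + (1 + K) ^ 2 * (1 * 1 * (P ^ 2 * ∫⁻ x, h x ^ p)))) := by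
        simp only [one_mul]
        gcongr
    _ ≤ 81 ^ 2 * (4 * ((1 + curveMeasure univ) ^ 4 * B ^ (1 / 2 : ℝ) *
          (L * (P ^ 2 * ∫⁻ x, h x ^ p))
          + (1 + K) ^ 2 * (B ^ (1 / 2 : ℝ) * L * (P ^ 2 * ∫⁻ x, h x ^ p))
          + (1 + K) ^ 2 * (B ^ (1 / 2 : ℝ) * L * (P ^ 2 * ∫⁻ x, h x ^ p)))) := by
        have hB2 : 1 ≤ B ^ (1 / 2 : ℝ) := ENNReal.one_le_rpow hB1 (by norm_num)
        gcongr 81 ^ 2 * (4 * (_ + _ * (?_ * ?_ * _) + _ * (?_ * ?_ * _)))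
    _ = _ := by ring

lemma curveBound_of_step {β e : ℝ} {l : ℕ} {c : ℤ × ℤ → ℝ} {S : Finset (ℤ × ℤ)} {p : ℝ}
    (hp : 1 ≤ p) {Q : ℝ≥0∞} (hQ : 1 ≤ Q)
    (hstep : ∀ B : ℝ≥0∞, 1 ≤ B → CurveBound β e l c S p B →
      CurveBound β e l c S p (Q * B ^ (1 / 2 : ℝ))) : CurveBound β e l c S p (2 * Q ^ 2) := by
  have hind : ∀ n : ℕ, CurveBound β e l c S p (2 ^ (2 ^ n) * Q ^ 2) →
      CurveBound β e l c S p (2 * Q ^ 2) := by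
    intro n
    induction n with
    | zero => simp
    | succ n ih =>
      intro h
      refine ih ?_
      have h1 : (1 : ℝ≥0∞) ≤ 2 ^ (2 ^ (n + 1)) * Q ^ 2 := by
        rw [← one_mul 1]
        gcongr
        · exact one_le_pow₀ (by norm_num)
        · exact one_le_pow₀ hQ
      have h2 := hstep _ h1 h
      have h3 : ((2:ℝ≥0∞) ^ (2 ^ (n + 1)) * Q ^ 2) ^ (1 / 2 : ℝ) = 2 ^ (2 ^ n) * Q := by
        rw [pow_succ 2 n, pow_mul, ← mul_pow, ← ENNReal.rpow_natCast, ← ENNReal.rpow_mul]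
        norm_num
      rw [h3] at h2
      convert h2 using 1
      ring
  have h0 := curveBound_trivial β e l c S hp
  have hfin : (S.card : ℝ≥0∞) * curveMeasure univ ^ p ≠ ⊤ :=
    ENNReal.mul_ne_top (by simp) (ENNReal.rpow_ne_top_of_nonneg (by linarith) (measure_ne_top _ _))
  obtain ⟨n, hn⟩ := ENNReal.exists_nat_gt hfin
  refine hind n (h0.mono ?_)
  calc _ ≤ (n : ℝ≥0∞) := hn.le
    _ ≤ ((2 ^ (2 ^ n) : ℕ) : ℝ≥0∞) := by
        gcongr
        exact (Nat.lt_two_pow_self.trans Nat.lt_two_pow_self).le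
    _ ≤ 2 ^ (2 ^ n) * Q ^ 2 := by
        push_cast
        exact le_mul_of_one_le_right zero_le (one_le_pow₀ hQ)

/-- The square function of averages over thickened curves, applied to Littlewood–Paley
differences, is bounded on `L^p` with explicit dependence on `p` and `l`. -/
theorem curveAvg_square {β : ℝ} (hβ : 1 ≤ β) {c₀ c₁ : ℝ} (hc₀ : 0 < c₀) :
    ∃ D : ℝ≥0, ∀ (e : ℝ), |e| = 1 → ∀ (l : ℕ), 1 ≤ l → ∀ c : ℤ × ℤ → ℝ,
      (∀ α, c₀ ≤ |c α|) → (∀ α, |c α| ≤ c₁) → ∀ p : ℝ, 1 < p → p ≤ 2 →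
      ∀ (S : Finset (ℤ × ℤ)) (m : ℤ) (f : ℝ × ℝ → ℝ), Measurable f → (∃ K, ∀ x, ‖f x‖ ≤ K) →
      ∫⁻ x, (∑ α ∈ S, curveAvg β e l (c α) α.1 α.2
          (fun y => ‖dDiff2 (α.1 + m) (α.2 + m) f y‖ₑ) x ^ 2) ^ (p / 2)
        ≤ D * ((l : ℝ≥0∞) ^ 4) ^ (p / 2) * ENNReal.ofReal (2048 / (p - 1)) ^ 4
          * ∫⁻ x, ‖f x‖ₑ ^ p := by
  obtain ⟨K, hK⟩ := exists_curveAvg_boxAvg hβ (c₁ := c₁) hc₀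
  set N : ℝ≥0∞ := curveMeasure univ with hN
  have hNtop : N ≠ ⊤ := measure_ne_top _ _
  set D₀ : ℝ≥0∞ := 81 ^ 2 * 4 * ((1 + N) ^ 4 + 2 * (1 + K) ^ 2) with hD₀
  have hD₀top : D₀ ≠ ⊤ := by
    refine ENNReal.mul_ne_top (by norm_num) (ENNReal.add_ne_top.2 ⟨?_, ?_⟩)
    · exact ENNReal.pow_ne_top (ENNReal.add_ne_top.2 ⟨by simp, hNtop⟩)
    · exact ENNReal.mul_ne_top (by norm_num)
        (ENNReal.pow_ne_top (ENNReal.add_ne_top.2 ⟨by simp, by simp⟩))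
  have hD₀1 : 1 ≤ D₀ := by
    calc (1 : ℝ≥0∞) = 1 * 1 := (one_mul 1).symm
      _ ≤ D₀ := mul_le_mul' (by norm_num) ((one_le_pow₀ le_self_add).trans le_self_add)
  have hDtop : (1 + N) ^ 4 * (2 * D₀) ≠ ⊤ :=
    ENNReal.mul_ne_top (ENNReal.pow_ne_top (ENNReal.add_ne_top.2 ⟨by simp, hNtop⟩))
      (ENNReal.mul_ne_top (by norm_num) hD₀top)
  refine ⟨((1 + N) ^ 4 * (2 * D₀)).toNNReal, fun e he l hl c hc hc1 p hp hp2 S m f hf hfb => ?_⟩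
  rw [ENNReal.coe_toNNReal hDtop]
  obtain ⟨M, hM⟩ := hfb
  have hp0 : 0 < p := by linarith
  set P : ℝ≥0∞ := ENNReal.ofReal (2048 / (p - 1)) with hP
  set L : ℝ≥0∞ := ((l : ℝ≥0∞) ^ 4) ^ (p / 2) with hL
  have hL1 : 1 ≤ L := by
    refine ENNReal.one_le_rpow ?_ (by positivity)
    exact_mod_cast Nat.one_le_pow _ _ hl
  have hP1 : 1 ≤ P := by
    rw [hP, ENNReal.one_le_ofReal, le_div_iff₀ (by linarith)]
    linarith
  have hQ : 1 ≤ D₀ * L * P ^ 2 := by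
    calc (1 : ℝ≥0∞) = 1 * 1 * 1 := by simp
      _ ≤ _ := by
        gcongr
        exact one_le_pow₀ hP1
  have hbound : CurveBound β e l c S p (2 * (D₀ * L * P ^ 2) ^ 2) :=
    curveBound_of_step hp.le hQ fun B hB1 hB => curveBound_step hl hp hp2
      (fun α h hh x => hK e he l (c α) (hc α) (hc1 α) α.1 α.2 h hh x) hB1 hB
  have hm := fun α : ℤ × ℤ => measurable_curvePt β e l (c α) α.1 α.2
  have hv := avgOp_vector S hm hp hp2 hbound (h := fun α y => ‖dDiff2 (α.1 + m) (α.2 + m) f y‖ₑ)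
    (fun α => (measurable_dDiff2 hf _ _).enorm) ⟨(2 * (2 * M)).toNNReal, fun α x => by
      rw [enorm_le_coe, ← NNReal.coe_le_coe, coe_nnnorm]
      exact (norm_dDiff_le (fun s => norm_dDiff_le (fun t => hM _) _ _) _ _).trans
        (Real.le_coe_toNNReal _)⟩
  refine hv.trans ?_
  calc _ ≤ (1 + N) ^ 4 * (2 * (D₀ * L * P ^ 2)) * (P ^ 2 * ∫⁻ x, ‖f x‖ₑ ^ p) := by
        gcongr ?_ * ?_ * ?_
        · calc (N ^ p) ^ (p / 2) ≤ ((1 + N) ^ 2) ^ (p / 2) := by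
                gcongr
                exact rpow_le_one_add_sq _ hp0.le hp2
            _ ≤ ((1 + N) ^ 2) ^ (2:ℝ) :=
                ENNReal.rpow_le_rpow_of_exponent_le (one_le_pow₀ le_self_add) (by linarith)
            _ = _ := by
                rw [← ENNReal.rpow_natCast, ← ENNReal.rpow_natCast, ← ENNReal.rpow_mul]; norm_num
        · calc (2 * (D₀ * L * P ^ 2) ^ 2) ^ (1 - p / 2)
              ≤ ((2 * (D₀ * L * P ^ 2)) ^ 2) ^ (1 - p / 2) := by
                refine ENNReal.rpow_le_rpow ?_ (by linarith)
                rw [mul_pow 2]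
                exact mul_le_mul' (by norm_num) le_rfl
            _ ≤ ((2 * (D₀ * L * P ^ 2)) ^ 2) ^ (1 / 2 : ℝ) := by
                refine ENNReal.rpow_le_rpow_of_exponent_le (one_le_pow₀ ?_) (by linarith)
                exact hQ.trans (le_mul_of_one_le_left zero_le (by norm_num))
            _ = _ := by rw [← ENNReal.rpow_natCast, ← ENNReal.rpow_mul]; norm_num
        · exact dDiff2_shift_square hf hM hp hp2 S m
    _ = _ := by ring

/-! ### Fourier transforms on the plane -/

lemma norm_FT_le (g : ℝ × ℝ → ℂ) (ξ : ℝ × ℝ) : ‖FT g ξ‖ ≤ ∫ x, ‖g x‖ := by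
  refine (norm_integral_le_integral_norm _).trans (le_of_eq ?_)
  simp only [norm_mul, Complex.norm_exp_ofReal_mul_I, one_mul]

lemma norm_FTinv_le (g : ℝ × ℝ → ℂ) (ξ : ℝ × ℝ) : ‖FTinv g ξ‖ ≤ ∫ x, ‖g x‖ := by
  refine (norm_integral_le_integral_norm _).trans (le_of_eq ?_)
  simp only [norm_mul, Complex.norm_exp_ofReal_mul_I, one_mul]

lemma integrable_expI_mul {α : Type*} [MeasurableSpace α] {μ : Measure α} {g : α → ℂ}
    (hg : Integrable g μ) {θ : α → ℝ} (hθ : Measurable θ) :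
    Integrable (fun x => Complex.exp (((θ x : ℝ) : ℂ) * Complex.I) * g x) μ := by
  refine hg.bdd_mul (c := 1) (by fun_prop) (ae_of_all _ fun x => ?_)
  rw [Complex.norm_exp_ofReal_mul_I]

lemma continuous_FT {g : ℝ × ℝ → ℂ} (hg : Integrable g) : Continuous (FT g) := by
  refine continuous_of_dominated (bound := fun x => ‖g x‖) (fun ξ => ?_) (fun ξ => ?_) hg.norm ?_
  · exact (integrable_expI_mul hg (by fun_prop)).aestronglyMeasurable
  · exact ae_of_all _ fun x => by simp only [norm_mul, Complex.norm_exp_ofReal_mul_I, one_mul]; rfl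
  · exact ae_of_all _ fun x => by fun_prop

lemma FTinv_eq_FT_neg (g : ℝ × ℝ → ℂ) (x : ℝ × ℝ) : FTinv g x = FT g (-x) := by
  unfold FTinv FT
  congr 1; ext ξ; congr 4
  simp only [Prod.fst_neg, Prod.snd_neg]
  ring

lemma continuous_FTinv {g : ℝ × ℝ → ℂ} (hg : Integrable g) : Continuous (FTinv g) := by
  simp_rw [funext (FTinv_eq_FT_neg g)]
  exact (continuous_FT hg).comp continuous_neg

lemma FTinv_mul_FT {H g : ℝ × ℝ → ℂ} (hH : Integrable H) (hg : Integrable g) (x : ℝ × ℝ) :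
    FTinv (fun ξ => H ξ * FT g ξ) x = ∫ y, g y * FTinv H (x - y) := by
  have hint : Integrable (fun q : (ℝ × ℝ) × (ℝ × ℝ) =>
      Complex.exp (((2 * Real.pi * ((x.1 - q.2.1) * q.1.1 + (x.2 - q.2.2) * q.1.2) : ℝ) : ℂ)
        * Complex.I) * (H q.1 * g q.2)) (volume.prod volume) :=
    integrable_expI_mul (hH.mul_prod hg) (by fun_prop)
  calc FTinv (fun ξ => H ξ * FT g ξ) x
      = ∫ ξ : ℝ × ℝ, ∫ y : ℝ × ℝ,
        Complex.exp (((2 * Real.pi * ((x.1 - y.1) * ξ.1 + (x.2 - y.2) * ξ.2) : ℝ) : ℂ)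
        * Complex.I) * (H ξ * g y) := by
        unfold FTinv FT
        refine integral_congr_ae (ae_of_all _ fun ξ => ?_)
        beta_reduce
        rw [← mul_assoc, ← integral_const_mul]
        refine integral_congr_ae (ae_of_all _ fun y => ?_)
        beta_reduce
        rw [show 2 * Real.pi * ((x.1 - y.1) * ξ.1 + (x.2 - y.2) * ξ.2)
          = 2 * Real.pi * (x.1 * ξ.1 + x.2 * ξ.2) + -(2 * Real.pi * (y.1 * ξ.1 + y.2 * ξ.2)) by
            ring, Complex.ofReal_add, add_mul, Complex.exp_add]
        ring
    _ = _ := by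
        rw [integral_integral_swap hint]
        refine integral_congr_ae (ae_of_all _ fun y => ?_)
        beta_reduce
        unfold FTinv
        rw [← integral_const_mul]
        refine integral_congr_ae (ae_of_all _ fun ξ => ?_)
        beta_reduce
        rw [Prod.fst_sub, Prod.snd_sub]
        ring

/-- Averages over the segment from `x` to `x + v`. -/
def segAvg (v : ℝ × ℝ) (f : ℝ × ℝ → ℝ) (x : ℝ × ℝ) : ℝ := ∫ t in (0:ℝ)..1, f (x + t • v)

lemma integrable_translates {f : ℝ × ℝ → ℝ} (hf : Measurable f) (hfi : Integrable f)
    (v : ℝ × ℝ) : Integrable (fun q : (ℝ × ℝ) × ℝ => f (q.1 + q.2 • v))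
      (volume.prod (volume.restrict (Ioc (0:ℝ) 1))) := by
  have hm : Measurable (fun q : (ℝ × ℝ) × ℝ => f (q.1 + q.2 • v)) := by fun_prop
  rw [integrable_prod_iff' hm.aestronglyMeasurable]
  refine ⟨ae_of_all _ fun t => hfi.comp_add_right (t • v), ?_⟩
  simp_rw [fun t : ℝ => integral_add_right_eq_self (μ := volume) (fun x => ‖f x‖) (t • v)]
  exact integrable_const _

lemma integrable_segAvg {f : ℝ × ℝ → ℝ} (hf : Measurable f) (hfi : Integrable f) (v : ℝ × ℝ) :
    Integrable (segAvg v f) := by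
  have := (integrable_translates hf hfi v).integral_prod_left
  unfold segAvg
  simpa only [intervalIntegral.integral_of_le zero_le_one] using this

/-- The multiplier of the average over a segment. -/
def segMul (θ : ℝ) : ℂ :=
  ∫ t in (0:ℝ)..1, Complex.exp (((2 * Real.pi * (t * θ) : ℝ) : ℂ) * Complex.I)

lemma FT_segAvg {f : ℝ × ℝ → ℝ} (hf : Measurable f) (hfi : Integrable f) (v ξ : ℝ × ℝ) :
    FT (fun x => ((segAvg v f x : ℝ) : ℂ)) ξ
      = segMul (v.1 * ξ.1 + v.2 * ξ.2) * FT (fun x => ((f x : ℝ) : ℂ)) ξ := by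
  have hint := integrable_expI_mul (integrable_translates hf hfi v).ofReal
    (θ := fun q => -(2 * Real.pi * (q.1.1 * ξ.1 + q.1.2 * ξ.2))) (by fun_prop)
  unfold FT segAvg segMul
  simp only [intervalIntegral.integral_of_le zero_le_one]
  calc _ = ∫ x : ℝ × ℝ, ∫ t in Ioc (0:ℝ) 1,
        Complex.exp (((-(2 * Real.pi * (x.1 * ξ.1 + x.2 * ξ.2)) : ℝ) : ℂ) * Complex.I)
          * ((f (x + t • v) : ℝ) : ℂ) := by
        refine integral_congr_ae (ae_of_all _ fun x => ?_)
        beta_reduce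
        rw [← integral_complex_ofReal, ← integral_const_mul]
    _ = ∫ t in Ioc (0:ℝ) 1, ∫ x : ℝ × ℝ,
        Complex.exp (((-(2 * Real.pi * (x.1 * ξ.1 + x.2 * ξ.2)) : ℝ) : ℂ) * Complex.I)
          * ((f (x + t • v) : ℝ) : ℂ) := integral_integral_swap hint
    _ = _ := by
        rw [← integral_mul_const]
        refine integral_congr_ae (ae_of_all _ fun t => ?_)
        beta_reduce
        rw [← integral_const_mul]
        refine Eq.trans ?_ (integral_add_right_eq_self _ (t • v))
        refine integral_congr_ae (ae_of_all _ fun x => ?_)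
        beta_reduce
        rw [← mul_assoc, ← Complex.exp_add, ← add_mul, ← Complex.ofReal_add]
        congr 5
        simp only [Prod.fst_add, Prod.snd_add, Prod.smul_fst, Prod.smul_snd, smul_eq_mul]
        ring

/-- The multiplier of the dyadic difference. -/
def diffMul (θ : ℝ) : ℂ := segMul (θ / 2) - segMul θ

lemma segMul_mul (θ : ℝ) : segMul θ * (2 * Real.pi * θ * Complex.I)
    = Complex.exp (2 * Real.pi * θ * Complex.I) - 1 := by
  unfold segMul
  rw [← intervalIntegral.integral_mul_const]
  have h : ∀ t ∈ uIcc (0:ℝ) 1, HasDerivAt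
      (fun t : ℝ => Complex.exp (((2 * Real.pi * (t * θ) : ℝ) : ℂ) * Complex.I))
      (Complex.exp (((2 * Real.pi * (t * θ) : ℝ) : ℂ) * Complex.I)
        * (2 * Real.pi * θ * Complex.I)) t := by
    intro t _
    have h1 : HasDerivAt (fun t : ℝ => 2 * Real.pi * (t * θ)) (2 * Real.pi * (1 * θ)) t :=
      ((hasDerivAt_id t).mul_const θ).const_mul _
    have h2 := (h1.ofReal_comp.mul_const Complex.I).cexp
    convert h2 using 2
    push_cast
    ring
  rw [intervalIntegral.integral_eq_sub_of_hasDerivAt h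
    (Continuous.intervalIntegrable (by fun_prop) _ _)]
  simp

lemma diffMul_mul (θ : ℝ) : diffMul θ * (2 * Real.pi * θ * Complex.I)
    = -(Complex.exp (Real.pi * θ * Complex.I) - 1) ^ 2 := by
  have h1 := segMul_mul (θ / 2)
  have h2 := segMul_mul θ
  have h3 : Complex.exp (2 * Real.pi * θ * Complex.I)
      = Complex.exp (Real.pi * θ * Complex.I) ^ 2 := by
    rw [← Complex.exp_nat_mul]; congr 1; push_cast; ring
  rw [show (2:ℂ) * Real.pi * ((θ / 2 : ℝ) : ℂ) * Complex.I = Real.pi * θ * Complex.I by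
    push_cast; ring] at h1
  unfold diffMul
  linear_combination 2 * h1 - h2 - h3

lemma expI_ne_one {θ : ℝ} (h0 : θ ≠ 0) (h2 : |θ| < 2) :
    Complex.exp (Real.pi * θ * Complex.I) - 1 ≠ 0 := by
  rw [sub_ne_zero, Ne, Complex.exp_eq_one_iff]
  rintro ⟨n, hn⟩
  have h : θ = 2 * n := by
    have hpi : (Real.pi : ℂ) * Complex.I ≠ 0 := by simp [Real.pi_ne_zero, Complex.I_ne_zero]
    have : (θ : ℂ) = 2 * n := by
      apply mul_right_cancel₀ hpi
      linear_combination hn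
    exact_mod_cast this
  rw [h, abs_mul, abs_two] at h2
  have h3 : |(n : ℝ)| < 1 := by linarith
  have h4 : n = 0 := by
    rw [← Int.abs_lt_one_iff]; exact_mod_cast h3
  simp [h, h4] at h0

lemma dDiff_eq_segAvg_fst (j : ℤ) (f : ℝ × ℝ → ℝ) (x : ℝ × ℝ) :
    dDiff j (fun s => f (s, x.2)) x.1
      = segAvg ((2:ℝ) ^ (-(j + 1)), 0) f x - segAvg ((2:ℝ) ^ (-j), 0) f x := by
  unfold dDiff dAvg segAvg
  congr! 5 <;> simp [mul_comm]

lemma dDiff_eq_segAvg_snd (j : ℤ) (f : ℝ × ℝ → ℝ) (x : ℝ × ℝ) :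
    dDiff j (fun s => f (x.1, s)) x.2
      = segAvg (0, (2:ℝ) ^ (-(j + 1))) f x - segAvg (0, (2:ℝ) ^ (-j)) f x := by
  unfold dDiff dAvg segAvg
  congr! 5 <;> simp [mul_comm]

lemma measurable_segAvg {f : ℝ × ℝ → ℝ} (hf : Measurable f) (v : ℝ × ℝ) :
    Measurable (segAvg v f) := by
  unfold segAvg
  simp only [intervalIntegral.integral_of_le zero_le_one]
  exact (StronglyMeasurable.integral_prod_right' (f := fun q : (ℝ × ℝ) × ℝ => f (q.1 + q.2 • v))
    (by fun_prop : Measurable _).stronglyMeasurable).measurable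

lemma FT_sub {f g : ℝ × ℝ → ℝ} (hf : Integrable f) (hg : Integrable g) (ξ : ℝ × ℝ) :
    FT (fun x => ((f x - g x : ℝ) : ℂ)) ξ
      = FT (fun x => ((f x : ℝ) : ℂ)) ξ - FT (fun x => ((g x : ℝ) : ℂ)) ξ := by
  refine Eq.trans ?_ (integral_sub (integrable_expI_mul hf.ofReal (by fun_prop))
    (integrable_expI_mul hg.ofReal (by fun_prop)))
  unfold FT
  congr 1; ext x; push_cast; ring

lemma two_zpow_half (j : ℤ) (t : ℝ) : (2:ℝ) ^ (-(j + 1)) * t = (2:ℝ) ^ (-j) * t / 2 := by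
  rw [show -(j + 1) = -j - 1 by ring, zpow_sub_one₀ (by norm_num)]; ring

lemma FT_dDiff2 {f : ℝ × ℝ → ℝ} (hf : Measurable f) (hfi : Integrable f) (j k : ℤ) :
    Integrable (dDiff2 j k f) ∧ ∀ ξ : ℝ × ℝ, FT (fun x => ((dDiff2 j k f x : ℝ) : ℂ)) ξ
      = diffMul ((2:ℝ) ^ (-j) * ξ.1) * diffMul ((2:ℝ) ^ (-k) * ξ.2)
        * FT (fun x => ((f x : ℝ) : ℂ)) ξ := by
  set g : ℝ × ℝ → ℝ := fun x => segAvg (0, (2:ℝ) ^ (-(k + 1))) f x - segAvg (0, (2:ℝ) ^ (-k)) f x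
    with hg
  have hgm : Measurable g := (measurable_segAvg hf _).sub (measurable_segAvg hf _)
  have hgi : Integrable g := (integrable_segAvg hf hfi _).sub (integrable_segAvg hf hfi _)
  have h2 : dDiff2 j k f = fun x => segAvg ((2:ℝ) ^ (-(j + 1)), 0) g x
      - segAvg ((2:ℝ) ^ (-j), 0) g x := by
    ext x
    rw [← dDiff_eq_segAvg_fst, dDiff2]
    congr 1; ext s
    exact dDiff_eq_segAvg_snd k f (s, x.2)
  rw [h2]
  refine ⟨(integrable_segAvg hgm hgi _).sub (integrable_segAvg hgm hgi _), fun ξ => ?_⟩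
  rw [FT_sub (integrable_segAvg hgm hgi _) (integrable_segAvg hgm hgi _),
    FT_segAvg hgm hgi, FT_segAvg hgm hgi, hg,
    FT_sub (integrable_segAvg hf hfi _) (integrable_segAvg hf hfi _),
    FT_segAvg hf hfi, FT_segAvg hf hfi]
  simp only [zero_mul, zero_add, add_zero, diffMul, two_zpow_half]
  ring

/-! ### Kernel bounds for smooth compactly supported symbols with a parameter -/

/-- Smooth functions of `(ρ, η)` which vanish for `η` outside a fixed square. -/
def PlaneSymbol (R : ℝ) (G : ℝ × ℝ × ℝ → ℂ) : Prop :=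
  ContDiff ℝ ((⊤ : ℕ∞) : WithTop ℕ∞) G ∧ ∀ z, (R < |z.2.1| ∨ R < |z.2.2|) → G z = 0

lemma PlaneSymbol.fderiv_apply {R : ℝ} {G : ℝ × ℝ × ℝ → ℂ} (hG : PlaneSymbol R G)
    (v : ℝ × ℝ) : PlaneSymbol R fun z => fderiv ℝ G z (0, v) := by
  refine ⟨(hG.1.fderiv_right (by norm_cast)).clm_apply contDiff_const, fun z hz => ?_⟩
  have hopen : IsOpen ({z : ℝ × ℝ × ℝ | R < |z.2.1|} ∪ {z : ℝ × ℝ × ℝ | R < |z.2.2|}) :=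
    (isOpen_lt continuous_const (by fun_prop)).union (isOpen_lt continuous_const (by fun_prop))
  have h : G =ᶠ[𝓝 z] fun _ => 0 := by
    filter_upwards [hopen.mem_nhds hz] with y hy using hG.2 y hy
  change fderiv ℝ G z (0, v) = 0
  rw [h.fderiv_eq]
  simp

lemma PlaneSymbol.hasCompactSupport {R : ℝ} {G : ℝ × ℝ × ℝ → ℂ} (hG : PlaneSymbol R G)
    (ρ : ℝ) : HasCompactSupport fun η : ℝ × ℝ => G (ρ, η) := by
  refine HasCompactSupport.intro (K := Icc (-R) R ×ˢ Icc (-R) R)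
    (isCompact_Icc.prod isCompact_Icc) fun η hη => hG.2 _ ?_
  rw [mem_prod, not_and_or] at hη
  simpa [← abs_le] using hη

lemma PlaneSymbol.continuous_slice {R : ℝ} {G : ℝ × ℝ × ℝ → ℂ} (hG : PlaneSymbol R G)
    (ρ : ℝ) : Continuous fun η : ℝ × ℝ => G (ρ, η) := by
  have := hG.1.continuous
  fun_prop

lemma PlaneSymbol.integrable {R : ℝ} {G : ℝ × ℝ × ℝ → ℂ} (hG : PlaneSymbol R G)
    (ρ : ℝ) : Integrable fun η : ℝ × ℝ => G (ρ, η) :=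
  (hG.continuous_slice ρ).integrable_of_hasCompactSupport (hG.hasCompactSupport ρ)

lemma differentiable_expI (x : ℝ × ℝ) : Differentiable ℝ (fun η : ℝ × ℝ =>
      Complex.exp (((2 * Real.pi * (x.1 * η.1 + x.2 * η.2) : ℝ) : ℂ) * Complex.I)) := by
  intro η
  have h0 : DifferentiableAt ℝ (fun η : ℝ × ℝ => 2 * Real.pi * (x.1 * η.1 + x.2 * η.2)) η := by
    fun_prop
  have h1 : DifferentiableAt ℝ
      (fun η : ℝ × ℝ => ((2 * Real.pi * (x.1 * η.1 + x.2 * η.2) : ℝ) : ℂ)) η :=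
    Complex.ofRealCLM.differentiableAt.comp η h0
  exact (h1.mul_const _).cexp

lemma fderiv_expI_apply (x η v : ℝ × ℝ) :
    fderiv ℝ (fun η : ℝ × ℝ =>
      Complex.exp (((2 * Real.pi * (x.1 * η.1 + x.2 * η.2) : ℝ) : ℂ) * Complex.I)) η v
      = (2 * Real.pi * (x.1 * v.1 + x.2 * v.2) : ℝ) * Complex.I
        * Complex.exp (((2 * Real.pi * (x.1 * η.1 + x.2 * η.2) : ℝ) : ℂ) * Complex.I) := by
  rw [← (differentiable_expI x η).lineDeriv_eq_fderiv, lineDeriv]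
  have h1 : HasDerivAt (fun t : ℝ => 2 * Real.pi * (x.1 * (η.1 + t * v.1) + x.2 * (η.2 + t * v.2)))
      (2 * Real.pi * (x.1 * (1 * v.1) + x.2 * (1 * v.2))) 0 :=
    ((((((hasDerivAt_id (0:ℝ)).mul_const v.1).const_add η.1).const_mul x.1).add
      ((((hasDerivAt_id (0:ℝ)).mul_const v.2).const_add η.2).const_mul x.2)).const_mul _)
  have h2 := (h1.ofReal_comp.mul_const Complex.I).cexp
  simp only [zero_mul, add_zero, one_mul] at h2
  exact h2.deriv.trans (mul_comm _ _)

lemma PlaneSymbol.FTinv_fderiv {R : ℝ} {G : ℝ × ℝ × ℝ → ℂ} (hG : PlaneSymbol R G)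
    (v : ℝ × ℝ) (ρ : ℝ) (x : ℝ × ℝ) :
    FTinv (fun η => fderiv ℝ G (ρ, η) (0, v)) x
      = -((2 * Real.pi * (x.1 * v.1 + x.2 * v.2) : ℝ) * Complex.I
        * FTinv (fun η => G (ρ, η)) x) := by
  have hGd : Differentiable ℝ G := hG.1.differentiable (by norm_cast)
  have hslice : ∀ η, HasFDerivAt (fun η : ℝ × ℝ => G (ρ, η))
      ((fderiv ℝ G (ρ, η)).comp (ContinuousLinearMap.inr ℝ ℝ (ℝ × ℝ))) η := fun η =>
    (hGd (ρ, η)).hasFDerivAt.comp η (hasFDerivAt_prodMk_right ρ η)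
  have hs2 : ∀ η, fderiv ℝ (fun η : ℝ × ℝ => G (ρ, η)) η v = fderiv ℝ G (ρ, η) (0, v) := by
    intro η; rw [(hslice η).fderiv]; simp
  have key := integral_mul_fderiv_eq_neg_fderiv_mul_of_integrable (μ := (volume : Measure (ℝ × ℝ)))
    (f := fun η : ℝ × ℝ =>
      Complex.exp (((2 * Real.pi * (x.1 * η.1 + x.2 * η.2) : ℝ) : ℂ) * Complex.I))
    (g := fun η => G (ρ, η)) (v := v) ?_ ?_ ?_ ?_ ?_
  · unfold FTinv
    simp_rw [hs2, fderiv_expI_apply] at key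
    rw [key, ← integral_const_mul]
    simp only [mul_assoc]
  · simp_rw [fderiv_expI_apply, mul_assoc]
    exact ((integrable_expI_mul (hG.integrable ρ) (by fun_prop)).const_mul _).const_mul _
  · simp_rw [hs2]
    exact integrable_expI_mul ((hG.fderiv_apply v).integrable ρ) (by fun_prop)
  · exact integrable_expI_mul (hG.integrable ρ) (by fun_prop)
  · exact fun η _ => differentiable_expI x η
  · exact fun η _ => (hslice η).differentiableAt

lemma PlaneSymbol.exists_moment_bound {R : ℝ} (r₁ r₂ : ℝ) (a b : ℕ) :
    ∀ {G : ℝ × ℝ × ℝ → ℂ}, PlaneSymbol R G →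
    ∃ C : ℝ, ∀ ρ ∈ Icc r₁ r₂, ∀ x : ℝ × ℝ,
      |x.1| ^ a * |x.2| ^ b * ‖FTinv (fun η => G (ρ, η)) x‖ ≤ C := by
  have hpi : 1 ≤ 2 * Real.pi := by linarith [Real.pi_gt_three]
  induction a with
  | zero =>
    induction b with
    | zero =>
      intro G hG
      obtain ⟨B, hB⟩ := ((isCompact_Icc (a := r₁) (b := r₂)).prod
        ((isCompact_Icc (a := -R) (b := R)).prod
          (isCompact_Icc (a := -R) (b := R)))).exists_bound_of_continuousOn hG.1.continuous.continuousOn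
      refine ⟨max B 0 * volume.real (Icc (-R) R ×ˢ Icc (-R) R), fun ρ hρ x => ?_⟩
      have hz : ∀ η ∉ Icc (-R) R ×ˢ Icc (-R) R,
        (fun η : ℝ × ℝ => ‖G (ρ, η)‖) η = 0 := by
        intro η hη
        rw [mem_prod, not_and_or] at hη
        simp only [norm_eq_zero]
        exact hG.2 _ (by simpa [← abs_le] using hη)
      calc _ = ‖FTinv (fun η => G (ρ, η)) x‖ := by simp
        _ ≤ ∫ η, ‖G (ρ, η)‖ := norm_FTinv_le _ _
        _ = ∫ η in Icc (-R) R ×ˢ Icc (-R) R, ‖G (ρ, η)‖ :=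
            (setIntegral_eq_integral_of_forall_compl_eq_zero hz).symm
        _ ≤ ‖∫ η in Icc (-R) R ×ˢ Icc (-R) R, ‖G (ρ, η)‖‖ := le_abs_self _
        _ ≤ _ := by
            refine norm_setIntegral_le_of_norm_le_const
              (isCompact_Icc.prod isCompact_Icc).measure_lt_top fun η hη => ?_
            rw [norm_norm]
            exact (hB (ρ, η) ⟨hρ, hη⟩).trans (le_max_left _ _)
    | succ b ih =>
      intro G hG
      obtain ⟨C, hC⟩ := ih (hG.fderiv_apply (0, 1))
      refine ⟨C, fun ρ hρ x => le_trans ?_ (hC ρ hρ x)⟩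
      rw [hG.FTinv_fderiv]
      simp only [norm_neg, norm_mul, Complex.norm_I, Complex.norm_real, Real.norm_eq_abs,
        mul_zero, mul_one, zero_add, abs_two, abs_of_pos Real.pi_pos, pow_succ]
      have : 0 ≤ |x.1| ^ 0 * |x.2| ^ b * |x.2| * ‖FTinv (fun η => G (ρ, η)) x‖ := by positivity
      nlinarith
  | succ a ih =>
    intro G hG
    obtain ⟨C, hC⟩ := ih (hG.fderiv_apply (1, 0))
    refine ⟨C, fun ρ hρ x => le_trans ?_ (hC ρ hρ x)⟩
    rw [hG.FTinv_fderiv]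
    simp only [norm_neg, norm_mul, Complex.norm_I, Complex.norm_real, Real.norm_eq_abs,
      mul_zero, mul_one, add_zero, abs_two, abs_of_pos Real.pi_pos, pow_succ]
    have : 0 ≤ |x.1| ^ a * |x.1| * |x.2| ^ b * ‖FTinv (fun η => G (ρ, η)) x‖ := by positivity
    nlinarith

lemma PlaneSymbol.exists_kernel_bound {R : ℝ} {G : ℝ × ℝ × ℝ → ℂ} (hG : PlaneSymbol R G)
    (r₁ r₂ : ℝ) : ∃ C : ℝ, 0 ≤ C ∧ ∀ ρ ∈ Icc r₁ r₂, ∀ x : ℝ × ℝ,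
      ‖FTinv (fun η => G (ρ, η)) x‖ ≤ C * (((1 + x.1 ^ 2) ^ 2)⁻¹ * ((1 + x.2 ^ 2) ^ 2)⁻¹) := by
  obtain ⟨C₀, h₀⟩ := PlaneSymbol.exists_moment_bound r₁ r₂ 0 0 hG
  obtain ⟨C₁, h₁⟩ := PlaneSymbol.exists_moment_bound r₁ r₂ 0 4 hG
  obtain ⟨C₂, h₂⟩ := PlaneSymbol.exists_moment_bound r₁ r₂ 4 0 hG
  obtain ⟨C₃, h₃⟩ := PlaneSymbol.exists_moment_bound r₁ r₂ 4 4 hG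
  refine ⟨|4 * (C₀ + C₁ + C₂ + C₃)|, abs_nonneg _, fun ρ hρ x => ?_⟩
  set F := ‖FTinv (fun η => G (ρ, η)) x‖ with hF
  have hF0 : 0 ≤ F := norm_nonneg _
  have e₀ := h₀ ρ hρ x
  have e₁ := h₁ ρ hρ x
  have e₂ := h₂ ρ hρ x
  have e₃ := h₃ ρ hρ x
  rw [← hF] at e₀ e₁ e₂ e₃
  have h4 : ∀ y : ℝ, |y| ^ 4 = y ^ 4 := fun y => by
    rw [← abs_pow, abs_of_nonneg (by positivity)]
  simp only [h4, pow_zero, one_mul, mul_one] at e₀ e₁ e₂ e₃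
  have hx : ∀ y : ℝ, (1 + y ^ 2) ^ 2 ≤ 2 * (1 + y ^ 4) := fun y => by
    nlinarith [sq_nonneg (y ^ 2 - 1)]
  rw [← mul_inv, ← div_eq_mul_inv, le_div_iff₀ (by positivity)]
  calc F * ((1 + x.1 ^ 2) ^ 2 * (1 + x.2 ^ 2) ^ 2)
      ≤ F * ((2 * (1 + x.1 ^ 4)) * (2 * (1 + x.2 ^ 4))) := by
        gcongr
        · exact hx _
        · exact hx _
    _ = 4 * (F + x.2 ^ 4 * F + x.1 ^ 4 * F + x.1 ^ 4 * x.2 ^ 4 * F) := by ring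
    _ ≤ 4 * (C₀ + C₁ + C₂ + C₃) := by linarith
    _ ≤ _ := le_abs_self _

/-! ### Multipliers along curves -/

lemma measurableEmbedding_dil {a b : ℝ} (ha : a ≠ 0) (hb : b ≠ 0) :
    MeasurableEmbedding fun ξ : ℝ × ℝ => (a * ξ.1, b * ξ.2) :=
  ((MeasurableEquiv.mulLeft₀ a ha).prodCongr (MeasurableEquiv.mulLeft₀ b hb)).measurableEmbedding

lemma map_dil_volume {a b : ℝ} (ha : a ≠ 0) (hb : b ≠ 0) :
    Measure.map (fun ξ : ℝ × ℝ => (a * ξ.1, b * ξ.2)) volume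
      = ENNReal.ofReal (|a⁻¹| * |b⁻¹|) • (volume : Measure (ℝ × ℝ)) := by
  have h := Measure.map_prod_map (volume : Measure ℝ) (volume : Measure ℝ)
    (measurable_const_mul a) (measurable_const_mul b)
  rw [Real.map_volume_mul_left ha, Real.map_volume_mul_left hb, Measure.prod_smul_left,
    Measure.prod_smul_right, smul_smul, ← ENNReal.ofReal_mul (abs_nonneg _)] at h
  exact h.symm

lemma integral_dil {a b : ℝ} (ha : a ≠ 0) (hb : b ≠ 0) (F : ℝ × ℝ → ℂ) :
    ∫ ξ : ℝ × ℝ, F (a * ξ.1, b * ξ.2) = ((|a⁻¹| * |b⁻¹| : ℝ) : ℂ) * ∫ ξ, F ξ := by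
  rw [← (measurableEmbedding_dil ha hb).integral_map, map_dil_volume ha hb, integral_smul_measure,
    ENNReal.toReal_ofReal (by positivity), Complex.real_smul]

lemma integrable_dil {a b : ℝ} (ha : a ≠ 0) (hb : b ≠ 0) {F : ℝ × ℝ → ℂ} (hF : Integrable F) :
    Integrable fun ξ : ℝ × ℝ => F (a * ξ.1, b * ξ.2) := by
  have := (measurableEmbedding_dil ha hb).integrable_map_iff (μ := volume) (g := F)
  rw [map_dil_volume ha hb] at this
  exact this.1 (hF.smul_measure ENNReal.ofReal_ne_top)

lemma FTinv_dil {a b : ℝ} (ha : a ≠ 0) (hb : b ≠ 0) (G : ℝ × ℝ → ℂ) (z : ℝ × ℝ) :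
    FTinv (fun ξ => G (a * ξ.1, b * ξ.2)) z
      = ((|a⁻¹| * |b⁻¹| : ℝ) : ℂ) * FTinv G (z.1 / a, z.2 / b) := by
  unfold FTinv
  rw [← integral_dil ha hb]
  congr 1; ext ξ; congr 4
  field_simp

/-- The Fourier transform of the density `a` on the curve `(e t, c t^β)`. -/
def curveFT (β e c : ℝ) (a : ℝ → ℝ) (X : ℝ × ℝ) : ℂ :=
  ∫ t : ℝ, Complex.exp (((-(2 * Real.pi * (X.1 * (e * t) + X.2 * (c * t ^ β))) : ℝ) : ℂ)
    * Complex.I) * ((a t : ℝ) : ℂ)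

lemma norm_curveFT_le (β e c : ℝ) (a : ℝ → ℝ) (X : ℝ × ℝ) :
    ‖curveFT β e c a X‖ ≤ ∫ t, |a t| := by
  refine (norm_integral_le_integral_norm _).trans (le_of_eq ?_)
  simp only [norm_mul, Complex.norm_exp_ofReal_mul_I, one_mul, Complex.norm_real,
    Real.norm_eq_abs]

lemma continuous_curveFT (β e c : ℝ) {a : ℝ → ℝ} (ha : Integrable a) :
    Continuous (curveFT β e c a) := by
  refine continuous_of_dominated (bound := fun x => ‖a x‖) (fun ξ => ?_) (fun ξ => ?_) ha.norm ?_
  · exact (integrable_expI_mul ha.ofReal (by fun_prop)).aestronglyMeasurable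
  · refine ae_of_all _ fun x => ?_
    simp only [norm_mul, Complex.norm_exp_ofReal_mul_I, one_mul, Complex.norm_real]
    rfl
  · exact ae_of_all _ fun x => by fun_prop

lemma integrable_mul_curveFT (β e c r s : ℝ) {a : ℝ → ℝ} (ha : Integrable a) {G : ℝ × ℝ → ℂ}
    (hG : Integrable G) :
    Integrable fun ξ : ℝ × ℝ => G ξ * curveFT β e c a (r * ξ.1, s * ξ.2) := by
  have := continuous_curveFT β e c ha
  refine hG.mul_bdd (c := ∫ t, |a t|) (Continuous.aestronglyMeasurable (by fun_prop))
    (ae_of_all _ fun x => norm_curveFT_le _ _ _ _ _)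

lemma FTinv_mul_curveFT (β e c r s : ℝ) {a : ℝ → ℝ} (ha : Integrable a) {G : ℝ × ℝ → ℂ}
    (hG : Integrable G) (z : ℝ × ℝ) :
    FTinv (fun ξ => G ξ * curveFT β e c a (r * ξ.1, s * ξ.2)) z
      = ∫ t, (a t : ℂ) * FTinv G (z - (r * (e * t), s * (c * t ^ β))) := by
  have hint : Integrable (fun q : (ℝ × ℝ) × ℝ =>
      Complex.exp (((2 * Real.pi * ((z.1 - r * (e * q.2)) * q.1.1
        + (z.2 - s * (c * q.2 ^ β)) * q.1.2) : ℝ) : ℂ)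
        * Complex.I) * (G q.1 * ((a q.2 : ℝ) : ℂ))) (volume.prod volume) :=
    integrable_expI_mul (hG.mul_prod ha.ofReal) (by fun_prop)
  calc _ = ∫ ξ : ℝ × ℝ, ∫ t : ℝ,
        Complex.exp (((2 * Real.pi * ((z.1 - r * (e * t)) * ξ.1
        + (z.2 - s * (c * t ^ β)) * ξ.2) : ℝ) : ℂ) * Complex.I) * (G ξ * ((a t : ℝ) : ℂ)) := by
        unfold FTinv curveFT
        refine integral_congr_ae (ae_of_all _ fun ξ => ?_)
        beta_reduce
        rw [← mul_assoc, ← integral_const_mul]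
        refine integral_congr_ae (ae_of_all _ fun y => ?_)
        beta_reduce
        rw [show 2 * Real.pi * ((z.1 - r * (e * y)) * ξ.1 + (z.2 - s * (c * y ^ β)) * ξ.2)
          = 2 * Real.pi * (z.1 * ξ.1 + z.2 * ξ.2)
            + -(2 * Real.pi * (r * ξ.1 * (e * y) + s * ξ.2 * (c * y ^ β))) by
            ring, Complex.ofReal_add, add_mul, Complex.exp_add]
        ring
    _ = _ := by
        rw [integral_integral_swap hint]
        refine integral_congr_ae (ae_of_all _ fun y => ?_)
        beta_reduce
        unfold FTinv
        rw [← integral_const_mul]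
        refine integral_congr_ae (ae_of_all _ fun ξ => ?_)
        beta_reduce
        rw [Prod.fst_sub, Prod.snd_sub]
        ring

/-- The dilated multiplier `m(2^{-l} X) τ̂(X)` with `X = (2^{-j} ξ₁, 2^{-k} σ ξ₂)`. -/
def curveSymbol (m : ℝ × ℝ → ℂ) (a : ℝ → ℝ) (β e c : ℝ) (l : ℕ) (σ : ℝ) (j k : ℤ)
    (ξ : ℝ × ℝ) : ℂ :=
  m ((2:ℝ) ^ (-(j + l)) * ξ.1, (2:ℝ) ^ (-(k + l)) * σ * ξ.2)
    * curveFT β e c a ((2:ℝ) ^ (-j) * ξ.1, (2:ℝ) ^ (-k) * σ * ξ.2)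

/-- The operator with multiplier `curveSymbol`. -/
def curveOp (m : ℝ × ℝ → ℂ) (a : ℝ → ℝ) (β e c : ℝ) (l : ℕ) (σ : ℝ) (j k : ℤ)
    (f : ℝ × ℝ → ℝ) : ℝ × ℝ → ℂ :=
  FTinv fun ξ => curveSymbol m a β e c l σ j k ξ * FT (fun x => ((f x : ℝ) : ℂ)) ξ

lemma decay_neg (u : ℝ) : decay (-u) = decay u := by simp [decay]

lemma decay_div_le {σ K : ℝ} (hσ : 0 < σ) (hσK : σ ≤ K) (hK : 1 ≤ K) (v : ℝ) :
    decay (v / σ) ≤ ENNReal.ofReal (K ^ 4) * decay v := by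
  unfold decay
  rw [← ENNReal.ofReal_mul (by positivity)]
  apply ENNReal.ofReal_le_ofReal
  have h1 : 1 + v ^ 2 ≤ K ^ 2 * (1 + (v / σ) ^ 2) := by
    have h2 : v ^ 2 = σ ^ 2 * (v / σ) ^ 2 := by field_simp
    have h3 : σ ^ 2 ≤ K ^ 2 := by gcongr
    nlinarith [sq_nonneg (v / σ)]
  rw [inv_le_iff_one_le_mul₀ (by positivity), mul_right_comm, ← div_eq_mul_inv,
    one_le_div (by positivity)]
  calc (1 + v ^ 2) ^ 2 ≤ (K ^ 2 * (1 + (v / σ) ^ 2)) ^ 2 := by gcongr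
    _ = _ := by ring

lemma lintegral_plane_affine {F : ℝ × ℝ → ℝ≥0∞} (hF : Measurable F) (p : ℝ × ℝ) {r s : ℝ}
    (hr : 0 < r) (hs : 0 < s) :
    ∫⁻ y, F y = ENNReal.ofReal (r * s) * ∫⁻ u, (∫⁻ v, F (p.1 + r * u, p.2 + s * v)) := by
  have h2 : ∀ y₁ : ℝ, ∫⁻ v, F (y₁, p.2 + s * v) = ENNReal.ofReal s⁻¹ * ∫⁻ y, F (y₁, y) :=
    fun y₁ => lintegral_affine (g := fun y => F (y₁, y)) (by fun_prop) p.2 hs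
  simp_rw [h2]
  rw [lintegral_const_mul _ (by fun_prop),
    lintegral_affine (g := fun y₁ => ∫⁻ y, F (y₁, y)) (by fun_prop) p.1 hr,
    ← mul_assoc, ← mul_assoc, ← ENNReal.ofReal_mul (by positivity),
    ← ENNReal.ofReal_mul (by positivity), Measure.volume_eq_prod, lintegral_prod _ hF.aemeasurable]
  rw [show r * s * s⁻¹ * r⁻¹ = 1 by field_simp]
  simp

lemma curve_lintegral_eq {F : ℝ × ℝ × ℝ → ℝ≥0∞} (hF : Measurable F) :
    ∫⁻ t in Icc (1 / 2 : ℝ) 2, (∫⁻ u, (∫⁻ v, decay u * decay v * F (u, v, t)))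
      = ∫⁻ z, F z ∂curveMeasure := by
  have hd := measurable_decay
  rw [lintegral_curveMeasure hF, lintegral_decayMeasure (by fun_prop),
    lintegral_lintegral_swap (by fun_prop)]
  refine lintegral_congr fun u => ?_
  rw [lintegral_decayMeasure (by fun_prop), ← lintegral_const_mul _ (by fun_prop),
    lintegral_lintegral_swap (by fun_prop)]
  refine lintegral_congr fun v => ?_
  rw [lintegral_const_mul _ (by fun_prop), mul_assoc]

lemma lintegral_curve_kernel_le {β e c : ℝ} {l : ℕ} {σ K : ℝ} {j k : ℤ} (hK : 1 ≤ K)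
    (hσ : σ ∈ Icc K⁻¹ K) {C : ℝ} (hC : 0 ≤ C) (A : ℝ≥0∞) {h : ℝ × ℝ → ℝ≥0∞} (hh : Measurable h)
    (x : ℝ × ℝ) :
    ∫⁻ y, h y * (∫⁻ t in Icc (1 / 2 : ℝ) 2, A *
        (ENNReal.ofReal (((2:ℝ) ^ (-(j + l)))⁻¹ * ((2:ℝ) ^ (-(k + l)) * σ)⁻¹ * C)
        * (decay ((x - y - ((2:ℝ) ^ (-j) * (e * t), (2:ℝ) ^ (-k) * σ * (c * t ^ β))).1
            / (2:ℝ) ^ (-(j + l)))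
          * decay ((x - y - ((2:ℝ) ^ (-j) * (e * t), (2:ℝ) ^ (-k) * σ * (c * t ^ β))).2
            / ((2:ℝ) ^ (-(k + l)) * σ)))))
      ≤ A * ENNReal.ofReal (C * K ^ 5) * curveAvg β (-e) l (-(σ * c)) j k h x := by
  have hd := measurable_decay
  have hK0 : 0 < K := by linarith
  have hσ0 : 0 < σ := lt_of_lt_of_le (inv_pos.2 hK0) hσ.1
  set r : ℝ := (2:ℝ) ^ (-(j + l)) with hr
  set s : ℝ := (2:ℝ) ^ (-(k + l)) with hs
  have hr0 : 0 < r := by positivity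
  have hs0 : 0 < s := by positivity
  have hpt := measurable_curvePt β (-e) l (-(σ * c)) j k
  have hrw : ∀ y, h y * (∫⁻ t in Icc (1 / 2 : ℝ) 2, A *
        (ENNReal.ofReal (r⁻¹ * (s * σ)⁻¹ * C)
        * (decay ((x - y - ((2:ℝ) ^ (-j) * (e * t), (2:ℝ) ^ (-k) * σ * (c * t ^ β))).1 / r)
          * decay ((x - y - ((2:ℝ) ^ (-j) * (e * t), (2:ℝ) ^ (-k) * σ * (c * t ^ β))).2
            / (s * σ)))))
      = ∫⁻ t in Icc (1 / 2 : ℝ) 2, h y * (A * (ENNReal.ofReal (r⁻¹ * (s * σ)⁻¹ * C)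
        * (decay ((x - y - ((2:ℝ) ^ (-j) * (e * t), (2:ℝ) ^ (-k) * σ * (c * t ^ β))).1 / r)
          * decay ((x - y - ((2:ℝ) ^ (-j) * (e * t), (2:ℝ) ^ (-k) * σ * (c * t ^ β))).2
            / (s * σ))))) := fun y => (lintegral_const_mul _ (by fun_prop)).symm
  simp_rw [hrw]
  rw [lintegral_lintegral_swap (by fun_prop), curveAvg, avgOp,
    ← curve_lintegral_eq (F := fun z => h (x + curvePt β (-e) l (-(σ * c)) j k z)) (by fun_prop),
    ← lintegral_const_mul _ (by fun_prop)]
  refine lintegral_mono fun t => ?_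
  rw [lintegral_plane_affine (by fun_prop)
      (x - ((2:ℝ) ^ (-j) * (e * t), (2:ℝ) ^ (-k) * σ * (c * t ^ β))) hr0 hs0,
    ← lintegral_const_mul _ (by fun_prop), ← lintegral_const_mul _ (by fun_prop)]
  refine lintegral_mono fun u => ?_
  rw [← lintegral_const_mul _ (by fun_prop), ← lintegral_const_mul _ (by fun_prop)]
  refine lintegral_mono fun v => ?_
  beta_reduce
  have h1 : (x - ((x - ((2:ℝ) ^ (-j) * (e * t), (2:ℝ) ^ (-k) * σ * (c * t ^ β))).1 + r * u,
      (x - ((2:ℝ) ^ (-j) * (e * t), (2:ℝ) ^ (-k) * σ * (c * t ^ β))).2 + s * v)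
      - ((2:ℝ) ^ (-j) * (e * t), (2:ℝ) ^ (-k) * σ * (c * t ^ β))) = (-(r * u), -(s * v)) := by
    ext <;> simp only [Prod.fst_sub, Prod.snd_sub] <;> ring
  have h2 : ((x - ((2:ℝ) ^ (-j) * (e * t), (2:ℝ) ^ (-k) * σ * (c * t ^ β))).1 + r * u,
      (x - ((2:ℝ) ^ (-j) * (e * t), (2:ℝ) ^ (-k) * σ * (c * t ^ β))).2 + s * v)
      = x + curvePt β (-e) l (-(σ * c)) j k (u, v, t) := by
    ext <;> simp only [curvePt, Prod.fst_add, Prod.snd_add, Prod.fst_sub, Prod.snd_sub, hr, hs] <;>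
      ring
  rw [h1, h2]
  set H := h (x + curvePt β (-e) l (-(σ * c)) j k (u, v, t))
  have h3 : -(r * u) / r = -u := by field_simp
  have h4 : -(s * v) / (s * σ) = -(v / σ) := by field_simp
  simp only [h3, h4, decay_neg]
  have h5 : ENNReal.ofReal (r * s) * ENNReal.ofReal (r⁻¹ * (s * σ)⁻¹ * C) * ENNReal.ofReal (K ^ 4)
      ≤ ENNReal.ofReal (C * K ^ 5) := by
    rw [← ENNReal.ofReal_mul (by positivity), ← ENNReal.ofReal_mul (by positivity)]
    apply ENNReal.ofReal_le_ofReal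
    have h6 : r * s * (r⁻¹ * (s * σ)⁻¹ * C) * K ^ 4 = σ⁻¹ * (C * K ^ 4) := by field_simp
    rw [h6]
    calc σ⁻¹ * (C * K ^ 4) ≤ K * (C * K ^ 4) := by
          gcongr
          exact inv_le_of_inv_le₀ hK0 hσ.1
      _ = _ := by ring
  calc _ = A * H * decay u * (ENNReal.ofReal (r * s)
        * ENNReal.ofReal (r⁻¹ * (s * σ)⁻¹ * C)) * decay (v / σ) := by ring
    _ ≤ A * H * decay u * (ENNReal.ofReal (r * s)
        * ENNReal.ofReal (r⁻¹ * (s * σ)⁻¹ * C)) * (ENNReal.ofReal (K ^ 4) * decay v) := by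
        gcongr _ * ?_
        exact decay_div_le hσ0 hσ.2 hK v
    _ = A * H * decay u * decay v * (ENNReal.ofReal (r * s)
        * ENNReal.ofReal (r⁻¹ * (s * σ)⁻¹ * C) * ENNReal.ofReal (K ^ 4)) := by ring
    _ ≤ A * H * decay u * decay v * ENNReal.ofReal (C * K ^ 5) := by gcongr _ * ?_
    _ = _ := by ring

/-- A symbol that is smooth after division by the multipliers of the dyadic differences gives
operators dominated by averages, over thickened curves, of dyadic differences. -/
lemma exists_curveOp_le {m : ℝ × ℝ → ℂ} {G : ℝ × ℝ × ℝ → ℂ} {R : ℝ} (hG : PlaneSymbol R G)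
    {K : ℝ} (hK : 1 ≤ K) {r : ℕ}
    (hm : ∀ ρ ∈ Icc K⁻¹ K, ∀ η : ℝ × ℝ, m η = G (ρ, η)
      * (diffMul ((2:ℝ) ^ (-(r : ℤ)) * η.1) * diffMul ((2:ℝ) ^ (-(r : ℤ)) * (ρ * η.2))))
    {a : ℝ → ℝ} (ha : Continuous a) (hsupp : ∀ t, t ∉ Icc (1 / 2 : ℝ) 2 → a t = 0) (β e c : ℝ) :
    ∃ C : ℝ≥0, ∀ (l : ℕ) (σ : ℝ), σ ∈ Icc K⁻¹ K → ∀ (j k : ℤ) (f : ℝ × ℝ → ℝ), Measurable f →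
      Integrable f → ∀ x, ‖curveOp m a β e c l σ j k f x‖ₑ
        ≤ C * curveAvg β (-e) l (-(σ * c)) j k
          (fun y => ‖dDiff2 (j + (l + r : ℤ)) (k + (l + r : ℤ)) f y‖ₑ) x := by
  obtain ⟨A, hA⟩ := isCompact_Icc.exists_bound_of_continuousOn
    (s := Icc (1 / 2 : ℝ) 2) ha.continuousOn
  obtain ⟨C, hC, hker⟩ := hG.exists_kernel_bound K⁻¹ K
  have hK0 : 0 < K := by linarith
  have hai : Integrable a := ha.integrable_of_hasCompactSupport
    (HasCompactSupport.intro isCompact_Icc fun t ht => hsupp t ht)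
  refine ⟨A.toNNReal * (C * K ^ 5).toNNReal, fun l σ hσ j k f hf hfi x => ?_⟩
  have hσ0 : 0 < σ := lt_of_lt_of_le (inv_pos.2 hK0) hσ.1
  set ρ := σ⁻¹ with hρ
  have hρK : ρ ∈ Icc K⁻¹ K :=
    ⟨(inv_le_inv₀ hK0 hσ0).2 hσ.2, inv_le_of_inv_le₀ hK0 hσ.1⟩
  set g := dDiff2 (j + (l + r : ℤ)) (k + (l + r : ℤ)) f with hg
  obtain ⟨hgi, hFTg⟩ := FT_dDiff2 hf hfi (j + (l + r : ℤ)) (k + (l + r : ℤ))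
  have hgm : Measurable g := measurable_dDiff2 hf _ _
  set μ₁ : ℝ := (2:ℝ) ^ (-(j + l)) with hμ₁
  set μ₂ : ℝ := (2:ℝ) ^ (-(k + l)) * σ with hμ₂
  have hμ₁0 : 0 < μ₁ := by positivity
  have hμ₂0 : 0 < μ₂ := by positivity
  set G' : ℝ × ℝ → ℂ := fun ξ => G (ρ, (μ₁ * ξ.1, μ₂ * ξ.2)) with hG'
  have hG'i : Integrable G' := integrable_dil hμ₁0.ne' hμ₂0.ne' (hG.integrable ρ)
  have hop : curveOp m a β e c l σ j k f x
      = ∫ y, (g y : ℂ) * ∫ t, (a t : ℂ) *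
        FTinv G' (x - y - ((2:ℝ) ^ (-j) * (e * t), (2:ℝ) ^ (-k) * σ * (c * t ^ β))) := by
    simp_rw [← FTinv_mul_curveFT β e c _ _ hai hG'i]
    refine Eq.trans ?_ (FTinv_mul_FT (integrable_mul_curveFT β e c _ _ hai hG'i)
      (g := fun y => ((g y : ℝ) : ℂ)) hgi.ofReal x)
    rw [curveOp]
    congr 1
    ext ξ
    change _ = _ * FT (fun x => ((g x : ℝ) : ℂ)) ξ
    rw [hFTg, curveSymbol, ← hμ₁, ← hμ₂, hm ρ hρK]
    have e1 : (2:ℝ) ^ (-(r : ℤ)) * (μ₁ * ξ.1) = (2:ℝ) ^ (-(j + (l + r : ℤ))) * ξ.1 := by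
      rw [hμ₁, ← mul_assoc, ← zpow_add₀ (by norm_num)]; congr 2; ring
    have e2 : (2:ℝ) ^ (-(r : ℤ)) * (ρ * (μ₂ * ξ.2)) = (2:ℝ) ^ (-(k + (l + r : ℤ))) * ξ.2 := by
      rw [hμ₂, hρ, show (2:ℝ) ^ (-(r : ℤ)) * (σ⁻¹ * ((2:ℝ) ^ (-(k + (l : ℤ))) * σ * ξ.2))
        = (2:ℝ) ^ (-(r : ℤ)) * (2:ℝ) ^ (-(k + (l : ℤ))) * ξ.2 by field_simp,
        ← zpow_add₀ (by norm_num)]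
      congr 2; ring
    simp only [e1, e2]
    ring
  have hbound : ∀ z : ℝ × ℝ, ‖FTinv G' z‖ₑ
      ≤ ENNReal.ofReal (μ₁⁻¹ * μ₂⁻¹ * C) * (decay (z.1 / μ₁) * decay (z.2 / μ₂)) := by
    intro z
    rw [hG', FTinv_dil hμ₁0.ne' hμ₂0.ne' (fun η => G (ρ, η)), decay, decay,
      ← ENNReal.ofReal_mul (by positivity), ← ENNReal.ofReal_mul (by positivity), ← ofReal_norm]
    apply ENNReal.ofReal_le_ofReal
    rw [norm_mul, Complex.norm_real, Real.norm_eq_abs, abs_mul, abs_abs, abs_abs,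
      abs_of_pos (inv_pos.2 hμ₁0), abs_of_pos (inv_pos.2 hμ₂0), mul_assoc]
    rw [mul_assoc (μ₁⁻¹ * μ₂⁻¹), mul_assoc]
    gcongr
    exact hker ρ hρK _
  rw [hop]
  calc _ ≤ ∫⁻ y, ‖g y‖ₑ * (∫⁻ t in Icc (1 / 2 : ℝ) 2, ENNReal.ofReal A *
        (ENNReal.ofReal (μ₁⁻¹ * μ₂⁻¹ * C)
        * (decay ((x - y - ((2:ℝ) ^ (-j) * (e * t), (2:ℝ) ^ (-k) * σ * (c * t ^ β))).1 / μ₁)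
          * decay ((x - y - ((2:ℝ) ^ (-j) * (e * t), (2:ℝ) ^ (-k) * σ * (c * t ^ β))).2
            / μ₂)))) := by
        refine (enorm_integral_le_lintegral_enorm _).trans (lintegral_mono fun y => ?_)
        beta_reduce
        rw [enorm_mul]
        gcongr ?_ * ?_
        · rw [← ofReal_norm, ← ofReal_norm, Complex.norm_real]
        · refine (enorm_integral_le_lintegral_enorm _).trans ?_
          rw [← lintegral_indicator measurableSet_Icc]
          refine lintegral_mono fun t => ?_
          by_cases ht : t ∈ Icc (1 / 2 : ℝ) 2
          · rw [indicator_of_mem ht, enorm_mul]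
            gcongr ?_ * ?_
            · rw [← ofReal_norm, Complex.norm_real]
              exact ENNReal.ofReal_le_ofReal (hA t ht)
            · exact hbound _
          · simp [hsupp t ht]
    _ ≤ _ := lintegral_curve_kernel_le hK hσ hC _ hgm.enorm x
    _ = _ := by simp [ENNReal.ofReal]

/-- The multiplier of a dyadic difference has a smooth inverse away from the origin. -/
lemma exists_smooth_inv_diffMul {a : ℝ} (ha : 0 < a) :
    ∃ w : ℝ → ℂ, ContDiff ℝ ((⊤ : ℕ∞) : WithTop ℕ∞) w ∧
      ∀ x, a ≤ |x| → |x| ≤ 1 → w x * diffMul x = 1 := by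
  set χ : ℝ → ℝ := fun x => Real.smoothTransition (2 * x ^ 2 / a ^ 2 - 1)
    * Real.smoothTransition (2 - x ^ 2) with hχ
  have hχs : ContDiff ℝ ((⊤ : ℕ∞) : WithTop ℕ∞) χ :=
    (Real.smoothTransition.contDiff.comp (by fun_prop)).mul
      (Real.smoothTransition.contDiff.comp (by fun_prop))
  set E : ℝ → ℂ := fun x => Complex.exp (Real.pi * x * Complex.I) - 1 with hE
  have hEs : ContDiff ℝ ((⊤ : ℕ∞) : WithTop ℕ∞) E := by
    have h1 : ContDiff ℝ ((⊤ : ℕ∞) : WithTop ℕ∞) (fun x : ℝ => (x : ℂ)) :=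
      Complex.ofRealCLM.contDiff
    exact ((contDiff_const.mul h1).mul contDiff_const).cexp.sub contDiff_const
  have hns : ContDiff ℝ ((⊤ : ℕ∞) : WithTop ℕ∞)
      (fun x : ℝ => (χ x : ℂ) * -(2 * Real.pi * x * Complex.I)) := by
    have h1 : ContDiff ℝ ((⊤ : ℕ∞) : WithTop ℕ∞) (fun x : ℝ => (x : ℂ)) :=
      Complex.ofRealCLM.contDiff
    exact (h1.comp hχs).mul (((contDiff_const.mul h1).mul contDiff_const).neg)
  refine ⟨fun x => (χ x : ℂ) * -(2 * Real.pi * x * Complex.I) / E x ^ 2, ?_, ?_⟩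
  · rw [contDiff_iff_contDiffAt]
    intro x
    by_cases hx0 : x = 0
    · refine (contDiffAt_const (c := (0 : ℂ))).congr_of_eventuallyEq ?_
      have hev : ∀ᶠ y in 𝓝 x, 2 * y ^ 2 / a ^ 2 - 1 < 0 := by
        refine (Continuous.continuousAt (by fun_prop)).eventually_lt continuousAt_const ?_
        simp [hx0]
      filter_upwards [hev] with y hy
      simp [hχ, Real.smoothTransition.zero_of_nonpos hy.le]
    by_cases hx2 : |x| < 2
    · simp_rw [div_eq_mul_inv]
      refine hns.contDiffAt.mul (ContDiffAt.inv (hEs.contDiffAt.pow 2) ?_)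
      exact pow_ne_zero 2 (expI_ne_one hx0 hx2)
    · refine (contDiffAt_const (c := (0 : ℂ))).congr_of_eventuallyEq ?_
      have hev : ∀ᶠ y in 𝓝 x, 2 - y ^ 2 < 0 := by
        refine (Continuous.continuousAt (by fun_prop)).eventually_lt continuousAt_const ?_
        have : 2 ≤ |x| := not_lt.1 hx2
        have := sq_abs x
        nlinarith
      filter_upwards [hev] with y hy
      simp [hχ, Real.smoothTransition.zero_of_nonpos hy.le]
  · intro x h1 h2
    have hx0 : x ≠ 0 := by
      rintro rfl
      simp at h1; linarith
    have hE0 : E x ≠ 0 := expI_ne_one hx0 (by linarith)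
    have hsq : a ^ 2 ≤ x ^ 2 := by rw [← sq_abs x]; gcongr
    have hsq' : x ^ 2 ≤ 1 := by rw [← sq_abs x]; nlinarith [abs_nonneg x]
    have hχ1 : χ x = 1 := by
      have e1 : (1:ℝ) ≤ 2 * x ^ 2 / a ^ 2 - 1 := by
        rw [le_sub_iff_add_le, le_div_iff₀ (by positivity)]; linarith
      simp only [hχ]
      rw [Real.smoothTransition.one_of_one_le e1,
        Real.smoothTransition.one_of_one_le (by linarith), one_mul]
    have hd : diffMul x * (2 * Real.pi * x * Complex.I) = -(E x) ^ 2 := diffMul_mul x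
    have hne := pow_ne_zero 2 hE0
    beta_reduce
    rw [hχ1, Complex.ofReal_one, div_mul_eq_mul_div, div_eq_one_iff_eq hne]
    linear_combination -hd

/-- A smooth function supported away from the coordinate axes is a smooth multiple of the
multipliers of dyadic differences at any comparable scales. -/
lemma exists_planeSymbol {m : ℝ × ℝ → ℂ} (hm : ContDiff ℝ ((⊤ : ℕ∞) : WithTop ℕ∞) m)
    {r₀ R₀ K : ℝ} (hr₀ : 0 < r₀) (hK : 1 ≤ K)
    (hsupp : ∀ η, m η ≠ 0 → r₀ ≤ |η.1| ∧ |η.1| ≤ R₀ ∧ r₀ ≤ |η.2| ∧ |η.2| ≤ R₀) :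
    ∃ (r : ℕ) (G : ℝ × ℝ × ℝ → ℂ), PlaneSymbol R₀ G ∧
      ∀ ρ ∈ Icc K⁻¹ K, ∀ η : ℝ × ℝ, m η = G (ρ, η)
        * (diffMul ((2:ℝ) ^ (-(r : ℤ)) * η.1) * diffMul ((2:ℝ) ^ (-(r : ℤ)) * (ρ * η.2))) := by
  obtain ⟨r, hr⟩ := pow_unbounded_of_one_lt (|R₀| * K) (one_lt_two (α := ℝ))
  have hK0 : 0 < K := by linarith
  obtain ⟨w, hw, hw1⟩ := exists_smooth_inv_diffMul
    (a := (2:ℝ) ^ (-(r : ℤ)) * (r₀ * K⁻¹)) (by positivity)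
  have h2 : (2:ℝ) ^ (-(r : ℤ)) * (|R₀| * K) ≤ 1 := by
    rw [zpow_neg, zpow_natCast, inv_mul_le_iff₀ (by positivity)]; linarith
  refine ⟨r, fun z => m z.2 * (w ((2:ℝ) ^ (-(r : ℤ)) * z.2.1)
    * w ((2:ℝ) ^ (-(r : ℤ)) * (z.1 * z.2.2))), ⟨?_, ?_⟩, ?_⟩
  · have h1 : ContDiff ℝ ((⊤ : ℕ∞) : WithTop ℕ∞)
      (fun z : ℝ × ℝ × ℝ => (2:ℝ) ^ (-(r : ℤ)) * z.2.1) := by fun_prop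
    have h2 : ContDiff ℝ ((⊤ : ℕ∞) : WithTop ℕ∞)
      (fun z : ℝ × ℝ × ℝ => (2:ℝ) ^ (-(r : ℤ)) * (z.1 * z.2.2)) := by fun_prop
    exact (hm.comp contDiff_snd).mul ((hw.comp h1).mul (hw.comp h2))
  · intro z hz
    have : m z.2 = 0 := by
      by_contra h
      obtain ⟨-, h1, -, h2⟩ := hsupp _ h
      rcases hz with hz | hz <;> linarith
    simp [this]
  · intro ρ hρ η
    by_cases h : m η = 0
    · simp [h]
    obtain ⟨h11, h12, h21, h22⟩ := hsupp _ h
    have hρ0 : 0 < ρ := lt_of_lt_of_le (inv_pos.2 hK0) hρ.1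
    have hR := le_abs_self R₀
    have hKi : K⁻¹ ≤ 1 := inv_le_one_of_one_le₀ hK
    have e1 : w ((2:ℝ) ^ (-(r : ℤ)) * η.1) * diffMul ((2:ℝ) ^ (-(r : ℤ)) * η.1) = 1 := by
      apply hw1
      · rw [abs_mul, abs_of_pos (by positivity)]
        gcongr
        calc r₀ * K⁻¹ ≤ r₀ * 1 := by gcongr
          _ ≤ _ := by linarith
      · rw [abs_mul, abs_of_pos (by positivity)]
        refine le_trans ?_ h2
        gcongr
        calc |η.1| ≤ |R₀| * 1 := by linarith
          _ ≤ _ := by gcongr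
    have e2 : w ((2:ℝ) ^ (-(r : ℤ)) * (ρ * η.2)) * diffMul ((2:ℝ) ^ (-(r : ℤ)) * (ρ * η.2))
        = 1 := by
      apply hw1
      · rw [abs_mul, abs_mul, abs_of_pos (show (0:ℝ) < 2 ^ (-(r : ℤ)) by positivity),
          abs_of_pos hρ0, mul_comm r₀]
        gcongr
        exact hρ.1
      · rw [abs_mul, abs_mul, abs_of_pos (show (0:ℝ) < 2 ^ (-(r : ℤ)) by positivity),
          abs_of_pos hρ0, mul_comm ρ]
        refine le_trans ?_ h2
        gcongr _ * (?_ * ?_)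
        · linarith
        · exact hρ.2
    linear_combination (-m η) * (w ((2:ℝ) ^ (-(r : ℤ)) * η.1)
      * diffMul ((2:ℝ) ^ (-(r : ℤ)) * η.1)) * e2 - m η * e1

/-- The van der Corput estimate for phases whose second derivative has a fixed sign. -/
lemma norm_integral_expI_le {φ g g' a a' : ℝ → ℝ} {p q A A' lam s : ℝ} (hpq : p ≤ q)
    (hφ : ∀ t ∈ Icc p q, HasDerivAt φ (g t) t) (hg : ∀ t ∈ Icc p q, HasDerivAt g (g' t) t)
    (hg' : ContinuousOn g' (Icc p q)) (ha : ∀ t ∈ Icc p q, HasDerivAt a (a' t) t)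
    (ha' : ContinuousOn a' (Icc p q)) (hap : a p = 0) (haq : a q = 0) (hlam : 0 < lam)
    (hs : |s| = 1) (hsg : ∀ t ∈ Icc p q, lam ≤ s * g' t) (hA : ∀ t ∈ Icc p q, |a t| ≤ A)
    (hA' : ∀ t ∈ Icc p q, |a' t| ≤ A') :
    ‖∫ t in p..q, Complex.exp ((φ t : ℂ) * Complex.I) * (a t : ℂ)‖
      ≤ ((q - p) * A' + 2 * Real.pi * A) / √lam := by
  set δ := √lam with hδ
  have hδ0 : 0 < δ := Real.sqrt_pos.2 hlam
  have hδ2 : δ ^ 2 = lam := Real.sq_sqrt hlam.le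
  have hD : ∀ t, 0 < g t ^ 2 + δ ^ 2 := fun t => by positivity
  have hA0 : 0 ≤ A := (abs_nonneg _).trans (hA p ⟨le_rfl, hpq⟩)
  have hA'0 : 0 ≤ A' := (abs_nonneg _).trans (hA' p ⟨le_rfl, hpq⟩)
  set h' : ℝ → ℝ := fun t => ((a' t * g t + a t * g' t) * (g t ^ 2 + δ ^ 2)
    - a t * g t * (2 * g t * g' t)) / (g t ^ 2 + δ ^ 2) ^ 2 with hh'
  have hh : ∀ t ∈ Icc p q, HasDerivAt (fun t => a t * g t / (g t ^ 2 + δ ^ 2)) (h' t) t := by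
    intro t ht
    have h1 : HasDerivAt (fun t => g t ^ 2 + δ ^ 2) (2 * g t * g' t) t := by
      simpa using! ((hg t ht).pow 2).add_const (δ ^ 2)
    exact ((ha t ht).mul (hg t ht)).div h1 (hD t).ne'
  have hexp : ∀ t ∈ Icc p q, HasDerivAt (fun t => Complex.exp ((φ t : ℂ) * Complex.I))
      (Complex.exp ((φ t : ℂ) * Complex.I) * (g t * Complex.I)) t := fun t ht =>
    ((hφ t ht).ofReal_comp.mul_const Complex.I).cexp
  have cφ : ContinuousOn φ (Icc p q) := fun t ht => (hφ t ht).continuousAt.continuousWithinAt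
  have cg : ContinuousOn g (Icc p q) := fun t ht => (hg t ht).continuousAt.continuousWithinAt
  have ca : ContinuousOn a (Icc p q) := fun t ht => (ha t ht).continuousAt.continuousWithinAt
  have cof : ∀ {u : ℝ → ℝ}, ContinuousOn u (Icc p q) →
      ContinuousOn (fun t => (u t : ℂ)) (Icc p q) := fun hu =>
    Complex.continuous_ofReal.comp_continuousOn hu
  have cexp : ContinuousOn (fun t => Complex.exp ((φ t : ℂ) * Complex.I)) (Icc p q) :=
    ((cof cφ).mul continuousOn_const).cexp
  have cD : ContinuousOn (fun t => g t ^ 2 + δ ^ 2) (Icc p q) := by fun_prop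
  have ch' : ContinuousOn h' (Icc p q) := by
    refine ContinuousOn.div (by fun_prop) (by fun_prop) fun t _ => (pow_pos (hD t) 2).ne'
  set F' : ℝ → ℂ := fun t => Complex.exp ((φ t : ℂ) * Complex.I) * (g t * Complex.I)
    * ((a t * g t / (g t ^ 2 + δ ^ 2) : ℝ) : ℂ)
    + Complex.exp ((φ t : ℂ) * Complex.I) * (h' t : ℂ) with hF'
  have cq : ContinuousOn (fun t => a t * g t / (g t ^ 2 + δ ^ 2)) (Icc p q) :=
    (ca.mul cg).div cD fun t _ => (hD t).ne'
  have cF' : ContinuousOn F' (Icc p q) :=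
    ((cexp.mul ((cof cg).mul continuousOn_const)).mul (cof cq)).add (cexp.mul (cof ch'))
  have hF : ∫ t in p..q, F' t = 0 := by
    have := intervalIntegral.integral_eq_sub_of_hasDerivAt
      (f := fun t => Complex.exp ((φ t : ℂ) * Complex.I)
        * ((a t * g t / (g t ^ 2 + δ ^ 2) : ℝ) : ℂ)) (f' := F') (a := p) (b := q)
      (fun t ht => by
        rw [uIcc_of_le hpq] at ht
        exact (hexp t ht).mul (hh t ht).ofReal_comp)
      (ContinuousOn.intervalIntegrable (by rwa [uIcc_of_le hpq]))
    rw [this]; simp [hap, haq]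
  set E : ℝ → ℂ := fun t => Complex.exp ((φ t : ℂ) * Complex.I)
    * (((a t * δ ^ 2 / (g t ^ 2 + δ ^ 2) : ℝ) : ℂ) + Complex.I * (h' t : ℂ)) with hE
  have cE : ContinuousOn E (Icc p q) := by
    refine cexp.mul ((cof ?_).add (continuousOn_const.mul (cof ch')))
    exact (ca.mul continuousOn_const).div cD fun t _ => (hD t).ne'
  have hsplit : ∫ t in p..q, Complex.exp ((φ t : ℂ) * Complex.I) * (a t : ℂ)
      = ∫ t in p..q, E t := by
    have h1 : ∫ t in p..q, Complex.exp ((φ t : ℂ) * Complex.I) * (a t : ℂ)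
        = ∫ t in p..q, (E t - Complex.I * F' t) := by
      congr 1
      ext t
      have h2 : ((g t : ℂ) ^ 2 + (δ : ℂ) ^ 2) ≠ 0 := by exact_mod_cast (hD t).ne'
      simp only [hE, hF']
      push_cast
      field_simp
      linear_combination ((a t : ℂ) * g t ^ 2) * Complex.I_sq
    rw [h1, intervalIntegral.integral_sub, intervalIntegral.integral_const_mul, hF]
    · simp
    · exact ContinuousOn.intervalIntegrable (by rwa [uIcc_of_le hpq])
    · exact (ContinuousOn.intervalIntegrable (by rwa [uIcc_of_le hpq])).const_mul _
  set B : ℝ → ℝ := fun t => A' / (2 * δ) + 2 * A * (s * g' t / (g t ^ 2 + δ ^ 2)) with hB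
  have cB : ContinuousOn B (Icc p q) :=
    continuousOn_const.add (continuousOn_const.mul
      ((continuousOn_const.mul hg').div cD fun t _ => (hD t).ne'))
  have hle : ∀ t ∈ Icc p q, ‖E t‖ ≤ B t := by
    intro t ht
    have hsg' := hsg t ht
    have habs : |g' t| = s * g' t := by
      rw [← abs_of_nonneg (hlam.le.trans hsg'), abs_mul, hs, one_mul]
    have hDt := hD t
    rw [hE, norm_mul, Complex.norm_exp_ofReal_mul_I, one_mul]
    refine (norm_add_le _ _).trans ?_
    rw [norm_mul, Complex.norm_I, one_mul, Complex.norm_real, Complex.norm_real,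
      Real.norm_eq_abs, Real.norm_eq_abs]
    have e1 : |a t * δ ^ 2 / (g t ^ 2 + δ ^ 2)| ≤ A * (s * g' t / (g t ^ 2 + δ ^ 2)) := by
      rw [abs_div, abs_mul, abs_of_pos hDt, abs_of_pos (by positivity : 0 < δ ^ 2), mul_div_assoc]
      gcongr
      · exact hA t ht
      · rw [hδ2]; exact hsg'
    have e2 : h' t = a' t * (g t / (g t ^ 2 + δ ^ 2))
        + a t * (g' t / (g t ^ 2 + δ ^ 2)) * ((δ ^ 2 - g t ^ 2) / (g t ^ 2 + δ ^ 2)) := by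
      simp only [hh']; field_simp; ring
    have e3 : |g t / (g t ^ 2 + δ ^ 2)| ≤ 1 / (2 * δ) := by
      rw [abs_div, abs_of_pos hDt, div_le_div_iff₀ hDt (by positivity)]
      nlinarith [sq_nonneg (|g t| - δ), sq_abs (g t)]
    have e4 : |(δ ^ 2 - g t ^ 2) / (g t ^ 2 + δ ^ 2)| ≤ 1 := by
      rw [abs_div, abs_of_pos hDt, div_le_one hDt, abs_le]
      constructor <;> nlinarith [sq_nonneg (g t), sq_nonneg δ]
    have e5 : |h' t| ≤ A' / (2 * δ) + A * (s * g' t / (g t ^ 2 + δ ^ 2)) := by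
      rw [e2]
      refine (abs_add_le _ _).trans ?_
      rw [abs_mul, abs_mul, abs_mul, abs_div (g' t), abs_of_pos hDt, habs]
      refine add_le_add ?_ ?_
      · rw [div_eq_mul_one_div A']
        exact mul_le_mul (hA' t ht) e3 (abs_nonneg _) hA'0
      · have : 0 ≤ s * g' t := hlam.le.trans hsg'
        calc _ ≤ A * (s * g' t / (g t ^ 2 + δ ^ 2)) * 1 := by
              gcongr
              exact hA t ht
          _ = _ := mul_one _
    simp only [hB]
    linarith
  rw [hsplit]
  refine (intervalIntegral.norm_integral_le_of_norm_le hpq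
    (Filter.Eventually.of_forall fun t ht => hle t (Ioc_subset_Icc_self ht))
    (ContinuousOn.intervalIntegrable (by rwa [uIcc_of_le hpq]))).trans ?_
  have hint := intervalIntegral.integral_eq_sub_of_hasDerivAt
    (f := fun t => A' / (2 * δ) * t + 2 * A * (s / δ * Real.arctan (g t / δ))) (f' := B)
    (a := p) (b := q)
    (fun t ht => by
      rw [uIcc_of_le hpq] at ht
      have h1 := (((hg t ht).div_const δ).arctan.const_mul (s / δ)).const_mul (2 * A)
      have h2 := ((hasDerivAt_id t).const_mul (A' / (2 * δ))).add h1
      refine h2.congr_deriv ?_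
      simp only [hB]
      have := hD t
      field_simp
      ring)
    (ContinuousOn.intervalIntegrable (by rwa [uIcc_of_le hpq]))
  rw [hint]
  have hdiff : |Real.arctan (g q / δ) - Real.arctan (g p / δ)| ≤ Real.pi := by
    have h1 := Real.arctan_lt_pi_div_two (g q / δ)
    have h2 := Real.neg_pi_div_two_lt_arctan (g q / δ)
    have h3 := Real.arctan_lt_pi_div_two (g p / δ)
    have h4 := Real.neg_pi_div_two_lt_arctan (g p / δ)
    rw [abs_le]; constructor <;> linarith
  have hs' : s * (Real.arctan (g q / δ) - Real.arctan (g p / δ)) ≤ Real.pi := by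
    refine (le_abs_self _).trans ?_
    rw [abs_mul, hs, one_mul]; exact hdiff
  have hpos : 0 ≤ (q - p) * A' := mul_nonneg (by linarith) hA'0
  rw [le_div_iff₀ hδ0]
  have e : (A' / (2 * δ) * q + 2 * A * (s / δ * Real.arctan (g q / δ))
      - (A' / (2 * δ) * p + 2 * A * (s / δ * Real.arctan (g p / δ)))) * δ
      = (q - p) * A' / 2
        + 2 * A * (s * (Real.arctan (g q / δ) - Real.arctan (g p / δ))) := by
    field_simp; ring
  rw [e]
  nlinarith [mul_le_mul_of_nonneg_left hs' hA0]

/-- Decay of the Fourier transform of a smooth measure on the curve. -/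
lemma exists_curveFT_decay {a : ℝ → ℝ} (ha : ContDiff ℝ ((⊤ : ℕ∞) : WithTop ℕ∞) a)
    (hsupp : ∀ t, t ∉ Icc (1 / 2 : ℝ) 2 → a t = 0) {β : ℝ} (hβ : 1 < β) (e : ℝ) {c : ℝ}
    (hc : c ≠ 0) :
    ∃ C : ℝ, 0 ≤ C ∧ ∀ X : ℝ × ℝ, ‖curveFT β e c a X‖ ^ 2 * |X.2| ≤ C := by
  have hac := ha.continuous
  have hz : ∀ t₀ ∈ closure {t : ℝ | t ∉ Icc (1 / 2 : ℝ) 2}, a t₀ = 0 := by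
    intro t₀ ht₀
    have hcl : IsClosed {t | a t = 0} := isClosed_eq hac continuous_const
    exact hcl.closure_subset_iff.2 (fun t ht => hsupp t ht) ht₀
  have hz1 : a (1 / 2) = 0 := by
    apply hz
    have h1 : Iio (1 / 2 : ℝ) ⊆ {t : ℝ | t ∉ Icc (1 / 2 : ℝ) 2} := fun t ht h =>
      absurd h.1 (not_le.2 ht)
    apply closure_mono h1
    rw [closure_Iio]; exact self_mem_Iic
  have hz2 : a 2 = 0 := by
    apply hz
    have h1 : Ioi (2 : ℝ) ⊆ {t : ℝ | t ∉ Icc (1 / 2 : ℝ) 2} := fun t ht h =>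
      absurd h.2 (not_le.2 ht)
    apply closure_mono h1
    rw [closure_Ioi]; exact self_mem_Ici
  have had : ∀ t, HasDerivAt a (deriv a t) t := fun t =>
    (ha.differentiable (by simp)).differentiableAt.hasDerivAt
  have ha' : Continuous (deriv a) := ha.continuous_deriv (by norm_cast)
  obtain ⟨A, hA⟩ := isCompact_Icc.exists_bound_of_continuousOn
    (s := Icc (1 / 2 : ℝ) 2) hac.continuousOn
  obtain ⟨A', hA'⟩ := isCompact_Icc.exists_bound_of_continuousOn
    (s := Icc (1 / 2 : ℝ) 2) ha'.continuousOn
  have hpos : ∀ t ∈ Icc (1 / 2 : ℝ) 2, 0 < t := fun t ht => by linarith [ht.1]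
  have hcp : ContinuousOn (fun t : ℝ => t ^ (β - 2)) (Icc (1 / 2 : ℝ) 2) := fun t ht =>
    (Real.continuousAt_rpow_const _ _ (Or.inl (hpos t ht).ne')).continuousWithinAt
  obtain ⟨t₁, ht₁, hmin⟩ := isCompact_Icc.exists_isMinOn
    (nonempty_Icc.2 (by norm_num : (1 / 2 : ℝ) ≤ 2)) hcp
  set μ : ℝ := t₁ ^ (β - 2) with hμ
  have hμ0 : 0 < μ := Real.rpow_pos_of_pos (hpos t₁ ht₁) _
  set κ : ℝ := 2 * Real.pi * |c| * β * (β - 1) * μ with hκ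
  have hc0 : 0 < |c| := abs_pos.2 hc
  have hβ1 : 0 < β - 1 := by linarith
  have hβ0 : 0 < β := by linarith
  have hκ0 : 0 < κ := by have := Real.pi_pos; positivity
  refine ⟨((2 - 1 / 2) * A' + 2 * Real.pi * A) ^ 2 / κ, by positivity, fun X => ?_⟩
  by_cases hX : X.2 = 0
  · simp only [hX, abs_zero, mul_zero]; positivity
  have hX0 : 0 < |X.2| := abs_pos.2 hX
  set φ : ℝ → ℝ := fun t => -(2 * Real.pi * (X.1 * (e * t) + X.2 * (c * t ^ β))) with hφ
  have heq : curveFT β e c a X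
      = ∫ t in (1 / 2 : ℝ)..2, Complex.exp ((φ t : ℂ) * Complex.I) * (a t : ℂ) := by
    rw [intervalIntegral.integral_of_le (by norm_num), ← integral_Icc_eq_integral_Ioc,
      setIntegral_eq_integral_of_forall_compl_eq_zero fun t ht => by simp [hsupp t ht]]
    rfl
  have hs : |-(SignType.sign (X.2 * c) : ℝ)| = 1 := by
    rcases lt_or_gt_of_ne (mul_ne_zero hX hc) with h | h <;> simp [h]
  have hvdc := norm_integral_expI_le (φ := φ) (a := a) (a' := deriv a) (p := 1 / 2) (q := 2)
    (g := fun t => -(2 * Real.pi * (X.1 * e + X.2 * (c * (β * t ^ (β - 1))))))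
    (g' := fun t => -(2 * Real.pi * (X.2 * (c * (β * ((β - 1) * t ^ (β - 2)))))))
    (A := A) (A' := A') (lam := κ * |X.2|) (s := -(SignType.sign (X.2 * c) : ℝ))
    (by norm_num)
    (fun t ht => by
      have h1 := Real.hasDerivAt_rpow_const (x := t) (p := β) (Or.inl (hpos t ht).ne')
      have h2 := ((((hasDerivAt_id t).const_mul e).const_mul X.1).add
        ((h1.const_mul c).const_mul X.2)).const_mul (2 * Real.pi)
      refine h2.neg.congr_deriv ?_
      simp)
    (fun t ht => by
      have h1 := Real.hasDerivAt_rpow_const (x := t) (p := β - 1) (Or.inl (hpos t ht).ne')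
      have h2 := ((((h1.const_mul β).const_mul c).const_mul X.2).const_add (X.1 * e)).const_mul
        (2 * Real.pi)
      refine h2.neg.congr_deriv ?_
      rw [show β - 1 - 1 = β - 2 by ring])
    (by fun_prop) (fun t _ => had t) ha'.continuousOn hz1 hz2 (by positivity) hs
    (fun t ht => by
      have h1 : μ ≤ t ^ (β - 2) := hmin ht
      have h2 : (SignType.sign (X.2 * c) : ℝ) * (X.2 * c) = |X.2| * |c| := by
        rw [← abs_mul, sign_mul_self]
      calc κ * |X.2| = 2 * Real.pi * β * (β - 1) * (|X.2| * |c|) * μ := by rw [hκ]; ring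
        _ ≤ 2 * Real.pi * β * (β - 1) * (|X.2| * |c|) * t ^ (β - 2) := by
          have := Real.pi_pos
          gcongr
        _ = _ := by rw [← h2]; ring)
    hA hA'
  rw [← heq] at hvdc
  have h3 : ‖curveFT β e c a X‖ ^ 2
      ≤ (((2 - 1 / 2) * A' + 2 * Real.pi * A) / √(κ * |X.2|)) ^ 2 := by gcongr
  rw [div_pow, Real.sq_sqrt (by positivity)] at h3
  calc _ ≤ ((2 - 1 / 2) * A' + 2 * Real.pi * A) ^ 2 / (κ * |X.2|) * |X.2| := by gcongr
    _ = _ := by field_simp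

section Plancherel

open FourierTransform SchwartzMap in
/-- Plancherel's theorem for the Fourier integral of integrable square-integrable functions. -/
lemma eLpNorm_fourier_eq {E : Type*} [NormedAddCommGroup E] [InnerProductSpace ℝ E]
    [FiniteDimensional ℝ E] [MeasurableSpace E] [BorelSpace E] {F : E → ℂ} (hF : Integrable F)
    (hF2 : MemLp F 2) : eLpNorm (𝓕 F) 2 = eLpNorm F 2 := by
  set h : Lp (α := E) ℂ 2 volume := 𝓕 (hF2.toLp F) with hh
  have hcont : Continuous (𝓕 F) := VectorFourier.fourierIntegral_continuous (μ := volume)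
    Real.continuous_fourierChar (L := innerₗ E) continuous_inner hF
  have hae : ∀ᵐ x, h x = 𝓕 F x := by
    refine ae_eq_of_integral_contDiff_smul_eq ((Lp.memLp h).locallyIntegrable one_le_two)
      hcont.locallyIntegrable fun g hg hgc => ?_
    have hgc' : HasCompactSupport fun x => (g x : ℂ) := 
      hgc.comp_left (g := fun y : ℝ => (y : ℂ)) Complex.ofReal_zero
    have hg' : ContDiff ℝ ((⊤ : ℕ∞) : WithTop ℕ∞) fun x => (g x : ℂ) :=
      Complex.ofRealCLM.contDiff.comp hg
    set G : 𝓢(E, ℂ) := hgc'.toSchwartzMap hg' with hG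
    have h1 : ∫ x, G x • h x = ∫ x, (𝓕 G) x • F x := by
      rw [← Lp.toTemperedDistribution_apply, hh, ← Lp.fourier_toTemperedDistribution_eq,
        TemperedDistribution.fourier_apply, Lp.toTemperedDistribution_apply]
      refine integral_congr_ae ?_
      filter_upwards [hF2.coeFn_toLp] with x hx
      rw [hx]
    have h2 : ∫ x, (𝓕 G) x • F x = ∫ x, G x • 𝓕 F x := by
      simpa using! VectorFourier.integral_bilin_fourierIntegral_eq_flip
        (ContinuousLinearMap.lsmul ℂ ℂ) (L := innerₗ E) Real.continuous_fourierChar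
        continuous_inner G.integrable hF
    simp_rw [← Complex.coe_smul]
    exact h1.trans h2
  rw [← eLpNorm_congr_ae hae]
  have h3 : ‖h‖ = ‖hF2.toLp F‖ := Lp.norm_fourier_eq _
  have h4 : ‖h‖ₑ = ‖hF2.toLp F‖ₑ := by rw [← ofReal_norm, h3, ofReal_norm]
  rw [Lp.enorm_def, Lp.enorm_def] at h4
  rw [h4, eLpNorm_congr_ae hF2.coeFn_toLp]

end Plancherel

lemma lintegral_sq_eq_eLpNorm {α : Type*} [MeasurableSpace α] {μ : Measure α} (g : α → ℂ) :
    ∫⁻ x, ‖g x‖ₑ ^ 2 ∂μ = eLpNorm g 2 μ ^ 2 := by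
  rw [eLpNorm_eq_lintegral_rpow_enorm_toReal (by norm_num) (by norm_num), ← ENNReal.rpow_natCast,
    ← ENNReal.rpow_mul]
  simp

/-- Plancherel's theorem in the plane. -/
lemma lintegral_FT_sq {g : ℝ × ℝ → ℂ} (hg : Integrable g) (hg2 : MemLp g 2) :
    ∫⁻ ξ, ‖FT g ξ‖ₑ ^ 2 = ∫⁻ x, ‖g x‖ₑ ^ 2 := by
  have hmp := WithLp.volume_preserving_ofLp ℝ ℝ
  have hmp' := WithLp.volume_preserving_toLp ℝ ℝ
  have hFT : ∀ v : WithLp 2 (ℝ × ℝ), FT g (WithLp.ofLp v)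
      = FourierTransform.fourier (fun v : WithLp 2 (ℝ × ℝ) => g (WithLp.ofLp v)) v := by
    intro v
    rw [Real.fourier_eq', FT,
      ← hmp.integral_comp (MeasurableEquiv.toLp 2 (ℝ × ℝ)).symm.measurableEmbedding]
    congr 1
    ext w
    rw [smul_eq_mul]
    congr 3
    simp [WithLp.prod_inner_apply]
    ring
  have key := eLpNorm_fourier_eq (F := fun v : WithLp 2 (ℝ × ℝ) => g (WithLp.ofLp v))
    (hmp.integrable_comp_of_integrable hg) (hg2.comp_measurePreserving hmp)
  rw [lintegral_sq_eq_eLpNorm g, ← eLpNorm_comp_measurePreserving hg2.1 hmp, Function.comp_def,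
    ← key, ← lintegral_sq_eq_eLpNorm]
  simp_rw [← hFT]
  exact (hmp.lintegral_comp ((continuous_FT hg).enorm.measurable.pow_const 2)).symm

lemma lintegral_FTinv_sq {g : ℝ × ℝ → ℂ} (hg : Integrable g) (hg2 : MemLp g 2) :
    ∫⁻ ξ, ‖FTinv g ξ‖ₑ ^ 2 = ∫⁻ x, ‖g x‖ₑ ^ 2 := by
  rw [← lintegral_FT_sq hg hg2]
  simp_rw [FTinv_eq_FT_neg]
  exact lintegral_neg_eq_self (fun x => ‖FT g x‖ₑ ^ 2)

lemma memLp_two_of_bounded {α E : Type*} [MeasurableSpace α] [NormedAddCommGroup E]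
    {μ : Measure α} {g : α → E} (hg : Integrable g μ) {B : ℝ} (hB : ∀ x, ‖g x‖ ≤ B) :
    MemLp g 2 μ := by
  refine ⟨hg.1, ?_⟩
  rw [eLpNorm_lt_top_iff_lintegral_rpow_enorm_lt_top (by norm_num) (by norm_num)]
  calc ∫⁻ x, ‖g x‖ₑ ^ (2 : ℝ≥0∞).toReal ∂μ ≤ ∫⁻ x, ENNReal.ofReal B * ‖g x‖ₑ ∂μ := by
        refine lintegral_mono fun x => ?_
        have : ‖g x‖ₑ ≤ ENNReal.ofReal B := by
          rw [← ofReal_norm]; exact ENNReal.ofReal_le_ofReal (hB x)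
        calc _ = ‖g x‖ₑ * ‖g x‖ₑ := by
              rw [ENNReal.toReal_ofNat, ENNReal.rpow_two, sq]
          _ ≤ _ := by gcongr
    _ = ENNReal.ofReal B * ∫⁻ x, ‖g x‖ₑ ∂μ := lintegral_const_mul' _ _ ENNReal.ofReal_ne_top
    _ < ⊤ := ENNReal.mul_lt_top ENNReal.ofReal_lt_top hg.2

lemma card_le_of_two_zpow_le {T : Finset ℤ} {N : ℕ}
    (h : ∀ i ∈ T, ∀ j ∈ T, (2:ℝ) ^ i ≤ 2 ^ N * (2:ℝ) ^ j) : T.card ≤ N + 1 := by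
  rcases T.eq_empty_or_nonempty with rfl | hT
  · simp
  have hsub : T ⊆ Finset.Icc (T.min' hT) (T.min' hT + N) := by
    intro i hi
    rw [Finset.mem_Icc]
    refine ⟨T.min'_le i hi, ?_⟩
    have h1 := h i hi _ (T.min'_mem hT)
    rw [← zpow_natCast, ← zpow_add₀ (by norm_num)] at h1
    have := (zpow_le_zpow_iff_right₀ (by norm_num : (1:ℝ) < 2)).1 h1
    omega
  refine (Finset.card_le_card hsub).trans ?_
  rw [Int.card_Icc]
  omega

/-- Bounded overlap and decay of the symbols. -/
lemma exists_sum_curveSymbol_sq_le {m : ℝ × ℝ → ℂ} {M r₀ R₀ K : ℝ} (hM : ∀ η, ‖m η‖ ≤ M)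
    (hr₀ : 0 < r₀) (hK : 1 ≤ K)
    (hsupp : ∀ η, m η ≠ 0 → r₀ ≤ |η.1| ∧ |η.1| ≤ R₀ ∧ r₀ ≤ |η.2| ∧ |η.2| ≤ R₀)
    {a : ℝ → ℝ} (ha : ContDiff ℝ ((⊤ : ℕ∞) : WithTop ℕ∞) a)
    (hasupp : ∀ t, t ∉ Icc (1 / 2 : ℝ) 2 → a t = 0) {β : ℝ} (hβ : 1 < β) (e : ℝ) {c : ℝ}
    (hc : c ≠ 0) :
    ∃ C : ℝ≥0, ∀ (l : ℕ) (σ : ℤ × ℤ → ℝ), (∀ α, σ α ∈ Icc K⁻¹ K) → ∀ (S : Finset (ℤ × ℤ)) ξ,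
      ∑ α ∈ S, ‖curveSymbol m a β e c l (σ α) α.1 α.2 ξ‖ ^ 2 ≤ C * ((2:ℝ) ^ l)⁻¹ := by
  obtain ⟨C, hC0, hC⟩ := exists_curveFT_decay ha hasupp hβ e hc
  have hK0 : 0 < K := by linarith
  obtain ⟨N, hN⟩ := pow_unbounded_of_one_lt (K ^ 2 * R₀ / r₀) (one_lt_two (α := ℝ))
  refine ⟨((N + 1) * (N + 1) * (M ^ 2 * (C / r₀))).toNNReal, fun l σ hσ S ξ => ?_⟩
  rw [Real.coe_toNNReal _ (by positivity)]
  set S' := S.filter fun α : ℤ × ℤ => m ((2:ℝ) ^ (-(α.1 + l)) * ξ.1, (2:ℝ) ^ (-(α.2 + l)) * σ α * ξ.2) ≠ 0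
    with hS'
  have hσ0 : ∀ α, 0 < σ α := fun α => lt_of_lt_of_le (inv_pos.2 hK0) (hσ α).1
  have hfac : ∀ α ∈ S', r₀ * (2:ℝ) ^ (α.1 + l) ≤ |ξ.1| ∧ |ξ.1| ≤ R₀ * (2:ℝ) ^ (α.1 + l)
      ∧ r₀ * (2:ℝ) ^ (α.2 + l) ≤ σ α * |ξ.2| ∧ σ α * |ξ.2| ≤ R₀ * (2:ℝ) ^ (α.2 + l) := by
    intro α hα
    obtain ⟨h1, h2, h3, h4⟩ := hsupp _ (Finset.mem_filter.1 hα).2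
    have p1 : (0:ℝ) < 2 ^ (α.1 + l) := by positivity
    have p2 : (0:ℝ) < 2 ^ (α.2 + l) := by positivity
    simp only [abs_mul, zpow_neg, abs_inv, abs_of_pos p1, abs_of_pos p2, abs_of_pos (hσ0 α),
      mul_assoc] at h1 h2 h3 h4
    rw [le_inv_mul_iff₀ p1] at h1
    rw [le_inv_mul_iff₀ p2] at h3
    rw [inv_mul_le_iff₀ p1] at h2
    rw [inv_mul_le_iff₀ p2] at h4
    refine ⟨?_, ?_, ?_, ?_⟩ <;> linarith
  have hR₀ : ∀ α ∈ S', 0 < R₀ := by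
    intro α hα
    obtain ⟨h1, h2, -, -⟩ := hfac α hα
    have p1 : (0:ℝ) < 2 ^ (α.1 + l) := by positivity
    have h5 : r₀ * (2:ℝ) ^ (α.1 + l) ≤ R₀ * (2:ℝ) ^ (α.1 + l) := h1.trans h2
    linarith [le_of_mul_le_mul_right h5 p1]
  have hcard : S'.card ≤ (N + 1) * (N + 1) := by
    have hsub : S' ⊆ S'.image Prod.fst ×ˢ S'.image Prod.snd := by
      intro α hα
      exact Finset.mem_product.2 ⟨Finset.mem_image_of_mem _ hα, Finset.mem_image_of_mem _ hα⟩
    refine (Finset.card_le_card hsub).trans ?_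
    rw [Finset.card_product]
    have h2l : (0:ℝ) < 2 ^ (l : ℤ) := by positivity
    refine Nat.mul_le_mul (card_le_of_two_zpow_le ?_) (card_le_of_two_zpow_le ?_)
    · intro i hi j hj
      obtain ⟨α, hα, rfl⟩ := Finset.mem_image.1 hi
      obtain ⟨α', hα', rfl⟩ := Finset.mem_image.1 hj
      have h1 := (hfac α hα).1
      have h2 := (hfac α' hα').2.1
      have hR := hR₀ α hα
      rw [zpow_add₀ (by norm_num)] at h1 h2
      have h3 : (2:ℝ) ^ α.1 * r₀ ≤ R₀ * (2:ℝ) ^ α'.1 := by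
        refine le_of_mul_le_mul_right ?_ h2l
        linarith
      rw [← le_div_iff₀ hr₀] at h3
      refine h3.trans ?_
      have h4 : R₀ / r₀ ≤ 2 ^ N := by
        refine le_trans ?_ hN.le
        gcongr
        calc R₀ = 1 ^ 2 * R₀ := by ring
          _ ≤ _ := by gcongr
      calc _ = R₀ / r₀ * (2:ℝ) ^ α'.1 := by ring
        _ ≤ _ := by gcongr
    · intro i hi j hj
      obtain ⟨α, hα, rfl⟩ := Finset.mem_image.1 hi
      obtain ⟨α', hα', rfl⟩ := Finset.mem_image.1 hj
      have h1 := (hfac α hα).2.2.1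
      have h2 := (hfac α' hα').2.2.2
      have hR := hR₀ α hα
      rw [zpow_add₀ (by norm_num)] at h1 h2
      have h5 : σ α * |ξ.2| ≤ K ^ 2 * (σ α' * |ξ.2|) := by
        have h6 : σ α ≤ K ^ 2 * σ α' := by
          calc σ α ≤ K := (hσ α).2
            _ = K ^ 2 * K⁻¹ := by field_simp
            _ ≤ _ := by gcongr; exact (hσ α').1
        calc _ ≤ (K ^ 2 * σ α') * |ξ.2| := by gcongr
          _ = _ := by ring
      have h3 : (2:ℝ) ^ α.2 * r₀ ≤ K ^ 2 * R₀ * (2:ℝ) ^ α'.2 := by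
        refine le_of_mul_le_mul_right ?_ h2l
        have h7 : K ^ 2 * (σ α' * |ξ.2|) ≤ K ^ 2 * (R₀ * ((2:ℝ) ^ α'.2 * 2 ^ (l : ℤ))) := by
          gcongr
        linarith
      rw [← le_div_iff₀ hr₀] at h3
      refine h3.trans ?_
      calc _ = K ^ 2 * R₀ / r₀ * (2:ℝ) ^ α'.2 := by ring
        _ ≤ _ := by gcongr
  have hterm : ∀ α ∈ S', ‖curveSymbol m a β e c l (σ α) α.1 α.2 ξ‖ ^ 2
      ≤ M ^ 2 * (C / r₀) * ((2:ℝ) ^ l)⁻¹ := by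
    intro α hα
    have h3 := (hfac α hα).2.2.1
    rw [curveSymbol, norm_mul, mul_pow, mul_assoc (M ^ 2)]
    gcongr ?_ ^ 2 * ?_
    · exact hM _
    have hX := hC ((2:ℝ) ^ (-α.1) * ξ.1, (2:ℝ) ^ (-α.2) * σ α * ξ.2)
    have hlow : r₀ * 2 ^ l ≤ |(2:ℝ) ^ (-α.2) * σ α * ξ.2| := by
      have p2 : (0:ℝ) < 2 ^ α.2 := by positivity
      rw [abs_mul, abs_mul, abs_of_pos (hσ0 α), zpow_neg, abs_inv, abs_of_pos p2, mul_assoc,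
        le_inv_mul_iff₀ p2]
      rw [zpow_add₀ (by norm_num), zpow_natCast] at h3
      linarith
    have h4 : ‖curveFT β e c a ((2:ℝ) ^ (-α.1) * ξ.1, (2:ℝ) ^ (-α.2) * σ α * ξ.2)‖ ^ 2
        * (r₀ * 2 ^ l) ≤ C := by
      refine le_trans ?_ hX
      gcongr
    rw [← le_div_iff₀ (by positivity)] at h4
    refine h4.trans_eq ?_
    field_simp
  have hzero : ∑ α ∈ S, ‖curveSymbol m a β e c l (σ α) α.1 α.2 ξ‖ ^ 2
      = ∑ α ∈ S', ‖curveSymbol m a β e c l (σ α) α.1 α.2 ξ‖ ^ 2 := by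
    rw [hS', Finset.sum_filter_of_ne]
    intro α _ h h0
    apply h
    rw [curveSymbol, h0]; simp
  rw [hzero]
  refine (Finset.sum_le_card_nsmul _ _ _ hterm).trans ?_
  rw [nsmul_eq_mul, ← mul_assoc]
  gcongr
  exact_mod_cast hcard

lemma exists_curveSymbol_regular {m : ℝ × ℝ → ℂ} (hmi : Integrable m) {M : ℝ}
    (hM : ∀ η, ‖m η‖ ≤ M) {a : ℝ → ℝ} (ha : Integrable a) (β e c : ℝ) (l : ℕ) {σ : ℝ}
    (hσ : 0 < σ) (j k : ℤ) :
    Integrable (curveSymbol m a β e c l σ j k) ∧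
      ∃ B, ∀ ξ, ‖curveSymbol m a β e c l σ j k ξ‖ ≤ B := by
  constructor
  · exact integrable_mul_curveFT β e c _ _ ha
      (integrable_dil (F := m) (by positivity) (by positivity) hmi)
  · refine ⟨M * ∫ t, ‖(a t : ℂ)‖, fun ξ => ?_⟩
    rw [curveSymbol, norm_mul]
    have hM0 : 0 ≤ M := (norm_nonneg _).trans (hM 0)
    gcongr
    · exact hM _
    · simpa using norm_curveFT_le β e c a _

lemma integrable_curveSymbol_mul_FT {m : ℝ × ℝ → ℂ} (hmi : Integrable m) {M : ℝ}
    (hM : ∀ η, ‖m η‖ ≤ M) {a : ℝ → ℝ} (ha : Integrable a) (β e c : ℝ) (l : ℕ) {σ : ℝ}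
    (hσ : 0 < σ) (j k : ℤ) {f : ℝ × ℝ → ℝ} (hf : Integrable f) :
    Integrable (fun ξ => curveSymbol m a β e c l σ j k ξ * FT (fun x => ((f x : ℝ) : ℂ)) ξ)
      ∧ MemLp (fun ξ => curveSymbol m a β e c l σ j k ξ * FT (fun x => ((f x : ℝ) : ℂ)) ξ) 2 := by
  obtain ⟨h1, B, hB⟩ := exists_curveSymbol_regular hmi hM ha β e c l hσ j k
  have hfc : Integrable fun x => ((f x : ℝ) : ℂ) := hf.ofReal
  have h2 : Integrable
      (fun ξ => curveSymbol m a β e c l σ j k ξ * FT (fun x => ((f x : ℝ) : ℂ)) ξ) :=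
    h1.mul_bdd (c := ∫ x, ‖((f x : ℝ) : ℂ)‖) (continuous_FT hfc).aestronglyMeasurable
      (Eventually.of_forall fun ξ => norm_FT_le _ ξ)
  refine ⟨h2, memLp_two_of_bounded h2 (B := B * ∫ x, ‖((f x : ℝ) : ℂ)‖) fun ξ => ?_⟩
  have hB0 : 0 ≤ B := (norm_nonneg _).trans (hB 0)
  rw [norm_mul]
  gcongr
  · exact hB ξ
  · exact norm_FT_le _ ξ

lemma continuous_curveOp {m : ℝ × ℝ → ℂ} (hmi : Integrable m) {M : ℝ}
    (hM : ∀ η, ‖m η‖ ≤ M) {a : ℝ → ℝ} (ha : Integrable a) (β e c : ℝ) (l : ℕ) {σ : ℝ}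
    (hσ : 0 < σ) (j k : ℤ) {f : ℝ × ℝ → ℝ} (hf : Integrable f) :
    Continuous (curveOp m a β e c l σ j k f) :=
  continuous_FTinv (integrable_curveSymbol_mul_FT hmi hM ha β e c l hσ j k hf).1

/-- The square function estimate on `L²`. -/
lemma exists_lintegral_sum_curveOp_sq_le {m : ℝ × ℝ → ℂ} (hmi : Integrable m) {M r₀ R₀ K : ℝ}
    (hM : ∀ η, ‖m η‖ ≤ M) (hr₀ : 0 < r₀) (hK : 1 ≤ K)
    (hsupp : ∀ η, m η ≠ 0 → r₀ ≤ |η.1| ∧ |η.1| ≤ R₀ ∧ r₀ ≤ |η.2| ∧ |η.2| ≤ R₀)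
    {a : ℝ → ℝ} (ha : ContDiff ℝ ((⊤ : ℕ∞) : WithTop ℕ∞) a)
    (hasupp : ∀ t, t ∉ Icc (1 / 2 : ℝ) 2 → a t = 0) {β : ℝ} (hβ : 1 < β) (e : ℝ) {c : ℝ}
    (hc : c ≠ 0) :
    ∃ C : ℝ≥0, ∀ (l : ℕ) (σ : ℤ × ℤ → ℝ), (∀ α, σ α ∈ Icc K⁻¹ K) → ∀ (S : Finset (ℤ × ℤ))
      (f : ℝ × ℝ → ℝ), Integrable f → (∃ B, ∀ x, ‖f x‖ ≤ B) →
      ∫⁻ x, ∑ α ∈ S, ‖curveOp m a β e c l (σ α) α.1 α.2 f x‖ₑ ^ 2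
        ≤ C * ((2:ℝ≥0∞) ^ l)⁻¹ * ∫⁻ x, ‖f x‖ₑ ^ 2 := by
  obtain ⟨C, hC⟩ := exists_sum_curveSymbol_sq_le hM hr₀ hK hsupp ha hasupp hβ e hc
  have hai : Integrable a := ha.continuous.integrable_of_hasCompactSupport
    (HasCompactSupport.intro isCompact_Icc fun t ht => hasupp t ht)
  refine ⟨C, fun l σ hσ S f hf ⟨B, hB⟩ => ?_⟩
  have hσ0 : ∀ α, 0 < σ α := fun α => lt_of_lt_of_le (inv_pos.2 (by linarith)) (hσ α).1
  have hfc : Integrable fun x => ((f x : ℝ) : ℂ) := hf.ofReal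
  have hFT : Continuous (FT fun x => ((f x : ℝ) : ℂ)) := continuous_FT hfc
  rw [lintegral_finsetSum _ fun α _ =>
    ((continuous_curveOp hmi hM hai β e c l (hσ0 α) α.1 α.2 hf).enorm.measurable.pow_const 2)]
  have h1 : ∀ α, ∫⁻ x, ‖curveOp m a β e c l (σ α) α.1 α.2 f x‖ₑ ^ 2
      = ∫⁻ ξ, ‖curveSymbol m a β e c l (σ α) α.1 α.2 ξ
        * FT (fun x => ((f x : ℝ) : ℂ)) ξ‖ₑ ^ 2 := fun α => by
    have := integrable_curveSymbol_mul_FT hmi hM hai β e c l (hσ0 α) α.1 α.2 hf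
    exact lintegral_FTinv_sq this.1 this.2
  simp_rw [h1]
  rw [← lintegral_finsetSum' _ fun α _ =>
    ((integrable_curveSymbol_mul_FT hmi hM hai β e c l (hσ0 α) α.1 α.2
      hf).1.aestronglyMeasurable.enorm.pow_const 2)]
  calc _ ≤ ∫⁻ ξ, (C * ((2:ℝ≥0∞) ^ l)⁻¹) * ‖FT (fun x => ((f x : ℝ) : ℂ)) ξ‖ₑ ^ 2 := by
        refine lintegral_mono fun ξ => ?_
        simp_rw [enorm_mul, mul_pow]
        rw [← Finset.sum_mul]
        gcongr
        have h2 := ENNReal.ofReal_le_ofReal (hC l σ hσ S ξ)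
        rw [ENNReal.ofReal_sum_of_nonneg fun _ _ => by positivity,
          ENNReal.ofReal_mul (by positivity), ENNReal.ofReal_inv_of_pos (by positivity),
          ENNReal.ofReal_pow (by norm_num)] at h2
        simpa [ENNReal.ofReal_pow, ofReal_norm] using h2
    _ = C * ((2:ℝ≥0∞) ^ l)⁻¹ * ∫⁻ ξ, ‖FT (fun x => ((f x : ℝ) : ℂ)) ξ‖ₑ ^ 2 :=
        lintegral_const_mul _ (hFT.enorm.measurable.pow_const 2)
    _ = _ := by
        rw [lintegral_FT_sq hfc (memLp_two_of_bounded hfc (B := B)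
          fun x => by rw [Complex.norm_real]; exact hB x)]
        congr 2
        ext x
        rw [← ofReal_norm, Complex.norm_real, ofReal_norm]

/-- The mass of a Marcinkiewicz-type average of a minimum. -/
def minMass (η : ℝ) : ℝ≥0∞ :=
  ∫⁻ t in Ioi (0:ℝ), min 1 (ENNReal.ofReal t) * ENNReal.ofReal (t ^ (-η - 1))

lemma minMass_ne_zero (η : ℝ) : minMass η ≠ 0 := by
  rw [minMass, ← lintegral_indicator measurableSet_Ioi]
  intro h
  rw [lintegral_eq_zero_iff (by fun_prop (disch := exact measurableSet_Ioi))] at h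
  have h1 : volume (Ioi (0:ℝ)) = 0 := by
    refine measure_mono_null (fun t ht => ?_) (ae_iff.1 h)
    have ht0 : (0:ℝ) < t := ht
    have h2 : 0 < t ^ (-η - 1) := Real.rpow_pos_of_pos ht0 _
    change ¬ _ = _
    rw [indicator_of_mem ht]
    simp [h2, ht0]
  simp at h1

lemma minMass_ne_top {η : ℝ} (h0 : 0 < η) (h1 : η < 1) : minMass η ≠ ⊤ := by
  have hu : Ioi (0:ℝ) = Ioc 0 1 ∪ Ioi 1 := (Ioc_union_Ioi_eq_Ioi zero_le_one).symm
  rw [minMass, hu]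
  refine ((lintegral_union_le _ _ _).trans_lt (ENNReal.add_lt_top.2 ⟨?_, ?_⟩)).ne
  · have hi : IntegrableOn (fun t : ℝ => t ^ (-η)) (Ioc 0 1) := by
      rw [← intervalIntegrable_iff_integrableOn_Ioc_of_le zero_le_one]
      exact intervalIntegral.intervalIntegrable_rpow' (by linarith)
    refine lt_of_le_of_lt ?_ hi.2
    refine setLIntegral_mono' measurableSet_Ioc fun t ht => ?_
    have e : t * t ^ (-η - 1) = t ^ (-η) := by
      rw [Real.rpow_sub_one ht.1.ne']; field_simp [ht.1.ne']
    calc _ ≤ ENNReal.ofReal t * ENNReal.ofReal (t ^ (-η - 1)) := by gcongr; exact min_le_right _ _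
      _ = ENNReal.ofReal (t ^ (-η)) := by rw [← ENNReal.ofReal_mul ht.1.le, e]
      _ ≤ _ := Real.ofReal_le_enorm _
  · have hi : IntegrableOn (fun t : ℝ => t ^ (-η - 1)) (Ioi 1) :=
      integrableOn_Ioi_rpow_of_lt (by linarith) one_pos
    refine lt_of_le_of_lt ?_ hi.2
    refine setLIntegral_mono' measurableSet_Ioi fun t _ => ?_
    calc _ ≤ 1 * ENNReal.ofReal (t ^ (-η - 1)) := by gcongr; exact min_le_left _ _
      _ = ENNReal.ofReal (t ^ (-η - 1)) := one_mul _
      _ ≤ _ := Real.ofReal_le_enorm _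

lemma lintegral_min_mul {η : ℝ} (h0 : 0 < η) (h1 : η < 1) {A B : ℝ≥0∞} (hA : A ≠ ⊤)
    (hB : B ≠ ⊤) :
    ∫⁻ t in Ioi (0:ℝ), min A (ENNReal.ofReal t * B) * ENNReal.ofReal (t ^ (-η - 1))
      = minMass η * (A ^ (1 - η) * B ^ η) := by
  by_cases hA0 : A = 0
  · simp [hA0, ENNReal.zero_rpow_of_pos (by linarith : 0 < 1 - η)]
  by_cases hB0 : B = 0
  · simp [hB0, ENNReal.zero_rpow_of_pos h0]
  have ha : 0 < A.toReal := ENNReal.toReal_pos hA0 hA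
  have hb : 0 < B.toReal := ENNReal.toReal_pos hB0 hB
  set s := B.toReal / A.toReal with hs
  have hs0 : 0 < s := by positivity
  have key := lintegral_affine (g := (Ioi (0:ℝ)).indicator fun t =>
    min 1 (ENNReal.ofReal t) * ENNReal.ofReal (t ^ (-η - 1)))
    ((by fun_prop : Measurable fun t : ℝ =>
      min 1 (ENNReal.ofReal t) * ENNReal.ofReal (t ^ (-η - 1))).indicator measurableSet_Ioi) 0 hs0
  rw [lintegral_indicator measurableSet_Ioi] at key
  change _ = _ * minMass η at key
  have hpt : ∀ t : ℝ, (Ioi (0:ℝ)).indicator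
      (fun t => min A (ENNReal.ofReal t * B) * ENNReal.ofReal (t ^ (-η - 1))) t
      = A * ENNReal.ofReal (s ^ (η + 1)) * (Ioi (0:ℝ)).indicator (fun t =>
        min 1 (ENNReal.ofReal t) * ENNReal.ofReal (t ^ (-η - 1))) (0 + s * t) := by
    intro t
    by_cases ht : t ∈ Ioi (0:ℝ)
    · have ht0 : 0 < t := ht
      have hst : 0 + s * t ∈ Ioi (0:ℝ) := by
        simp only [mem_Ioi]; positivity
      rw [indicator_of_mem ht, indicator_of_mem hst, zero_add]
      have e1 : A * ENNReal.ofReal (s * t) = ENNReal.ofReal t * B := by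
        rw [← ENNReal.ofReal_toReal hA, ← ENNReal.ofReal_toReal hB,
          ← ENNReal.ofReal_mul ha.le, ← ENNReal.ofReal_mul ht0.le]
        congr 1
        rw [hs]; field_simp
      have e2 : ENNReal.ofReal (s ^ (η + 1)) * ENNReal.ofReal ((s * t) ^ (-η - 1))
          = ENNReal.ofReal (t ^ (-η - 1)) := by
        rw [← ENNReal.ofReal_mul (by positivity), Real.mul_rpow hs0.le ht0.le, ← mul_assoc,
          ← Real.rpow_add hs0]
        simp
      calc _ = min (A * 1) (A * ENNReal.ofReal (s * t)) * ENNReal.ofReal (t ^ (-η - 1)) := by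
            rw [mul_one, e1]
        _ = A * min 1 (ENNReal.ofReal (s * t)) * (ENNReal.ofReal (s ^ (η + 1))
            * ENNReal.ofReal ((s * t) ^ (-η - 1))) := by
            rw [e2, mul_min]
        _ = _ := by ring
    · have hst : 0 + s * t ∉ Ioi (0:ℝ) := by
        simp only [mem_Ioi, not_lt] at ht ⊢
        rw [zero_add]
        exact mul_nonpos_of_nonneg_of_nonpos hs0.le ht
      rw [indicator_of_notMem ht, indicator_of_notMem hst, mul_zero]
  rw [← lintegral_indicator measurableSet_Ioi]
  simp_rw [hpt]
  rw [lintegral_const_mul' _ _ (ENNReal.mul_ne_top hA ENNReal.ofReal_ne_top), key, ← mul_assoc,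
    mul_comm (minMass η)]
  congr 1
  rw [mul_assoc, ← ENNReal.ofReal_mul (by positivity)]
  have e3 : s ^ (η + 1) * s⁻¹ = s ^ η := by
    rw [Real.rpow_add_one hs0.ne']; field_simp
  rw [e3]
  have e4 : A ^ (1 - η) * B ^ η = ENNReal.ofReal (A.toReal ^ (1 - η) * B.toReal ^ η) := by
    rw [ENNReal.ofReal_mul (by positivity), ← ENNReal.ofReal_rpow_of_pos ha,
      ← ENNReal.ofReal_rpow_of_pos hb, ENNReal.ofReal_toReal hA, ENNReal.ofReal_toReal hB]
  have e5 : A = ENNReal.ofReal A.toReal := (ENNReal.ofReal_toReal hA).symm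
  have e6 : A * ENNReal.ofReal (s ^ η) = ENNReal.ofReal (A.toReal * s ^ η) := by
    rw [ENNReal.ofReal_mul ha.le, ← e5]
  rw [e4, e6]
  congr 1
  rw [hs, Real.div_rpow hb.le ha.le, Real.rpow_sub ha, Real.rpow_one]
  ring

lemma min_add_rpow_le (a b t : ℝ≥0∞) {q : ℝ} (hq : 0 ≤ q) (hq2 : q ≤ 2) :
    min ((a + b) ^ q) (t * (a + b) ^ (2:ℝ)) ≤ 4 * (a ^ q + t * b ^ (2:ℝ)) := by
  have h4 : (2:ℝ≥0∞) ^ (2:ℝ) = 4 := by rw [ENNReal.rpow_two]; norm_num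
  have h4' : (2:ℝ≥0∞) ^ q ≤ 4 := by
    rw [← h4]; exact ENNReal.rpow_le_rpow_of_exponent_le (by norm_num) hq2
  rcases le_total b a with h | h
  · calc _ ≤ (a + b) ^ q := min_le_left _ _
      _ ≤ (2 * a) ^ q := by
        gcongr
        rw [two_mul]; gcongr
      _ = 2 ^ q * a ^ q := ENNReal.mul_rpow_of_nonneg _ _ hq
      _ ≤ 4 * (a ^ q + t * b ^ (2:ℝ)) := by gcongr; exact le_self_add
  · calc _ ≤ t * (a + b) ^ (2:ℝ) := min_le_right _ _
      _ ≤ t * (2 * b) ^ (2:ℝ) := by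
        gcongr
        rw [two_mul]; gcongr
      _ = 4 * (t * b ^ (2:ℝ)) := by
        rw [ENNReal.mul_rpow_of_nonneg _ _ (by norm_num), h4]; ring
      _ ≤ 4 * (a ^ q + t * b ^ (2:ℝ)) := by gcongr; exact le_add_self

/-- Real interpolation of a sublinear operator between two strong-type bounds, with a constant
that does not blow up at the endpoints. -/
lemma interpolate_strong_type {T : (ℝ × ℝ → ℝ) → ℝ × ℝ → ℝ≥0∞} {A₀ A₁ : ℝ≥0∞} {q η : ℝ}
    (hq : 1 ≤ q) (hq2 : q ≤ 2) (h0 : 0 < η) (h1 : η < 1)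
    (hA₀ : A₀ ≠ ⊤) (hA₁ : A₁ ≠ ⊤)
    (hmeas : ∀ f, Integrable f → Measurable (T f))
    (hfin : ∀ f x, T f x ≠ ⊤)
    (hadd : ∀ f g, Integrable f → Integrable g → ∀ x, T (fun y => f y + g y) x ≤ T f x + T g x)
    (hT₀ : ∀ f, Measurable f → Integrable f → (∃ B, ∀ x, ‖f x‖ ≤ B) →
      ∫⁻ x, T f x ^ q ≤ A₀ * ∫⁻ x, ‖f x‖ₑ ^ q)
    (hT₁ : ∀ f, Measurable f → Integrable f → (∃ B, ∀ x, ‖f x‖ ≤ B) →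
      ∫⁻ x, T f x ^ (2:ℝ) ≤ A₁ * ∫⁻ x, ‖f x‖ₑ ^ (2:ℝ))
    {f : ℝ × ℝ → ℝ} (hf : Measurable f) (hfi : Integrable f) (hfb : ∃ B, ∀ x, ‖f x‖ ≤ B) :
    ∫⁻ x, T f x ^ (q * (1 - η) + 2 * η)
      ≤ 4 * (A₀ ^ (1 - η) * A₁ ^ η) * ∫⁻ x, ‖f x‖ₑ ^ (q * (1 - η) + 2 * η) := by
  have hq0 : 0 ≤ q := by linarith
  have hη : 0 ≤ 1 - η := by linarith
  have hTm := hmeas f hfi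
  have hexp : ∀ y : ℝ≥0∞, (y ^ q) ^ (1 - η) * (y ^ (2:ℝ)) ^ η = y ^ (q * (1 - η) + 2 * η) := by
    intro y
    rw [← ENNReal.rpow_mul, ← ENNReal.rpow_mul, ENNReal.rpow_add_of_nonneg _ _ (by positivity)
      (by positivity)]
  have hbound : ∀ t : ℝ, ∫⁻ x, min (T f x ^ q) (ENNReal.ofReal t * T f x ^ (2:ℝ))
      ≤ 4 * ∫⁻ x, min (A₀ * ‖f x‖ₑ ^ q) (ENNReal.ofReal t * (A₁ * ‖f x‖ₑ ^ (2:ℝ))) := by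
    intro t
    set E : Set (ℝ × ℝ) := {x | A₀ * ‖f x‖ₑ ^ q ≤ ENNReal.ofReal t * (A₁ * ‖f x‖ₑ ^ (2:ℝ))}
      with hE
    have hEm : MeasurableSet E := measurableSet_le (by fun_prop) (by fun_prop)
    obtain ⟨B, hB⟩ := hfb
    have hbd : ∀ (s : Set (ℝ × ℝ)) x, ‖s.indicator f x‖ ≤ B := fun s x =>
      (norm_indicator_le_norm_self _ _).trans (hB x)
    have hsum : f = fun y => E.indicator f y + Eᶜ.indicator f y := by
      ext y
      exact (congrFun (indicator_self_add_compl E f) y).symm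
    have hTm₀ := hmeas _ (hfi.indicator hEm)
    have hTm₁ := hmeas _ (hfi.indicator hEm.compl)
    calc _ ≤ ∫⁻ x, 4 * (T (E.indicator f) x ^ q
          + ENNReal.ofReal t * T (Eᶜ.indicator f) x ^ (2:ℝ)) := by
          refine lintegral_mono fun x => ?_
          refine le_trans ?_ (min_add_rpow_le _ _ _ hq0 hq2)
          have h := hadd _ _ (hfi.indicator hEm) (hfi.indicator hEm.compl) x
          rw [← hsum] at h
          gcongr
      _ = 4 * (∫⁻ x, T (E.indicator f) x ^ q)
          + 4 * (ENNReal.ofReal t * ∫⁻ x, T (Eᶜ.indicator f) x ^ (2:ℝ)) := by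
          rw [lintegral_const_mul _ (by fun_prop), lintegral_add_left (by fun_prop),
            lintegral_const_mul _ (by fun_prop), mul_add]
      _ ≤ 4 * (A₀ * ∫⁻ x, ‖E.indicator f x‖ₑ ^ q)
          + 4 * (ENNReal.ofReal t * (A₁ * ∫⁻ x, ‖Eᶜ.indicator f x‖ₑ ^ (2:ℝ))) := by
          gcongr 4 * ?_ + 4 * (_ * ?_)
          · exact hT₀ _ (hf.indicator hEm) (hfi.indicator hEm) ⟨B, hbd _⟩
          · exact hT₁ _ (hf.indicator hEm.compl) (hfi.indicator hEm.compl) ⟨B, hbd _⟩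
      _ = 4 * ∫⁻ x, (A₀ * ‖E.indicator f x‖ₑ ^ q
          + ENNReal.ofReal t * (A₁ * ‖Eᶜ.indicator f x‖ₑ ^ (2:ℝ))) := by
          have m0 : Measurable fun x => ‖E.indicator f x‖ₑ := (hf.indicator hEm).enorm
          have m1 : Measurable fun x => ‖Eᶜ.indicator f x‖ₑ := (hf.indicator hEm.compl).enorm
          rw [lintegral_add_left (by fun_prop), lintegral_const_mul _ (by fun_prop),
            lintegral_const_mul _ (by fun_prop), lintegral_const_mul _ (by fun_prop), mul_add]
      _ ≤ _ := by
          gcongr 4 * ?_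
          refine lintegral_mono fun x => ?_
          by_cases hx : x ∈ E
          · have hx' : x ∉ Eᶜ := fun h => h hx
            rw [indicator_of_mem hx, indicator_of_notMem hx', min_eq_left hx]
            simp
          · have hx' : x ∈ Eᶜ := hx
            have hx2 : ENNReal.ofReal t * (A₁ * ‖f x‖ₑ ^ (2:ℝ)) ≤ A₀ * ‖f x‖ₑ ^ q := by
              by_contra h
              exact hx (not_le.1 h).le
            rw [indicator_of_notMem hx, indicator_of_mem hx', min_eq_right hx2]
            have : (0:ℝ) < q := by linarith
            simp [ENNReal.zero_rpow_of_pos this]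
  have hL : ∫⁻ t in Ioi (0:ℝ), (∫⁻ x, min (T f x ^ q) (ENNReal.ofReal t * T f x ^ (2:ℝ)))
      * ENNReal.ofReal (t ^ (-η - 1)) = minMass η * ∫⁻ x, T f x ^ (q * (1 - η) + 2 * η) := by
    have hw : ∀ t : ℝ, (∫⁻ x, min (T f x ^ q) (ENNReal.ofReal t * T f x ^ (2:ℝ)))
        * ENNReal.ofReal (t ^ (-η - 1))
        = ∫⁻ x, min (T f x ^ q) (ENNReal.ofReal t * T f x ^ (2:ℝ))
          * ENNReal.ofReal (t ^ (-η - 1)) := fun t => (lintegral_mul_const _ (by fun_prop)).symm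
    simp_rw [hw]
    rw [lintegral_lintegral_swap (by fun_prop), ← lintegral_const_mul _ (by fun_prop)]
    refine lintegral_congr fun x => ?_
    rw [lintegral_min_mul h0 h1 (ENNReal.rpow_ne_top_of_nonneg hq0 (hfin f x))
      (ENNReal.rpow_ne_top_of_nonneg (by norm_num) (hfin f x)), hexp]
  have hR : ∫⁻ t in Ioi (0:ℝ), (∫⁻ x, min (A₀ * ‖f x‖ₑ ^ q)
      (ENNReal.ofReal t * (A₁ * ‖f x‖ₑ ^ (2:ℝ)))) * ENNReal.ofReal (t ^ (-η - 1))
      = minMass η * (A₀ ^ (1 - η) * A₁ ^ η * ∫⁻ x, ‖f x‖ₑ ^ (q * (1 - η) + 2 * η)) := by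
    have hw : ∀ t : ℝ, (∫⁻ x, min (A₀ * ‖f x‖ₑ ^ q)
        (ENNReal.ofReal t * (A₁ * ‖f x‖ₑ ^ (2:ℝ)))) * ENNReal.ofReal (t ^ (-η - 1))
        = ∫⁻ x, min (A₀ * ‖f x‖ₑ ^ q) (ENNReal.ofReal t * (A₁ * ‖f x‖ₑ ^ (2:ℝ)))
          * ENNReal.ofReal (t ^ (-η - 1)) := fun t => (lintegral_mul_const _ (by fun_prop)).symm
    simp_rw [hw]
    rw [lintegral_lintegral_swap (by fun_prop), ← lintegral_const_mul _ (by fun_prop),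
      ← lintegral_const_mul _ (by fun_prop)]
    refine lintegral_congr fun x => ?_
    rw [lintegral_min_mul h0 h1
      (ENNReal.mul_ne_top hA₀ (ENNReal.rpow_ne_top_of_nonneg hq0 enorm_ne_top))
      (ENNReal.mul_ne_top hA₁ (ENNReal.rpow_ne_top_of_nonneg (by norm_num) enorm_ne_top)),
      ENNReal.mul_rpow_of_nonneg _ _ hη, ENNReal.mul_rpow_of_nonneg _ _ h0.le, ← hexp]
    ring
  rw [← ENNReal.mul_le_mul_iff_right (minMass_ne_zero η) (minMass_ne_top h0 h1), ← hL]
  calc _ ≤ ∫⁻ t in Ioi (0:ℝ), 4 * ((∫⁻ x, min (A₀ * ‖f x‖ₑ ^ q)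
      (ENNReal.ofReal t * (A₁ * ‖f x‖ₑ ^ (2:ℝ)))) * ENNReal.ofReal (t ^ (-η - 1))) := by
        refine lintegral_mono fun t => ?_
        rw [← mul_assoc]
        gcongr ?_ * _
        exact hbound t
    _ = _ := by
        rw [lintegral_const_mul' _ _ (by norm_num), hR]
        ring

lemma rpow_inv_self_le_two {x : ℝ} (hx : 1 ≤ x) : x ^ (1 / x) ≤ 2 := by
  have h0 : 0 < x := by linarith
  have h1 : x ≤ (2:ℝ) ^ x := by
    have := one_add_mul_self_le_rpow_one_add (s := 1) (by norm_num) hx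
    norm_num at this
    linarith
  calc x ^ (1 / x) ≤ ((2:ℝ) ^ x) ^ (1 / x) := Real.rpow_le_rpow h0.le h1 (by positivity)
    _ = 2 := by rw [← Real.rpow_mul (by norm_num), mul_one_div_cancel h0.ne', Real.rpow_one]

lemma rpow_six_mul_le {x : ℝ} (hx : 0 ≤ x) : x ^ 6 * (2:ℝ) ^ (-(x / 2)) ≤ 12 ^ 6 := by
  have h1 : x / 12 ≤ (2:ℝ) ^ (x / 12) := by
    rcases le_total (x / 12) 1 with h | h
    · exact h.trans (Real.one_le_rpow (by norm_num) (by positivity))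
    · have := one_add_mul_self_le_rpow_one_add (s := 1) (by norm_num) h
      norm_num at this
      linarith
  have h2 : x ^ 6 ≤ 12 ^ 6 * (2:ℝ) ^ (x / 2) := by
    calc x ^ 6 = 12 ^ 6 * (x / 12) ^ 6 := by ring
      _ ≤ 12 ^ 6 * ((2:ℝ) ^ (x / 12)) ^ 6 := by gcongr
      _ = 12 ^ 6 * (2:ℝ) ^ (x / 2) := by
        rw [← Real.rpow_mul_natCast (by norm_num)]
        congr 2
        push_cast
        ring
  calc _ ≤ 12 ^ 6 * (2:ℝ) ^ (x / 2) * (2:ℝ) ^ (-(x / 2)) := by gcongr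
    _ = 12 ^ 6 := by rw [mul_assoc, ← Real.rpow_add (by norm_num)]; simp

lemma endpoint_constant_le {L p : ℝ} (hL : 1 ≤ L) (hp : 1 < p) (hpL : p - 1 ≤ 1 / L) :
    L ^ (2 * p) * (p - 1) ^ (-4 : ℝ)
      ≤ 8 * ((p - 1) ^ (-6 : ℝ) * (2:ℝ) ^ (-(L * (p - 1) * p / 2))) := by
  have hL0 : 0 < L := by linarith
  have hp0 : 0 < p - 1 := by linarith
  have hp1 : L * (p - 1) ≤ 1 := by
    rw [le_div_iff₀ hL0] at hpL; linarith
  have hp2 : p ≤ 2 := by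
    have : 1 / L ≤ 1 := by rw [div_le_one hL0]; exact hL
    linarith
  have h1 : L ^ (2 * p) ≤ 4 * (p - 1) ^ (-2 : ℝ) := by
    have e : L ^ (2 * p) = L ^ (2:ℝ) * (L ^ (p - 1)) ^ (2:ℝ) := by
      rw [← Real.rpow_mul hL0.le, ← Real.rpow_add hL0]; congr 1; ring
    have h2 : L ^ (p - 1) ≤ 2 :=
      (Real.rpow_le_rpow_of_exponent_le hL hpL).trans (rpow_inv_self_le_two hL)
    have h3 : L ≤ (p - 1)⁻¹ := by
      rw [le_inv_comm₀ hL0 hp0, ← one_div]; exact hpL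
    have h4 : L ^ (2:ℝ) ≤ (p - 1) ^ (-2 : ℝ) := by
      rw [Real.rpow_neg hp0.le, ← Real.inv_rpow hp0.le]
      exact Real.rpow_le_rpow hL0.le h3 (by norm_num)
    have h5 : (L ^ (p - 1)) ^ (2:ℝ) ≤ 4 := by
      refine (Real.rpow_le_rpow (by positivity) h2 (by norm_num)).trans ?_
      norm_num
    rw [e]
    calc _ ≤ (p - 1) ^ (-2 : ℝ) * 4 := by gcongr
      _ = _ := by ring
  have h2 : (1 / 2 : ℝ) ≤ (2:ℝ) ^ (-(L * (p - 1) * p / 2)) := by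
    calc (1 / 2 : ℝ) = (2:ℝ) ^ (-1 : ℝ) := by rw [Real.rpow_neg_one]; norm_num
      _ ≤ _ := Real.rpow_le_rpow_of_exponent_le (by norm_num) (by nlinarith)
  have e6 : (p - 1) ^ (-6 : ℝ) = (p - 1) ^ (-2 : ℝ) * (p - 1) ^ (-4 : ℝ) := by
    rw [← Real.rpow_add hp0]; norm_num
  have h6 : 0 < (p - 1) ^ (-6 : ℝ) := by positivity
  calc _ ≤ 4 * (p - 1) ^ (-2 : ℝ) * (p - 1) ^ (-4 : ℝ) := by gcongr
    _ = 8 * ((p - 1) ^ (-6 : ℝ) * (1 / 2)) := by rw [e6]; ring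
    _ ≤ _ := by gcongr

lemma interior_constant_le {L p η : ℝ} (hL : 1 ≤ L) (hp : 1 < p) (hp2 : p < 2)
    (hη : η * (1 - 1 / (2 * L)) = p - 1 - 1 / (2 * L)) (hη0 : 0 < η) :
    L ^ (6 * (1 - η)) * (2:ℝ) ^ (-(L * η))
      ≤ 128 * 12 ^ 6 * ((p - 1) ^ (-6 : ℝ) * (2:ℝ) ^ (-(L * (p - 1) * p / 2))) := by
  have hL0 : 0 < L := by linarith
  have hp0 : 0 < p - 1 := by linarith
  have hinv : 0 < 1 / (2 * L) := by positivity
  have hinv2 : 1 / (2 * L) ≤ 1 / 2 := by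
    gcongr; linarith
  have hLinv : L * (1 / (2 * L)) = 1 / 2 := by field_simp
  have h1 : L * (p - 1) - 1 / 2 ≤ L * η := by nlinarith
  have h2 : 1 - η ≤ (2 - p) + 1 / L := by
    have e : (1 - η) * (1 - 1 / (2 * L)) = 2 - p := by linarith
    have e2 : 1 / L = 2 * (1 / (2 * L)) := by field_simp
    rw [e2]
    nlinarith
  have h3 : (2:ℝ) ^ (-(L * η)) ≤ 2 * (2:ℝ) ^ (-(L * (p - 1))) := by
    calc _ ≤ (2:ℝ) ^ (1 + -(L * (p - 1))) :=
          Real.rpow_le_rpow_of_exponent_le (by norm_num) (by linarith)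
      _ = _ := by rw [Real.rpow_add (by norm_num), Real.rpow_one]
  have h4 : L ^ (6 * (1 - η)) ≤ 64 * (L ^ (6:ℝ)) ^ (2 - p) := by
    calc L ^ (6 * (1 - η)) ≤ L ^ (6 * (2 - p) + 1 / L * 6) :=
          Real.rpow_le_rpow_of_exponent_le hL (by linarith)
      _ = (L ^ (6:ℝ)) ^ (2 - p) * (L ^ (1 / L)) ^ (6:ℝ) := by
          rw [Real.rpow_add hL0, Real.rpow_mul hL0.le, Real.rpow_mul hL0.le]
      _ ≤ (L ^ (6:ℝ)) ^ (2 - p) * (2:ℝ) ^ (6:ℝ) := by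
          gcongr
          exact rpow_inv_self_le_two hL
      _ = _ := by norm_num; ring
  have h5 : L ^ (6:ℝ) * (2:ℝ) ^ (-(L * (p - 1) / 2)) ≤ 12 ^ 6 * (p - 1) ^ (-6 : ℝ) := by
    have h := rpow_six_mul_le (x := L * (p - 1)) (by positivity)
    rw [Real.rpow_neg hp0.le, ← div_eq_mul_inv, le_div_iff₀ (by positivity)]
    refine le_trans (le_of_eq ?_) h
    rw [mul_pow, ← Real.rpow_natCast L, ← Real.rpow_natCast (p - 1)]
    push_cast
    ring
  have h6 : 1 ≤ 12 ^ 6 * (p - 1) ^ (-6 : ℝ) := by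
    have : 1 ≤ (p - 1) ^ (-6 : ℝ) :=
      Real.one_le_rpow_of_pos_of_le_one_of_nonpos hp0 (by linarith) (by norm_num)
    linarith
  have h7 : (L ^ (6:ℝ)) ^ (2 - p) * (2:ℝ) ^ (-(L * (p - 1)))
      ≤ 12 ^ 6 * (p - 1) ^ (-6 : ℝ) * (2:ℝ) ^ (-(L * (p - 1) * p / 2)) := by
    have e : (2:ℝ) ^ (-(L * (p - 1))) = ((2:ℝ) ^ (-(L * (p - 1) / 2))) ^ (2 - p)
        * (2:ℝ) ^ (-(L * (p - 1) * p / 2)) := by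
      rw [← Real.rpow_mul (by norm_num), ← Real.rpow_add (by norm_num)]
      congr 1
      ring
    rw [e, ← mul_assoc, ← Real.mul_rpow (by positivity) (by positivity)]
    gcongr
    calc _ ≤ (12 ^ 6 * (p - 1) ^ (-6 : ℝ)) ^ (2 - p) :=
          Real.rpow_le_rpow (by positivity) h5 (by linarith)
      _ ≤ (12 ^ 6 * (p - 1) ^ (-6 : ℝ)) ^ (1:ℝ) :=
          Real.rpow_le_rpow_of_exponent_le h6 (by linarith)
      _ = _ := Real.rpow_one _
  calc _ ≤ 64 * (L ^ (6:ℝ)) ^ (2 - p) * (2 * (2:ℝ) ^ (-(L * (p - 1)))) := by gcongr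
    _ = 128 * ((L ^ (6:ℝ)) ^ (2 - p) * (2:ℝ) ^ (-(L * (p - 1)))) := by ring
    _ ≤ 128 * (12 ^ 6 * (p - 1) ^ (-6 : ℝ) * (2:ℝ) ^ (-(L * (p - 1) * p / 2))) := by gcongr
    _ = _ := by ring

/-- Interpolation between `L²` decay and `L^p` bounds that blow up polynomially as `p → 1`. -/
lemma interpolated_bound {T : (ℝ × ℝ → ℝ) → ℝ × ℝ → ℝ≥0∞} {D E L : ℝ} (hD : 1 ≤ D) (hE : 1 ≤ E)
    (hL : 1 ≤ L)
    (hmeas : ∀ f, Integrable f → Measurable (T f))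
    (hfin : ∀ f x, T f x ≠ ⊤)
    (hadd : ∀ f g, Integrable f → Integrable g → ∀ x, T (fun y => f y + g y) x ≤ T f x + T g x)
    (hT₀ : ∀ p : ℝ, 1 < p → p ≤ 2 → ∀ f, Measurable f → Integrable f → (∃ B, ∀ x, ‖f x‖ ≤ B) →
      ∫⁻ x, T f x ^ p ≤ ENNReal.ofReal (D * (L ^ (2 * p) * (p - 1) ^ (-4 : ℝ))) * ∫⁻ x, ‖f x‖ₑ ^ p)
    (hT₁ : ∀ f, Measurable f → Integrable f → (∃ B, ∀ x, ‖f x‖ ≤ B) →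
      ∫⁻ x, T f x ^ (2:ℝ) ≤ ENNReal.ofReal (E * (2:ℝ) ^ (-L)) * ∫⁻ x, ‖f x‖ₑ ^ (2:ℝ))
    {p : ℝ} (hp : 1 < p) (hp2 : p ≤ 2)
    {f : ℝ × ℝ → ℝ} (hf : Measurable f) (hfi : Integrable f) (hfb : ∃ B, ∀ x, ‖f x‖ ≤ B) :
    ∫⁻ x, T f x ^ p ≤ ENNReal.ofReal (2 ^ 14 * 12 ^ 6 * (D * E)
      * ((p - 1) ^ (-6 : ℝ) * (2:ℝ) ^ (-(L * (p - 1) * p / 2)))) * ∫⁻ x, ‖f x‖ₑ ^ p := by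
  have hL0 : 0 < L := by linarith
  have hp0 : 0 < p - 1 := by linarith
  have hX : 0 < (p - 1) ^ (-6 : ℝ) * (2:ℝ) ^ (-(L * (p - 1) * p / 2)) := by positivity
  set X := (p - 1) ^ (-6 : ℝ) * (2:ℝ) ^ (-(L * (p - 1) * p / 2)) with hXdef
  have hDE : D ≤ D * E := by nlinarith
  have hDE' : E ≤ D * E := by nlinarith
  rcases le_or_gt (p - 1) (1 / L) with h | h
  · refine (hT₀ p hp hp2 f hf hfi hfb).trans ?_
    gcongr ENNReal.ofReal ?_ * _
    calc _ ≤ D * (8 * X) := by gcongr D * ?_; exact endpoint_constant_le hL hp h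
      _ ≤ D * E * (2 ^ 14 * 12 ^ 6 * X) := by gcongr; norm_num
      _ = _ := by ring
  rcases hp2.eq_or_lt with rfl | hlt
  · refine (hT₁ f hf hfi hfb).trans ?_
    gcongr ENNReal.ofReal ?_ * _
    have e : (2:ℝ) ^ (-L) = X := by
      rw [hXdef]
      norm_num
    rw [e]
    gcongr
    nlinarith
  · have hinv : 0 < 1 / (2 * L) := by positivity
    have hinv2 : 1 / (2 * L) ≤ 1 / 2 := by
      gcongr; linarith
    have hLinv : 1 / L = 2 * (1 / (2 * L)) := by field_simp
    have hden : 0 < 1 - 1 / (2 * L) := by linarith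
    set η := (p - 1 - 1 / (2 * L)) / (1 - 1 / (2 * L)) with hηdef
    have hη : η * (1 - 1 / (2 * L)) = p - 1 - 1 / (2 * L) := div_mul_cancel₀ _ hden.ne'
    have hη0 : 0 < η := div_pos (by linarith) hden
    have hη1 : η < 1 := by rw [hηdef, div_lt_one hden]; linarith
    set q := 1 + 1 / (2 * L) with hq
    have hpq : q * (1 - η) + 2 * η = p := by
      rw [hq]; linarith
    have hA : D * (L ^ (2 * q) * (q - 1) ^ (-4 : ℝ)) ≤ 32 * D * L ^ (6:ℝ) := by
      have e1 : L ^ (2 * q) = L ^ (2:ℝ) * L ^ (1 / L) := by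
        rw [← Real.rpow_add hL0, hLinv, hq]; congr 1; ring
      have e2 : (q - 1) ^ (-4 : ℝ) = 16 * L ^ (4:ℝ) := by
        rw [show q - 1 = (2 * L)⁻¹ by rw [hq]; ring, Real.inv_rpow (by positivity),
          Real.rpow_neg (by positivity), inv_inv, Real.mul_rpow (by norm_num) hL0.le]
        norm_num
      have e3 : L ^ (6:ℝ) = L ^ (2:ℝ) * L ^ (4:ℝ) := by rw [← Real.rpow_add hL0]; norm_num
      rw [e1, e2, e3]
      calc _ ≤ D * (L ^ (2:ℝ) * 2 * (16 * L ^ (4:ℝ))) := by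
            gcongr; exact rpow_inv_self_le_two hL
        _ = _ := by ring
    have key := interpolate_strong_type (T := T) (A₀ := ENNReal.ofReal (32 * D * L ^ (6:ℝ)))
      (A₁ := ENNReal.ofReal (E * (2:ℝ) ^ (-L))) (q := q) (η := η) (by linarith) (by linarith)
      hη0 hη1 ENNReal.ofReal_ne_top ENNReal.ofReal_ne_top hmeas hfin hadd
      (fun g hg hgi hgb => (hT₀ q (by linarith) (by linarith) g hg hgi hgb).trans (by
        gcongr ENNReal.ofReal ?_ * _)) hT₁ hf hfi hfb
    rw [hpq] at key
    refine key.trans ?_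
    gcongr ?_ * _
    have hη' : 0 ≤ 1 - η := by linarith
    rw [ENNReal.ofReal_rpow_of_nonneg (by positivity) hη',
      ENNReal.ofReal_rpow_of_nonneg (by positivity) hη0.le, ← ENNReal.ofReal_mul (by positivity),
      show (4:ℝ≥0∞) = ENNReal.ofReal 4 by norm_num, ← ENNReal.ofReal_mul (by norm_num)]
    gcongr ENNReal.ofReal ?_
    have hint := interior_constant_le hL hp hlt hη hη0
    have e4 : (32 * D * L ^ (6:ℝ)) ^ (1 - η) = (32 * D) ^ (1 - η) * L ^ (6 * (1 - η)) := by
      rw [Real.mul_rpow (by positivity) (by positivity), ← Real.rpow_mul hL0.le]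
    have e5 : (E * (2:ℝ) ^ (-L)) ^ η = E ^ η * (2:ℝ) ^ (-(L * η)) := by
      rw [Real.mul_rpow (by positivity) (by positivity), ← Real.rpow_mul (by norm_num)]
      congr 2; ring
    have h8 : (32 * D) ^ (1 - η) ≤ 32 * D := by
      refine (Real.rpow_le_rpow_of_exponent_le (by linarith) (by linarith)).trans
        (Real.rpow_one _).le
    have h9 : E ^ η ≤ E :=
      (Real.rpow_le_rpow_of_exponent_le hE hη1.le).trans (Real.rpow_one _).le
    rw [e4, e5]
    calc _ = 4 * ((32 * D) ^ (1 - η) * E ^ η * (L ^ (6 * (1 - η)) * (2:ℝ) ^ (-(L * η)))) := by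
          ring
      _ ≤ 4 * (32 * D * E * (128 * 12 ^ 6 * X)) := by gcongr
      _ = _ := by ring

lemma sqrt_sum_sq_add_le {ι : Type*} (S : Finset ι) (u v w : ι → ℝ≥0∞)
    (h : ∀ i ∈ S, u i ≤ v i + w i) :
    (∑ i ∈ S, u i ^ 2) ^ (1 / 2 : ℝ)
      ≤ (∑ i ∈ S, v i ^ 2) ^ (1 / 2 : ℝ) + (∑ i ∈ S, w i ^ 2) ^ (1 / 2 : ℝ) := by
  have := ENNReal.Lp_add_le S v w (p := 2) (by norm_num)
  simp only [ENNReal.rpow_two] at this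
  refine le_trans ?_ this
  gcongr with i hi
  exact h i hi

lemma FT_add {g h : ℝ × ℝ → ℂ} (hg : Integrable g) (hh : Integrable h) (ξ : ℝ × ℝ) :
    FT (fun x => g x + h x) ξ = FT g ξ + FT h ξ := by
  have hθ : Measurable fun x : ℝ × ℝ => -(2 * Real.pi * (x.1 * ξ.1 + x.2 * ξ.2)) := by fun_prop
  have h := integral_add (integrable_expI_mul hg hθ) (integrable_expI_mul hh hθ)
  unfold FT
  rw [← h]
  exact integral_congr_ae (Eventually.of_forall fun x => mul_add _ _ _)

lemma FTinv_add {g h : ℝ × ℝ → ℂ} (hg : Integrable g) (hh : Integrable h) (x : ℝ × ℝ) :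
    FTinv (fun ξ => g ξ + h ξ) x = FTinv g x + FTinv h x := by
  simp only [FTinv_eq_FT_neg]
  exact FT_add hg hh _

lemma curveOp_add {m : ℝ × ℝ → ℂ} (hmi : Integrable m) {M : ℝ}
    (hM : ∀ η, ‖m η‖ ≤ M) {a : ℝ → ℝ} (ha : Integrable a) (β e c : ℝ) (l : ℕ) {σ : ℝ}
    (hσ : 0 < σ) (j k : ℤ) {f g : ℝ × ℝ → ℝ} (hf : Integrable f) (hg : Integrable g)
    (x : ℝ × ℝ) :
    curveOp m a β e c l σ j k (fun y => f y + g y) x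
      = curveOp m a β e c l σ j k f x + curveOp m a β e c l σ j k g x := by
  have hFT : ∀ ξ, FT (fun y => ((f y + g y : ℝ) : ℂ)) ξ
      = FT (fun y => ((f y : ℝ) : ℂ)) ξ + FT (fun y => ((g y : ℝ) : ℂ)) ξ := by
    intro ξ
    simp only [Complex.ofReal_add]
    have hf' : Integrable fun y => ((f y : ℝ) : ℂ) := hf.ofReal
    have hg' : Integrable fun y => ((g y : ℝ) : ℂ) := hg.ofReal
    exact FT_add hf' hg' ξ
  have h1 := (integrable_curveSymbol_mul_FT hmi hM ha β e c l hσ j k hf).1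
  have h2 := (integrable_curveSymbol_mul_FT hmi hM ha β e c l hσ j k hg).1
  refine Eq.trans ?_ (FTinv_add h1 h2 x)
  simp only [curveOp, hFT, mul_add]

/-- The square function estimate for `curveOp` with explicit dependence on `p` and `l`. -/
theorem exists_lintegral_curveOp_square_le {m : ℝ × ℝ → ℂ}
    (hm : ContDiff ℝ ((⊤ : ℕ∞) : WithTop ℕ∞) m) {r₀ R₀ K : ℝ} (hr₀ : 0 < r₀) (hK : 1 ≤ K)
    (hsupp : ∀ η, m η ≠ 0 → r₀ ≤ |η.1| ∧ |η.1| ≤ R₀ ∧ r₀ ≤ |η.2| ∧ |η.2| ≤ R₀)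
    {a : ℝ → ℝ} (ha : ContDiff ℝ ((⊤ : ℕ∞) : WithTop ℕ∞) a)
    (hasupp : ∀ t, t ∉ Icc (1 / 2 : ℝ) 2 → a t = 0) {β : ℝ} (hβ : 1 < β) {e : ℝ} (he : |e| = 1)
    {c : ℝ} (hc : c ≠ 0) :
    ∃ C : ℝ, 0 ≤ C ∧ ∀ (l : ℕ), 1 ≤ l → ∀ (σ : ℤ × ℤ → ℝ), (∀ α, σ α ∈ Icc K⁻¹ K) →
      ∀ p : ℝ, 1 < p → p ≤ 2 → ∀ (S : Finset (ℤ × ℤ)) (f : ℝ × ℝ → ℝ), Measurable f →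
      Integrable f → (∃ B, ∀ x, ‖f x‖ ≤ B) →
      ∫⁻ x, (∑ α ∈ S, ‖curveOp m a β e c l (σ α) α.1 α.2 f x‖ₑ ^ 2) ^ (p / 2)
        ≤ ENNReal.ofReal (C * ((p - 1) ^ (-6 : ℝ) * (2:ℝ) ^ (-(l * (p - 1) * p / 2))))
          * ∫⁻ x, ‖f x‖ₑ ^ p := by
  have hK0 : 0 < K := by linarith
  have hmc : HasCompactSupport m := by
    refine HasCompactSupport.intro ((isCompact_Icc (a := -R₀) (b := R₀)).prod
      (isCompact_Icc (a := -R₀) (b := R₀))) fun η hη => ?_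
    by_contra h
    obtain ⟨-, h1, -, h2⟩ := hsupp η h
    exact hη ⟨abs_le.1 h1, abs_le.1 h2⟩
  have hmi : Integrable m := hm.continuous.integrable_of_hasCompactSupport hmc
  obtain ⟨M, hM⟩ := hm.continuous.bounded_above_of_compact_support hmc
  have hai : Integrable a := ha.continuous.integrable_of_hasCompactSupport
    (HasCompactSupport.intro isCompact_Icc fun t ht => hasupp t ht)
  obtain ⟨r, G, hG, hmG⟩ := exists_planeSymbol hm hr₀ hK hsupp
  obtain ⟨C₁, hC₁⟩ := exists_curveOp_le hG hK hmG ha.continuous hasupp β e c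
  obtain ⟨D, hD⟩ := curveAvg_square hβ.le (c₀ := K⁻¹ * |c|) (c₁ := K * |c|) (by positivity)
  obtain ⟨C₂, hC₂⟩ := exists_lintegral_sum_curveOp_sq_le hmi hM hr₀ hK hsupp ha hasupp hβ e hc
  set D' : ℝ := 1 + (1 + C₁) ^ 2 * D * 2048 ^ 4 with hD'
  set E' : ℝ := 1 + C₂ with hE'
  have hD'1 : 1 ≤ D' := by rw [hD']; have : (0:ℝ) ≤ (1 + C₁) ^ 2 * D * 2048 ^ 4 := by positivity
                           linarith
  have hE'1 : 1 ≤ E' := by rw [hE']; have : (0:ℝ) ≤ C₂ := C₂.2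
                           linarith
  refine ⟨2 ^ 14 * 12 ^ 6 * (D' * E'), by positivity, ?_⟩
  intro l hl σ hσ p hp hp2 S f hf hfi hfb
  have hL : (1:ℝ) ≤ l := by exact_mod_cast hl
  have hσ0 : ∀ α, 0 < σ α := fun α => lt_of_lt_of_le (inv_pos.2 hK0) (hσ α).1
  set T : (ℝ × ℝ → ℝ) → ℝ × ℝ → ℝ≥0∞ := fun g x =>
    (∑ α ∈ S, ‖curveOp m a β e c l (σ α) α.1 α.2 g x‖ₑ ^ 2) ^ (1 / 2 : ℝ) with hT
  have hTp : ∀ (q : ℝ) g x, T g x ^ q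
      = (∑ α ∈ S, ‖curveOp m a β e c l (σ α) α.1 α.2 g x‖ₑ ^ 2) ^ (q / 2) := by
    intro q g x
    rw [hT]
    simp only
    rw [← ENNReal.rpow_mul]
    congr 1
    ring
  have main := interpolated_bound (T := T) (L := l) hD'1 hE'1 hL ?_ ?_ ?_ ?_ ?_ hp hp2 hf hfi hfb
  · simpa only [hTp] using main
  · intro g hg
    have hc : ∀ α : ℤ × ℤ, Measurable fun x => ‖curveOp m a β e c l (σ α) α.1 α.2 g x‖ₑ :=
      fun α => (continuous_curveOp hmi hM hai β e c l (hσ0 α) α.1 α.2 hg).enorm.measurable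
    exact (Finset.measurable_fun_sum S fun α _ => (hc α).pow_const 2).pow_const _
  · intro g x
    refine ENNReal.rpow_ne_top_of_nonneg (by norm_num) ?_
    exact ENNReal.sum_ne_top.2 fun α _ => ENNReal.pow_ne_top enorm_ne_top
  · intro g h hg hh x
    refine sqrt_sum_sq_add_le S _ _ _ fun α _ => ?_
    rw [curveOp_add hmi hM hai β e c l (hσ0 α) α.1 α.2 hg hh]
    exact enorm_add_le _ _
  · intro q hq hq2 g hg hgi hgb
    simp only [hTp]
    have h1 : ∀ α : ℤ × ℤ, K⁻¹ * |c| ≤ |(-(σ α * c))| := fun α => by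
      rw [abs_neg, abs_mul, abs_of_pos (hσ0 α)]; gcongr; exact (hσ α).1
    have h2 : ∀ α : ℤ × ℤ, |(-(σ α * c))| ≤ K * |c| := fun α => by
      rw [abs_neg, abs_mul, abs_of_pos (hσ0 α)]; gcongr; exact (hσ α).2
    have key := hD (-e) (by rw [abs_neg, he]) l hl (fun α => -(σ α * c)) h1 h2 q hq hq2 S (l + r : ℤ)
      g hg hgb
    have hq0 : 0 < q - 1 := by linarith
    calc _ ≤ ∫⁻ x, (((C₁:ℝ≥0∞) ^ 2) ^ (q / 2)) * (∑ α ∈ S,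
          curveAvg β (-e) l (-(σ α * c)) α.1 α.2
            (fun y => ‖dDiff2 (α.1 + (l + r : ℤ)) (α.2 + (l + r : ℤ)) g y‖ₑ) x ^ 2) ^ (q / 2) := by
          refine lintegral_mono fun x => ?_
          rw [← ENNReal.mul_rpow_of_nonneg _ _ (by linarith), Finset.mul_sum]
          gcongr with α hα
          rw [← mul_pow]
          gcongr
          exact hC₁ l (σ α) (hσ α) α.1 α.2 g hg hgi x
      _ = ((C₁:ℝ≥0∞) ^ 2) ^ (q / 2) * ∫⁻ x, (∑ α ∈ S,
          curveAvg β (-e) l (-(σ α * c)) α.1 α.2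
            (fun y => ‖dDiff2 (α.1 + (l + r : ℤ)) (α.2 + (l + r : ℤ)) g y‖ₑ) x ^ 2) ^ (q / 2) :=
          lintegral_const_mul' _ _ (ENNReal.rpow_ne_top_of_nonneg (by linarith)
            (ENNReal.pow_ne_top ENNReal.coe_ne_top))
      _ ≤ ((C₁:ℝ≥0∞) ^ 2) ^ (q / 2) * (D * ((l : ℝ≥0∞) ^ 4) ^ (q / 2)
          * ENNReal.ofReal (2048 / (q - 1)) ^ 4 * ∫⁻ x, ‖g x‖ₑ ^ q) := by gcongr
      _ ≤ (1 + C₁:ℝ≥0∞) ^ 2 * (D * ENNReal.ofReal ((l:ℝ) ^ (2 * q))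
          * ENNReal.ofReal (2048 / (q - 1)) ^ 4 * ∫⁻ x, ‖g x‖ₑ ^ q) := by
          gcongr
          · calc ((C₁:ℝ≥0∞) ^ 2) ^ (q / 2) ≤ ((1 + C₁:ℝ≥0∞) ^ 2) ^ (q / 2) := by
                  gcongr
                  exact le_add_self
              _ ≤ ((1 + C₁:ℝ≥0∞) ^ 2) ^ (1:ℝ) := by
                  refine ENNReal.rpow_le_rpow_of_exponent_le ?_ (by linarith)
                  exact one_le_pow₀ le_self_add
              _ = _ := ENNReal.rpow_one _
          · rw [← ENNReal.rpow_natCast, ← ENNReal.rpow_mul,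
              ← ENNReal.ofReal_rpow_of_pos (by positivity), ENNReal.ofReal_natCast]
            refine le_of_eq ?_
            congr 1
            push_cast; ring
      _ = ENNReal.ofReal ((1 + C₁) ^ 2 * (D * (l:ℝ) ^ (2 * q) * (2048 / (q - 1)) ^ 4))
          * ∫⁻ x, ‖g x‖ₑ ^ q := by
          rw [ENNReal.ofReal_mul (by positivity), ENNReal.ofReal_mul (by positivity),
            ENNReal.ofReal_mul (by positivity), ENNReal.ofReal_pow (by positivity),
            ENNReal.ofReal_pow (by positivity), ENNReal.ofReal_add (by norm_num) C₁.coe_nonneg,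
            ENNReal.ofReal_one, ENNReal.ofReal_coe_nnreal, ENNReal.ofReal_coe_nnreal]
          ring
      _ ≤ _ := by
          gcongr ENNReal.ofReal ?_ * _
          have e4 : (2048 / (q - 1)) ^ 4 = 2048 ^ 4 * (q - 1) ^ (-4 : ℝ) := by
            rw [Real.rpow_neg hq0.le, div_pow, div_eq_mul_inv]
            norm_num
          rw [e4]
          have : 0 ≤ (l:ℝ) ^ (2 * q) * (q - 1) ^ (-4 : ℝ) := by positivity
          calc _ = ((1 + C₁) ^ 2 * D * 2048 ^ 4) * ((l:ℝ) ^ (2 * q) * (q - 1) ^ (-4 : ℝ)) := by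
                ring
            _ ≤ _ := by
                gcongr
                rw [hD']; linarith
  · intro g hg hgi hgb
    simp only [hTp]
    have key := hC₂ l σ hσ S g hgi hgb
    simp only [ENNReal.rpow_two, div_self (two_ne_zero' ℝ), ENNReal.rpow_one]
    refine key.trans ?_
    gcongr ?_ * _
    have e1 : ((2:ℝ≥0∞) ^ l)⁻¹ = ENNReal.ofReal ((2:ℝ) ^ (-(l:ℝ))) := by
      rw [Real.rpow_neg (by norm_num), Real.rpow_natCast, ENNReal.ofReal_inv_of_pos (by positivity),
        ENNReal.ofReal_pow (by norm_num)]
      norm_num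
    rw [e1, ENNReal.ofReal_mul (by linarith)]
    gcongr
    rw [← ENNReal.ofReal_coe_nnreal]
    gcongr
    rw [hE']; linarith

lemma lintegral_tsum_rpow_le {ι X : Type*} [Denumerable ι] [MeasurableSpace X] {μ : Measure X}
    {r : ℝ} (hr : 0 < r) {G : ι → X → ℝ≥0∞} (hG : ∀ i, Measurable (G i)) {B : ℝ≥0∞}
    (h : ∀ t : Finset ι, ∫⁻ x, (∑ i ∈ t, G i x) ^ r ∂μ ≤ B) :
    ∫⁻ x, (∑' i, G i x) ^ r ∂μ ≤ B := by
  have e := (Denumerable.eqv ι).symm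
  have h1 : ∀ x, (∑' i, G i x) ^ r = ⨆ N : ℕ, (∑ k ∈ Finset.range N, G (e k) x) ^ r := by
    intro x
    rw [← e.tsum_eq fun i => G i x, ENNReal.tsum_eq_iSup_nat]
    exact (ENNReal.orderIsoRpow r hr).map_iSup _
  simp_rw [h1]
  rw [lintegral_iSup]
  · refine iSup_le fun N => ?_
    refine le_trans (le_of_eq ?_) (h ((Finset.range N).map e.toEmbedding))
    refine lintegral_congr fun x => ?_
    rw [Finset.sum_map]
    rfl
  · intro N
    exact (Finset.measurable_fun_sum _ fun k _ => hG (e k)).pow_const _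
  · intro N M hNM x
    simp only
    gcongr

lemma sum_rpow_le_rpow_sum {ι : Type*} (I : Finset ι) (y : ι → ℝ≥0∞) {q : ℝ} (hq : 1 ≤ q) :
    ∑ i ∈ I, y i ^ q ≤ (∑ i ∈ I, y i) ^ q := by
  induction I using Finset.cons_induction with
  | empty => simp
  | cons i I hi ih =>
    rw [Finset.sum_cons, Finset.sum_cons]
    calc _ ≤ y i ^ q + (∑ i ∈ I, y i) ^ q := by gcongr
      _ ≤ _ := ENNReal.add_rpow_le_rpow_add _ _ hq

lemma rpow_add_rpow_subadditive {q : ℝ} (hq : 1 ≤ q) (a b c d : ℝ≥0∞) :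
    ((a + b) ^ q + (c + d) ^ q) ^ (1 / q) ≤ (a ^ q + c ^ q) ^ (1 / q) + (b ^ q + d ^ q) ^ (1 / q) := by
  have := ENNReal.Lp_add_le (Finset.univ : Finset (Fin 2)) ![a, c] ![b, d] hq
  simpa using this

lemma rpow_sum_add_rpow_sum_le {ι : Type*} (I : Finset ι) (y z : ι → ℝ≥0∞) {q : ℝ} (hq : 1 ≤ q) :
    ((∑ i ∈ I, y i) ^ q + (∑ i ∈ I, z i) ^ q) ^ (1 / q)
      ≤ ∑ i ∈ I, (y i ^ q + z i ^ q) ^ (1 / q) := by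
  have hq0 : 0 < q := by linarith
  induction I using Finset.cons_induction with
  | empty => simp [hq0]
  | cons i I hi ih =>
    rw [Finset.sum_cons, Finset.sum_cons, Finset.sum_cons]
    refine (rpow_add_rpow_subadditive hq _ _ _ _).trans ?_
    gcongr

/-- A weighted square sum is dominated by a convex combination of unweighted terms. -/
lemma add_sum_sq_rpow_le {ι : Type*} {p : ℝ} (hp : 1 ≤ p) (hp2 : p ≤ 2) (h : ℝ≥0∞)
    (F w : ι → ℝ≥0∞) (I : Finset ι) (hw : ∑ i ∈ I, w i ^ p ≤ 1) :
    (h + ∑ i ∈ I, (w i * F i) ^ 2) ^ (p / 2)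
      ≤ (∑ i ∈ I, w i ^ p * (h + F i ^ 2) ^ (p / 2))
        + (1 - ∑ i ∈ I, w i ^ p) * h ^ (p / 2) := by
  have hp0 : 0 < p := by linarith
  set q := 2 / p with hq
  have hq1 : 1 ≤ q := by rw [hq, one_le_div hp0]; exact hp2
  have hq0 : 0 < q := by linarith
  have hqi : 1 / q = p / 2 := by rw [hq, one_div_div]
  have hpow : ∀ y : ℝ≥0∞, (y ^ (p / 2)) ^ q = y := fun y => by
    rw [← ENNReal.rpow_mul, ← hqi, one_div_mul_cancel hq0.ne', ENNReal.rpow_one]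
  have hpow2 : ∀ y : ℝ≥0∞, (y ^ p) ^ q = y ^ 2 := fun y => by
    rw [← ENNReal.rpow_mul, hq, mul_div_cancel₀ _ hp0.ne', ENNReal.rpow_two]
  have hhom : ∀ c y z : ℝ≥0∞, ((c * y) ^ q + (c * z) ^ q) ^ (1 / q)
      = c * (y ^ q + z ^ q) ^ (1 / q) := fun c y z => by
    rw [ENNReal.mul_rpow_of_nonneg _ _ hq0.le, ENNReal.mul_rpow_of_nonneg _ _ hq0.le, ← mul_add,
      ENNReal.mul_rpow_of_nonneg _ _ (by positivity), ← ENNReal.rpow_mul,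
      mul_one_div_cancel hq0.ne', ENNReal.rpow_one]
  set H := h ^ (p / 2) with hH
  set π₀ := 1 - ∑ i ∈ I, w i ^ p with hπ₀
  have hsum : H = (∑ i ∈ I, w i ^ p * H) + π₀ * H := by
    rw [← Finset.sum_mul, ← add_mul, hπ₀, add_tsub_cancel_of_le hw, one_mul]
  calc (h + ∑ i ∈ I, (w i * F i) ^ 2) ^ (p / 2)
      ≤ (H ^ q + (∑ i ∈ I, w i ^ p * F i ^ p) ^ q) ^ (1 / q) := by
        rw [hqi, hpow h]
        gcongr
        refine le_trans (le_of_eq ?_) (sum_rpow_le_rpow_sum I _ hq1)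
        refine Finset.sum_congr rfl fun i _ => ?_
        rw [← ENNReal.mul_rpow_of_nonneg _ _ hp0.le, hpow2]
    _ = (((∑ i ∈ I, w i ^ p * H) + π₀ * H) ^ q
          + ((∑ i ∈ I, w i ^ p * F i ^ p) + 0) ^ q) ^ (1 / q) := by
        rw [← hsum, add_zero]
    _ ≤ ((∑ i ∈ I, w i ^ p * H) ^ q + (∑ i ∈ I, w i ^ p * F i ^ p) ^ q) ^ (1 / q)
          + ((π₀ * H) ^ q + 0 ^ q) ^ (1 / q) := rpow_add_rpow_subadditive hq1 _ _ _ _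
    _ ≤ (∑ i ∈ I, ((w i ^ p * H) ^ q + (w i ^ p * F i ^ p) ^ q) ^ (1 / q)) + π₀ * H := by
        gcongr
        · exact rpow_sum_add_rpow_sum_le I _ _ hq1
        · rw [ENNReal.zero_rpow_of_pos hq0, add_zero, ← ENNReal.rpow_mul,
            mul_one_div_cancel hq0.ne', ENNReal.rpow_one]
    _ = _ := by
        congr 1
        refine Finset.sum_congr rfl fun i _ => ?_
        rw [hhom, hpow h, hpow2, hqi]

lemma lintegral_add_sum_sq_rpow_le {ι X : Type*} [Nonempty ι] [MeasurableSpace X] {μ : Measure X}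
    {p : ℝ} (hp : 1 ≤ p) (hp2 : p ≤ 2) {h : X → ℝ≥0∞} (hh : Measurable h)
    {F : ι → X → ℝ≥0∞} (hF : ∀ i, Measurable (F i)) {w : ι → ℝ≥0∞} {I : Finset ι}
    (hw : ∑ i ∈ I, w i ^ p ≤ 1) {B : ℝ≥0∞}
    (hB : ∀ i, ∫⁻ x, (h x + F i x ^ 2) ^ (p / 2) ∂μ ≤ B) :
    ∫⁻ x, (h x + ∑ i ∈ I, (w i * F i x) ^ 2) ^ (p / 2) ∂μ ≤ B := by
  have hp0 : 0 ≤ p / 2 := by linarith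
  have hm : ∀ i, Measurable fun x => (h x + F i x ^ 2) ^ (p / 2) := fun i =>
    (hh.add ((hF i).pow_const 2)).pow_const _
  calc _ ≤ ∫⁻ x, ((∑ i ∈ I, w i ^ p * (h x + F i x ^ 2) ^ (p / 2))
        + (1 - ∑ i ∈ I, w i ^ p) * h x ^ (p / 2)) ∂μ :=
        lintegral_mono fun x => add_sum_sq_rpow_le hp hp2 _ _ _ _ hw
    _ = (∑ i ∈ I, w i ^ p * ∫⁻ x, (h x + F i x ^ 2) ^ (p / 2) ∂μ)
        + (1 - ∑ i ∈ I, w i ^ p) * ∫⁻ x, h x ^ (p / 2) ∂μ := by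
        rw [lintegral_add_right _ ((hh.pow_const _).const_mul _),
          lintegral_finsetSum _ fun i _ => (hm i).const_mul _,
          lintegral_const_mul _ (hh.pow_const _)]
        congr 1
        exact Finset.sum_congr rfl fun i _ => lintegral_const_mul _ (hm i)
    _ ≤ (∑ i ∈ I, w i ^ p * B) + (1 - ∑ i ∈ I, w i ^ p) * B := by
        gcongr with i hi
        · exact hB i
        · obtain ⟨i₀⟩ := ‹Nonempty ι›
          refine le_trans (lintegral_mono fun x => ?_) (hB i₀)
          gcongr
          exact le_self_add
    _ = B := by rw [← Finset.sum_mul, ← add_mul, add_tsub_cancel_of_le hw, one_mul]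

lemma lintegral_weighted_square_le_aux {ι κ X : Type*} [Nonempty ι] [MeasurableSpace X]
    {μ : Measure X} {p : ℝ} (hp : 1 ≤ p) (hp2 : p ≤ 2)
    {F : κ → ι → X → ℝ≥0∞} (hF : ∀ α i, Measurable (F α i)) {w : κ → ι → ℝ≥0∞} {I : Finset ι}
    (hw : ∀ α, ∑ i ∈ I, w α i ^ p ≤ 1) {B : ℝ≥0∞} (S : Finset κ) :
    ∀ h : X → ℝ≥0∞, Measurable h →
    (∀ ch : κ → ι, ∫⁻ x, (h x + ∑ α ∈ S, F α (ch α) x ^ 2) ^ (p / 2) ∂μ ≤ B) →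
    ∫⁻ x, (h x + ∑ α ∈ S, ∑ i ∈ I, (w α i * F α i x) ^ 2) ^ (p / 2) ∂μ ≤ B := by
  induction S using Finset.cons_induction with
  | empty =>
    intro h hh hB
    obtain ⟨i₀⟩ := ‹Nonempty ι›
    simpa using hB fun _ => i₀
  | cons α₀ S hα ih =>
    intro h hh hB
    simp only [Finset.sum_cons, ← add_assoc] at hB ⊢
    refine ih (fun x => h x + ∑ i ∈ I, (w α₀ i * F α₀ i x) ^ 2)
      (hh.add (Finset.measurable_fun_sum _ fun i _ => ((hF α₀ i).const_mul _).pow_const 2)) ?_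
    intro ch
    refine le_trans (le_of_eq (lintegral_congr fun x => by rw [add_right_comm]))
      (lintegral_add_sum_sq_rpow_le (h := fun x => h x + ∑ α ∈ S, F α (ch α) x ^ 2) hp hp2
      (hh.add (Finset.measurable_fun_sum _ fun α _ => (hF α _).pow_const 2)) (hF α₀) (hw α₀) ?_)
    intro i
    refine le_trans (le_of_eq (lintegral_congr fun x => ?_)) (hB (Function.update ch α₀ i))
    rw [Function.update_self, add_right_comm]
    congr 2
    refine Finset.sum_congr rfl fun α hαS => ?_
    rw [Function.update_of_ne (fun e : α = α₀ => hα (e ▸ hαS))]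

/-- Randomising the choice of one index in each fibre bounds the weighted square function. -/
lemma lintegral_weighted_square_le {ι κ X : Type*} [Nonempty ι] [MeasurableSpace X]
    {μ : Measure X} {p : ℝ} (hp : 1 ≤ p) (hp2 : p ≤ 2)
    {F : κ → ι → X → ℝ≥0∞} (hF : ∀ α i, Measurable (F α i)) {w : κ → ι → ℝ≥0∞} {I : Finset ι}
    {V : ℝ≥0∞} (hV : V ≠ ⊤) (hw : ∀ α, ∑ i ∈ I, w α i ^ p ≤ V) {B : ℝ≥0∞} (S : Finset κ)
    (hB : ∀ ch : κ → ι, ∫⁻ x, (∑ α ∈ S, F α (ch α) x ^ 2) ^ (p / 2) ∂μ ≤ B) :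
    ∫⁻ x, (∑ α ∈ S, ∑ i ∈ I, (w α i * F α i x) ^ 2) ^ (p / 2) ∂μ ≤ V * B := by
  have hp0 : 0 < p := by linarith
  by_cases hV0 : V = 0
  · have h0 : ∀ α, ∀ i ∈ I, w α i = 0 := fun α i hi => by
      have h1 := (Finset.single_le_sum (f := fun i => w α i ^ p) (fun _ _ => zero_le) hi).trans
        ((hw α).trans hV0.le)
      simpa [hp0, hp0.le, not_lt.2 hp0.le] using h1
    have h2 : ∀ x, (∑ α ∈ S, ∑ i ∈ I, (w α i * F α i x) ^ 2) ^ (p / 2) = 0 := fun x => by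
      rw [Finset.sum_eq_zero fun α _ => Finset.sum_eq_zero fun i hi => by simp [h0 α i hi]]
      exact ENNReal.zero_rpow_of_pos (by linarith)
    simp [h2]
  set v := V ^ (1 / p) with hv
  have hvp : v ^ p = V := by
    rw [hv, ← ENNReal.rpow_mul, one_div_mul_cancel hp0.ne', ENNReal.rpow_one]
  have hv0 : v ≠ 0 := fun h => hV0 (by rw [← hvp, h, ENNReal.zero_rpow_of_pos hp0])
  have hvt : v ≠ ⊤ := ENNReal.rpow_ne_top_of_nonneg (by positivity) hV
  have key := lintegral_weighted_square_le_aux (μ := μ) hp hp2 hF (w := fun α i => v⁻¹ * w α i)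
    (I := I) (B := B) ?_ S (fun _ => 0) measurable_const (by simpa using hB)
  · have h3 : ∀ x, (∑ α ∈ S, ∑ i ∈ I, (w α i * F α i x) ^ 2) ^ (p / 2)
        = V * (0 + ∑ α ∈ S, ∑ i ∈ I, (v⁻¹ * w α i * F α i x) ^ 2) ^ (p / 2) := by
      intro x
      have e : V = (v ^ 2) ^ (p / 2) := by
        rw [← ENNReal.rpow_two, ← ENNReal.rpow_mul, show (2:ℝ) * (p / 2) = p by ring, hvp]
      rw [e, ← ENNReal.mul_rpow_of_nonneg _ _ (by linarith), zero_add, Finset.mul_sum]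
      congr 1
      refine Finset.sum_congr rfl fun α _ => ?_
      rw [Finset.mul_sum]
      refine Finset.sum_congr rfl fun i _ => ?_
      rw [← mul_pow, ← mul_assoc, ← mul_assoc, ENNReal.mul_inv_cancel hv0 hvt, one_mul]
    simp_rw [h3]
    rw [lintegral_const_mul' _ _ hV]
    gcongr
  · intro α
    simp_rw [ENNReal.mul_rpow_of_nonneg _ _ hp0.le]
    rw [← Finset.mul_sum, ENNReal.inv_rpow, hvp]
    calc _ ≤ V⁻¹ * V := by gcongr; exact hw α
      _ = 1 := ENNReal.inv_mul_cancel hV0 hV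

lemma lintegral_tsum_weighted_square_le {X : Type*} [MeasurableSpace X]
    {μ : Measure X} {p : ℝ} (hp : 1 ≤ p) (hp2 : p ≤ 2)
    {F : ℤ → ℤ → ℕ → X → ℝ≥0∞} (hF : ∀ j n i, Measurable (F j n i)) {w : ℤ → ℕ → ℝ≥0∞}
    (hwt : ∀ n i, w n i ≠ ⊤)
    {V : ℝ≥0∞} (hw : ∀ n, ∑' i, w n i ^ p ≤ V) {B : ℝ≥0∞}
    (hB : ∀ (S : Finset (ℤ × ℤ)) (ch : ℤ × ℤ → ℕ),
      ∫⁻ x, (∑ α ∈ S, F α.1 α.2 (ch α) x ^ 2) ^ (p / 2) ∂μ ≤ B) :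
    ∫⁻ x, (∑' z : ℤ × ℤ × ℕ, (w z.2.1 z.2.2 * F z.1 z.2.1 z.2.2 x) ^ 2) ^ (p / 2) ∂μ
      ≤ V * B := by
  have hp0 : 0 < p := by linarith
  refine lintegral_tsum_rpow_le (by linarith)
    (fun z : ℤ × ℤ × ℕ => ((hF z.1 z.2.1 z.2.2).const_mul _).pow_const 2) fun t => ?_
  set S : Finset (ℤ × ℤ) := t.image fun z => (z.1, z.2.1) with hS
  set I : Finset ℕ := t.image fun z => z.2.2 with hI
  set V' : ℝ≥0∞ := S.sup fun α => ∑ i ∈ I, w α.2 i ^ p with hV'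
  have hV'V : V' ≤ V := Finset.sup_le fun α _ => (ENNReal.sum_le_tsum I).trans (hw α.2)
  have hV't : V' ≠ ⊤ := by
    rw [← lt_top_iff_ne_top, hV', Finset.sup_lt_iff (by simp)]
    intro α _
    exact ENNReal.sum_lt_top.2 fun i _ => ENNReal.rpow_lt_top_of_nonneg hp0.le (hwt _ _)
  have key := lintegral_weighted_square_le (μ := μ) hp hp2
    (F := fun (α : ℤ × ℤ) i => F α.1 α.2 i) (fun α i => hF _ _ _)
    (w := fun α i => if α ∈ S then w α.2 i else 0) (I := I) hV't ?_ S (hB S)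
  · refine le_trans (lintegral_mono fun x => ?_) (key.trans (by gcongr))
    gcongr ?_ ^ _
    calc _ ≤ ∑ z ∈ (S ×ˢ I : Finset ((ℤ × ℤ) × ℕ)), (w z.1.2 z.2 * F z.1.1 z.1.2 z.2 x) ^ 2 := by
          have hinj : Function.Injective fun z : ℤ × ℤ × ℕ => ((z.1, z.2.1), z.2.2) := by
            rintro ⟨a, b, c⟩ ⟨a', b', c'⟩ h
            simpa [and_assoc] using h
          rw [← Finset.sum_image (f := fun z : (ℤ × ℤ) × ℕ =>
            (w z.1.2 z.2 * F z.1.1 z.1.2 z.2 x) ^ 2) hinj.injOn]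
          refine Finset.sum_le_sum_of_subset fun z hz => ?_
          obtain ⟨y, hy, rfl⟩ := Finset.mem_image.1 hz
          exact Finset.mem_product.2 ⟨Finset.mem_image_of_mem _ hy, Finset.mem_image_of_mem _ hy⟩
      _ = ∑ α ∈ S, ∑ i ∈ I, (w α.2 i * F α.1 α.2 i x) ^ 2 := Finset.sum_product _ _ _
      _ ≤ _ := by
          refine Finset.sum_le_sum fun α hα => Finset.sum_le_sum fun i _ => ?_
          rw [if_pos hα]
  · intro α
    by_cases hα : α ∈ S
    · simp only [if_pos hα]
      exact Finset.le_sup (f := fun α : ℤ × ℤ => ∑ i ∈ I, w α.2 i ^ p) hα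
    · simp [if_neg hα, ENNReal.zero_rpow_of_pos hp0]

/-- The dyadic exponent of the second frequency variable for the dilation `2^{-jb} 2^{bn}`. -/
def dilExp (b : ℝ) (j n : ℤ) : ℤ := ⌊b * ((j : ℝ) - n)⌋

/-- The bounded factor complementing `dilExp`. -/
def dilMod (b : ℝ) (j n : ℤ) (v : ℝ) : ℝ :=
  (2:ℝ) ^ ((dilExp b j n : ℝ) - b * ((j : ℝ) - n)) * v

lemma dilMod_mem {b : ℝ} (hb : 1 < b) (j n : ℤ) {v : ℝ} (hv : v ∈ Icc (1:ℝ) ((2:ℝ) ^ b)) :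
    dilMod b j n v ∈ Icc ((2:ℝ) ^ b)⁻¹ ((2:ℝ) ^ b) := by
  have h1 : (dilExp b j n : ℝ) ≤ b * ((j : ℝ) - n) := Int.floor_le _
  have h2 : b * ((j : ℝ) - n) < dilExp b j n + 1 := Int.lt_floor_add_one _
  have h3 : (2:ℝ) ^ (-b) ≤ (2:ℝ) ^ ((dilExp b j n : ℝ) - b * ((j : ℝ) - n)) :=
    Real.rpow_le_rpow_of_exponent_le (by norm_num) (by linarith)
  have h4 : (2:ℝ) ^ ((dilExp b j n : ℝ) - b * ((j : ℝ) - n)) ≤ 1 :=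
    Real.rpow_le_one_of_one_le_of_nonpos (by norm_num) (by linarith)
  rw [Real.rpow_neg (by norm_num)] at h3
  constructor
  · calc ((2:ℝ) ^ b)⁻¹ = ((2:ℝ) ^ b)⁻¹ * 1 := (mul_one _).symm
      _ ≤ _ := by unfold dilMod; gcongr; exact hv.1
  · calc dilMod b j n v ≤ 1 * v := by
          unfold dilMod
          gcongr
          linarith [hv.1]
      _ ≤ _ := by rw [one_mul]; exact hv.2

lemma two_zpow_mul_dilMod (b : ℝ) (j n : ℤ) (v : ℝ) :
    (2:ℝ) ^ (-dilExp b j n) * dilMod b j n v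
      = (2:ℝ) ^ (-((j : ℝ) * b)) * ((2:ℝ) ^ (b * (n : ℝ)) * v) := by
  rw [dilMod, ← Real.rpow_intCast, ← mul_assoc, ← mul_assoc, ← Real.rpow_add (by norm_num),
    ← Real.rpow_add (by norm_num)]
  congr 2
  push_cast
  ring

lemma dilExp_injective {b : ℝ} (hb : 1 < b) :
    Function.Injective fun α : ℤ × ℤ => (α.1, dilExp b α.1 α.2) := by
  have key : ∀ j n n' : ℤ, n < n' → dilExp b j n' < dilExp b j n := by
    intro j n n' h
    have h0 : (n : ℝ) + 1 ≤ n' := by exact_mod_cast h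
    have h1 : (dilExp b j n' : ℝ) ≤ b * ((j : ℝ) - n') := Int.floor_le _
    have h2 : b * ((j : ℝ) - n) < dilExp b j n + 1 := Int.lt_floor_add_one _
    have h3 : (dilExp b j n' : ℝ) < dilExp b j n := by nlinarith
    exact_mod_cast h3
  rintro ⟨j, n⟩ ⟨j', n'⟩ h
  simp only [Prod.mk.injEq] at h
  obtain ⟨rfl, h⟩ := h
  rcases lt_trichotomy n n' with h' | h' | h'
  · exact absurd h (key j n n' h').ne'
  · rw [h']
  · exact absurd h (key j n' n h').ne

/-- A family of operators indexed by two dyadic parameters and a point of `[1, 2^b]` satisfies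
the weighted square function estimate at level `l` with constant `C`. -/
def SquareBound (b C : ℝ) (l : ℕ) (Op : ℤ → ℤ → ℝ → (ℝ × ℝ → ℝ) → ℝ × ℝ → ℂ) : Prop :=
  0 ≤ C ∧
  (∀ j n, ∀ v ∈ Icc (1:ℝ) ((2:ℝ) ^ b), ∀ f : SchwartzMap (ℝ × ℝ) ℝ, Measurable (Op j n v f)) ∧
  ∀ p : ℝ, 1 < p → p ≤ 2 → ∀ s : ℤ → ℕ → ℝ, (∀ n i, s n i ∈ Icc (1:ℝ) ((2:ℝ) ^ b)) →
    ∀ (w : ℤ → ℕ → ℂ) (V : ℝ≥0∞), (∀ n, ∑' i, ‖w n i‖ₑ ^ p ≤ V) →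
    ∀ f : SchwartzMap (ℝ × ℝ) ℝ,
      ∫⁻ x, (∑' z : ℤ × ℤ × ℕ,
          (‖w z.2.1 z.2.2‖ₑ * ‖Op z.1 z.2.1 (s z.2.1 z.2.2) f x‖ₑ) ^ 2) ^ (p / 2)
        ≤ V * (ENNReal.ofReal (C * ((p - 1) ^ (-6 : ℝ) * (2:ℝ) ^ (-(l * (p - 1) * p / 2))))
            * ∫⁻ x, ‖f x‖ₑ ^ p)

lemma SquareBound.mono {b C D : ℝ} {l : ℕ} {Op : ℤ → ℤ → ℝ → (ℝ × ℝ → ℝ) → ℝ × ℝ → ℂ}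
    (h : SquareBound b C l Op) (hCD : C ≤ D) : SquareBound b D l Op := by
  refine ⟨h.1.trans hCD, h.2.1, fun p hp hp2 s hs w V hV f => (h.2.2 p hp hp2 s hs w V hV f).trans ?_⟩
  have : 0 < (p - 1) ^ (-6 : ℝ) := Real.rpow_pos_of_pos (by linarith) _
  gcongr V * (ENNReal.ofReal (?_ * _) * _)

lemma SquareBound.congr {b C : ℝ} {l : ℕ} {Op Op' : ℤ → ℤ → ℝ → (ℝ × ℝ → ℝ) → ℝ × ℝ → ℂ}
    (h : SquareBound b C l Op) (he : ∀ j n, ∀ v ∈ Icc (1:ℝ) ((2:ℝ) ^ b),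
      ∀ f : SchwartzMap (ℝ × ℝ) ℝ, Op' j n v f = Op j n v f) : SquareBound b C l Op' := by
  refine ⟨h.1, fun j n v hv f => by rw [he j n v hv f]; exact h.2.1 j n v hv f, ?_⟩
  intro p hp hp2 s hs w V hV f
  simp_rw [fun j n n' i => he j n (s n' i) (hs n' i) f]
  exact h.2.2 p hp hp2 s hs w V hV f

lemma SquareBound.of_norm_le_add {b C D : ℝ} {l : ℕ}
    {Op Op₁ Op₂ : ℤ → ℤ → ℝ → (ℝ × ℝ → ℝ) → ℝ × ℝ → ℂ}
    (h₁ : SquareBound b C l Op₁) (h₂ : SquareBound b D l Op₂)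
    (hm : ∀ j n, ∀ v ∈ Icc (1:ℝ) ((2:ℝ) ^ b), ∀ f : SchwartzMap (ℝ × ℝ) ℝ,
      Measurable (Op j n v f))
    (hle : ∀ j n, ∀ v ∈ Icc (1:ℝ) ((2:ℝ) ^ b), ∀ (f : SchwartzMap (ℝ × ℝ) ℝ) x,
      ‖Op j n v f x‖ₑ ≤ ‖Op₁ j n v f x‖ₑ + ‖Op₂ j n v f x‖ₑ) :
    SquareBound b (2 * (C + D)) l Op := by
  have hC := h₁.1
  have hD := h₂.1
  refine ⟨by linarith, hm, fun p hp hp2 s hs w V hV f => ?_⟩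
  have hp0 : 0 ≤ p / 2 := by linarith
  set K := (p - 1) ^ (-6 : ℝ) * (2:ℝ) ^ (-(l * (p - 1) * p / 2)) with hK
  have hK0 : 0 ≤ K := mul_nonneg (Real.rpow_nonneg (by linarith) _) (by positivity)
  set G : (ℤ → ℤ → ℝ → (ℝ × ℝ → ℝ) → ℝ × ℝ → ℂ) → ℝ × ℝ → ℝ≥0∞ := fun O x =>
    (∑' z : ℤ × ℤ × ℕ, (‖w z.2.1 z.2.2‖ₑ * ‖O z.1 z.2.1 (s z.2.1 z.2.2) f x‖ₑ) ^ 2) with hG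
  have hpt : ∀ x, G Op x ^ (p / 2) ≤ 2 * (G Op₁ x ^ (p / 2) + G Op₂ x ^ (p / 2)) := by
    intro x
    have h2 : G Op x ≤ 2 * (G Op₁ x + G Op₂ x) := by
      simp only [hG]
      rw [← ENNReal.tsum_add, ← ENNReal.tsum_mul_left]
      refine ENNReal.tsum_le_tsum fun z => ?_
      have h3 := ENNReal.rpow_add_le_mul_rpow_add_rpow
        (‖w z.2.1 z.2.2‖ₑ * ‖Op₁ z.1 z.2.1 (s z.2.1 z.2.2) f x‖ₑ)
        (‖w z.2.1 z.2.2‖ₑ * ‖Op₂ z.1 z.2.1 (s z.2.1 z.2.2) f x‖ₑ) (p := 2) (by norm_num)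
      norm_num at h3
      refine le_trans ?_ h3
      rw [← mul_add]
      gcongr
      exact hle _ _ _ (hs _ _) f x
    calc G Op x ^ (p / 2) ≤ (2 * (G Op₁ x + G Op₂ x)) ^ (p / 2) := by gcongr
      _ = 2 ^ (p / 2) * (G Op₁ x + G Op₂ x) ^ (p / 2) := ENNReal.mul_rpow_of_nonneg _ _ hp0
      _ ≤ 2 ^ (1:ℝ) * (G Op₁ x ^ (p / 2) + G Op₂ x ^ (p / 2)) := by
          gcongr
          · norm_num
          · linarith
          · exact ENNReal.rpow_add_le_add_rpow _ _ hp0 (by linarith)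
      _ = _ := by rw [ENNReal.rpow_one]
  have hmeas : Measurable fun x => G Op₁ x ^ (p / 2) := by
    refine Measurable.pow_const (Measurable.tsum fun z => ?_) _
    exact ((h₁.2.1 _ _ _ (hs _ _) f).enorm.const_mul _).pow_const 2
  calc _ ≤ ∫⁻ x, 2 * (G Op₁ x ^ (p / 2) + G Op₂ x ^ (p / 2)) := lintegral_mono hpt
    _ = 2 * ((∫⁻ x, G Op₁ x ^ (p / 2)) + ∫⁻ x, G Op₂ x ^ (p / 2)) := by
        rw [lintegral_const_mul' _ _ (by norm_num), lintegral_add_left hmeas]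
    _ ≤ 2 * (V * (ENNReal.ofReal (C * K) * ∫⁻ x, ‖f x‖ₑ ^ p)
          + V * (ENNReal.ofReal (D * K) * ∫⁻ x, ‖f x‖ₑ ^ p)) := by
        gcongr
        · exact h₁.2.2 p hp hp2 s hs w V hV f
        · exact h₂.2.2 p hp hp2 s hs w V hV f
    _ = _ := by
        rw [← mul_add, ← add_mul, ← ENNReal.ofReal_add (by positivity) (by positivity),
          show 2 * (C + D) * K = 2 * (C * K + D * K) by ring,
          ENNReal.ofReal_mul (p := 2) (by norm_num)]
        norm_num
        ring

/-- The weighted square function estimate for `curveOp` along the dilations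
`(2^{-j}, 2^{-jb} 2^{bn} v)`. -/
theorem exists_squareBound_curveOp {b : ℝ} (hb : 1 < b) {m : ℝ × ℝ → ℂ}
    (hm : ContDiff ℝ ((⊤ : ℕ∞) : WithTop ℕ∞) m) {r₀ R₀ : ℝ} (hr₀ : 0 < r₀)
    (hsupp : ∀ η, m η ≠ 0 → r₀ ≤ |η.1| ∧ |η.1| ≤ R₀ ∧ r₀ ≤ |η.2| ∧ |η.2| ≤ R₀)
    {a : ℝ → ℝ} (ha : ContDiff ℝ ((⊤ : ℕ∞) : WithTop ℕ∞) a)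
    (hasupp : ∀ t, t ∉ Icc (1 / 2 : ℝ) 2 → a t = 0) {e : ℝ} (he : |e| = 1)
    {c : ℝ} (hc : c ≠ 0) :
    ∃ C : ℝ, ∀ l : ℕ, 1 ≤ l → SquareBound b C l fun j n v f =>
      curveOp m a b e c l (dilMod b j n v) j (dilExp b j n) f := by
  have hK : (1:ℝ) ≤ (2:ℝ) ^ b := Real.one_le_rpow (by norm_num) (by linarith)
  have hK0 : (0:ℝ) < ((2:ℝ) ^ b)⁻¹ := by positivity
  obtain ⟨C, hC0, hC⟩ := exists_lintegral_curveOp_square_le hm hr₀ hK hsupp ha hasupp hb he hc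
  have hmc : HasCompactSupport m := by
    refine HasCompactSupport.intro ((isCompact_Icc (a := -R₀) (b := R₀)).prod
      (isCompact_Icc (a := -R₀) (b := R₀))) fun η hη => ?_
    by_contra h
    obtain ⟨-, h1, -, h2⟩ := hsupp η h
    exact hη ⟨abs_le.1 h1, abs_le.1 h2⟩
  obtain ⟨M, hM⟩ := hmc.exists_bound_of_continuous hm.continuous
  have hmi : Integrable m := hm.continuous.integrable_of_hasCompactSupport hmc
  have hai : Integrable a := ha.continuous.integrable_of_hasCompactSupport
    (HasCompactSupport.intro isCompact_Icc hasupp)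
  have hmeas : ∀ l j n, ∀ v ∈ Icc (1:ℝ) ((2:ℝ) ^ b), ∀ f : SchwartzMap (ℝ × ℝ) ℝ,
      Measurable (curveOp m a b e c l (dilMod b j n v) j (dilExp b j n) f) :=
    fun l j n v hv f => (continuous_curveOp hmi hM hai b e c l
      (hK0.trans_le (dilMod_mem hb j n hv).1) j _ f.integrable).measurable
  refine ⟨C, fun l hl => ⟨hC0, hmeas l, fun p hp hp2 s hs w V hV f => ?_⟩⟩
  refine lintegral_tsum_weighted_square_le (F := fun j n i x =>
    ‖curveOp m a b e c l (dilMod b j n (s n i)) j (dilExp b j n) f x‖ₑ) hp.le hp2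
    (fun j n i => (hmeas l j n _ (hs n i) f).enorm) (w := fun n i => ‖w n i‖ₑ)
    (fun n i => enorm_ne_top) hV fun S ch => ?_
  set φ : ℤ × ℤ → ℤ × ℤ := fun α => (α.1, dilExp b α.1 α.2) with hφ
  have hφi : Function.Injective φ := dilExp_injective hb
  set σ : ℤ × ℤ → ℝ := Function.extend φ
    (fun α : ℤ × ℤ => dilMod b α.1 α.2 (s α.2 (ch α))) fun _ => 1 with hσ
  have hσφ : ∀ α : ℤ × ℤ, σ (φ α) = dilMod b α.1 α.2 (s α.2 (ch α)) := fun α =>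
    hφi.extend_apply _ _ α
  have hσm : ∀ β, σ β ∈ Icc ((2:ℝ) ^ b)⁻¹ ((2:ℝ) ^ b) := by
    intro β
    by_cases hβ : ∃ α, φ α = β
    · obtain ⟨α, rfl⟩ := hβ
      rw [hσφ]
      exact dilMod_mem hb _ _ (hs _ _)
    · rw [hσ, Function.extend_apply' _ _ _ hβ]
      exact ⟨inv_le_one_of_one_le₀ hK, hK⟩
  refine le_trans (le_of_eq ?_) (hC l hl σ hσm p hp hp2 (S.image φ) f f.continuous.measurable
    f.integrable ?_)
  · refine lintegral_congr fun x => ?_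
    rw [Finset.sum_image hφi.injOn]
    congr 1
    refine Finset.sum_congr rfl fun α _ => ?_
    rw [hσφ]
  · exact ⟨_, f.toBoundedContinuousFunction.norm_coe_le_norm⟩

/-- Differentiation of `curveFT` in the second frequency variable. -/
lemma hasDerivAt_curveFT (β e c : ℝ) {a : ℝ → ℝ} (ha : Integrable a)
    (ha' : Integrable fun t => 2 * Real.pi * (c * t ^ β) * a t) (x y : ℝ) :
    HasDerivAt (fun y => curveFT β e c a (x, y))
      (-Complex.I * curveFT β e c (fun t => 2 * Real.pi * (c * t ^ β) * a t) (x, y)) y := by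
  have hac : Integrable fun t => ((a t : ℝ) : ℂ) := ha.ofReal
  have hac' : Integrable fun t => ((2 * Real.pi * (c * t ^ β) * a t : ℝ) : ℂ) := ha'.ofReal
  have hθ : ∀ y : ℝ, Measurable fun t : ℝ =>
      -(2 * Real.pi * (x * (e * t) + y * (c * t ^ β))) := fun y => by fun_prop
  have key := (hasDerivAt_integral_of_dominated_loc_of_deriv_le (μ := volume) (𝕜 := ℝ)
    (F := fun y t => Complex.exp (((-(2 * Real.pi * (x * (e * t) + y * (c * t ^ β))) : ℝ) : ℂ)
      * Complex.I) * ((a t : ℝ) : ℂ))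
    (F' := fun y t => -Complex.I *
      (Complex.exp (((-(2 * Real.pi * (x * (e * t) + y * (c * t ^ β))) : ℝ) : ℂ)
      * Complex.I) * ((2 * Real.pi * (c * t ^ β) * a t : ℝ) : ℂ)))
    (bound := fun t => ‖2 * Real.pi * (c * t ^ β) * a t‖) (x₀ := y) (s := univ)
    Filter.univ_mem
    (Eventually.of_forall fun y => (integrable_expI_mul hac (hθ y)).aestronglyMeasurable)
    (integrable_expI_mul hac (hθ y))
    ((integrable_expI_mul hac' (hθ y)).aestronglyMeasurable.const_mul _)
    (ae_of_all _ fun t y _ => ?_) ha'.norm (ae_of_all _ fun t y _ => ?_)).2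
  · refine key.congr_deriv ?_
    rw [integral_const_mul]
    rfl
  · rw [norm_mul, norm_mul, Complex.norm_exp_ofReal_mul_I, norm_neg, Complex.norm_I, one_mul,
      one_mul, Complex.norm_real]
  · have h1 : HasDerivAt (fun y : ℝ => -(2 * Real.pi * (x * (e * t) + y * (c * t ^ β))))
        (-(2 * Real.pi * (c * t ^ β))) y := by
      refine ((((hasDerivAt_id y).mul_const (c * t ^ β)).const_add (x * (e * t))).const_mul
        (2 * Real.pi)).neg.congr_deriv (by ring)
    refine (((h1.ofReal_comp.mul_const Complex.I).cexp).mul_const _).congr_deriv ?_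
    push_cast
    ring

/-- The operator with the dilated multiplier `ξ ↦ Φ (2^{-j} ξ₁, 2^{-jb} u ξ₂)`. -/
def dilatedOp (b : ℝ) (Φ : ℝ × ℝ → ℂ) (j : ℤ) (u : ℝ) (f : ℝ × ℝ → ℝ) : ℝ × ℝ → ℂ :=
  FTinv fun ξ => Φ (dil b j u ξ) * FT (fun x => ((f x : ℝ) : ℂ)) ξ

lemma curveSymbol_dilMod (m : ℝ × ℝ → ℂ) (a : ℝ → ℝ) (b e c : ℝ) (l : ℕ) (j n : ℤ) (v : ℝ)
    (ξ : ℝ × ℝ) :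
    curveSymbol m a b e c l (dilMod b j n v) j (dilExp b j n) ξ
      = m ((2:ℝ) ^ (-(l:ℝ)) • dil b j ((2:ℝ) ^ (b * (n : ℝ)) * v) ξ)
        * curveFT b e c a (dil b j ((2:ℝ) ^ (b * (n : ℝ)) * v) ξ) := by
  have h1 := two_zpow_mul_dilMod b j n v
  have h2 : (2:ℝ) ^ (-(j + l : ℤ)) = (2:ℝ) ^ (-(l:ℝ)) * (2:ℝ) ^ (-(j:ℝ)) := by
    rw [← Real.rpow_intCast, ← Real.rpow_add (by norm_num)]
    congr 1; push_cast; ring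
  have h3 : (2:ℝ) ^ (-(dilExp b j n + l : ℤ)) = (2:ℝ) ^ (-(l:ℝ)) * (2:ℝ) ^ (-dilExp b j n) := by
    rw [← Real.rpow_intCast, ← Real.rpow_intCast, ← Real.rpow_add (by norm_num)]
    congr 1; push_cast; ring
  have h4 : (2:ℝ) ^ (-j) = (2:ℝ) ^ (-(j:ℝ)) := by
    rw [← Real.rpow_intCast]; push_cast; rfl
  have h5 : dil b j ((2:ℝ) ^ (b * (n : ℝ)) * v) ξ
      = ((2:ℝ) ^ (-j) * ξ.1, (2:ℝ) ^ (-dilExp b j n) * dilMod b j n v * ξ.2) := by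
    rw [h1, h4, dil]
    congr 1
    ring
  rw [h5, curveSymbol, h2, h3, h4]
  simp only [Prod.smul_mk, smul_eq_mul]
  congr 3
  · ring
  · ring

lemma curveOp_dilMod (m : ℝ × ℝ → ℂ) (a : ℝ → ℝ) (b e c : ℝ) (l : ℕ) (j n : ℤ) (v : ℝ)
    {Φ : ℝ × ℝ → ℂ} (hΦ : ∀ X, Φ X = m ((2:ℝ) ^ (-(l:ℝ)) • X) * curveFT b e c a X)
    (f : ℝ × ℝ → ℝ) :
    curveOp m a b e c l (dilMod b j n v) j (dilExp b j n) f
      = dilatedOp b Φ j ((2:ℝ) ^ (b * (n : ℝ)) * v) f := by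
  unfold curveOp dilatedOp
  simp_rw [curveSymbol_dilMod, hΦ]

lemma continuous_dil (b : ℝ) (j : ℤ) (u : ℝ) : Continuous (dil b j u) := by
  unfold dil; fun_prop

lemma integrable_dilatedOp_integrand (b : ℝ) {Φ : ℝ × ℝ → ℂ} (hΦ : Integrable Φ) (j : ℤ) {u : ℝ}
    (hu : 0 < u) {f : ℝ × ℝ → ℝ} (hf : Integrable f) :
    Integrable fun ξ => Φ (dil b j u ξ) * FT (fun x => ((f x : ℝ) : ℂ)) ξ := by
  have hfc : Integrable fun x => ((f x : ℝ) : ℂ) := hf.ofReal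
  have h1 := integrable_dil (a := (2:ℝ) ^ (-(j:ℝ))) (b := (2:ℝ) ^ (-((j:ℝ) * b)) * u)
    (by positivity) (by positivity) hΦ
  simp only [mul_assoc] at h1
  exact h1.mul_bdd (c := ∫ x, ‖((f x : ℝ) : ℂ)‖) (continuous_FT hfc).aestronglyMeasurable
    (Eventually.of_forall fun ξ => norm_FT_le _ ξ)

/-- Differentiation of `dilatedOp` in the dilation parameter. -/
lemma hasDerivAt_dilatedOp (b : ℝ) {Φ Ψ : ℝ × ℝ → ℂ} (hΦ : Continuous Φ)
    (hΦc : HasCompactSupport Φ) (hΨ : Continuous Ψ) (hΨc : HasCompactSupport Ψ)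
    (h : ∀ x y, ∃ D, HasDerivAt (fun y => Φ (x, y)) D y ∧ (y : ℂ) * D = Ψ (x, y))
    (j : ℤ) {q : ℝ} (hq : 0 < q) {f : ℝ × ℝ → ℝ} (hf : Integrable f) (x : ℝ × ℝ) {v : ℝ}
    (hv : 0 < v) :
    HasDerivAt (fun v => dilatedOp b Φ j (q * v) f x)
      ((v : ℂ)⁻¹ * dilatedOp b Ψ j (q * v) f x) v := by
  have hfc : Integrable fun x => ((f x : ℝ) : ℂ) := hf.ofReal
  obtain ⟨M, hM⟩ := hΨc.exists_bound_of_continuous hΨ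
  have hM0 : 0 ≤ M := (norm_nonneg _).trans (hM 0)
  obtain ⟨R, hR⟩ := hΨc.isCompact.isBounded.exists_norm_le
  have hR' : ∀ X, Ψ X ≠ 0 → |X.1| ≤ R ∧ |X.2| ≤ R := fun X hX => by
    have := hR X (subset_tsupport _ hX)
    exact ⟨(norm_fst_le X).trans this, (norm_snd_le X).trans this⟩
  set A := (2:ℝ) ^ (-(j:ℝ)) with hA
  set κ := (2:ℝ) ^ (-((j:ℝ) * b)) with hκ
  have hA0 : 0 < A := by positivity
  have hκ0 : 0 < κ := by positivity
  set Q : Set (ℝ × ℝ) := Icc (-(R / A)) (R / A) ×ˢ Icc (-(R / (κ * (q * (v / 2)))))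
    (R / (κ * (q * (v / 2)))) with hQ
  have hQc : IsCompact Q := isCompact_Icc.prod isCompact_Icc
  set N := ∫ x, ‖((f x : ℝ) : ℂ)‖ with hN
  have hN0 : 0 ≤ N := integral_nonneg fun _ => norm_nonneg _
  have key := (hasDerivAt_integral_of_dominated_loc_of_deriv_le (μ := volume) (𝕜 := ℝ)
    (F := fun v (ξ : ℝ × ℝ) =>
      Complex.exp (((2 * Real.pi * (x.1 * ξ.1 + x.2 * ξ.2) : ℝ) : ℂ) * Complex.I) *
        (Φ (dil b j (q * v) ξ) * FT (fun x => ((f x : ℝ) : ℂ)) ξ))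
    (F' := fun v (ξ : ℝ × ℝ) => (v : ℂ)⁻¹ * (
      Complex.exp (((2 * Real.pi * (x.1 * ξ.1 + x.2 * ξ.2) : ℝ) : ℂ) * Complex.I) *
        (Ψ (dil b j (q * v) ξ) * FT (fun x => ((f x : ℝ) : ℂ)) ξ)))
    (bound := Q.indicator fun _ => (v / 2)⁻¹ * (M * N)) (x₀ := v) (s := Ioi (v / 2))
    (Ioi_mem_nhds (by linarith)) ?_ ?_ ?_ (ae_of_all _ fun ξ y hy => ?_) ?_
    (ae_of_all _ fun ξ y hy => ?_)).2
  · refine key.congr_deriv ?_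
    rw [integral_const_mul]
    rfl
  · have := continuous_FT hfc
    refine Eventually.of_forall fun v => Continuous.aestronglyMeasurable ?_
    have := continuous_dil b j (q * v)
    fun_prop
  · exact integrable_expI_mul (integrable_dilatedOp_integrand b
      (hΦ.integrable_of_hasCompactSupport hΦc) j (mul_pos hq hv) hf) (by fun_prop)
  · have := continuous_FT hfc
    have := continuous_dil b j (q * v)
    exact Continuous.aestronglyMeasurable (by fun_prop)
  · have hy' : v / 2 < y := hy
    by_cases h0 : Ψ (dil b j (q * y) ξ) = 0
    · rw [h0]
      simp only [zero_mul, mul_zero, norm_zero]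
      exact indicator_nonneg (fun _ _ => by positivity) _
    · have hξ : ξ ∈ Q := by
        obtain ⟨h1, h2⟩ := hR' _ h0
        simp only [dil] at h1 h2
        rw [abs_mul, abs_of_pos hA0] at h1
        rw [abs_mul, abs_mul, abs_of_pos hκ0, abs_of_pos (mul_pos hq (by linarith))] at h2
        refine ⟨abs_le.1 ?_, abs_le.1 ?_⟩
        · rw [le_div_iff₀ hA0]; linarith
        · rw [le_div_iff₀ (by positivity)]
          refine le_trans ?_ h2
          calc |ξ.2| * (κ * (q * (v / 2))) = κ * (q * (v / 2) * |ξ.2|) := by ring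
            _ ≤ _ := by gcongr
      rw [indicator_of_mem hξ, norm_mul, norm_mul, Complex.norm_exp_ofReal_mul_I, one_mul,
        norm_mul, norm_inv, Complex.norm_real, Real.norm_eq_abs,
        abs_of_pos (show 0 < y by linarith)]
      gcongr (?_)⁻¹ * (?_ * ?_)
      · exact hM _
      · exact norm_FT_le _ _
  · exact (integrable_indicator_iff hQc.measurableSet).2
      (continuousOn_const.integrableOn_compact hQc)
  · have hy' : 0 < y := by linarith [show v / 2 < y from hy]
    obtain ⟨D, hD, hDΨ⟩ := h (A * ξ.1) (κ * (q * y * ξ.2))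
    have h1 : HasDerivAt (fun y : ℝ => κ * (q * y * ξ.2)) (κ * (q * ξ.2)) y := by
      refine ((((hasDerivAt_id y).const_mul q).mul_const ξ.2).const_mul κ).congr_deriv (by ring)
    have h2 := HasDerivAt.scomp (h := fun y : ℝ => κ * (q * y * ξ.2))
      (g₁ := fun z => Φ (A * ξ.1, z)) y hD h1
    refine (HasDerivAt.const_mul _ (HasDerivAt.mul_const h2 _)).congr_deriv ?_
    have h3 : Ψ (dil b j (q * y) ξ) = _ := hDΨ.symm
    have hyc : (y : ℂ) ≠ 0 := by exact_mod_cast hy'.ne'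
    rw [h3, Complex.real_smul]
    push_cast
    field_simp

lemma hasCompactSupport_of_abs_le {g : ℝ × ℝ → ℂ} {R : ℝ}
    (h : ∀ X, g X ≠ 0 → |X.1| ≤ R ∧ |X.2| ≤ R) : HasCompactSupport g := by
  refine HasCompactSupport.intro ((isCompact_Icc (a := -R) (b := R)).prod
    (isCompact_Icc (a := -R) (b := R))) fun X hX => ?_
  by_contra h0
  exact hX ⟨abs_le.1 (h X h0).1, abs_le.1 (h X h0).2⟩

lemma contDiff_mul_of_support {g a : ℝ → ℝ}
    (hg : ∀ t, 0 < t → ContDiffAt ℝ ((⊤ : ℕ∞) : WithTop ℕ∞) g t)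
    (ha : ContDiff ℝ ((⊤ : ℕ∞) : WithTop ℕ∞) a) (hasupp : ∀ t, t ∉ Icc (1 / 2 : ℝ) 2 → a t = 0) :
    ContDiff ℝ ((⊤ : ℕ∞) : WithTop ℕ∞) fun t => g t * a t := by
  rw [contDiff_iff_contDiffAt]
  intro t
  by_cases ht : 0 < t
  · exact (hg t ht).mul ha.contDiffAt
  · have h0 : (fun t => g t * a t) =ᶠ[𝓝 t] fun _ => 0 := by
      filter_upwards [Iio_mem_nhds (show t < 1 / 2 by linarith)] with s hs
      rw [hasupp s fun h => absurd h.1 (not_le.2 hs), mul_zero]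
    exact contDiffAt_const.congr_of_eventuallyEq h0

/-- The square function estimates for a multiplier `m (2^{-l} X) * curveFT X` and for its
normalised derivative in the dilation parameter. -/
lemma exists_squareBound_dilatedOp {b : ℝ} (hb : 1 < b) {m : ℝ × ℝ → ℂ}
    (hm : ContDiff ℝ ((⊤ : ℕ∞) : WithTop ℕ∞) m) {r₀ R₀ : ℝ} (hr₀ : 0 < r₀)
    (hsupp : ∀ η, m η ≠ 0 → r₀ ≤ |η.1| ∧ |η.1| ≤ R₀ ∧ r₀ ≤ |η.2| ∧ |η.2| ≤ R₀)
    {a : ℝ → ℝ} (ha : ContDiff ℝ ((⊤ : ℕ∞) : WithTop ℕ∞) a)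
    (hasupp : ∀ t, t ∉ Icc (1 / 2 : ℝ) 2 → a t = 0) {e : ℝ} (he : |e| = 1)
    {c : ℝ} (hc : c ≠ 0) :
    ∃ C : ℝ, ∀ l : ℕ, 1 ≤ l → ∀ Φ : ℝ × ℝ → ℂ,
      (∀ X, Φ X = m ((2:ℝ) ^ (-(l:ℝ)) • X) * curveFT b e c a X) →
      SquareBound b C l (fun j n v f => dilatedOp b Φ j ((2:ℝ) ^ (b * (n:ℝ)) * v) f) ∧
      SquareBound b C l (fun j n v f x => (((2:ℝ) ^ (-(l:ℝ)) : ℝ) : ℂ) *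
        deriv (fun v' : ℝ => dilatedOp b Φ j ((2:ℝ) ^ (b * (n:ℝ)) * v') f x) v) := by
  set a₂ : ℝ → ℝ := fun t => 2 * Real.pi * (c * t ^ b) * a t with ha₂
  set m₁ : ℝ × ℝ → ℂ := fun η => (η.2 : ℂ) * fderiv ℝ m η (0, 1) with hm₁
  set m₂ : ℝ × ℝ → ℂ := fun η => -Complex.I * ((η.2 : ℂ) * m η) with hm₂
  have hmd : Differentiable ℝ m := hm.differentiable (by simp)
  have hsnd : ContDiff ℝ ((⊤ : ℕ∞) : WithTop ℕ∞) fun η : ℝ × ℝ => (η.2 : ℂ) :=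
    Complex.ofRealCLM.contDiff.comp contDiff_snd
  have hm₁s : ContDiff ℝ ((⊤ : ℕ∞) : WithTop ℕ∞) m₁ :=
    hsnd.mul ((hm.fderiv_right (m := ((⊤ : ℕ∞) : WithTop ℕ∞)) (by simp)).clm_apply contDiff_const)
  have hm₂s : ContDiff ℝ ((⊤ : ℕ∞) : WithTop ℕ∞) m₂ := contDiff_const.mul (hsnd.mul hm)
  have ha₂s : ContDiff ℝ ((⊤ : ℕ∞) : WithTop ℕ∞) a₂ := contDiff_mul_of_support (fun t ht =>
    contDiffAt_const.mul (contDiffAt_const.mul (Real.contDiffAt_rpow_const_of_ne ht.ne')))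
    ha hasupp
  have ha₂supp : ∀ t, t ∉ Icc (1 / 2 : ℝ) 2 → a₂ t = 0 := fun t ht => by
    simp only [ha₂, hasupp t ht, mul_zero]
  have hsupp₂ : ∀ η, m₂ η ≠ 0 → r₀ ≤ |η.1| ∧ |η.1| ≤ R₀ ∧ r₀ ≤ |η.2| ∧ |η.2| ≤ R₀ :=
    fun η h => hsupp η fun h0 => h (by simp only [hm₂, h0, mul_zero])
  have hsupp₁ : ∀ η, m₁ η ≠ 0 → r₀ ≤ |η.1| ∧ |η.1| ≤ R₀ ∧ r₀ ≤ |η.2| ∧ |η.2| ≤ R₀ := by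
    intro η h
    by_contra h0
    have hcl : IsClosed {η : ℝ × ℝ | r₀ ≤ |η.1| ∧ |η.1| ≤ R₀ ∧ r₀ ≤ |η.2| ∧ |η.2| ≤ R₀} := by
      refine IsClosed.and ?_ (IsClosed.and ?_ (IsClosed.and ?_ ?_)) <;>
      exact isClosed_le (by fun_prop) (by fun_prop)
    have h1 : m =ᶠ[𝓝 η] fun _ => 0 := by
      filter_upwards [hcl.isOpen_compl.mem_nhds h0] with y hy
      by_contra hy0
      exact hy (hsupp y hy0)
    refine h ?_
    simp only [hm₁, h1.fderiv_eq, fderiv_fun_const]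
    simp
  have hai : Integrable a := ha.continuous.integrable_of_hasCompactSupport
    (HasCompactSupport.intro isCompact_Icc hasupp)
  have ha₂i : Integrable a₂ := ha₂s.continuous.integrable_of_hasCompactSupport
    (HasCompactSupport.intro isCompact_Icc ha₂supp)
  obtain ⟨C₀, hC₀⟩ := exists_squareBound_curveOp hb hm hr₀ hsupp ha hasupp he hc
  obtain ⟨C₁, hC₁⟩ := exists_squareBound_curveOp hb hm₁s hr₀ hsupp₁ ha hasupp he hc
  obtain ⟨C₂, hC₂⟩ := exists_squareBound_curveOp hb hm₂s hr₀ hsupp₂ ha₂s ha₂supp he hc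
  refine ⟨C₀ + 2 * (C₁ + C₂), fun l hl Φ hΦ => ?_⟩
  have p₀ := (hC₀ l hl).1
  have p₁ := (hC₁ l hl).1
  have p₂ := (hC₂ l hl).1
  set r := (2:ℝ) ^ (-(l:ℝ)) with hr
  have hr0 : 0 < r := by positivity
  have hr1 : r ≤ 1 := Real.rpow_le_one_of_one_le_of_nonpos (by norm_num) (by simp)
  refine ⟨((hC₀ l hl).mono (by linarith)).congr fun j n v _ f =>
    (curveOp_dilMod m a b e c l j n v hΦ f).symm, ?_⟩
  set Φ₁ : ℝ × ℝ → ℂ := fun X => m₁ (r • X) * curveFT b e c a X with hΦ₁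
  set Φ₂ : ℝ × ℝ → ℂ := fun X => m₂ (r • X) * curveFT b e c a₂ X with hΦ₂
  set Ψ : ℝ × ℝ → ℂ := fun X => Φ₁ X + (r : ℂ)⁻¹ * Φ₂ X with hΨ
  have hFc := continuous_curveFT b e c hai
  have hF₂c := continuous_curveFT b e c ha₂i
  have hmc := hm.continuous
  have hm₁c := hm₁s.continuous
  have hm₂c := hm₂s.continuous
  have hΦe : Φ = fun X => m (r • X) * curveFT b e c a X := funext hΦ
  have hΦc : Continuous Φ := by rw [hΦe]; fun_prop
  have hΦ₁c : Continuous Φ₁ := by fun_prop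
  have hΦ₂c : Continuous Φ₂ := by fun_prop
  have hscale : ∀ (g : ℝ × ℝ → ℂ) (F : ℝ × ℝ → ℂ),
      (∀ η, g η ≠ 0 → r₀ ≤ |η.1| ∧ |η.1| ≤ R₀ ∧ r₀ ≤ |η.2| ∧ |η.2| ≤ R₀) →
      HasCompactSupport fun X => g (r • X) * F X := by
    intro g F hg
    refine hasCompactSupport_of_abs_le (R := R₀ / r) fun X hX => ?_
    obtain ⟨-, h1, -, h2⟩ := hg _ (left_ne_zero_of_mul hX)
    simp only [Prod.smul_fst, Prod.smul_snd, smul_eq_mul, abs_mul, abs_of_pos hr0] at h1 h2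
    rw [le_div_iff₀ hr0, le_div_iff₀ hr0]
    exact ⟨by linarith, by linarith⟩
  have hΦs : HasCompactSupport Φ := by rw [hΦe]; exact hscale m _ hsupp
  have hΦ₁s : HasCompactSupport Φ₁ := hscale m₁ _ hsupp₁
  have hΦ₂s : HasCompactSupport Φ₂ := hscale m₂ _ hsupp₂
  have hder : ∀ x y : ℝ, ∃ D, HasDerivAt (fun y => Φ (x, y)) D y ∧ (y : ℂ) * D = Ψ (x, y) := by
    intro x y
    refine ⟨fderiv ℝ m (r • (x, y)) (0, r) * curveFT b e c a (x, y)
      + m (r • (x, y)) * (-Complex.I * curveFT b e c a₂ (x, y)), ?_, ?_⟩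
    · simp only [hΦe]
      refine HasDerivAt.mul ?_ (hasDerivAt_curveFT b e c hai ha₂i x y)
      have h1 : HasDerivAt (fun y : ℝ => r • (x, y)) (0, r) y := by
        refine ((((hasDerivAt_const y x).prodMk (hasDerivAt_id y)).const_smul r)).congr_deriv ?_
        simp
      exact (hmd (r • (x, y))).hasFDerivAt.comp_hasDerivAt y h1
    · have h2 : fderiv ℝ m (r • (x, y)) (0, r) = (r : ℂ) * fderiv ℝ m (r • (x, y)) (0, 1) := by
        rw [show ((0 : ℝ), r) = r • ((0 : ℝ), (1 : ℝ)) by simp, map_smul, Complex.real_smul]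
      have hrc : (r : ℂ) ≠ 0 := by exact_mod_cast hr0.ne'
      simp only [hΨ, hΦ₁, hΦ₂, hm₁, hm₂, h2, Prod.smul_snd, smul_eq_mul]
      push_cast
      field_simp
  have hΨs : HasCompactSupport Ψ := hΦ₁s.add hΦ₂s.mul_left
  have hop : ∀ (j n : ℤ), ∀ v ∈ Icc (1:ℝ) ((2:ℝ) ^ b), ∀ (f : SchwartzMap (ℝ × ℝ) ℝ) x,
      (r : ℂ) * deriv (fun v' : ℝ => dilatedOp b Φ j ((2:ℝ) ^ (b * (n:ℝ)) * v') f x) v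
        = (v : ℂ)⁻¹ * ((r : ℂ) * curveOp m₁ a b e c l (dilMod b j n v) j (dilExp b j n) f x
          + curveOp m₂ a₂ b e c l (dilMod b j n v) j (dilExp b j n) f x) := by
    intro j n v hv f x
    have hv0 : 0 < v := by linarith [hv.1]
    have hq : (0:ℝ) < (2:ℝ) ^ (b * (n:ℝ)) := by positivity
    have hrc : (r : ℂ) ≠ 0 := by exact_mod_cast hr0.ne'
    rw [(hasDerivAt_dilatedOp b hΦc hΦs (by fun_prop) hΨs hder j hq f.integrable x hv0).deriv,
      curveOp_dilMod m₁ a b e c l j n v (Φ := Φ₁) (fun _ => rfl) f,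
      curveOp_dilMod m₂ a₂ b e c l j n v (Φ := Φ₂) (fun _ => rfl) f]
    have i₁ := integrable_dilatedOp_integrand b (hΦ₁c.integrable_of_hasCompactSupport hΦ₁s) j
      (mul_pos hq hv0) f.integrable
    have i₂ := integrable_dilatedOp_integrand b (hΦ₂c.integrable_of_hasCompactSupport hΦ₂s) j
      (mul_pos hq hv0) f.integrable
    have h3 : dilatedOp b Ψ j ((2:ℝ) ^ (b * (n:ℝ)) * v) f x
        = dilatedOp b Φ₁ j ((2:ℝ) ^ (b * (n:ℝ)) * v) f x
          + (r : ℂ)⁻¹ * dilatedOp b Φ₂ j ((2:ℝ) ^ (b * (n:ℝ)) * v) f x := by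
      have h4 : dilatedOp b Ψ j ((2:ℝ) ^ (b * (n:ℝ)) * v) f x
          = dilatedOp b Φ₁ j ((2:ℝ) ^ (b * (n:ℝ)) * v) f x
          + FTinv (fun ξ => (r : ℂ)⁻¹ * (Φ₂ (dil b j ((2:ℝ) ^ (b * (n:ℝ)) * v) ξ)
              * FT (fun x => ((f x : ℝ) : ℂ)) ξ)) x := by
        refine Eq.trans ?_ (FTinv_add i₁ (i₂.const_mul _) x)
        simp only [dilatedOp, hΨ, add_mul, mul_assoc]
      rw [h4]
      congr 1
      simp only [FTinv, dilatedOp]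
      rw [← integral_const_mul]
      congr 1; ext ξ; ring
    rw [h3]
    field_simp
  refine ((hC₁ l hl).of_norm_le_add (hC₂ l hl) (fun j n v hv f => ?_) ?_).mono (by linarith)
  · simp only [hop j n v hv f]
    exact (((hC₁ l hl).2.1 j n v hv f).const_mul _ |>.add ((hC₂ l hl).2.1 j n v hv f)).const_mul _
  · intro j n v hv f x
    rw [hop j n v hv f x]
    refine le_trans ?_ (enorm_add_le _ _ |>.trans ?_) (b := ‖(r : ℂ) *
      curveOp m₁ a b e c l (dilMod b j n v) j (dilExp b j n) f x
      + curveOp m₂ a₂ b e c l (dilMod b j n v) j (dilExp b j n) f x‖ₑ)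
    · rw [enorm_mul]
      refine mul_le_of_le_one_left' ?_
      rw [← ofReal_norm, norm_inv, Complex.norm_real, Real.norm_eq_abs,
        abs_of_pos (show 0 < v by linarith [hv.1])]
      exact ENNReal.ofReal_le_one.2 (inv_le_one_of_one_le₀ hv.1)
    · gcongr ?_ + _
      rw [enorm_mul]
      refine mul_le_of_le_one_left' ?_
      rw [← ofReal_norm, Complex.norm_real, Real.norm_eq_abs, abs_of_pos hr0]
      exact ENNReal.ofReal_le_one.2 hr1

/-- The rescaled frequency cutoff at level `l`. -/
def conicCutoff (c : ℝ) (ς : ℝ → ℝ) (η ζ : ℝ × ℝ → ℝ) (l : ℕ) (X : ℝ × ℝ) : ℝ :=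
  (ζ X - ζ ((2:ℝ) • X)) * ((1 - η ((2:ℝ) ^ (l:ℝ) • X)) * ς (X.1 / (c * X.2)))

lemma annulus_of_ne {ζ : ℝ × ℝ → ℝ} (hζsupp : ∀ ξ : ℝ × ℝ, (4:ℝ) ≤ ξ.1 ^ 2 + ξ.2 ^ 2 → ζ ξ = 0)
    (hζone : ∀ ξ : ℝ × ℝ, ξ.1 ^ 2 + ξ.2 ^ 2 ≤ ((5:ℝ) / 4) ^ 2 → ζ ξ = 1) {X : ℝ × ℝ}
    (h : ζ X - ζ ((2:ℝ) • X) ≠ 0) :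
    X.1 ^ 2 + X.2 ^ 2 < 4 ∧ (5 / 8 : ℝ) ^ 2 < X.1 ^ 2 + X.2 ^ 2 := by
  have e : ((2:ℝ) • X).1 ^ 2 + ((2:ℝ) • X).2 ^ 2 = 4 * (X.1 ^ 2 + X.2 ^ 2) := by
    simp only [Prod.smul_fst, Prod.smul_snd, smul_eq_mul]; ring
  constructor
  · by_contra! h4
    exact h (by rw [hζsupp X h4, hζsupp _ (by rw [e]; linarith), sub_zero])
  · by_contra! h4
    refine h ?_
    rw [hζone X (by linarith), hζone _ (by rw [e]; linarith), sub_self]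

lemma conicCutoff_support {c κ₁ κ₂ : ℝ} (hc : c ≠ 0) (hκ₁ : 0 < κ₁) {ς : ℝ → ℝ}
    (hς : ∀ q, ς q ≠ 0 → κ₁ ≤ |q| ∧ |q| ≤ κ₂) {η ζ : ℝ × ℝ → ℝ}
    (hζsupp : ∀ ξ : ℝ × ℝ, (4:ℝ) ≤ ξ.1 ^ 2 + ξ.2 ^ 2 → ζ ξ = 0)
    (hζone : ∀ ξ : ℝ × ℝ, ξ.1 ^ 2 + ξ.2 ^ 2 ≤ ((5:ℝ) / 4) ^ 2 → ζ ξ = 1) :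
    ∃ r₀ : ℝ, 0 < r₀ ∧ ∀ l X, conicCutoff c ς η ζ l X ≠ 0 →
      r₀ ≤ |X.1| ∧ |X.1| ≤ 2 ∧ r₀ ≤ |X.2| ∧ |X.2| ≤ 2 := by
  have hc0 : 0 < |c| := abs_pos.2 hc
  set A := |κ₂| * |c| with hA
  set ρ := (5 / 8) / (1 + A) with hρ
  have hA0 : 0 ≤ A := by positivity
  have hρ0 : 0 < ρ := by positivity
  refine ⟨min ρ (κ₁ * |c| * ρ), by positivity, fun l X hX => ?_⟩
  obtain ⟨h1, h2⟩ := annulus_of_ne hζsupp hζone (left_ne_zero_of_mul hX)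
  obtain ⟨h3, h4⟩ := hς _ (right_ne_zero_of_mul (right_ne_zero_of_mul hX))
  have hX2 : 0 < |X.2| := by
    rw [abs_pos]
    intro h0
    rw [h0, mul_zero, div_zero, abs_zero] at h3
    linarith
  rw [abs_div, abs_mul] at h3 h4
  rw [le_div_iff₀ (by positivity)] at h3
  have h4' : |X.1| ≤ A * |X.2| := by
    rw [div_le_iff₀ (by positivity)] at h4
    calc _ ≤ _ := h4
      _ ≤ |κ₂| * (|c| * |X.2|) := by gcongr; exact le_abs_self _
      _ = _ := by rw [hA]; ring
  have h5 : ρ ≤ |X.2| := by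
    rw [hρ, div_le_iff₀ (by positivity)]
    have : (5 / 8 : ℝ) ^ 2 < (|X.1| + |X.2|) ^ 2 := by
      nlinarith [sq_abs X.1, sq_abs X.2, abs_nonneg X.1, abs_nonneg X.2]
    have := lt_of_pow_lt_pow_left₀ 2 (by positivity) this
    nlinarith
  refine ⟨(min_le_right _ _).trans ?_, ?_, (min_le_left _ _).trans h5, ?_⟩
  · calc κ₁ * |c| * ρ ≤ κ₁ * |c| * |X.2| := by gcongr
      _ = κ₁ * (|c| * |X.2|) := by ring
      _ ≤ _ := h3
  · exact abs_le_of_sq_le_sq (by nlinarith [sq_nonneg X.2]) (by norm_num)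
  · exact abs_le_of_sq_le_sq (by nlinarith [sq_nonneg X.1]) (by norm_num)

lemma contDiff_conicCutoff {c κ₁ κ₂ : ℝ} (hc : c ≠ 0) (hκ₁ : 0 < κ₁) {ς : ℝ → ℝ}
    (hςs : ContDiff ℝ ((⊤ : ℕ∞) : WithTop ℕ∞) ς)
    (hς : ∀ q, ς q ≠ 0 → κ₁ ≤ |q| ∧ |q| ≤ κ₂) {η ζ : ℝ × ℝ → ℝ}
    (hηs : ContDiff ℝ ((⊤ : ℕ∞) : WithTop ℕ∞) η) (hζs : ContDiff ℝ ((⊤ : ℕ∞) : WithTop ℕ∞) ζ)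
    (hζsupp : ∀ ξ : ℝ × ℝ, (4:ℝ) ≤ ξ.1 ^ 2 + ξ.2 ^ 2 → ζ ξ = 0)
    (hζone : ∀ ξ : ℝ × ℝ, ξ.1 ^ 2 + ξ.2 ^ 2 ≤ ((5:ℝ) / 4) ^ 2 → ζ ξ = 1) (l : ℕ) :
    ContDiff ℝ ((⊤ : ℕ∞) : WithTop ℕ∞) (conicCutoff c ς η ζ l) := by
  obtain ⟨r₀, hr₀, hsupp⟩ := conicCutoff_support (η := η) hc hκ₁ hς hζsupp hζone
  rw [contDiff_iff_contDiffAt]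
  intro X
  by_cases hX : X.2 = 0
  · refine contDiffAt_const (c := (0:ℝ)).congr_of_eventuallyEq ?_
    have h1 : IsOpen {Y : ℝ × ℝ | |Y.2| < r₀} := isOpen_lt (by fun_prop) (by fun_prop)
    filter_upwards [h1.mem_nhds (show |X.2| < r₀ by rw [hX, abs_zero]; exact hr₀)] with Y hY
    by_contra h0
    exact absurd hY (not_lt.2 (hsupp l Y h0).2.2.1)
  · have h1 : ContDiffAt ℝ ((⊤ : ℕ∞) : WithTop ℕ∞) (fun X : ℝ × ℝ => X.1 / (c * X.2)) X :=
      contDiffAt_fst.div (contDiffAt_const.mul contDiffAt_snd) (mul_ne_zero hc hX)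
    have h2 : ContDiffAt ℝ ((⊤ : ℕ∞) : WithTop ℕ∞) (fun X : ℝ × ℝ => ς (X.1 / (c * X.2))) X :=
      hςs.contDiffAt.comp X h1
    have h3 : ContDiff ℝ ((⊤ : ℕ∞) : WithTop ℕ∞) fun X : ℝ × ℝ => ζ X - ζ ((2:ℝ) • X) :=
      hζs.sub (hζs.comp (contDiff_id.const_smul (2:ℝ)))
    have h4 : ContDiff ℝ ((⊤ : ℕ∞) : WithTop ℕ∞) fun X : ℝ × ℝ => 1 - η ((2:ℝ) ^ (l:ℝ) • X) :=
      contDiff_const.sub (hηs.comp (contDiff_id.const_smul _))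
    exact h3.contDiffAt.mul (h4.contDiffAt.mul h2)

lemma conicCutoff_eq_min (c : ℝ) (ς : ℝ → ℝ) {η ζ : ℝ × ℝ → ℝ}
    (hηsupp : ∀ ξ : ℝ × ℝ, (100:ℝ) ^ 2 < ξ.1 ^ 2 + ξ.2 ^ 2 → η ξ = 0)
    (hζsupp : ∀ ξ : ℝ × ℝ, (4:ℝ) ≤ ξ.1 ^ 2 + ξ.2 ^ 2 → ζ ξ = 0)
    (hζone : ∀ ξ : ℝ × ℝ, ξ.1 ^ 2 + ξ.2 ^ 2 ≤ ((5:ℝ) / 4) ^ 2 → ζ ξ = 1) (l : ℕ) :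
    conicCutoff c ς η ζ l = conicCutoff c ς η ζ (min l 8) := by
  rcases le_total l 8 with h | h
  · rw [min_eq_left h]
  rw [min_eq_right h]
  funext X
  by_cases h0 : ζ X - ζ ((2:ℝ) • X) = 0
  · simp only [conicCutoff, h0, zero_mul]
  have h1 := (annulus_of_ne hζsupp hζone h0).2
  have h2 : ∀ k : ℕ, 8 ≤ k → η ((2:ℝ) ^ (k:ℝ) • X) = 0 := by
    intro k hk
    refine hηsupp _ ?_
    have h3 : (256:ℝ) ≤ (2:ℝ) ^ (k:ℝ) := by
      rw [Real.rpow_natCast]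
      calc (256:ℝ) = 2 ^ 8 := by norm_num
        _ ≤ _ := pow_le_pow_right₀ (by norm_num) hk
    simp only [Prod.smul_fst, Prod.smul_snd, smul_eq_mul, mul_pow, ← mul_add]
    calc (100:ℝ) ^ 2 < 256 ^ 2 * (5 / 8 : ℝ) ^ 2 := by norm_num
      _ ≤ _ := by gcongr
  simp only [conicCutoff, h2 l h, h2 8 le_rfl]

/-- The square function estimates for the frequency localised multipliers, uniformly in `l`. -/
theorem exists_squareBound_conicCutoff {b : ℝ} (hb : 1 < b) {c κ₁ κ₂ : ℝ} (hc : c ≠ 0)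
    (hκ₁ : 0 < κ₁) {ς : ℝ → ℝ} (hςs : ContDiff ℝ ((⊤ : ℕ∞) : WithTop ℕ∞) ς)
    (hς : ∀ q, ς q ≠ 0 → κ₁ ≤ |q| ∧ |q| ≤ κ₂) {η ζ : ℝ × ℝ → ℝ}
    (hηs : ContDiff ℝ ((⊤ : ℕ∞) : WithTop ℕ∞) η) (hζs : ContDiff ℝ ((⊤ : ℕ∞) : WithTop ℕ∞) ζ)
    (hηsupp : ∀ ξ : ℝ × ℝ, (100:ℝ) ^ 2 < ξ.1 ^ 2 + ξ.2 ^ 2 → η ξ = 0)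
    (hζsupp : ∀ ξ : ℝ × ℝ, (4:ℝ) ≤ ξ.1 ^ 2 + ξ.2 ^ 2 → ζ ξ = 0)
    (hζone : ∀ ξ : ℝ × ℝ, ξ.1 ^ 2 + ξ.2 ^ 2 ≤ ((5:ℝ) / 4) ^ 2 → ζ ξ = 1)
    {a : ℝ → ℝ} (ha : ContDiff ℝ ((⊤ : ℕ∞) : WithTop ℕ∞) a)
    (hasupp : ∀ t, t ∉ Icc (1 / 2 : ℝ) 2 → a t = 0) {e : ℝ} (he : |e| = 1) :
    ∃ C : ℝ, ∀ l : ℕ, 1 ≤ l → ∀ Φ : ℝ × ℝ → ℂ,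
      (∀ X, Φ X = ((zl ζ l X : ℝ) : ℂ) *
        ((((1 - η X) * ς (X.1 / (c * X.2)) : ℝ) : ℂ) * curveFT b e c a X)) →
      SquareBound b C l (fun j n v f => dilatedOp b Φ j ((2:ℝ) ^ (b * (n:ℝ)) * v) f) ∧
      SquareBound b C l (fun j n v f x => (((2:ℝ) ^ (-(l:ℝ)) : ℝ) : ℂ) *
        deriv (fun v' : ℝ => dilatedOp b Φ j ((2:ℝ) ^ (b * (n:ℝ)) * v') f x) v) := by
  obtain ⟨r₀, hr₀, hsupp⟩ := conicCutoff_support (η := η) hc hκ₁ hς hζsupp hζone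
  have key : ∀ k : ℕ, _ := fun k => exists_squareBound_dilatedOp hb
    (m := fun X => ((conicCutoff c ς η ζ k X : ℝ) : ℂ))
    (Complex.ofRealCLM.contDiff.comp
      (contDiff_conicCutoff hc hκ₁ hςs hς hηs hζs hζsupp hζone k)) hr₀
    (fun X hX => hsupp k X (fun h => hX (by rw [h, Complex.ofReal_zero]))) ha hasupp he hc
  choose C hC using key
  have hC0 : ∀ k, 0 ≤ C k := fun k => (hC k 1 le_rfl _ fun _ => rfl).1.1
  refine ⟨∑ k ∈ Finset.range 9, C k, fun l hl Φ hΦ => ?_⟩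
  have h1 : C (min l 8) ≤ ∑ k ∈ Finset.range 9, C k :=
    Finset.single_le_sum (fun k _ => hC0 k) (Finset.mem_range.2 (by omega))
  have h2 := hC (min l 8) l hl Φ fun X => by
    rw [hΦ, ← mul_assoc, ← Complex.ofReal_mul,
      ← conicCutoff_eq_min c ς hηsupp hζsupp hζone l]
    have hr : (0:ℝ) < (2:ℝ) ^ (-(l:ℝ)) := by positivity
    congr 2
    simp only [conicCutoff, zl, smul_smul, Prod.smul_fst, Prod.smul_snd, smul_eq_mul]
    rw [← Real.rpow_add (by norm_num), add_neg_cancel, Real.rpow_zero, one_smul,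
      show (2:ℝ) * (2:ℝ) ^ (-(l:ℝ)) = (2:ℝ) ^ (1 - (l:ℝ)) by
        rw [sub_eq_add_neg, Real.rpow_add (by norm_num), Real.rpow_one],
      show (2:ℝ) ^ (-(l:ℝ)) * X.1 / (c * ((2:ℝ) ^ (-(l:ℝ)) * X.2)) = X.1 / (c * X.2) by
        rw [mul_left_comm, mul_div_mul_left _ _ hr.ne']]
  exact ⟨h2.1.mono h1, h2.2.mono h1⟩

lemma tauHat_eq_curveFT (b cp cm : ℝ) {χp : ℝ → ℝ} (hχ : ∀ t, t ∉ Ioo (1 / 2 : ℝ) 2 → χp t = 0)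
    (X : ℝ × ℝ) : tauHat b cp cm χp X = curveFT b 1 cp χp X := by
  refine integral_congr_ae (ae_of_all _ fun t => ?_)
  by_cases ht : 0 < t
  · simp only [curve, if_pos ht, one_mul]
  · simp only [hχ t fun h => ht (by linarith [h.1]), Complex.ofReal_zero, mul_zero]

lemma sigmaHat_eq_curveFT (b cp cm : ℝ) {χp : ℝ → ℝ}
    (hχ : ∀ t, t ∉ Ioo (1 / 2 : ℝ) 2 → χp t = 0) (X : ℝ × ℝ) :
    sigmaHat b cp cm χp X = curveFT b 1 cp (fun t => t⁻¹ * χp t) X := by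
  refine integral_congr_ae (ae_of_all _ fun t => ?_)
  by_cases ht : 0 < t
  · simp only [curve, if_pos ht, one_mul, div_eq_inv_mul]
  · simp only [hχ t fun h => ht (by linarith [h.1]), Complex.ofReal_zero, mul_zero, zero_div]

lemma sigmaHat_reflect_eq_curveFT (b cp cm : ℝ) {χp : ℝ → ℝ}
    (hχ : ∀ t, t ∉ Ioo (1 / 2 : ℝ) 2 → χp t = 0) (X : ℝ × ℝ) :
    sigmaHat b cp cm (fun t => χp (-t)) X
      = curveFT b (-1) cm (fun t => -t⁻¹ * χp t) X := by
  unfold sigmaHat curveFT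
  rw [← integral_neg_eq_self]
  refine integral_congr_ae (ae_of_all _ fun t => ?_)
  by_cases ht : 0 < t
  · simp only [curve, if_neg (show ¬ 0 < -t by linarith), if_pos (show -t < 0 by linarith),
      neg_neg, mul_neg, neg_mul, one_mul, div_eq_inv_mul, inv_neg]
  · simp only [neg_neg, hχ t fun h => ht (by linarith [h.1]), Complex.ofReal_zero, mul_zero,
      zero_div]

lemma rpow_sub_one_le {p : ℝ} (hp : 1 < p) (hp2 : p ≤ 2) :
    ((p - 1) ^ (-6 : ℝ)) ^ (1 / p) ≤ 3 * (p - 1) ^ (3 - 10 / p) := by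
  have hd : 0 < p - 1 := by linarith
  have hp0 : 0 < p := by linarith
  have h2 : (p - 1) ^ (4 / p - 3) ≤ 3 := by
    rcases le_total p (4 / 3) with h | h
    · have : (3:ℝ) ≤ 4 / p := by rw [le_div_iff₀ hp0]; linarith
      exact (Real.rpow_le_one hd.le (by linarith) (by linarith)).trans (by norm_num)
    · have h3 : (2:ℝ) ≤ 4 / p := by rw [le_div_iff₀ hp0]; linarith
      calc (p - 1) ^ (4 / p - 3) ≤ (p - 1) ^ (-1 : ℝ) :=
            Real.rpow_le_rpow_of_exponent_ge hd (by linarith) (by linarith)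
        _ = (p - 1)⁻¹ := Real.rpow_neg_one _
        _ ≤ (1 / 3)⁻¹ := by gcongr; linarith
        _ = 3 := by norm_num
  rw [← Real.rpow_mul hd.le,
    show (-6 : ℝ) * (1 / p) = (4 / p - 3) + (3 - 10 / p) by field_simp; ring,
    Real.rpow_add hd]
  gcongr

lemma SquareBound.lpN_le {b C : ℝ} {l : ℕ} {Op : ℤ → ℤ → ℝ → (ℝ × ℝ → ℝ) → ℝ × ℝ → ℂ}
    (h : SquareBound b C l Op) {p : ℝ} (hp : 1 < p) (hp2 : p ≤ 2) {s : ℤ → ℕ → ℝ}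
    (hs : ∀ n i, s n i ∈ Icc (1:ℝ) ((2:ℝ) ^ b)) (f : SchwartzMap (ℝ × ℝ) ℝ) (w : ℤ → ℕ → ℂ) :
    lpN (fun x =>
        (∑' jni : ℤ × ℤ × ℕ,
          (ENNReal.ofReal ‖w jni.2.1 jni.2.2‖ *
            (‖Op jni.1 jni.2.1 (s jni.2.1 jni.2.2) f x‖₊ : ℝ≥0∞)) ^ (2:ℝ)) ^ ((1:ℝ)/2)) p
      ≤ ENNReal.ofReal
            (3 * (C + 1) * (p - 1) ^ (3 - 10 / p) * (2:ℝ) ^ (-(l : ℝ) * (p - 1) / 2))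
          * (⨆ n : ℤ, wNorm (w n) p) * eLpNorm f (eN p) volume := by
  have hp0 : 0 < p := by linarith
  have hd : 0 < p - 1 := by linarith
  have hC := h.1
  set W := ⨆ n : ℤ, wNorm (w n) p with hW
  have hV : ∀ n, ∑' i, ‖w n i‖ₑ ^ p ≤ W ^ p := by
    intro n
    have h1 : wNorm (w n) p ≤ W := le_iSup (fun n => wNorm (w n) p) n
    calc ∑' i, ‖w n i‖ₑ ^ p = (wNorm (w n) p) ^ p := by
          rw [wNorm, ← ENNReal.rpow_mul, one_div_mul_cancel hp0.ne', ENNReal.rpow_one]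
          refine tsum_congr fun i => ?_
          rw [← ofReal_norm, ENNReal.ofReal_rpow_of_nonneg (norm_nonneg _) hp0.le]
      _ ≤ _ := by gcongr
  have key := h.2.2 p hp hp2 s hs w _ hV f
  have hK : (C * ((p - 1) ^ (-6 : ℝ) * (2:ℝ) ^ (-(l * (p - 1) * p / 2)))) ^ (1 / p)
      ≤ 3 * (C + 1) * (p - 1) ^ (3 - 10 / p) * (2:ℝ) ^ (-(l : ℝ) * (p - 1) / 2) := by
    rw [Real.mul_rpow hC (by positivity), Real.mul_rpow (by positivity) (by positivity),
      ← Real.rpow_mul (by norm_num : (0:ℝ) ≤ 2),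
      show -(l * (p - 1) * p / 2) * (1 / p) = -(l : ℝ) * (p - 1) / 2 by field_simp]
    have h1 : C ^ (1 / p) ≤ C + 1 := by
      calc C ^ (1 / p) ≤ (C + 1) ^ (1 / p) := by gcongr; linarith
        _ ≤ (C + 1) ^ (1:ℝ) := Real.rpow_le_rpow_of_exponent_le (by linarith)
            (by rw [div_le_one hp0]; exact hp.le)
        _ = C + 1 := Real.rpow_one _
    calc _ ≤ (C + 1) * ((3 * (p - 1) ^ (3 - 10 / p)) * (2:ℝ) ^ (-(l : ℝ) * (p - 1) / 2)) := by
          gcongr ?_ * (?_ * _)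
          exact rpow_sub_one_le hp hp2
      _ = _ := by ring
  have hf : eLpNorm f (eN p) volume = (∫⁻ x, ‖f x‖ₑ ^ p) ^ (1 / p) := by
    rw [eN, eLpNorm_eq_lintegral_rpow_enorm_toReal (by simpa using hp0) ENNReal.ofReal_ne_top,
      ENNReal.toReal_ofReal hp0.le]
  have hL : ∀ x, ((∑' jni : ℤ × ℤ × ℕ, (ENNReal.ofReal ‖w jni.2.1 jni.2.2‖ *
        (‖Op jni.1 jni.2.1 (s jni.2.1 jni.2.2) f x‖₊ : ℝ≥0∞)) ^ (2:ℝ)) ^ ((1:ℝ)/2)) ^ p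
      = (∑' z : ℤ × ℤ × ℕ,
          (‖w z.2.1 z.2.2‖ₑ * ‖Op z.1 z.2.1 (s z.2.1 z.2.2) f x‖ₑ) ^ 2) ^ (p / 2) := by
    intro x
    rw [← ENNReal.rpow_mul, one_div_mul_eq_div]
    simp_rw [ENNReal.rpow_two, ofReal_norm]
    rfl
  unfold lpN
  simp_rw [hL]
  calc _ ≤ (W ^ p * (ENNReal.ofReal (C * ((p - 1) ^ (-6 : ℝ) *
          (2:ℝ) ^ (-(l * (p - 1) * p / 2)))) * ∫⁻ x, ‖f x‖ₑ ^ p)) ^ (1 / p) := by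
        gcongr
    _ = W * (ENNReal.ofReal ((C * ((p - 1) ^ (-6 : ℝ) *
          (2:ℝ) ^ (-(l * (p - 1) * p / 2)))) ^ (1 / p)) * (∫⁻ x, ‖f x‖ₑ ^ p) ^ (1 / p)) := by
        have hi : 0 ≤ 1 / p := by positivity
        rw [ENNReal.mul_rpow_of_nonneg _ _ hi, ENNReal.mul_rpow_of_nonneg _ _ hi,
          ← ENNReal.rpow_mul, mul_one_div_cancel hp0.ne', ENNReal.rpow_one,
          ENNReal.ofReal_rpow_of_nonneg (by positivity) hi]
    _ ≤ W * (ENNReal.ofReal (3 * (C + 1) * (p - 1) ^ (3 - 10 / p) *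
          (2:ℝ) ^ (-(l : ℝ) * (p - 1) / 2)) * (∫⁻ x, ‖f x‖ₑ ^ p) ^ (1 / p)) := by
        gcongr W * (ENNReal.ofReal ?_ * _)
    _ = _ := by rw [hf]; ring

theorem statement12 (b cp cm : ℝ) (hb : 1 < b) (hcp : cp ≠ 0) (hcm : cm ≠ 0)
    (χp : ℝ → ℝ) (hχsm : ContDiff ℝ (⊤ : ℕ∞) χp)
    (hχsupp : ∀ t : ℝ, t ∉ Ioo (1/2 : ℝ) 2 → χp t = 0)
    (hχsum : ∀ t : ℝ, 0 < t → HasSum (fun j : ℤ => χp ((2:ℝ) ^ j * t)) 1)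
    (η : ℝ × ℝ → ℝ) (hηsm : ContDiff ℝ (⊤ : ℕ∞) η)
    (hηsupp : ∀ ξ : ℝ × ℝ, (100:ℝ)^2 < ξ.1^2 + ξ.2^2 → η ξ = 0)
    (hηone : ∀ ξ : ℝ × ℝ, ξ.1^2 + ξ.2^2 ≤ (50:ℝ)^2 → η ξ = 1)
    (ςp : ℝ → ℝ) (hςpsm : ContDiff ℝ (⊤ : ℕ∞) ςp)
    (hςpsupp : ∀ v : ℝ, v ∉ Ioo (b * (4:ℝ)⁻¹ ^ (b-1)) (b * (4:ℝ) ^ (b-1)) → ςp v = 0)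
    (hςpone : ∀ v ∈ Icc (b * ((2:ℝ)/7) ^ (b-1)) (b * ((7:ℝ)/2) ^ (b-1)), ςp v = 1)
    (ςm : ℝ → ℝ) (hςmsm : ContDiff ℝ (⊤ : ℕ∞) ςm)
    (hςmsupp : ∀ v : ℝ, v ∉ Ioo (-(b * (4:ℝ) ^ (b-1))) (-(b * (4:ℝ)⁻¹ ^ (b-1))) → ςm v = 0)
    (hςmone : ∀ v ∈ Icc (-(b * ((7:ℝ)/2) ^ (b-1))) (-(b * ((2:ℝ)/7) ^ (b-1))), ςm v = 1)
    (ζ : ℝ × ℝ → ℝ) (hζsm : ContDiff ℝ (⊤ : ℕ∞) ζ)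
    (hζsupp : ∀ ξ : ℝ × ℝ, (4:ℝ) ≤ ξ.1^2 + ξ.2^2 → ζ ξ = 0)
    (hζone : ∀ ξ : ℝ × ℝ, ξ.1^2 + ξ.2^2 ≤ ((5:ℝ)/4)^2 → ζ ξ = 1) :
    ∃ C : ℝ, ∀ s : ℤ → ℕ → ℝ, (∀ n i, s n i ∈ Icc (1:ℝ) ((2:ℝ) ^ b)) →
      ∀ p : ℝ, 1 < p → p ≤ 2 → ∀ l : ℕ, 1 ≤ l →
      ∀ 𝒜 : ℤ → ℤ → ℕ → (ℝ × ℝ → ℝ) → ℝ × ℝ → ℂ,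
      ((∀ j n i f, 𝒜 j n i f =
          Ajl b cp cm χp η ςm ζ j l ((2:ℝ) ^ (b * (n : ℝ)) * s n i) f) ∨
       (∀ j n i f x, 𝒜 j n i f x =
          (((2:ℝ) ^ (-(l : ℝ)) : ℝ) : ℂ) *
            deriv (fun v : ℝ =>
              Ajl b cp cm χp η ςm ζ j l ((2:ℝ) ^ (b * (n : ℝ)) * v) f x) (s n i)) ∨
       (∀ j n i f, 𝒜 j n i f =
          Tjl b cp cm χp η ςp ςm ζ true j l ((2:ℝ) ^ (b * (n : ℝ)) * s n i) f) ∨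
       (∀ j n i f x, 𝒜 j n i f x =
          (((2:ℝ) ^ (-(l : ℝ)) : ℝ) : ℂ) *
            deriv (fun v : ℝ =>
              Tjl b cp cm χp η ςp ςm ζ true j l ((2:ℝ) ^ (b * (n : ℝ)) * v) f x) (s n i)) ∨
       (∀ j n i f, 𝒜 j n i f =
          Tjl b cp cm χp η ςp ςm ζ false j l ((2:ℝ) ^ (b * (n : ℝ)) * s n i) f) ∨
       (∀ j n i f x, 𝒜 j n i f x =
          (((2:ℝ) ^ (-(l : ℝ)) : ℝ) : ℂ) *
            deriv (fun v : ℝ =>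
              Tjl b cp cm χp η ςp ςm ζ false j l ((2:ℝ) ^ (b * (n : ℝ)) * v) f x) (s n i))) →
      ∀ (f : SchwartzMap (ℝ × ℝ) ℝ) (w : ℤ → ℕ → ℂ),
        lpN (fun x =>
            (∑' jni : ℤ × ℤ × ℕ,
              (ENNReal.ofReal ‖w jni.2.1 jni.2.2‖ *
                (‖𝒜 jni.1 jni.2.1 jni.2.2 ⇑f x‖₊ : ℝ≥0∞)) ^ (2:ℝ)) ^ ((1:ℝ)/2)) p
          ≤ ENNReal.ofReal
                (C * (p - 1) ^ (3 - 10 / p) * (2:ℝ) ^ (-(l : ℝ) * (p - 1) / 2))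
              * (⨆ n : ℤ, wNorm (w n) p) * eLpNorm ⇑f (eN p) volume := by
  have hςm' : ∀ q, ςm q ≠ 0 → b * (4:ℝ)⁻¹ ^ (b-1) ≤ |q| ∧ |q| ≤ b * (4:ℝ) ^ (b-1) := by
    intro q hq
    have h1 : q ∈ Ioo (-(b * (4:ℝ) ^ (b-1))) (-(b * (4:ℝ)⁻¹ ^ (b-1))) := by
      by_contra h0
      exact hq (hςmsupp q h0)
    have h2 : 0 < b * (4:ℝ)⁻¹ ^ (b-1) := by positivity
    rw [abs_of_neg (by linarith [h1.2])]
    exact ⟨by linarith [h1.2], by linarith [h1.1]⟩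
  have hςp' : ∀ q, ςp q ≠ 0 → b * (4:ℝ)⁻¹ ^ (b-1) ≤ |q| ∧ |q| ≤ b * (4:ℝ) ^ (b-1) := by
    intro q hq
    have h1 : q ∈ Ioo (b * (4:ℝ)⁻¹ ^ (b-1)) (b * (4:ℝ) ^ (b-1)) := by
      by_contra h0
      exact hq (hςpsupp q h0)
    have h2 : 0 < b * (4:ℝ)⁻¹ ^ (b-1) := by positivity
    rw [abs_of_pos (by linarith [h1.1])]
    exact ⟨h1.1.le, h1.2.le⟩
  have hκ : 0 < b * (4:ℝ)⁻¹ ^ (b-1) := by positivity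
  have hχI : ∀ t, t ∉ Icc (1 / 2 : ℝ) 2 → χp t = 0 := fun t ht =>
    hχsupp t fun h => ht (Ioo_subset_Icc_self h)
  have hinv : ContDiff ℝ ((⊤ : ℕ∞) : WithTop ℕ∞) fun t => t⁻¹ * χp t :=
    contDiff_mul_of_support (fun t ht => contDiffAt_inv ℝ ht.ne') hχsm hχI
  have hninv : ContDiff ℝ ((⊤ : ℕ∞) : WithTop ℕ∞) fun t => -t⁻¹ * χp t :=
    contDiff_mul_of_support (fun t ht => (contDiffAt_inv ℝ ht.ne').neg) hχsm hχI
  obtain ⟨C₁, h₁⟩ := exists_squareBound_conicCutoff hb hcp hκ hςmsm hςm' hηsm hζsm hηsupp hζsupp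
    hζone hχsm hχI (e := 1) (by simp)
  obtain ⟨C₂, h₂⟩ := exists_squareBound_conicCutoff hb hcp hκ hςmsm hςm' hηsm hζsm hηsupp hζsupp
    hζone hinv (fun t ht => by simp only [hχI t ht, mul_zero]) (e := 1) (by simp)
  obtain ⟨C₃, h₃⟩ := exists_squareBound_conicCutoff hb hcm hκ hςpsm hςp' hηsm hζsm hηsupp hζsupp
    hζone hninv (fun t ht => by simp only [hχI t ht, mul_zero]) (e := -1) (by simp)
  have p₁ := (h₁ 1 le_rfl _ fun _ => rfl).1.1
  have p₂ := (h₂ 1 le_rfl _ fun _ => rfl).1.1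
  have p₃ := (h₃ 1 le_rfl _ fun _ => rfl).1.1
  refine ⟨3 * (C₁ + C₂ + C₃ + 1), fun s hs p hp hp2 l hl 𝒜 h𝒜 f w => ?_⟩
  obtain ⟨a₁, a₁'⟩ := h₁ l hl (fun X => ((zl ζ l X : ℝ) : ℂ) * rhoHat b cp cm χp η ςm X)
    fun X => by simp only [rhoHat, tauHat_eq_curveFT b cp cm hχsupp]
  obtain ⟨a₂, a₂'⟩ := h₂ l hl (fun X => ((zl ζ l X : ℝ) : ℂ) * muHat b cp cm χp η ςp ςm true X)
    fun X => by simp only [muHat, if_true, sigmaHat_eq_curveFT b cp cm hχsupp]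
  obtain ⟨a₃, a₃'⟩ := h₃ l hl (fun X => ((zl ζ l X : ℝ) : ℂ) * muHat b cp cm χp η ςp ςm false X)
    fun X => by
      simp only [muHat, Bool.false_eq_true, if_false, sigmaHat_reflect_eq_curveFT b cp cm hχsupp]
  have main : ∀ (C : ℝ) (Op : ℤ → ℤ → ℝ → (ℝ × ℝ → ℝ) → ℝ × ℝ → ℂ), SquareBound b C l Op →
      C ≤ C₁ + C₂ + C₃ → (∀ j n i f x, 𝒜 j n i f x = Op j n (s n i) f x) → _ :=
    fun C Op hOp hC h𝒜 => by
      have := (hOp.mono hC).lpN_le hp hp2 hs f w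
      simp only [← h𝒜] at this
      exact this
  rcases h𝒜 with h | h | h | h | h | h
  · exact main _ _ a₁ (by linarith) fun j n i f x => congrFun (h j n i f) x
  · exact main _ _ a₁' (by linarith) h
  · exact main _ _ a₂ (by linarith) fun j n i f x => congrFun (h j n i f) x
  · exact main _ _ a₂' (by linarith) h
  · exact main _ _ a₃ (by linarith) fun j n i f x => congrFun (h j n i f) x
  · exact main _ _ a₃' (by linarith) h

end
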